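/- Let $K/k$ be an extension of algebraically closed fields with $\mathrm{trdeg}_k(K) > 0$. Let $X$ be a projective K3 surface over $k$, let $X_K = X \times_k K$ be its base change, and write $\mathrm{CH}^2$ for the Chow group of codimension-two cycles (zero-cycles) modulo rational equivalence. If $\mathrm{CH}^2(X)$ is not isomorphic to $\mathbb{Z}$, then the base change map $\mathrm{CH}^2(X) \to \mathrm{CH}^2(X_K)$, i.e. the pull-back along the projection $X_K \to X$, is not surjective. -/

import Mathlib

open AlgebraicGeometry CategoryTheory Limits Opposite TopologicalSpace TensorProduct
open IsLocalRing (maximalIdeal)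
universe u v w

noncomputable section
namespace K3

section
variable {A B : Type*} [CommRing A] [CommRing B]

/-- Precomposition of a `B`-alternating map with a semilinear map along `φ : A → B`. -/
def alternatingMapComp {n : ℕ} {φ : A →+* B} {M N P : Type*} [AddCommGroup M] [Module A M]
    [AddCommGroup N] [Module B N] [AddCommGroup P] [Module B P] [Module A P]
    (hP : ∀ (a : A) (p : P), a • p = φ a • p) (g : N [⋀^Fin n]→ₗ[B] P) (h : M →ₛₗ[φ] N) :
    M [⋀^Fin n]→ₗ[A] P where
  toFun m := g (h ∘ m)
  map_update_add' m i x y := by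
    rw [Function.comp_update, Function.comp_update, Function.comp_update, map_add,
      g.map_update_add]
  map_update_smul' m i a x := by
    rw [Function.comp_update, Function.comp_update, h.map_smulₛₗ, g.map_update_smul, hP]
  map_eq_zero_of_eq' m i j hij hne := g.map_eq_zero_of_eq _ (by simp [hij]) hne

end
section
variable {C : Type v} [Category.{w} C] {R : Cᵒᵖ ⥤ CommRingCat.{u}}

/-- A morphism into a restriction of scalars, as a semilinear map. -/
def semilin {A B : Type u} [Ring A] [Ring B] {φ : A →+* B} {M : ModuleCat.{u} A} {N : ModuleCat.{u} B}
    (h : M ⟶ (ModuleCat.restrictScalars φ).obj N) : M →ₛₗ[φ] N where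
  toFun m := h.hom m
  map_add' x y := h.hom.map_add x y
  map_smul' a x := h.hom.map_smul a x

/-- The map `⋀ⁿ M → ⋀ⁿ N` induced by a semilinear map `M → N`. -/
def exteriorPowerMap (n : ℕ) {A B : Type u} [CommRing A] [CommRing B] {φ : A →+* B}
    {M : ModuleCat.{u} A} {N : ModuleCat.{u} B}
    (h : M ⟶ (ModuleCat.restrictScalars φ).obj N) :
    M.exteriorPower n ⟶ (ModuleCat.restrictScalars φ).obj (N.exteriorPower n) :=
  letI : Module A (N.exteriorPower n) := Module.compHom _ φ
  ModuleCat.ofHom (Y := (ModuleCat.restrictScalars φ).obj (N.exteriorPower n))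
    (exteriorPower.alternatingMapLinearEquiv
      (alternatingMapComp (P := N.exteriorPower n) (fun _ _ => rfl)
        (exteriorPower.ιMulti B n (M := N)) (semilin h)))

lemma exteriorPowerMap_mk (n : ℕ) {A B : Type u} [CommRing A] [CommRing B] {φ : A →+* B}
    {M : ModuleCat.{u} A} {N : ModuleCat.{u} B}
    (h : M ⟶ (ModuleCat.restrictScalars φ).obj N) (m : Fin n → M) :
    (exteriorPowerMap n h).hom (exteriorPower.ιMulti A n m) =
      exteriorPower.ιMulti B n (M := N) (semilin h ∘ m) := by
  let _ : Module A (N.exteriorPower n) := Module.compHom _ φ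
  exact exteriorPower.alternatingMapLinearEquiv_apply_ιMulti
    (alternatingMapComp (P := N.exteriorPower n) (fun _ _ => rfl)
        (exteriorPower.ιMulti B n (M := N)) (semilin h)) m

/-- The presheaf of modules `U ↦ ⋀ⁿ M(U)`. -/
def exteriorPowerPresheaf (n : ℕ) (M : PresheafOfModules.{u} (R ⋙ forget₂ CommRingCat RingCat)) :
    PresheafOfModules.{u} (R ⋙ forget₂ CommRingCat RingCat) where
  obj U := ModuleCat.exteriorPower (R := R.obj U) (M.obj U) n
  map {U V} f := exteriorPowerMap n (A := R.obj U) (B := R.obj V) (φ := (R.map f).hom)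
    (M := M.obj U) (N := M.obj V) (M.map f)
  map_id U := by
    refine ModuleCat.hom_ext ?_
    refine exteriorPower.linearMap_ext (R := R.obj U) ?_
    ext m
    refine (exteriorPowerMap_mk n (A := R.obj U) _ m).trans ?_
    rw [M.map_id]
    rfl
  map_comp {U V W} f g := by
    refine ModuleCat.hom_ext ?_
    refine exteriorPower.linearMap_ext (R := R.obj U) ?_
    ext m
    refine (exteriorPowerMap_mk n (A := R.obj U) _ m).trans ?_
    rw [M.map_comp]
    symm
    refine (congrArg (exteriorPowerMap n (A := R.obj V) (B := R.obj W) (φ := (R.map g).hom)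
      (M := M.obj V) (N := M.obj W) (M.map g)).hom (exteriorPowerMap_mk n (A := R.obj U) (B := R.obj V) (φ := (R.map f).hom)
      (M := M.obj U) (N := M.obj V) (M.map f) m)).trans ?_
    refine (exteriorPowerMap_mk n (A := R.obj V) (B := R.obj W) (φ := (R.map g).hom)
      (M := M.obj V) (N := M.obj W) (M.map g) _).trans ?_
    rfl
end

section
variable {k : Type u} [Field k] {X : Scheme.{u}} (s : X ⟶ Spec (.of k))

/-- The structure of a presheaf of `k`-algebras on `𝒪_X` given by `s : X ⟶ Spec k`. -/
def constToPresheaf : (Functor.const (Opens X)ᵒᵖ).obj (CommRingCat.of k) ⟶ X.presheaf where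
  app U := (Scheme.ΓSpecIso (.of k)).inv ≫ s.appTop ≫ X.presheaf.map (homOfLE le_top : U.unop ⟶ ⊤).op
  naturality U V f := by
    simp [← Functor.map_comp]
    rfl

/-- The sheaf `Ωⁿ` of `n`-forms of `X` over `k`: the sheafification of the presheaf
`U ↦ ⋀ⁿ Ω_{𝒪(U)/k}`. For `X` smooth of dimension `n` this is the canonical sheaf `ω_X`. -/
def canonicalSheaf (n : ℕ) : SheafOfModules.{u} X.ringCatSheaf :=
  (PresheafOfModules.sheafification (𝟙 X.ringCatSheaf.obj)).obj
    (exteriorPowerPresheaf n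
      (PresheafOfModules.DifferentialsConstruction.relativeDifferentials' (constToPresheaf s)))

/-- Projective `n`-space over `k`, as `Proj k[x₀, …, xₙ]`. -/
def projectiveSpace (n : ℕ) (k : Type u) [Field k] : Scheme.{u} :=
  letI := MvPolynomial.gradedAlgebra (σ := Fin (n + 1)) (R := k)
  Proj (MvPolynomial.homogeneousSubmodule (Fin (n + 1)) k)

/-- The structure morphism `ℙⁿ ⟶ Spec k`. -/
def projectiveSpaceToSpec (n : ℕ) (k : Type u) [Field k] : projectiveSpace n k ⟶ Spec (.of k) :=
  letI := MvPolynomial.gradedAlgebra (σ := Fin (n + 1)) (R := k)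
  Proj.toSpecZero (MvPolynomial.homogeneousSubmodule (Fin (n + 1)) k) ≫
    Spec.map (CommRingCat.ofHom (algebraMap k (MvPolynomial.homogeneousSubmodule (Fin (n + 1)) k 0)))

/-- `s : X ⟶ Spec k` is a projective K3 surface: a smooth projective geometrically integral surface
over `k` with trivial canonical sheaf and `H¹(X, 𝒪_X) = 0`. -/
class IsProjectiveK3 : Prop where
  projective : ∃ (n : ℕ) (i : X ⟶ projectiveSpace n k),
    IsClosedImmersion i ∧ i ≫ projectiveSpaceToSpec n k = s
  smooth : SmoothOfRelativeDimension 2 s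
  geometricallyIntegral : GeometricallyIntegral s
  canonical_trivial : Nonempty (canonicalSheaf s 2 ≅ SheafOfModules.unit X.ringCatSheaf)
  h1_eq_zero : Subsingleton (Sheaf.H ((SheafOfModules.toSheaf X.ringCatSheaf).obj
    (SheafOfModules.unit X.ringCatSheaf)) 1)

instance [IsProjectiveK3 s] : LocallyOfFiniteType s :=
  have : SmoothOfRelativeDimension 2 s := IsProjectiveK3.smooth
  have : Smooth s := SmoothOfRelativeDimension.smooth 2 s
  inferInstance
end

theorem tensor_noZero_fg {k A B : Type*} [Field k] [IsAlgClosed k] [CommRing A] [IsDomain A] [Algebra k A]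
    [Algebra.FiniteType k A] [CommRing B] [IsDomain B] [Algebra k B] (u v : A ⊗[k] B) (huv : u * v = 0) :
    u = 0 ∨ v = 0 := by
  classical
  let b := Module.Basis.ofVectorSpace k B
  let β := Algebra.TensorProduct.basis A b
  by_contra! h
  obtain ⟨hu, hv⟩ := h
  obtain ⟨i, hi⟩ : ∃ i, β.repr u i ≠ 0 := by
    by_contra! h
    exact hu (β.repr.map_eq_zero_iff.mp (Finsupp.ext h))
  obtain ⟨j, hj⟩ : ∃ j, β.repr v j ≠ 0 := by
    by_contra! h
    exact hv (β.repr.map_eq_zero_iff.mp (Finsupp.ext h))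
  have hne : β.repr u i * β.repr v j ≠ 0 := mul_ne_zero hi hj
  have : IsJacobsonRing A := isJacobsonRing_of_finiteType (A := k)
  have hj0 : Ideal.jacobson (⊥ : Ideal A) = ⊥ :=
    isJacobsonRing_iff_prime_eq.mp this ⊥ Ideal.isPrime_bot
  obtain ⟨m, hm, hnm⟩ : ∃ m : Ideal A, m.IsMaximal ∧ β.repr u i * β.repr v j ∉ m := by
    by_contra! h
    apply hne
    rw [← Ideal.mem_bot, ← hj0, Ideal.jacobson, Ideal.mem_sInf]
    intro m hm
    exact h m hm.2
  let _ : Field (A ⧸ m) := Ideal.Quotient.field m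
  have : Module.Finite k (A ⧸ m) := finite_of_finite_type_of_isJacobsonRing _ _
  let φ : A →ₐ[k] k := (IsAlgClosed.lift (S := A ⧸ m) (M := k) (R := k)).comp (Ideal.Quotient.mkₐ k m)
  have hφ : ∀ a, φ a = 0 → a ∈ m := fun a ha => by
    have : IsAlgClosed.lift (S := A ⧸ m) (M := k) (R := k) (Ideal.Quotient.mk m a) = 0 := ha
    rw [map_eq_zero] at this
    exact Ideal.Quotient.eq_zero_iff_mem.mp this
  let Φ : A ⊗[k] B →ₐ[k] B := Algebra.TensorProduct.lift ((Algebra.ofId k B).comp φ) (AlgHom.id k B)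
    (fun _ _ => mul_comm _ _)
  have key : ∀ (x : A ⊗[k] B) (l), b.repr (Φ x) l = φ (β.repr x l) := by
    intro x l
    induction x with
    | zero => simp
    | add x y hx hy => simp [hx, hy]
    | tmul a c =>
      have h1 : Φ (a ⊗ₜ[k] c) = φ a • c := by
        rw [Algebra.smul_def]; exact Algebra.TensorProduct.lift_tmul _ _ _ a c
      rw [h1]
      simp [β, Algebra.TensorProduct.basis_repr_tmul]
  have h0 : Φ u * Φ v = 0 := by rw [← map_mul, huv, map_zero]
  rcases mul_eq_zero.mp h0 with h | h
  · exact hnm (Ideal.mul_mem_right _ _ (hφ _ (by rw [← key, h]; simp)))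
  · exact hnm (Ideal.mul_mem_left _ _ (hφ _ (by rw [← key, h]; simp)))

theorem isDomain_tensor {k A B : Type*} [Field k] [IsAlgClosed k] [CommRing A] [IsDomain A] [Algebra k A]
    [CommRing B] [IsDomain B] [Algebra k B] : IsDomain (B ⊗[k] A) := by
  have : NoZeroDivisors (B ⊗[k] A) := by
    refine ⟨fun {u v} huv => ?_⟩
    obtain ⟨D, hD, hu⟩ := exists_fg_and_mem_baseChange u
    obtain ⟨D', hD', hv⟩ := exists_fg_and_mem_baseChange v
    have hE := hD.sup hD'
    have hmono : ∀ {S T : Subalgebra k A}, S ≤ T → S.baseChange B ≤ T.baseChange B := by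
      rintro S T hST _ ⟨z, rfl⟩
      refine ⟨Algebra.TensorProduct.map (AlgHom.id B B) (Subalgebra.inclusion hST) z, ?_⟩
      induction z with
      | zero => simp
      | add x y hx hy => simp_all
      | tmul a c => rfl
    have hu := hmono (le_sup_left : D ≤ D ⊔ D') hu
    have hv := hmono (le_sup_right : D' ≤ D ⊔ D') hv
    generalize D ⊔ D' = E at hE hu hv
    obtain ⟨u, rfl⟩ := hu
    obtain ⟨v, rfl⟩ := hv
    have h_inj : Function.Injective (Algebra.TensorProduct.map (AlgHom.id B B) E.val) :=
      Module.Flat.lTensor_preserves_injective_linearMap _ Subtype.val_injective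
    have : Algebra.FiniteType k E := E.fg_iff_finiteType.mp hE
    have h0 : u * v = 0 := h_inj (by rw [map_mul, map_zero]; exact huv)
    have h1 := tensor_noZero_fg (Algebra.TensorProduct.comm k B E u)
      (Algebra.TensorProduct.comm k B E v) (by rw [← map_mul, h0, map_zero])
    rw [EmbeddingLike.map_eq_zero_iff, EmbeddingLike.map_eq_zero_iff] at h1
    rcases h1 with rfl | rfl
    · left; exact map_zero _
    · right; exact map_zero _
  have : Nontrivial (B ⊗[k] A) :=
    (Algebra.TensorProduct.includeLeft_injective (R := k) (S := k) (A := B) (B := A)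
      (algebraMap k A).injective).nontrivial
  exact NoZeroDivisors.to_isDomain _

theorem length_baseChange {A B : Type u} [CommRing A] [IsLocalRing A] [CommRing B] [Algebra A B]
    [Module.Flat A B]
    (M : Type u) [AddCommGroup M] [Module A M] (hM : IsFiniteLength A M) :
    Module.length B (B ⊗[A] M) = Module.length A M *
      Module.length B (B ⧸ (IsLocalRing.maximalIdeal A).map (algebraMap A B)) := by
  induction hM with
  | of_subsingleton => simp [Module.length_eq_zero]
  | @of_simple_quotient M _ _ N hs hN ih =>
    have e1 := Module.length_eq_add_of_exact N.subtype N.mkQ N.subtype_injective N.mkQ_surjective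
      (LinearMap.exact_subtype_mkQ N)
    have e2 := Module.length_eq_add_of_exact (N.subtype.baseChange B) (N.mkQ.baseChange B)
      (Module.Flat.lTensor_preserves_injective_linearMap _ N.subtype_injective)
      (LinearMap.lTensor_surjective _ N.mkQ_surjective)
      (lTensor_exact B (LinearMap.exact_subtype_mkQ N) N.mkQ_surjective)
    obtain ⟨I, hI, ⟨e⟩⟩ := isSimpleModule_iff_quot_maximal.mp hs
    obtain rfl := IsLocalRing.eq_maximalIdeal hI
    have e3 : Module.length B (B ⊗[A] (M ⧸ N)) =
        Module.length B (B ⧸ (IsLocalRing.maximalIdeal A).map (algebraMap A B)) :=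
      ((e.baseChange A B _ _).trans (Algebra.TensorProduct.quotIdealMapEquivTensorQuot B
        (IsLocalRing.maximalIdeal A)).symm.toLinearEquiv).length_eq
    rw [e2, e1, ih, e3, add_mul, Module.length_eq_one A (M ⧸ N), one_mul]

/-- Orders of vanishing under a flat local extension. -/
theorem ord_map {A B : Type u} [CommRing A] [IsLocalRing A] [CommRing B] [Algebra A B] [Module.Flat A B]
    [IsNoetherianRing A] [Ring.KrullDimLE 1 A] {a : A} (ha : a ∈ nonZeroDivisors A) :
    Ring.ord B (algebraMap A B a) = Ring.ord A a *
      Module.length B (B ⧸ (IsLocalRing.maximalIdeal A).map (algebraMap A B)) := by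
  rw [Ring.ord, Ring.ord, ← length_baseChange (A ⧸ Ideal.span {a}) (isFiniteLength_quotient_span_singleton A ha)]
  have := (Algebra.TensorProduct.quotIdealMapEquivTensorQuot B (Ideal.span {a})).toLinearEquiv.length_eq
  rw [← this, Ideal.map_span, Set.image_singleton]

theorem ordFrac_map {A B : Type u} [CommRing A] [IsDomain A] [IsLocalRing A] [CommRing B] [IsDomain B] [Algebra A B]
    [Module.Flat A B] [FaithfulSMul A B]
    [IsNoetherianRing A] [Ring.KrullDimLE 1 A] [IsNoetherianRing B] [Ring.KrullDimLE 1 B]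
    {L M : Type u} [Field L] [Algebra A L] [IsFractionRing A L] [Field M] [Algebra B M] [IsFractionRing B M]
    (φ : L →+* M) (hφ : ∀ a, φ (algebraMap A L a) = algebraMap B M (algebraMap A B a))
    (e : ℕ) (he : Module.length B (B ⧸ (IsLocalRing.maximalIdeal A).map (algebraMap A B)) = e)
    (f : L) (hf : f ≠ 0) :
    Ring.ordFrac B (φ f) = (Ring.ordFrac A f) ^ e := by
  have key : ∀ a : A, a ≠ 0 →
      Ring.ordFrac B (φ (algebraMap A L a)) = (Ring.ordFrac A (algebraMap A L a)) ^ e := by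
    intro a ha
    have hb : algebraMap A B a ≠ 0 := by
      rwa [Ne, FaithfulSMul.algebraMap_eq_zero_iff]
    have ha' := mem_nonZeroDivisors_of_ne_zero ha
    have hb' := mem_nonZeroDivisors_of_ne_zero hb
    obtain ⟨n, hn⟩ := ENat.ne_top_iff_exists.mp (Ring.ord_ne_top ha')
    rw [hφ, Ring.ordFrac_eq_ord B hb, Ring.ordFrac_eq_ord A ha,
      Ring.ordMonoidWithZeroHom_eq_coe A ha' hn.symm,
      Ring.ordMonoidWithZeroHom_eq_coe B hb' (n := n * e)
        (by rw [ord_map ha', he, ← hn]; rfl), ← WithZero.coe_pow, ← ofAdd_nsmul]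
    simp [mul_comm]
  obtain ⟨a, b, hb, rfl⟩ := IsFractionRing.div_surjective (A := A) f
  have hb0 := nonZeroDivisors.ne_zero hb
  have ha0 : a ≠ 0 := by rintro rfl; simp at hf
  rw [map_div₀, map_div₀, map_div₀, div_pow, key a ha0, key b hb0]

section
variable {X Y Z W V : Scheme.{u}}

/-- The ideal `𝔪_{f x} 𝒪_{X, x}`, which cuts out the fibre of `f` through `x` in the local ring at `x`. -/
def fiberIdeal (f : X ⟶ Y) (x : X) : Ideal (X.presheaf.stalk x) :=
  (maximalIdeal (Y.presheaf.stalk (f x))).map (f.stalkMap x).hom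

/-- The length of `𝒪_{X, x} / 𝔪_{f x} 𝒪_{X, x}`: if `x` is a generic point of the fibre of `f` through
it, this is the multiplicity of the component of `f⁻¹(closure {f x})` with generic point `x`. -/
def fiberMultiplicity (f : X ⟶ Y) (x : X) : ℕ :=
  (Module.length (X.presheaf.stalk x) (X.presheaf.stalk x ⧸ fiberIdeal f x)).toNat

lemma fiberIdeal_comp (f : X ⟶ Y) (g : Y ⟶ Z) (x : X) :
    fiberIdeal (f ≫ g) x = (fiberIdeal g (f x)).map (f.stalkMap x).hom := by
  rw [fiberIdeal, fiberIdeal, Ideal.map_map, ← CommRingCat.hom_comp, ← Scheme.Hom.stalkMap_comp]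
  rfl

lemma fiberIdeal_le (f : X ⟶ Y) (x : X) : fiberIdeal f x ≤ maximalIdeal _ :=
  ((IsLocalRing.local_hom_TFAE (f.stalkMap x).hom).out 0 2).mp (f.toLRSHom.prop x)

lemma fiberIdeal_of_isClosedImmersion (f : X ⟶ Y) [IsClosedImmersion f] (x : X) :
    fiberIdeal f x = maximalIdeal _ := by
  refine le_antisymm (fiberIdeal_le f x) fun a ha => ?_
  obtain ⟨b, rfl⟩ := f.stalkMap_surjective x a
  refine Ideal.mem_map_of_mem _ ?_
  rw [IsLocalRing.mem_maximalIdeal, mem_nonunits_iff] at ha ⊢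
  exact fun hb => ha (hb.map _)

lemma exists_eq_Spec_map {T : CommRingCat.{u}} [IsLocalRing T] (F : Spec T ⟶ X) (x : X)
    (h : F (IsLocalRing.closedPoint T) = x) :
    ∃ φ : X.presheaf.stalk x ⟶ T, F = Spec.map φ ≫ X.fromSpecStalk x := by
  subst h
  exact ⟨_, (Scheme.Spec_stalkClosedPointTo_fromSpecStalk F).symm⟩

lemma ker_le_fiberIdeal {g : V ⟶ W} {j : V ⟶ Y} {i : W ⟶ X} {f : Y ⟶ X}
    (sq : IsPullback g j i f) [IsClosedImmersion i] (v : V) :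
    RingHom.ker (j.stalkMap v).hom ≤ fiberIdeal f (j v) := by
  have : IsClosedImmersion j := MorphismProperty.of_isPullback sq ‹_›
  let R := Y.presheaf.stalk (j v)
  let I := fiberIdeal f (j v)
  have hI : I ≠ ⊤ := ne_top_of_le_ne_top (Ideal.IsPrime.ne_top inferInstance) (fiberIdeal_le f (j v))
  have : Nontrivial (R ⧸ I) := Ideal.Quotient.nontrivial_iff.mpr hI
  let T : CommRingCat.{u} := .of (R ⧸ I)
  have hT : IsLocalRing T := IsLocalRing.of_surjective' (Ideal.Quotient.mk I) Ideal.Quotient.mk_surjective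
  let q : R ⟶ T := CommRingCat.ofHom (Ideal.Quotient.mk I)
  have hq : Function.Surjective q.hom := Ideal.Quotient.mk_surjective
  let x : X := f (j v)
  let r : X.residueField x ⟶ T := CommRingCat.ofHom
    (Ideal.Quotient.lift (maximalIdeal (X.presheaf.stalk x)) (f.stalkMap (j v) ≫ q).hom (fun a ha => by
      change Ideal.Quotient.mk I ((f.stalkMap (j v)).hom a) = 0
      exact Ideal.Quotient.eq_zero_iff_mem.mpr (Ideal.mem_map_of_mem _ ha)))
  have hr : X.residue x ≫ r = f.stalkMap (j v) ≫ q := by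
    ext a; rfl
  have h1 : (Spec.map q ≫ Y.fromSpecStalk (j v)) ≫ f = Spec.map r ≫ X.fromSpecResidueField x := by
    rw [Scheme.fromSpecResidueField, ← Spec.map_comp_assoc, hr, Spec.map_comp_assoc,
      Scheme.SpecMap_stalkMap_fromSpecStalk, Category.assoc]
  have hsurj : Surjective (pullback.snd i (X.fromSpecResidueField x)) := by
    refine ⟨fun z => ?_⟩
    obtain ⟨t, -, ht⟩ := Scheme.Pullback.exists_preimage_pullback (f := i)
      (g := X.fromSpecResidueField x) (g v) z (by
        rw [Scheme.fromSpecResidueField_apply, ← Scheme.Hom.comp_apply, sq.w]; rfl)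
    exact ⟨t, ht⟩
  have : IsReduced (Spec (X.residueField x)) := inferInstance
  have hiso : IsIso (pullback.snd i (X.fromSpecResidueField x)) :=
    isIso_of_isClosedImmersion_of_surjective _
  let l : Spec T ⟶ W := Spec.map r ≫ inv (pullback.snd i (X.fromSpecResidueField x)) ≫ pullback.fst _ _
  have hl : l ≫ i = (Spec.map q ≫ Y.fromSpecStalk (j v)) ≫ f := by
    rw [h1]; simp [l, pullback.condition]
  let L : Spec T ⟶ V := sq.lift l (Spec.map q ≫ Y.fromSpecStalk (j v)) hl
  have hL : L ≫ j = Spec.map q ≫ Y.fromSpecStalk (j v) := sq.lift_snd _ _ _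
  have hpt : L (IsLocalRing.closedPoint T) = v := by
    apply j.isClosedEmbedding.injective
    refine (Scheme.Hom.comp_apply L j _).symm.trans ?_
    rw [hL]
    refine (Scheme.Hom.comp_apply _ _ _).trans ?_
    have : Spec.map q (IsLocalRing.closedPoint T) = IsLocalRing.closedPoint R := by
      have : IsLocalHom q.hom := .of_surjective _ hq
      exact IsLocalRing.comap_closedPoint q.hom
    exact (congrArg (Y.fromSpecStalk (j v)) this).trans Scheme.fromSpecStalk_closedPoint
  obtain ⟨φ, hφ⟩ := exists_eq_Spec_map L v hpt
  have h2 : q = j.stalkMap v ≫ φ := by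
    apply Spec.map_injective
    rw [← cancel_mono (Y.fromSpecStalk (j v)), ← hL, hφ, Spec.map_comp_assoc,
      Scheme.SpecMap_stalkMap_fromSpecStalk, Category.assoc]
  intro a ha
  apply Ideal.Quotient.eq_zero_iff_mem.mp
  change q.hom a = 0
  rw [h2, CommRingCat.hom_comp, RingHom.comp_apply, RingHom.mem_ker.mp ha, map_zero]

lemma map_fiberIdeal {g : V ⟶ W} {j : V ⟶ Y} {i : W ⟶ X} {f : Y ⟶ X}
    (sq : CommSq g j i f) [IsClosedImmersion i] (v : V) :
    (fiberIdeal f (j v)).map (j.stalkMap v).hom = fiberIdeal g v := by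
  rw [← fiberIdeal_comp, ← sq.w, fiberIdeal_comp, fiberIdeal_of_isClosedImmersion]
  rfl

/-- The local rings of the fibres agree. -/
def fiberEquiv {g : V ⟶ W} {j : V ⟶ Y} {i : W ⟶ X} {f : Y ⟶ X}
    (sq : IsPullback g j i f) [IsClosedImmersion i] (v : V) :
    (Y.presheaf.stalk (j v) ⧸ fiberIdeal f (j v)) ≃+* (V.presheaf.stalk v ⧸ fiberIdeal g v) :=
  RingEquiv.ofBijective
    (Ideal.quotientMap (fiberIdeal g v) (j.stalkMap v).hom (by
      rw [← map_fiberIdeal sq.toCommSq v]; exact Ideal.le_comap_map)) (by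
    have : IsClosedImmersion j := MorphismProperty.of_isPullback sq ‹_›
    have hs : Function.Surjective (j.stalkMap v).hom := j.stalkMap_surjective v
    refine ⟨Ideal.quotientMap_injective' ?_, Ideal.quotientMap_surjective hs⟩
    rw [← map_fiberIdeal sq.toCommSq v, Ideal.comap_map_of_surjective _ hs]
    exact sup_le le_rfl (ker_le_fiberIdeal sq v))

lemma length_eq_of_ringEquiv {A B : Type*} [CommRing A] [CommRing B] (I : Ideal A) (J : Ideal B)
    (e : (A ⧸ I) ≃+* (B ⧸ J)) : Module.length A (A ⧸ I) = Module.length B (B ⧸ J) := by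
  rw [Module.length_eq_of_surjective (R := A ⧸ I) (S := A) Ideal.Quotient.mk_surjective,
    Module.length_eq_of_surjective (R := B ⧸ J) (S := B) Ideal.Quotient.mk_surjective]
  have := Order.krullDim_eq_of_orderIso (RingEquiv.idealComapOrderIso e)
  rw [← WithBot.coe_inj, Module.coe_length, Module.coe_length]
  exact this.symm

/-- The dimension of the local ring at `x` of the fibre of `f` through `x`. -/
def fiberDim (f : X ⟶ Y) (x : X) : ℕ∞ :=
  ((maximalIdeal (X.presheaf.stalk x)).map (Ideal.Quotient.mk (fiberIdeal f x))).height

lemma fiberMultiplicity_eq {g : V ⟶ W} {j : V ⟶ Y} {i : W ⟶ X} {f : Y ⟶ X}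
    (sq : IsPullback g j i f) [IsClosedImmersion i] (v : V) :
    fiberMultiplicity f (j v) = fiberMultiplicity g v :=
  congrArg ENat.toNat (length_eq_of_ringEquiv _ _ (fiberEquiv sq v))

lemma coe_fiberDim (f : X ⟶ Y) (x : X) : (fiberDim f x : WithBot ℕ∞) =
    ringKrullDim (X.presheaf.stalk x ⧸ fiberIdeal f x) := by
  have hI : fiberIdeal f x ≠ ⊤ :=
    ne_top_of_le_ne_top (Ideal.IsPrime.ne_top inferInstance) (fiberIdeal_le f x)
  have : Nontrivial (X.presheaf.stalk x ⧸ fiberIdeal f x) := Ideal.Quotient.nontrivial_iff.mpr hI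
  have : IsLocalRing (X.presheaf.stalk x ⧸ fiberIdeal f x) :=
    IsLocalRing.of_surjective' (Ideal.Quotient.mk _) Ideal.Quotient.mk_surjective
  rw [← IsLocalRing.maximalIdeal_height_eq_ringKrullDim, fiberDim]
  congr 2
  refine IsLocalRing.eq_maximalIdeal ?_
  have := Ideal.map_eq_top_or_isMaximal_of_surjective (Ideal.Quotient.mk (fiberIdeal f x))
    Ideal.Quotient.mk_surjective (IsLocalRing.maximalIdeal.isMaximal (X.presheaf.stalk x))
  refine this.resolve_left fun h => ?_
  have h2 := congrArg (Ideal.comap (Ideal.Quotient.mk (fiberIdeal f x))) h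
  rw [Ideal.comap_map_of_surjective _ Ideal.Quotient.mk_surjective, Ideal.comap_top] at h2
  have h3 : Ideal.comap (Ideal.Quotient.mk (fiberIdeal f x)) ⊥ ≤ maximalIdeal _ := by
    rw [← RingHom.ker_eq_comap_bot, Ideal.mk_ker]; exact fiberIdeal_le f x
  rw [sup_eq_left.mpr h3] at h2
  exact (Ideal.IsPrime.ne_top inferInstance) h2

lemma fiberDim_eq {g : V ⟶ W} {j : V ⟶ Y} {i : W ⟶ X} {f : Y ⟶ X}
    (sq : IsPullback g j i f) [IsClosedImmersion i] (v : V) :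
    fiberDim f (j v) = fiberDim g v := by
  rw [← WithBot.coe_inj, coe_fiberDim, coe_fiberDim]
  exact ringKrullDim_eq_of_ringEquiv (fiberEquiv sq v)

lemma coheight_eq_add_fiberDim (f : X ⟶ Y) [Flat f] [IsLocallyNoetherian X] [IsLocallyNoetherian Y] (x : X) :
    Order.coheight x = Order.coheight (f x) + fiberDim f x := by
  have h1 : ∀ {S : Scheme.{u}} (z : S), (maximalIdeal (S.presheaf.stalk z)).height = Order.coheight z := by
    intro S z
    rw [← WithBot.coe_inj, IsLocalRing.maximalIdeal_height_eq_ringKrullDim, ringKrullDim_stalk_eq_coheight]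
  algebraize [(f.stalkMap x).hom]
  have : Module.Flat (Y.presheaf.stalk (f x)) (X.presheaf.stalk x) := Flat.stalkMap f x
  have : IsLocalHom (algebraMap (Y.presheaf.stalk (f x)) (X.presheaf.stalk x)) := f.toLRSHom.prop x
  have : (maximalIdeal (X.presheaf.stalk x)).LiesOver (maximalIdeal (Y.presheaf.stalk (f x))) := inferInstance
  have := Ideal.height_eq_height_add_of_liesOver_of_hasGoingDown
    (maximalIdeal (Y.presheaf.stalk (f x))) (maximalIdeal (X.presheaf.stalk x))
  rw [h1, h1] at this
  exact this


lemma map_genericPoint (g : V ⟶ W) [Flat g] [IsIntegral V] [IsIntegral W] :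
    g (genericPoint V) = genericPoint W := by
  obtain ⟨v, hv, hgv⟩ := Flat.generalizingMap g
    ((genericPoint_spec W).specializes (Set.mem_univ (g (genericPoint V))))
  have : v = genericPoint V :=
    (hv.antisymm ((genericPoint_spec V).specializes (Set.mem_univ v))).eq
  rw [← this, hgv]

/-- The extension of function fields defined by a flat morphism of integral schemes. -/
def functionFieldMap (g : V ⟶ W) [Flat g] [IsIntegral V] [IsIntegral W] :
    W.functionField ⟶ V.functionField :=
  W.presheaf.stalkSpecializes (specializes_of_eq (map_genericPoint g)) ≫ g.stalkMap (genericPoint V)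

lemma functionFieldMap_algebraMap (g : V ⟶ W) [Flat g] [IsIntegral V] [IsIntegral W] (v : V)
    (a : W.presheaf.stalk (g v)) :
    (functionFieldMap g).hom (algebraMap _ W.functionField a) =
      algebraMap _ V.functionField ((g.stalkMap v).hom a) := by
  have h1 := Scheme.Hom.stalkSpecializes_stalkMap g (genericPoint V) v
    ((genericPoint_spec V).specializes (Set.mem_univ v))
  have h2 : W.presheaf.stalkSpecializes ((genericPoint_spec W).specializes (Set.mem_univ (g v))) ≫
      functionFieldMap g = g.stalkMap v ≫ V.presheaf.stalkSpecializes
        ((genericPoint_spec V).specializes (Set.mem_univ v)) := by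
    rw [← h1, functionFieldMap, TopCat.Presheaf.stalkSpecializes_comp_assoc]
  exact congrArg (fun q => q.hom a) h2

lemma ord_functionFieldMap (g : V ⟶ W) [Flat g] [IsIntegral V] [IsIntegral W]
    [IsLocallyNoetherian V] [IsLocallyNoetherian W] (f : W.functionField) (hf : f ≠ 0) (v : V)
    (hv : Order.coheight v = 1) :
    Scheme.ord ((functionFieldMap g).hom f) v = Scheme.ord f (g v) * fiberMultiplicity g v := by
  have hdim := coheight_eq_add_fiberDim g v
  rw [hv] at hdim
  have hf' : (functionFieldMap g).hom f ≠ 0 := by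
    rwa [Ne, map_eq_zero]
  have : Ring.KrullDimLE 1 (V.presheaf.stalk v) := krullDimLE_of_coheight_le hv.le
  algebraize [(g.stalkMap v).hom]
  have : Module.Flat (W.presheaf.stalk (g v)) (V.presheaf.stalk v) := Flat.stalkMap g v
  have hloc : IsLocalHom (algebraMap (W.presheaf.stalk (g v)) (V.presheaf.stalk v)) := g.toLRSHom.prop v
  have : Module.FaithfullyFlat (W.presheaf.stalk (g v)) (V.presheaf.stalk v) :=
    .of_flat_of_isLocalHom
  have hfaith : FaithfulSMul (W.presheaf.stalk (g v)) (V.presheaf.stalk v) := inferInstance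
  by_cases hw : Order.coheight (g v) = 1
  · have : Ring.KrullDimLE 1 (W.presheaf.stalk (g v)) := krullDimLE_of_coheight_le hw.le
    obtain ⟨a, ham, ha0⟩ : ∃ a ∈ maximalIdeal (W.presheaf.stalk (g v)), a ≠ 0 := by
      by_contra! h
      have hbot : maximalIdeal (W.presheaf.stalk (g v)) = ⊥ := by
        rw [eq_bot_iff]; exact fun a ha => h a ha
      have h2 : IsField (W.presheaf.stalk (g v)) := IsLocalRing.isField_iff_maximalIdeal_eq.mpr hbot
      have h3 := ringKrullDim_eq_zero_of_isField h2
      rw [ringKrullDim_stalk_eq_coheight, hw] at h3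
      simp at h3
    have hfin : Module.length (V.presheaf.stalk v) (V.presheaf.stalk v ⧸ fiberIdeal g v) ≠ ⊤ := by
      have hb : algebraMap _ (V.presheaf.stalk v) a ≠ 0 := by
        rwa [Ne, FaithfulSMul.algebraMap_eq_zero_iff]
      have h1 := Ring.ord_ne_top (mem_nonZeroDivisors_of_ne_zero hb)
      rw [Ring.ord] at h1
      refine ne_top_of_le_ne_top h1 ?_
      have hle : Ideal.span {algebraMap _ (V.presheaf.stalk v) a} ≤ fiberIdeal g v := by
        rw [Ideal.span_singleton_le_iff_mem]
        exact Ideal.mem_map_of_mem _ ham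
      exact Module.length_le_of_surjective (Submodule.factor hle) (Submodule.factor_surjective hle)
    have key := ordFrac_map (A := W.presheaf.stalk (g v)) (B := V.presheaf.stalk v)
      (functionFieldMap g).hom (fun a => functionFieldMap_algebraMap g v a) (fiberMultiplicity g v)
      (ENat.natCast_toNat hfin).symm f hf
    rw [Scheme.ord_eq_iff hv hf']
    have h2 := (Scheme.ord_eq_iff hw hf (n := Scheme.ord f (g v))).mp rfl
    change Ring.ordFrac (V.presheaf.stalk v) _ = _
    change Ring.ordFrac (W.presheaf.stalk (g v)) _ = _ at h2
    rw [key, h2, ← WithZero.coe_pow, ← ofAdd_nsmul, nsmul_eq_mul, mul_comm]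
  · rw [Scheme.ord_eq_zero_of_coheight_neq_one hw, zero_mul, Scheme.ord_eq_iff hv hf']
    have h0 : Order.coheight (g v) = 0 := by
      have : Order.coheight (g v) ≤ 1 := hdim ▸ le_self_add
      exact Order.lt_one_iff.mp (lt_of_le_of_ne this hw)
    have hfld : IsField (W.presheaf.stalk (g v)) := by
      have h3 := ringKrullDim_stalk_eq_coheight (g v)
      rw [h0] at h3
      have : Ring.KrullDimLE 0 (W.presheaf.stalk (g v)) := by
        rw [Ring.krullDimLE_iff, h3]; rfl
      exact Ring.KrullDimLE.isField_of_isDomain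
    obtain ⟨a, b, hb, rfl⟩ := IsFractionRing.div_surjective (A := W.presheaf.stalk (g v)) f
    have hb0 := nonZeroDivisors.ne_zero hb
    have ha0 : a ≠ 0 := by rintro rfl; simp at hf
    change Ring.ordFrac (V.presheaf.stalk v) _ = _
    have unit : ∀ c : W.presheaf.stalk (g v), c ≠ 0 → Ring.ordFrac (V.presheaf.stalk v)
        ((functionFieldMap g).hom (algebraMap _ W.functionField c)) = 1 := by
      intro c hc
      rw [functionFieldMap_algebraMap]
      obtain ⟨d, hd⟩ := hfld.mul_inv_cancel hc
      exact Ring.ordFrac_of_isUnit ((IsUnit.of_mul_eq_one d hd).map _)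
    rw [map_div₀, map_div₀, unit a ha0, unit b hb0]
    simp

/-- The group of cycles of codimension `p`: locally finite integral combinations of points `x` of
codimension `p`, where `x` stands for the integral closed subscheme with generic point `x`. -/
def cyclesOfCodim (X : Scheme.{u}) (p : ℕ) : AddSubgroup (AlgebraicCycle X ℤ) where
  carrier := {c | ∀ x, c x ≠ 0 → Order.coheight x = p}
  zero_mem' x hx := absurd rfl hx
  add_mem' {a b} ha hb x hx := by
    by_cases h : a x = 0
    · exact hb x fun h' => hx (by simp [h, h'])
    · exact ha x h
  neg_mem' {a} ha x hx := ha x fun h => hx (by simp [h])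

/-- `c` is the divisor of a nonzero rational function on an integral closed subscheme `W` of
codimension `p - 1`. -/
def IsPrincipalCycle (p : ℕ) (c : AlgebraicCycle X ℤ) : Prop :=
  ∃ (W : Scheme.{u}) (i : W ⟶ X) (_ : IsClosedImmersion i) (_ : IsIntegral W)
    (_ : IsLocallyNoetherian W) (f : W.functionField),
    f ≠ 0 ∧ Order.coheight (i (genericPoint W)) + 1 = p ∧
      (∀ w, c (i w) = Scheme.ord f w) ∧ ∀ x ∉ Set.range i, c x = 0

/-- The cycles of codimension `p` that are rationally equivalent to zero. -/
def rationallyTrivial (X : Scheme.{u}) (p : ℕ) : AddSubgroup (cyclesOfCodim X p) :=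
  AddSubgroup.closure {c | IsPrincipalCycle p c.1}

/-- The Chow group `CH^p(X)` of cycles of codimension `p` modulo rational equivalence. -/
abbrev ChowGroup (X : Scheme.{u}) (p : ℕ) : Type u := cyclesOfCodim X p ⧸ rationallyTrivial X p

/-- The preimages under `f` of integral closed subschemes are integral. -/
def HasIntegralPreimages (f : Y ⟶ X) : Prop :=
  ∀ ⦃W : Scheme.{u}⦄ (i : W ⟶ X) [IsClosedImmersion i] [IsIntegral W], IsIntegral (pullback i f)

lemma eq_genericPoint_of_coheight_eq_zero [IsIntegral V] (v : V) (hv : Order.coheight v = 0) :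
    v = genericPoint V := by
  have h1 : genericPoint V ⤳ v := (genericPoint_spec V).specializes (Set.mem_univ v)
  have h2 : IsMax v := Order.coheight_eq_zero.mp hv
  exact ((Scheme.le_iff_specializes.mp (h2 (Scheme.le_iff_specializes.mpr h1))).antisymm h1).eq

lemma coheight_genericPoint [IsIntegral V] : Order.coheight (genericPoint V) = 0 := by
  rw [Order.coheight_eq_zero]
  intro v _
  exact Scheme.le_iff_specializes.mpr ((genericPoint_spec V).specializes (Set.mem_univ v))

lemma isIntegral_image [IsIntegral V] (q : V ⟶ X) [QuasiCompact q] : IsIntegral q.image where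
  nonempty := ⟨q.toImage (genericPoint V)⟩
  component_integral U hU := by
    have hne : Nonempty (q.toImage ⁻¹ᵁ U) := by
      obtain ⟨z, hz, v, rfl⟩ := (Scheme.Hom.denseRange q.toImage).inter_open_nonempty U U.isOpen
        (by obtain ⟨z⟩ := hU; exact ⟨z.1, z.2⟩)
      exact ⟨⟨v, hz⟩⟩
    have hinj : Function.Injective (q.toImage.app U).hom :=
      TopCat.Presheaf.app_injective_of_stalkFunctor_map_injective (F := q.image.sheaf) q.toImage.c U
        fun x _ => q.stalkFunctor_toImage_injective x
    exact Function.Injective.isDomain (q.toImage.app U).hom hinj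

section
variable (f : Y ⟶ X) [Flat f] [IsLocallyNoetherian X] [IsLocallyNoetherian Y]

lemma eq_of_map_eq (hf : HasIntegralPreimages f) {y y' : Y} (h : f y = f y')
    (hy : Order.coheight y = Order.coheight (f y)) (hy' : Order.coheight y' = Order.coheight (f y'))
    (hfin : Order.coheight (f y) ≠ ⊤) : y = y' := by
  let x := f y
  let q := X.fromSpecResidueField x
  have : IsIntegral q.image := isIntegral_image q
  let W := q.image
  let i : W ⟶ X := q.imageι
  have : IsIntegral (pullback i f) := hf i
  let g := pullback.fst i f
  let j := pullback.snd i f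
  have sq : IsPullback g j i f := .of_hasPullback _ _
  have : IsLocallyNoetherian W := LocallyOfFiniteType.isLocallyNoetherian i
  have : IsLocallyNoetherian (pullback i f) := LocallyOfFiniteType.isLocallyNoetherian j
  let t : Spec (X.residueField x) := IsLocalRing.closedPoint (X.residueField x)
  let w : W := q.toImage t
  have hw : i w = x := by
    refine (Scheme.Hom.comp_apply q.toImage q.imageι t).symm.trans ?_
    rw [Scheme.Hom.toImage_imageι]
    exact Scheme.fromSpecResidueField_apply x t
  have hwgen : w = genericPoint W := by
    have h1 : closure {w} = Set.univ := by
      rw [← (Scheme.Hom.denseRange q.toImage).closure_range]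
      congr 1
      ext z
      constructor
      · rintro rfl; exact ⟨t, rfl⟩
      · rintro ⟨t', rfl⟩
        rw [Subsingleton.elim t' t]; rfl
    exact (IsGenericPoint.eq (S := Set.univ) h1 (genericPoint_spec W))
  have key : ∀ z : Y, f z = x → Order.coheight z = Order.coheight (f z) →
      z = j (genericPoint ↥(pullback i f)) := by
    intro z hz hc
    obtain ⟨v, hv1, hv2⟩ := Scheme.Pullback.exists_preimage_pullback (f := i) (g := f) w z
      (hw.trans hz.symm)
    have hd : fiberDim f z = 0 := by
      have h1 := coheight_eq_add_fiberDim f z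
      rw [hc] at h1
      have h2 : Order.coheight (f z) ≠ ⊤ := by rw [hz]; exact hfin
      have h3 : Order.coheight (f z) + 0 = Order.coheight (f z) + fiberDim f z := by
        rw [add_zero]; exact h1
      exact (ENat.add_right_injective_of_ne_top h2 h3).symm
    have hd' : fiberDim g v = 0 := by
      rw [← fiberDim_eq sq v]
      change fiberDim f (pullback.snd i f v) = 0
      rw [hv2, hd]
    have h4 := coheight_eq_add_fiberDim g v
    have h5 : g v = genericPoint W := hv1.trans hwgen
    rw [hd', h5, coheight_genericPoint, add_zero] at h4
    rw [← eq_genericPoint_of_coheight_eq_zero v h4]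
    exact hv2.symm
  rw [key y rfl hy, key y' h.symm hy']

/-- Flat pull-back of cycles: the coefficient of `f^* c` at a point `y` of codimension `p` is the
coefficient of `c` at `f y` times the multiplicity of `y` in the fibre. -/
def pullbackCycle (hf : HasIntegralPreimages f) (p : ℕ) : cyclesOfCodim X p →+ cyclesOfCodim Y p where
  toFun c := ⟨{
    toFun := fun y => if Order.coheight y = p then c.1 (f y) * fiberMultiplicity f y else 0
    supportWithinDomain' := Set.subset_univ _
    supportLocallyFiniteWithinDomain' := fun y _ => by
      obtain ⟨t, ht, hfin⟩ := c.1.supportLocallyFiniteWithinDomain (f y) (Set.mem_univ _)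
      refine ⟨f ⁻¹' t, f.continuous.continuousAt ht, ?_⟩
      have hmem : ∀ z, (if Order.coheight z = (p : ℕ∞) then c.1 (f z) * (fiberMultiplicity f z : ℤ) else 0) ≠ 0 →
          Order.coheight z = p ∧ c.1 (f z) ≠ 0 := by
        intro z hz
        split_ifs at hz with h
        · exact ⟨h, left_ne_zero_of_mul hz⟩
        · exact absurd rfl hz
      refine Set.Finite.of_finite_image (f := f) (hfin.subset ?_) ?_
      · rintro _ ⟨z, ⟨hz, hz'⟩, rfl⟩
        exact ⟨hz, (hmem z hz').2⟩
      · rintro z ⟨-, hz⟩ z' ⟨-, hz'⟩ h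
        obtain ⟨h1, h2⟩ := hmem z hz
        obtain ⟨h1', h2'⟩ := hmem z' hz'
        have h3 := c.2 _ h2
        have h3' := c.2 _ h2'
        exact eq_of_map_eq f hf h (h1.trans h3.symm) (h1'.trans h3'.symm) (by rw [h3]; simp) },
    fun y hy => by
      by_contra h
      exact hy (if_neg h)⟩
  map_zero' := by
    ext y; simp
  map_add' a b := by
    ext y
    simp only [AddSubgroup.coe_add, Function.locallyFinsuppWithin.coe_add, Pi.add_apply,
      Function.locallyFinsuppWithin.coe_mk]
    split_ifs <;> simp [add_mul]

lemma pullbackCycle_apply (hf : HasIntegralPreimages f) (p : ℕ) (c : cyclesOfCodim X p) (y : Y)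
    (hy : Order.coheight y = p) :
    (pullbackCycle f hf p c).1 y = c.1 (f y) * fiberMultiplicity f y := if_pos hy

lemma pullbackCycle_apply_of_ne (hf : HasIntegralPreimages f) (p : ℕ) (c : cyclesOfCodim X p)
    (y : Y) (hy : Order.coheight y ≠ p) : (pullbackCycle f hf p c).1 y = 0 := if_neg hy

lemma pullbackCycle_apply_of_eq_zero (hf : HasIntegralPreimages f) (p : ℕ) (c : cyclesOfCodim X p)
    (y : Y) (hy : c.1 (f y) = 0) : (pullbackCycle f hf p c).1 y = 0 := by
  by_cases h : Order.coheight y = p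
  · rw [pullbackCycle_apply f hf p c y h, hy, zero_mul]
  · exact pullbackCycle_apply_of_ne f hf p c y h

lemma isPrincipalCycle_pullbackCycle (hf : HasIntegralPreimages f) (p : ℕ) (c : cyclesOfCodim X p)
    (hc : IsPrincipalCycle p c.1) : IsPrincipalCycle p (pullbackCycle f hf p c).1 := by
  obtain ⟨W, i, hi, hW, hWn, φ, hφ, hcod, hord, hoff⟩ := hc
  have hV : IsIntegral (pullback i f) := hf i
  let g := pullback.fst i f
  let j := pullback.snd i f
  have sq : IsPullback g j i f := .of_hasPullback _ _
  have hVn : IsLocallyNoetherian (pullback i f) := LocallyOfFiniteType.isLocallyNoetherian j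
  have hcomm : ∀ v, i (g v) = f (j v) := fun v => by
    rw [← Scheme.Hom.comp_apply, ← Scheme.Hom.comp_apply, sq.w]
  have hdim : ∀ v, fiberDim f (j v) = fiberDim g v := fun v => fiberDim_eq sq v
  refine ⟨pullback i f, j, inferInstance, hV, hVn, (functionFieldMap g).hom φ,
    (map_ne_zero _).mpr hφ, ?_, ?_, ?_⟩
  · have h1 := coheight_eq_add_fiberDim g (genericPoint ↥(pullback i f))
    rw [coheight_genericPoint] at h1
    have h2 : fiberDim g (genericPoint ↥(pullback i f)) = 0 := (add_eq_zero.mp h1.symm).2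
    rw [coheight_eq_add_fiberDim f, hdim, h2, add_zero, ← hcomm, map_genericPoint g, hcod]
  · intro v
    have h1 := coheight_eq_add_fiberDim g v
    have h2 := coheight_eq_add_fiberDim f (j v)
    rw [hdim] at h2
    by_cases hw : Order.coheight (g v) = 1
    · by_cases hz : Scheme.ord φ (g v) = 0
      · rw [pullbackCycle_apply_of_eq_zero f hf p c _ (by rw [← hcomm, hord, hz])]
        by_cases hv : Order.coheight v = 1
        · rw [ord_functionFieldMap g φ hφ v hv, hz, zero_mul]
        · rw [Scheme.ord_eq_zero_of_coheight_neq_one hv]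
      · have h3 : Order.coheight (f (j v)) = p := c.2 _ (by rwa [← hcomm, hord])
        by_cases hd : fiberDim g v = 0
        · rw [hd, add_zero] at h1 h2
          rw [pullbackCycle_apply f hf p c _ (h2.trans h3),
            ord_functionFieldMap g φ hφ v (h1.trans hw), ← hcomm, hord, fiberMultiplicity_eq sq v]
        · rw [pullbackCycle_apply_of_ne f hf p c, Scheme.ord_eq_zero_of_coheight_neq_one]
          · rw [h1, hw]
            intro h
            exact hd (ENat.add_right_injective_of_ne_top (n := 1) (by simp) (by simpa using h))
          · rw [h2, h3]
            intro h
            exact hd (ENat.add_right_injective_of_ne_top (n := (p : ℕ∞)) (by simp)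
              (by simpa using h))
    · have hz : Scheme.ord φ (g v) = 0 := Scheme.ord_eq_zero_of_coheight_neq_one hw φ
      rw [pullbackCycle_apply_of_eq_zero f hf p c _ (by rw [← hcomm, hord, hz])]
      by_cases hv : Order.coheight v = 1
      · rw [ord_functionFieldMap g φ hφ v hv, hz, zero_mul]
      · rw [Scheme.ord_eq_zero_of_coheight_neq_one hv]
  · intro y hy
    refine pullbackCycle_apply_of_eq_zero f hf p c y (hoff _ ?_)
    rintro ⟨w, hw⟩
    obtain ⟨v, -, hv⟩ := Scheme.Pullback.exists_preimage_pullback (f := i) (g := f) w y hw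
    exact hy ⟨v, hv⟩

/-- Flat pull-back `CH^p(X) → CH^p(Y)`. -/
def ChowGroup.pullback (hf : HasIntegralPreimages f) (p : ℕ) : ChowGroup X p →+ ChowGroup Y p :=
  QuotientAddGroup.map _ _ (pullbackCycle f hf p) <| by
    rw [rationallyTrivial, AddSubgroup.closure_le]
    exact fun c hc => AddSubgroup.subset_closure (isPrincipalCycle_pullbackCycle f hf p c hc)

end

end

section BaseChange
variable {k : Type u} [Field k] (K : Type u) [Field K] [Algebra k K]

lemma geometricallyIntegral_Spec_map [IsAlgClosed k] :
    GeometricallyIntegral (Spec.map (CommRingCat.ofHom (algebraMap k K))) := by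
  refine ⟨geometrically_iff_of_commRing.mpr fun L _ _ Y fst snd h => ?_⟩
  have : IsDomain (K ⊗[k] L) := isDomain_tensor
  have : Nonempty Y := Nonempty.map (h.isoPullback ≪≫ pullbackSpecIso k K L).inv inferInstance
  exact isIntegral_of_isOpenImmersion (h.isoPullback ≪≫ pullbackSpecIso k K L).hom

/-- The base change `X_K = X ×_k K`. -/
abbrev baseChangeScheme {X : Scheme.{u}} (s : X ⟶ Spec (.of k)) : Scheme.{u} :=
  Limits.pullback s (Spec.map (CommRingCat.ofHom (algebraMap k K)))

/-- The projection `X_K ⟶ X`. -/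
abbrev baseChangeProj {X : Scheme.{u}} (s : X ⟶ Spec (.of k)) : baseChangeScheme K s ⟶ X :=
  Limits.pullback.fst s (Spec.map (CommRingCat.ofHom (algebraMap k K)))

variable {X : Scheme.{u}} (s : X ⟶ Spec (.of k)) [LocallyOfFiniteType s]

lemma isLocallyNoetherian_of_field {X : Scheme.{u}} (s : X ⟶ Spec (.of k)) [LocallyOfFiniteType s] :
    IsLocallyNoetherian X :=
  LocallyOfFiniteType.isLocallyNoetherian s

lemma hasIntegralPreimages_baseChangeProj [IsAlgClosed k] :
    HasIntegralPreimages (baseChangeProj K s) := by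
  intro W i _ _
  have := geometricallyIntegral_Spec_map (k := k) K
  have : IsLocallyNoetherian W := LocallyOfFiniteType.isLocallyNoetherian (i ≫ s)
  have : IsIntegral (Limits.pullback (i ≫ s) (Spec.map (CommRingCat.ofHom (algebraMap k K)))) :=
    inferInstance
  exact isIntegral_of_isOpenImmersion
    (pullbackRightPullbackFstIso s (Spec.map (CommRingCat.ofHom (algebraMap k K))) i).hom

/-- The base change map `CH^p(X) → CH^p(X_K)`: flat pull-back along the projection `X_K ⟶ X`. -/
def ChowGroup.baseChange [IsAlgClosed k] (p : ℕ) :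
    ChowGroup X p →+ ChowGroup (baseChangeScheme K s) p :=
  haveI : Flat (baseChangeProj K s) := inferInstance
  haveI : IsLocallyNoetherian X := isLocallyNoetherian_of_field s
  haveI : IsLocallyNoetherian (baseChangeScheme K s) := isLocallyNoetherian_of_field
    (Limits.pullback.snd s (Spec.map (CommRingCat.ofHom (algebraMap k K))))
  ChowGroup.pullback (baseChangeProj K s) (hasIntegralPreimages_baseChangeProj K s) p

end BaseChange

end K3
end

noncomputable section
namespace K3

section Multiplicity
variable {S : Type*} [CommRing S]

/-- The multiplicity of a module at a maximal ideal: the length of its localization. -/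
def multAt (m : MaximalSpectrum S) (M : Type*) [AddCommGroup M] [Module S M] : ℕ :=
  (Module.length S (LocalizedModule m.asIdeal.primeCompl M)).toNat

lemma mkLinearMap_surjective (m : MaximalSpectrum S) {M : Type*} [AddCommGroup M]
    [Module S M] (hM : IsFiniteLength S M) :
    Function.Surjective (LocalizedModule.mkLinearMap m.asIdeal.primeCompl M) := by
  intro x
  induction x using LocalizedModule.induction_on with
  | h x s =>
    have hart : IsArtinian S M := (isFiniteLength_iff_isNoetherian_isArtinian.mp hM).2
    obtain ⟨n, hn⟩ := IsArtinian.exists_pow_succ_smul_dvd (s : S) x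
    obtain ⟨y, hy⟩ := hn
    refine ⟨y, ?_⟩
    rw [LocalizedModule.mkLinearMap_apply, LocalizedModule.mk_eq]
    refine ⟨s ^ n, ?_⟩
    simp only [one_smul, Submonoid.smul_def, SubmonoidClass.coe_pow, smul_smul]
    rw [← pow_succ]
    exact hy

lemma isFiniteLength_localizedModule (m : MaximalSpectrum S) {M : Type*} [AddCommGroup M]
    [Module S M] (hM : IsFiniteLength S M) :
    IsFiniteLength S (LocalizedModule m.asIdeal.primeCompl M) :=
  hM.of_surjective (mkLinearMap_surjective m hM)

variable {M N P : Type*} [AddCommGroup M] [Module S M] [AddCommGroup N] [Module S N]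
  [AddCommGroup P] [Module S P]

lemma multAt_eq_add (m : MaximalSpectrum S) (hM : IsFiniteLength S M) (f : N →ₗ[S] M)
    (g : M →ₗ[S] P) (hf : Function.Injective f) (hg : Function.Surjective g)
    (H : Function.Exact f g) : multAt m M = multAt m N + multAt m P := by
  have hN := isFiniteLength_localizedModule m (hM.of_injective hf)
  have hP := isFiniteLength_localizedModule m (hM.of_surjective hg)
  rw [multAt, multAt, multAt, Module.length_eq_add_of_exact
    ((LocalizedModule.map m.asIdeal.primeCompl f).restrictScalars S)
    ((LocalizedModule.map m.asIdeal.primeCompl g).restrictScalars S)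
    (LocalizedModule.map_injective _ f hf) (LocalizedModule.map_surjective _ g hg)
    (LocalizedModule.map_exact _ f g H)]
  exact ENat.toNat_add (Module.length_ne_top_iff.mpr hN) (Module.length_ne_top_iff.mpr hP)

lemma multAt_congr (m : MaximalSpectrum S) (e : M ≃ₗ[S] N) : multAt m M = multAt m N := by
  rw [multAt, multAt, (LinearEquiv.ofBijective
    ((LocalizedModule.map m.asIdeal.primeCompl e.toLinearMap).restrictScalars S)
    ⟨LocalizedModule.map_injective _ e.toLinearMap e.injective,
      LocalizedModule.map_surjective _ e.toLinearMap e.surjective⟩).length_eq]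

lemma multAt_of_subsingleton (m : MaximalSpectrum S) [Subsingleton M] : multAt m M = 0 := by
  have : Subsingleton (LocalizedModule m.asIdeal.primeCompl M) :=
    LocalizedModule.subsingleton_iff.mpr fun x => ⟨1, Submonoid.one_mem _, Subsingleton.elim _ _⟩
  rw [multAt, Module.length_eq_zero, ENat.toNat_zero]

lemma multAt_quotient_self (m : MaximalSpectrum S) : multAt m (S ⧸ m.asIdeal) = 1 := by
  have := m.isMaximal
  have : IsLocalizedModule m.asIdeal.primeCompl (LinearMap.id : S ⧸ m.asIdeal →ₗ[S] _) := by
    let _ := Ideal.Quotient.field m.asIdeal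
    refine ⟨fun s => ?_, fun x => ⟨(x, 1), by simp⟩, fun h => ⟨1, by simpa using h⟩⟩
    have hs : Ideal.Quotient.mk m.asIdeal s ≠ 0 := fun h =>
      s.2 (Ideal.Quotient.eq_zero_iff_mem.mp h)
    rw [Module.End.isUnit_iff]
    constructor
    · intro x y hxy
      simp only [Module.algebraMap_end_apply, Algebra.smul_def] at hxy
      exact mul_left_cancel₀ hs hxy
    · intro x
      refine ⟨(Ideal.Quotient.mk m.asIdeal s)⁻¹ * x, ?_⟩
      simp only [Module.algebraMap_end_apply, Algebra.smul_def]
      exact mul_inv_cancel_left₀ hs x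
  have : IsSimpleModule S (S ⧸ m.asIdeal) := isSimpleModule_iff_quot_maximal.mpr
    ⟨_, m.isMaximal, ⟨.refl _ _⟩⟩
  rw [multAt, (IsLocalizedModule.iso m.asIdeal.primeCompl
    (LinearMap.id : S ⧸ m.asIdeal →ₗ[S] _)).length_eq, Module.length_eq_one]
  rfl

lemma multAt_quotient_of_ne {m m' : MaximalSpectrum S} (h : m ≠ m') :
    multAt m (S ⧸ m'.asIdeal) = 0 := by
  obtain ⟨s, hs, hs'⟩ : ∃ s ∈ m'.asIdeal, s ∉ m.asIdeal := by
    by_contra! hle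
    exact h (MaximalSpectrum.ext (m'.isMaximal.eq_of_le m.isMaximal.ne_top hle).symm)
  have : Subsingleton (LocalizedModule m.asIdeal.primeCompl (S ⧸ m'.asIdeal)) :=
    LocalizedModule.subsingleton_iff.mpr fun x => ⟨s, hs', by
      obtain ⟨x, rfl⟩ := Ideal.Quotient.mk_surjective x
      rw [Algebra.smul_def, Ideal.Quotient.algebraMap_eq, ← map_mul]
      exact Ideal.Quotient.eq_zero_iff_mem.mpr (Ideal.mul_mem_right _ _ hs)⟩
  rw [multAt, Module.length_eq_zero, ENat.toNat_zero]

lemma finite_multAt_ne_zero (hM : IsFiniteLength S M) :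
    {m : MaximalSpectrum S | multAt m M ≠ 0}.Finite := by
  induction hM with
  | of_subsingleton => simp [multAt_of_subsingleton]
  | @of_simple_quotient M _ _ N hs hN ih =>
    obtain ⟨I, hI, ⟨e⟩⟩ := isSimpleModule_iff_quot_maximal.mp hs
    refine (ih.union (Set.finite_singleton ⟨I, hI⟩)).subset fun m hm => ?_
    rw [Set.mem_ofPred_eq, multAt_eq_add m (.of_simple_quotient hN) N.subtype N.mkQ
      N.subtype_injective N.mkQ_surjective (LinearMap.exact_subtype_mkQ N),
      multAt_congr m e] at hm
    by_cases h : m = ⟨I, hI⟩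
    · exact Or.inr h
    · rw [multAt_quotient_of_ne h, add_zero] at hm
      exact Or.inl hm

variable {G : Type*} [AddCommGroup G] (cl : MaximalSpectrum S → G)

/-- The image in `G` of the zero-cycle of a module of finite length under the homomorphism that
sends the point `m` to `cl m`. -/
def cycleOf (M : Type*) [AddCommGroup M] [Module S M] : G :=
  ∑ᶠ m : MaximalSpectrum S, multAt m M • cl m

lemma finite_support_smul (hM : IsFiniteLength S M) :
    (Function.support fun m : MaximalSpectrum S => multAt m M • cl m).Finite :=
  (finite_multAt_ne_zero hM).subset fun m hm h => hm (by simp [h])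

lemma cycleOf_eq_add (hM : IsFiniteLength S M) (f : N →ₗ[S] M)
    (g : M →ₗ[S] P) (hf : Function.Injective f) (hg : Function.Surjective g)
    (H : Function.Exact f g) : cycleOf cl M = cycleOf cl N + cycleOf cl P := by
  rw [cycleOf, cycleOf, cycleOf, ← finsum_add_distrib (finite_support_smul cl (hM.of_injective hf))
    (finite_support_smul cl (hM.of_surjective hg))]
  exact finsum_congr fun m => by rw [multAt_eq_add m hM f g hf hg H, add_smul]

lemma cycleOf_congr (e : M ≃ₗ[S] N) : cycleOf cl M = cycleOf cl N :=
  finsum_congr fun m => by rw [multAt_congr m e]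

lemma cycleOf_of_subsingleton [Subsingleton M] : cycleOf cl M = 0 := by
  simp [cycleOf, multAt_of_subsingleton]

lemma cycleOf_quotient (m : MaximalSpectrum S) : cycleOf cl (S ⧸ m.asIdeal) = cl m := by
  rw [cycleOf, finsum_eq_single _ m fun m' h => by rw [multAt_quotient_of_ne h, zero_smul],
    multAt_quotient_self, one_smul]

lemma cycleOf_submodule_add_quotient (hM : IsFiniteLength S M) (N : Submodule S M) :
    cycleOf cl M = cycleOf cl N + cycleOf cl (M ⧸ N) :=
  cycleOf_eq_add cl hM N.subtype N.mkQ N.subtype_injective N.mkQ_surjective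
    (LinearMap.exact_subtype_mkQ N)

lemma cycleOf_ker_add_range (hM : IsFiniteLength S M) (f : M →ₗ[S] N) :
    cycleOf cl M = cycleOf cl (LinearMap.ker f) + cycleOf cl (LinearMap.range f) := by
  rw [cycleOf_submodule_add_quotient cl hM (LinearMap.ker f),
    cycleOf_congr cl f.quotKerEquivRange]

lemma cycleOf_of_exact (f : N →ₗ[S] M) (g : M →ₗ[S] P) (H : Function.Exact f g)
    (hM : IsFiniteLength S M) :
    cycleOf cl M = cycleOf cl (LinearMap.range f) + cycleOf cl (LinearMap.range g) := by
  rw [cycleOf_ker_add_range cl hM g, LinearMap.exact_iff.mp H]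

/-- The alternating sum of the cycles of the cokernel and the kernel of multiplication by `a`. -/
def eulerCycle (a : S) (M : Type*) [AddCommGroup M] [Module S M] : G :=
  cycleOf cl (M ⧸ LinearMap.range (LinearMap.lsmul S M a)) -
    cycleOf cl (LinearMap.ker (LinearMap.lsmul S M a))

lemma eulerCycle_congr (a : S) (e : M ≃ₗ[S] N) : eulerCycle cl a M = eulerCycle cl a N := by
  rw [eulerCycle, eulerCycle]
  congr 1
  · refine cycleOf_congr cl (Submodule.Quotient.equiv _ _ e ?_)
    ext x
    simp only [Submodule.mem_map, LinearMap.mem_range, LinearMap.lsmul_apply]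
    constructor
    · rintro ⟨_, ⟨y, rfl⟩, rfl⟩
      exact ⟨e y, by simp⟩
    · rintro ⟨y, rfl⟩
      exact ⟨_, ⟨e.symm y, rfl⟩, by simp⟩
  · refine cycleOf_congr cl (e.ofSubmodules _ _ ?_)
    ext x
    simp only [Submodule.mem_map, LinearMap.mem_ker, LinearMap.lsmul_apply]
    constructor
    · rintro ⟨y, hy, rfl⟩
      simpa using congrArg e hy
    · intro hx
      exact ⟨e.symm x, by simpa using congrArg e.symm hx, by simp⟩

lemma eulerCycle_of_isFiniteLength (a : S) (hM : IsFiniteLength S M) : eulerCycle cl a M = 0 := by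
  have h1 := cycleOf_ker_add_range cl hM (LinearMap.lsmul S M a)
  have h2 := cycleOf_submodule_add_quotient cl hM (LinearMap.range (LinearMap.lsmul S M a))
  rw [eulerCycle, sub_eq_zero]
  rw [h2, add_comm] at h1
  exact add_right_cancel h1

lemma eulerCycle_eq_add (a : S) (f : N →ₗ[S] M) (g : M →ₗ[S] P) (hf : Function.Injective f)
    (hg : Function.Surjective g) (H : Function.Exact f g)
    (hN : IsFiniteLength S (N ⧸ LinearMap.range (LinearMap.lsmul S N a)))
    (hM : IsFiniteLength S (M ⧸ LinearMap.range (LinearMap.lsmul S M a)))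
    (hMk : IsFiniteLength S (LinearMap.ker (LinearMap.lsmul S M a)))
    (hPk : IsFiniteLength S (LinearMap.ker (LinearMap.lsmul S P a))) :
    eulerCycle cl a M = eulerCycle cl a N + eulerCycle cl a P := by
  let i₁ := LinearMap.lsmul S N a
  let i₂ := LinearMap.lsmul S M a
  let i₃ := LinearMap.lsmul S P a
  have h₁ : f.comp i₁ = i₂.comp f := by ext x; simp [i₁, i₂]
  have h₂ : g.comp i₂ = i₃.comp g := by ext x; simp [i₂, i₃]
  let A : LinearMap.ker i₁ →ₗ[S] LinearMap.ker i₂ := f.restrict fun x hx => by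
    rw [LinearMap.mem_ker] at hx ⊢
    rw [← LinearMap.comp_apply, ← h₁, LinearMap.comp_apply, hx, map_zero]
  let B : LinearMap.ker i₂ →ₗ[S] LinearMap.ker i₃ := g.restrict fun x hx => by
    rw [LinearMap.mem_ker] at hx ⊢
    rw [← LinearMap.comp_apply, ← h₂, LinearMap.comp_apply, hx, map_zero]
  let C : (N ⧸ LinearMap.range i₁) →ₗ[S] (M ⧸ LinearMap.range i₂) :=
    Submodule.mapQ _ _ f (by rintro _ ⟨x, rfl⟩; exact ⟨f x, (LinearMap.congr_fun h₁ x).symm⟩)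
  let D : (M ⧸ LinearMap.range i₂) →ₗ[S] (P ⧸ LinearMap.range i₃) :=
    Submodule.mapQ _ _ g (by rintro _ ⟨x, rfl⟩; exact ⟨g x, (LinearMap.congr_fun h₂ x).symm⟩)
  let δ := SnakeLemma.δ' i₁ i₂ i₃ f g H f g H h₁.symm.symm h₂.symm.symm
    (LinearMap.ker i₃).subtype (by exact LinearMap.exact_subtype_ker_map i₃)
    (LinearMap.range i₁).mkQ (LinearMap.exact_map_mkQ_range i₁) hg hf
  have hB : Function.Exact B δ := SnakeLemma.exact_δ'_right i₁ i₂ i₃ f g H f g H _ _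
    (LinearMap.ker i₂).subtype (LinearMap.exact_subtype_ker_map i₂) _ _ _ _ hg hf B
    (by ext; rfl) (Submodule.subtype_injective _)
  have hC : Function.Exact δ C := SnakeLemma.exact_δ'_left i₁ i₂ i₃ f g H f g H _ _ _ _ _ _
    (LinearMap.range i₂).mkQ (LinearMap.exact_map_mkQ_range i₂) hg hf C
    (by ext; rfl) (Submodule.mkQ_surjective _)
  have hA : Function.Injective A := fun x y h => Subtype.ext (hf (congrArg Subtype.val h))
  have hAB : Function.Exact A B := by
    intro x
    constructor
    · intro hx
      obtain ⟨y, hy⟩ := (H x).mp (congrArg Subtype.val hx)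
      refine ⟨⟨y, ?_⟩, Subtype.ext hy⟩
      rw [LinearMap.mem_ker]
      apply hf
      rw [map_zero, ← LinearMap.comp_apply, h₁, LinearMap.comp_apply, hy]
      exact x.2
    · rintro ⟨y, rfl⟩
      exact Subtype.ext (H.apply_apply_eq_zero y)
  have hCD : Function.Exact C D := by
    intro x
    obtain ⟨x, rfl⟩ := Submodule.mkQ_surjective _ x
    constructor
    · intro hx
      obtain ⟨z, hz⟩ := (Submodule.Quotient.mk_eq_zero _).mp (show Submodule.Quotient.mk (g x) = 0 from hx)
      obtain ⟨y, rfl⟩ := hg z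
      obtain ⟨w, hw⟩ := (H (x - i₂ y)).mp (by
        rw [map_sub, sub_eq_zero, ← hz, ← LinearMap.comp_apply, ← h₂]; rfl)
      refine ⟨Submodule.Quotient.mk w, ?_⟩
      refine (Submodule.Quotient.eq _).mpr ⟨-y, ?_⟩
      change i₂ (-y) = f w - x
      rw [hw, map_neg]; abel
    · rintro ⟨y, hy⟩
      obtain ⟨y, rfl⟩ := Submodule.mkQ_surjective _ y
      rw [← hy]
      change Submodule.Quotient.mk (g (f y)) = 0
      rw [H.apply_apply_eq_zero, Submodule.Quotient.mk_zero]
  have hD : Function.Surjective D := by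
    intro x
    obtain ⟨x, rfl⟩ := Submodule.mkQ_surjective _ x
    obtain ⟨y, rfl⟩ := hg x
    exact ⟨Submodule.Quotient.mk y, rfl⟩
  have e1 : cycleOf cl (LinearMap.ker i₁) = cycleOf cl (LinearMap.range A) :=
    cycleOf_congr cl (LinearEquiv.ofInjective A hA)
  have e2 := cycleOf_of_exact cl A B hAB hMk
  have e3 := cycleOf_of_exact cl B δ hB hPk
  have e4 := cycleOf_of_exact cl δ C hC hN
  have e5 := cycleOf_of_exact cl C D hCD hM
  have e6 : cycleOf cl (LinearMap.range D) = cycleOf cl (P ⧸ LinearMap.range i₃) := by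
    rw [LinearMap.range_eq_top.mpr hD]
    exact cycleOf_congr cl Submodule.topEquiv
  rw [eulerCycle, eulerCycle, eulerCycle]
  change cycleOf cl (M ⧸ LinearMap.range i₂) - cycleOf cl (LinearMap.ker i₂) =
    cycleOf cl (N ⧸ LinearMap.range i₁) - cycleOf cl (LinearMap.ker i₁) +
      (cycleOf cl (P ⧸ LinearMap.range i₃) - cycleOf cl (LinearMap.ker i₃))
  rw [e1, e2, e3, e4, e5, e6]
  abel

end Multiplicity
end K3
end

noncomputable section
namespace K3

section Expansion
variable {k A : Type*} [Field k] [CommRing A] [Algebra k A]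

/-- The value at `(a, b)` of the homogeneous polynomial of degree `n` with dehomogenization `p`. -/
def homValue (a b : A) (n : ℕ) (p : Polynomial k) : A :=
  ∑ j ∈ Finset.range (n + 1), algebraMap k A (p.coeff j) * a ^ (n - j) * b ^ j

lemma homValue_add (a b : A) (n : ℕ) (p q : Polynomial k) :
    homValue a b n (p + q) = homValue a b n p + homValue a b n q := by
  simp only [homValue, Polynomial.coeff_add, map_add, add_mul, Finset.sum_add_distrib]

lemma homValue_zero (a b : A) (n : ℕ) : homValue a b n (0 : Polynomial k) = 0 := by
  simp [homValue]

lemma homValue_neg (a b : A) (n : ℕ) (p : Polynomial k) :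
    homValue a b n (-p) = -homValue a b n p := by
  rw [eq_neg_iff_add_eq_zero, ← homValue_add, neg_add_cancel, homValue_zero]

lemma homValue_sum (a b : A) (n : ℕ) {ι : Type*} (s : Finset ι) (p : ι → Polynomial k) :
    homValue a b n (∑ i ∈ s, p i) = ∑ i ∈ s, homValue a b n (p i) := by
  classical
  induction s using Finset.induction_on with
  | empty => simp [homValue_zero]
  | insert i s hi ih => rw [Finset.sum_insert hi, Finset.sum_insert hi, homValue_add, ih]

lemma homValue_C (a b : A) (c : k) : homValue a b 0 (Polynomial.C c) = algebraMap k A c := by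
  simp [homValue]

lemma homValue_eq {L : Type*} [Field L] [Algebra k L] {a b : L} (ha : a ≠ 0) {n : ℕ}
    {p : Polynomial k} (hp : p.natDegree ≤ n) :
    homValue a b n p = a ^ n * Polynomial.aeval (b / a) p := by
  rw [homValue, Polynomial.aeval_eq_sum_range' (Nat.lt_succ_of_le hp), Finset.mul_sum]
  refine Finset.sum_congr rfl fun j hj => ?_
  have hj' : j ≤ n := Nat.lt_succ_iff.mp (Finset.mem_range.mp hj)
  obtain ⟨i, rfl⟩ := Nat.exists_eq_add_of_le hj'
  rw [Algebra.smul_def, Nat.add_sub_cancel_left, pow_add, div_pow]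
  field_simp

lemma map_homValue {B : Type*} [CommRing B] [Algebra k B] (φ : A →ₐ[k] B) (a b : A) (n : ℕ)
    (p : Polynomial k) : φ (homValue a b n p) = homValue (φ a) (φ b) n p := by
  simp [homValue]

lemma homValue_mul [IsDomain A] {a b : A} (ha : a ≠ 0) {n l : ℕ} {p q : Polynomial k}
    (hp : p.natDegree ≤ n) (hq : q.natDegree ≤ l) :
    homValue a b n p * homValue a b l q = homValue a b (n + l) (p * q) := by
  let φ : A →ₐ[k] FractionRing A := IsScalarTower.toAlgHom k A (FractionRing A)
  have hφ : Function.Injective φ := IsFractionRing.injective A (FractionRing A)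
  have ha' : φ a ≠ 0 := by rwa [Ne, map_eq_zero_iff φ hφ]
  apply hφ
  rw [map_mul, map_homValue, map_homValue, map_homValue, homValue_eq ha' hp, homValue_eq ha' hq,
    homValue_eq ha' (Polynomial.natDegree_mul_le.trans (add_le_add hp hq)), map_mul, pow_add]
  ring

variable {m : Ideal A} {a b : A}

lemma homValue_mem (ha : a ∈ m) (hb : b ∈ m) (n : ℕ) (p : Polynomial k) :
    homValue a b n p ∈ m ^ n := by
  refine Ideal.sum_mem _ fun j hj => ?_
  have hj' : j ≤ n := Nat.lt_succ_iff.mp (Finset.mem_range.mp hj)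
  have h : a ^ (n - j) * b ^ j ∈ m ^ (n - j) * m ^ j :=
    Ideal.mul_mem_mul (Ideal.pow_mem_pow ha _) (Ideal.pow_mem_pow hb _)
  rw [← pow_add, Nat.sub_add_cancel hj'] at h
  rw [mul_assoc]
  exact Ideal.mul_mem_left _ _ h

variable (k m a b) in
/-- `a, b` is a system of local parameters at the `k`-rational point `m`, and the powers of `m`
are separated. -/
structure IsLocalParameters : Prop where
  mem_left : a ∈ m
  mem_right : b ∈ m
  rational : ∀ f : A, ∃ c : k, f - algebraMap k A c ∈ m
  le : m ≤ Ideal.span {a, b} ⊔ m ^ 2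
  regular : ∀ (n : ℕ) (p : Polynomial k), p.natDegree ≤ n → homValue a b n p ∈ m ^ (n + 1) → p = 0
  iInf_pow : ⨅ n, m ^ n = ⊥

lemma exists_homValue [IsDomain A] (ha0 : a ≠ 0) (ha : a ∈ m) (hb : b ∈ m)
    (hrat : ∀ f : A, ∃ c : k, f - algebraMap k A c ∈ m)
    (hle : m ≤ Ideal.span {a, b} ⊔ m ^ 2) (n : ℕ) (f : A) (hf : f ∈ m ^ n) :
    ∃ p : Polynomial k, p.natDegree ≤ n ∧ f - homValue a b n p ∈ m ^ (n + 1) := by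
  induction n generalizing f with
  | zero =>
    obtain ⟨c, hc⟩ := hrat f
    exact ⟨Polynomial.C c, by simp, by simpa [homValue_C] using hc⟩
  | succ n ih =>
    rw [pow_succ] at hf
    induction hf using Submodule.mul_induction_on' with
    | mem_mul_mem g hg h hh =>
      obtain ⟨p, hp, hgp⟩ := ih g hg
      obtain ⟨y, hy, z, hz, rfl⟩ := Submodule.mem_sup.mp (hle hh)
      obtain ⟨α, β, rfl⟩ := Ideal.mem_span_pair.mp hy
      obtain ⟨c, hc⟩ := hrat α
      obtain ⟨d, hd⟩ := hrat β
      let q : Polynomial k := Polynomial.C d * Polynomial.X + Polynomial.C c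
      have hq : q.natDegree ≤ 1 := Polynomial.natDegree_linear_le
      have hq' : homValue a b 1 q = algebraMap k A c * a + algebraMap k A d * b := by
        simp [homValue, Finset.sum_range_succ, q]
      refine ⟨p * q, Polynomial.natDegree_mul_le.trans (add_le_add hp hq), ?_⟩
      rw [← homValue_mul ha0 hp hq]
      have h1 : α * a + β * b + z - homValue a b 1 q ∈ m ^ 2 := by
        have : α * a + β * b + z - homValue a b 1 q =
            (α - algebraMap k A c) * a + (β - algebraMap k A d) * b + z := by rw [hq']; ring
        rw [this, pow_two]
        exact add_mem (add_mem (Ideal.mul_mem_mul hc ha) (Ideal.mul_mem_mul hd hb)) (pow_two m ▸ hz)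
      have h2 : g * (α * a + β * b + z) - homValue a b n p * homValue a b 1 q =
          g * (α * a + β * b + z - homValue a b 1 q) +
            (g - homValue a b n p) * homValue a b 1 q := by ring
      rw [h2]
      refine add_mem ?_ ?_
      · have := Ideal.mul_mem_mul hg h1
        rwa [← pow_add] at this
      · have := Ideal.mul_mem_mul hgp (homValue_mem ha hb 1 q)
        rwa [← pow_add] at this
    | add x hx y hy ihx ihy =>
      obtain ⟨p, hp, hxp⟩ := ihx
      obtain ⟨q, hq, hyq⟩ := ihy
      refine ⟨p + q, (Polynomial.natDegree_add_le _ _).trans (max_le hp hq), ?_⟩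
      have := add_mem hxp hyq
      rwa [homValue_add, add_sub_add_comm]

lemma homValue_sub_eval_mem (c : k) (n : ℕ) {p : Polynomial k} (hp : p.natDegree ≤ n) :
    homValue a b n p - algebraMap k A (p.eval c) * a ^ n ∈
      Ideal.span {b - algebraMap k A c * a} := by
  rw [← Ideal.Quotient.mk_eq_mk_iff_sub_mem]
  have hb : Ideal.Quotient.mk (Ideal.span {b - algebraMap k A c * a}) b =
      Ideal.Quotient.mk _ (algebraMap k A c * a) :=
    (Ideal.Quotient.mk_eq_mk_iff_sub_mem _ _).mpr (Ideal.mem_span_singleton_self _)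
  rw [homValue, map_sum, Polynomial.eval_eq_sum_range' (Nat.lt_succ_of_le hp), map_sum,
    Finset.sum_mul, map_sum]
  refine Finset.sum_congr rfl fun j hj => ?_
  have hj' : j ≤ n := Nat.lt_succ_iff.mp (Finset.mem_range.mp hj)
  rw [map_mul, map_pow, hb, ← map_pow, ← map_mul]
  congr 1
  obtain ⟨i, rfl⟩ := Nat.exists_eq_add_of_le hj'
  rw [Nat.add_sub_cancel_left, map_mul, map_pow, mul_pow, pow_add]
  ring

/-- At a smooth point of a surface, two generators of the cotangent space are local parameters. -/
lemma isLocalParameters_of_height [Infinite k] [IsDomain A] [IsNoetherianRing A] [hm : m.IsMaximal]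
    (ha : a ∈ m) (hb : b ∈ m) (hrat : ∀ f : A, ∃ c : k, f - algebraMap k A c ∈ m)
    (hle : m ≤ Ideal.span {a, b} ⊔ m ^ 2) (hht : m.height = 2) :
    IsLocalParameters k m a b := by
  have key : ∀ (t : A) (n : ℕ), t ∈ m → m ^ n ≤ Ideal.span {t} ⊔ m ^ (n + 1) → False := by
    intro t n ht hn
    let q := Ideal.Quotient.mk (Ideal.span {t})
    have hN : m.map q ^ n ≤ m.map q • (m.map q ^ n) := by
      rw [smul_eq_mul, ← pow_succ', ← Ideal.map_pow, ← Ideal.map_pow]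
      refine (Ideal.map_mono hn).trans ?_
      rw [Ideal.map_sup, Ideal.map_quotient_self, bot_sup_eq]
    obtain ⟨r, hr, hr0⟩ := Submodule.exists_sub_one_mem_and_smul_eq_zero_of_fg_of_le_smul
      (m.map q) (m.map q ^ n) (IsNoetherian.noetherian _) hN
    obtain ⟨r, rfl⟩ := Ideal.Quotient.mk_surjective r
    have htm : Ideal.span {t} ≤ m := (Ideal.span_singleton_le_iff_mem _).mpr ht
    have hr1 : r ∉ m := by
      intro hrm
      have h1 : q (r - 1) ∈ m.map q := by simpa using hr
      rw [Ideal.mem_map_iff_of_surjective _ Ideal.Quotient.mk_surjective] at h1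
      obtain ⟨y, hy, hyr⟩ := h1
      have h2 : y - (r - 1) ∈ m :=
        htm ((Ideal.Quotient.mk_eq_mk_iff_sub_mem _ _).mp hyr)
      have h3 : (1 : A) ∈ m := by
        have := add_mem (sub_mem h2 hy) hrm
        simpa using this
      exact hm.ne_top ((Ideal.eq_top_iff_one _).mpr h3)
    have hmin : m ∈ (Ideal.span {t}).minimalPrimes := by
      refine ⟨⟨hm.isPrime, htm⟩, fun p hp hpm => ?_⟩
      have hpp := hp.1
      refine hpp.le_of_pow_le (n := n) fun x hx => ?_
      have h1 : q r * q x = 0 := hr0 _ (by rw [← Ideal.map_pow]; exact Ideal.mem_map_of_mem _ hx)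
      rw [← map_mul] at h1
      have h2 : r * x ∈ p := hp.2 (Ideal.Quotient.eq_zero_iff_mem.mp h1)
      exact (hpp.mem_or_mem h2).resolve_left fun h => hr1 (hpm h)
    have := Ideal.height_le_one_of_isPrincipal_of_mem_minimalPrimes (Ideal.span {t}) m hmin
    rw [hht] at this
    exact absurd this (by decide)
  have ha0 : a ≠ 0 := by
    rintro rfl
    refine key b 1 hb ?_
    rw [pow_one]
    refine hle.trans (sup_le_sup_right (Ideal.span_le.mpr ?_) _)
    rintro x (rfl | rfl)
    · exact zero_mem _
    · exact Ideal.mem_span_singleton_self _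
  refine ⟨ha, hb, hrat, hle, fun n p hp hmem => ?_, ?_⟩
  · by_contra hp0
    obtain ⟨c, hc⟩ : ∃ c, p.eval c ≠ 0 := by
      by_contra! h
      exact hp0 (Polynomial.funext fun c => by rw [h c, Polynomial.eval_zero])
    let t := b - algebraMap k A c * a
    have han : a ^ n ∈ Ideal.span {t} ⊔ m ^ (n + 1) := by
      have h1 := sub_mem (Ideal.mem_sup_right (S := Ideal.span {t}) hmem)
        (Ideal.mem_sup_left (T := m ^ (n + 1)) (homValue_sub_eval_mem (a := a) (b := b) c n hp))
      rw [sub_sub_cancel] at h1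
      have h2 := Ideal.mul_mem_left _ (algebraMap k A (p.eval c)⁻¹) h1
      rwa [← mul_assoc, ← map_mul, inv_mul_cancel₀ hc, map_one, one_mul] at h2
    refine key t n (sub_mem hb (Ideal.mul_mem_left _ _ ha)) fun f hf => ?_
    obtain ⟨q, hq, hfq⟩ := exists_homValue ha0 ha hb hrat hle n f hf
    have h1 := Ideal.mem_sup_left (T := m ^ (n + 1)) (homValue_sub_eval_mem (a := a) (b := b) c n hq)
    have h2 := Ideal.mem_sup_right (S := Ideal.span {t}) hfq
    have h3 := Ideal.mul_mem_left _ (algebraMap k A (q.eval c)) han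
    have := add_mem (add_mem h2 h1) h3
    simpa using this
  · exact Ideal.iInf_pow_eq_bot_of_isDomain m hm.ne_top

end Expansion
end K3
end

noncomputable section
namespace K3

section Expansion
variable {k A : Type*} [Field k] [CommRing A] [IsDomain A] [Algebra k A] {m : Ideal A} {a b : A}

variable (m a b) in
/-- `φ` is the expansion of `f` in the local parameters `a = s` and `b = us`. -/
def IsExpansion (f : A) (φ : PowerSeries (Polynomial k)) : Prop :=
  ∀ N, (φ.coeff N).natDegree ≤ N ∧
    f - ∑ n ∈ Finset.range N, homValue a b n (φ.coeff n) ∈ m ^ N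

namespace IsLocalParameters

lemma left_ne_zero (h : IsLocalParameters k m a b) : a ≠ 0 := by
  rintro rfl
  have := h.regular 1 1 (by simp) (by
    simp [homValue, Polynomial.coeff_one])
  exact one_ne_zero this

lemma eq_of_isExpansion (h : IsLocalParameters k m a b) {f : A} {φ ψ : PowerSeries (Polynomial k)}
    (hφ : IsExpansion m a b f φ) (hψ : IsExpansion m a b f ψ) : φ = ψ := by
  ext1 n
  induction n using Nat.strong_induction_on with
  | _ n ih =>
    have h1 := sub_mem (hφ (n + 1)).2 (hψ (n + 1)).2
    have hs : ∑ i ∈ Finset.range n, homValue a b i (φ.coeff i) =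
        ∑ i ∈ Finset.range n, homValue a b i (ψ.coeff i) :=
      Finset.sum_congr rfl fun i hi => by rw [ih i (Finset.mem_range.mp hi)]
    rw [sub_sub_sub_cancel_left, Finset.sum_range_succ, Finset.sum_range_succ, hs,
      add_sub_add_left_eq_sub, sub_eq_add_neg, ← homValue_neg, ← homValue_add] at h1
    have h2 := h.regular n _ ((Polynomial.natDegree_add_le _ _).trans (max_le (hψ n).1
      (by rw [Polynomial.natDegree_neg]; exact (hφ n).1))) h1
    rw [← sub_eq_add_neg, sub_eq_zero] at h2
    exact h2.symm

lemma exists_isExpansion (h : IsLocalParameters k m a b) (f : A) :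
    ∃ φ : PowerSeries (Polynomial k), IsExpansion m a b f φ := by
  have step : ∀ n (g : A), ∃ p : Polynomial k, p.natDegree ≤ n ∧
      (g ∈ m ^ n → g - homValue a b n p ∈ m ^ (n + 1)) := by
    intro n g
    by_cases hg : g ∈ m ^ n
    · obtain ⟨p, hp, hp'⟩ := exists_homValue h.left_ne_zero h.mem_left h.mem_right h.rational h.le n g hg
      exact ⟨p, hp, fun _ => hp'⟩
    · exact ⟨0, by simp, fun h => absurd h hg⟩
  choose p hp hp' using step
  let r : ℕ → A := fun n => Nat.rec f (fun n g => g - homValue a b n (p n g)) n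
  let φ : PowerSeries (Polynomial k) := PowerSeries.mk fun n => p n (r n)
  have hr : ∀ N, r N = f - ∑ n ∈ Finset.range N, homValue a b n (φ.coeff n) := by
    intro N
    induction N with
    | zero => simp [r]
    | succ N ih =>
      rw [Finset.sum_range_succ, ← sub_sub, ← ih, PowerSeries.coeff_mk]
  have hmem : ∀ N, r N ∈ m ^ N := by
    intro N
    induction N with
    | zero => simp
    | succ N ih => exact hp' N (r N) ih
  refine ⟨φ, fun N => ⟨?_, hr N ▸ hmem N⟩⟩
  rw [PowerSeries.coeff_mk]
  exact hp N _

end IsLocalParameters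

namespace IsExpansion

lemma add {f g : A} {φ ψ : PowerSeries (Polynomial k)} (hf : IsExpansion m a b f φ)
    (hg : IsExpansion m a b g ψ) : IsExpansion m a b (f + g) (φ + ψ) := by
  intro N
  refine ⟨by
    rw [map_add]
    exact (Polynomial.natDegree_add_le _ _).trans (max_le (hf N).1 (hg N).1), ?_⟩
  have := add_mem (hf N).2 (hg N).2
  simpa only [map_add, homValue_add, Finset.sum_add_distrib, add_sub_add_comm] using this

lemma mul (ha0 : a ≠ 0) (ha : a ∈ m) (hb : b ∈ m) {f g : A} {φ ψ : PowerSeries (Polynomial k)}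
    (hf : IsExpansion m a b f φ) (hg : IsExpansion m a b g ψ) :
    IsExpansion m a b (f * g) (φ * ψ) := by
  intro N
  constructor
  · rw [PowerSeries.coeff_mul]
    refine Polynomial.natDegree_sum_le_of_forall_le _ _ fun p hp => ?_
    rw [← Finset.HasAntidiagonal.mem_antidiagonal.mp hp]
    exact Polynomial.natDegree_mul_le.trans (add_le_add (hf _).1 (hg _).1)
  · let F := ∑ n ∈ Finset.range N, homValue a b n (φ.coeff n)
    let G := ∑ n ∈ Finset.range N, homValue a b n (ψ.coeff n)
    have hFG : F * G - ∑ n ∈ Finset.range N, homValue a b n ((φ * ψ).coeff n) ∈ m ^ N := by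
      let c : ℕ × ℕ → A := fun p => homValue a b (p.1 + p.2) (φ.coeff p.1 * ψ.coeff p.2)
      have h1 : F * G = ∑ p ∈ Finset.range N ×ˢ Finset.range N, c p := by
        rw [Finset.sum_mul_sum, ← Finset.sum_product']
        exact Finset.sum_congr rfl fun p _ => homValue_mul ha0 (hf _).1 (hg _).1
      have h2 : ∑ n ∈ Finset.range N, homValue a b n ((φ * ψ).coeff n) =
          ∑ p ∈ Finset.range N ×ˢ Finset.range N with p.1 + p.2 < N, c p := by
        rw [← Finset.sum_fiberwise_of_maps_to (t := Finset.range N) (g := fun p : ℕ × ℕ => p.1 + p.2)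
          (fun p hp => Finset.mem_range.mpr (Finset.mem_filter.mp hp).2)]
        refine Finset.sum_congr rfl fun n hn => ?_
        rw [PowerSeries.coeff_mul, homValue_sum]
        refine Finset.sum_congr ?_ fun p hp => ?_
        · ext p
          simp only [Finset.HasAntidiagonal.mem_antidiagonal, Finset.mem_filter, Finset.mem_product,
            Finset.mem_range] at hn ⊢
          omega
        · have hp' : p.1 + p.2 = n := (Finset.mem_filter.mp hp).2
          rw [← hp']
      rw [h1, h2, ← Finset.sum_filter_add_sum_filter_not (Finset.range N ×ˢ Finset.range N)
        (fun p => p.1 + p.2 < N), add_sub_cancel_left]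
      refine Ideal.sum_mem _ fun p hp => ?_
      exact Ideal.pow_le_pow_right (not_lt.mp (Finset.mem_filter.mp hp).2)
        (homValue_mem ha hb _ _)
    have h3 : f * g - ∑ n ∈ Finset.range N, homValue a b n ((φ * ψ).coeff n) =
        (f - F) * g + F * (g - G) +
          (F * G - ∑ n ∈ Finset.range N, homValue a b n ((φ * ψ).coeff n)) := by ring
    rw [h3]
    exact add_mem (add_mem (Ideal.mul_mem_right _ _ (hf N).2) (Ideal.mul_mem_left _ _ (hg N).2)) hFG

lemma const (c : k) : IsExpansion m a b (algebraMap k A c) (PowerSeries.C (Polynomial.C c)) := by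
  intro N
  constructor
  · rw [PowerSeries.coeff_C]; split_ifs <;> simp
  · cases N with
    | zero => simp
    | succ N =>
      rw [Finset.sum_range_succ']
      simp [PowerSeries.coeff_C, homValue_zero, homValue_C]

lemma left (ha : a ∈ m) : IsExpansion m a b a (PowerSeries.X : PowerSeries (Polynomial k)) := by
  intro N
  constructor
  · rw [PowerSeries.coeff_X]; split_ifs <;> simp
  · match N with
    | 0 => simp
    | 1 => simpa [PowerSeries.coeff_X, homValue_zero] using ha
    | N + 2 =>
      rw [Finset.sum_range_succ', Finset.sum_range_succ']
      simp [PowerSeries.coeff_X, homValue, Polynomial.coeff_one]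

lemma right (hb : b ∈ m) : IsExpansion m a b b
    (PowerSeries.C Polynomial.X * PowerSeries.X : PowerSeries (Polynomial k)) := by
  intro N
  constructor
  · rw [PowerSeries.coeff_C_mul, PowerSeries.coeff_X]; split_ifs with h <;> simp [h]
  · match N with
    | 0 => simp
    | 1 => simpa [PowerSeries.coeff_X, homValue_zero] using hb
    | N + 2 =>
      rw [Finset.sum_range_succ', Finset.sum_range_succ']
      simp [PowerSeries.coeff_C_mul, PowerSeries.coeff_X, homValue, Polynomial.coeff_X]

end IsExpansion

/-- Expansion in the local parameters `a = s` and `b = us`, as a ring homomorphism. -/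
def IsLocalParameters.expansion (h : IsLocalParameters k m a b) : A →+* PowerSeries (Polynomial k) where
  toFun f := (h.exists_isExpansion f).choose
  map_one' := h.eq_of_isExpansion (h.exists_isExpansion 1).choose_spec
    (by simpa using IsExpansion.const (m := m) (a := a) (b := b) (1 : k))
  map_mul' f g := h.eq_of_isExpansion (h.exists_isExpansion (f * g)).choose_spec
    (.mul h.left_ne_zero h.mem_left h.mem_right (h.exists_isExpansion f).choose_spec
      (h.exists_isExpansion g).choose_spec)
  map_zero' := h.eq_of_isExpansion (h.exists_isExpansion 0).choose_spec
    (by simpa using IsExpansion.const (m := m) (a := a) (b := b) (0 : k))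
  map_add' f g := h.eq_of_isExpansion (h.exists_isExpansion (f + g)).choose_spec
    (.add (h.exists_isExpansion f).choose_spec (h.exists_isExpansion g).choose_spec)

namespace IsLocalParameters

lemma isExpansion (h : IsLocalParameters k m a b) (f : A) : IsExpansion m a b f (h.expansion f) :=
  (h.exists_isExpansion f).choose_spec

lemma expansion_algebraMap (h : IsLocalParameters k m a b) (c : k) :
    h.expansion (algebraMap k A c) = PowerSeries.C (Polynomial.C c) :=
  h.eq_of_isExpansion (h.isExpansion _) (.const c)

lemma expansion_left (h : IsLocalParameters k m a b) : h.expansion a = PowerSeries.X :=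
  h.eq_of_isExpansion (h.isExpansion _) (.left h.mem_left)

lemma expansion_right (h : IsLocalParameters k m a b) :
    h.expansion b = PowerSeries.C Polynomial.X * PowerSeries.X :=
  h.eq_of_isExpansion (h.isExpansion _) (.right h.mem_right)

lemma expansion_injective (h : IsLocalParameters k m a b) : Function.Injective h.expansion := by
  rw [injective_iff_map_eq_zero]
  intro f hf
  have h1 := h.isExpansion f
  rw [hf] at h1
  rw [← Ideal.mem_bot, ← h.iInf_pow, Ideal.mem_iInf]
  intro n
  simpa [homValue_zero] using (h1 n).2

lemma mem_of_eval_constantCoeff (h : IsLocalParameters k m a b) {f : A} (c : k)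
    (hf : Polynomial.eval c (PowerSeries.coeff 0 (h.expansion f)) = 0) : f ∈ m := by
  obtain ⟨h1, -⟩ := h.isExpansion f 0
  obtain ⟨-, h2⟩ := h.isExpansion f 1
  rw [Polynomial.eq_C_of_natDegree_le_zero h1, Polynomial.eval_C] at hf
  rw [Finset.sum_range_one, Polynomial.eq_C_of_natDegree_le_zero h1, hf, map_zero, homValue_zero,
    sub_zero, pow_one] at h2
  exact h2

end IsLocalParameters
end Expansion
end K3
end

noncomputable section
namespace K3

/-- Vectors killed by all linear relations of a family lie in its span up to a common denominator. -/
lemma exists_smul_mem_span {R : Type*} [CommRing R] [IsDomain R] [IsPrincipalIdealRing R] {r : Type*}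
    [Fintype r] {J : Type*} (v w : J → r → R)
    (h : ∀ c : r → R, (∀ n, ∑ i, c i * v n i = 0) → ∀ n, ∑ i, c i * w n i = 0) :
    ∃ d : R, d ≠ 0 ∧ ∀ n, d • w n ∈ Submodule.span R (Set.range v) := by
  classical
  let S := Submodule.span R (Set.range v)
  let M := (r → R) ⧸ S
  let T := Submodule.torsion R M
  have hw : ∀ n, S.mkQ (w n) ∈ T := by
    intro n
    by_contra hn
    have : Module.Free R (M ⧸ T) := Module.free_of_finite_type_torsion_free'
    have hne : T.mkQ (S.mkQ (w n)) ≠ 0 := by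
      rwa [Ne, Submodule.mkQ_apply, Submodule.Quotient.mk_eq_zero]
    obtain ⟨f, hf⟩ := Module.Projective.exists_dual_ne_zero R hne
    let g : (r → R) →ₗ[R] R := f ∘ₗ T.mkQ ∘ₗ S.mkQ
    have hg : ∀ x : r → R, ∑ i, g (Pi.single i 1) * x i = g x := by
      intro x
      conv_rhs => rw [pi_eq_sum_univ' x, map_sum]
      refine Finset.sum_congr rfl fun i _ => ?_
      rw [map_smul, smul_eq_mul, mul_comm]
    refine hf ?_
    have := h (fun i => g (Pi.single i 1)) (fun n => ?_) n
    · rwa [hg] at this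
    · rw [hg]
      have h1 : S.mkQ (v n) = 0 :=
        (Submodule.Quotient.mk_eq_zero S).mpr (Submodule.subset_span ⟨n, rfl⟩)
      simp only [g, LinearMap.comp_apply, h1, map_zero]
  have : Module.Finite R T := inferInstance
  obtain ⟨d, hd, hd0⟩ := Submodule.annihilator_top_inter_nonZeroDivisors
    (Submodule.torsion_isTorsion (R := R) (M := M))
  refine ⟨d, nonZeroDivisors.ne_zero hd0, fun n => ?_⟩
  have h1 := Submodule.mem_annihilator.mp hd ⟨_, hw n⟩ trivial
  have h2 : S.mkQ (d • w n) = 0 := by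
    rw [map_smul]; exact congrArg Subtype.val h1
  exact (Submodule.Quotient.mk_eq_zero S).mp h2

section TwoPoints
variable {k A : Type*} [Field k] [CommRing A] [IsDomain A] [Algebra k A] {m₁ m₂ m : Ideal A} {a b : A}

lemma IsLocalParameters.expansion_homValue (h : IsLocalParameters k m a b) {n : ℕ} {p : Polynomial k}
    (hp : p.natDegree ≤ n) : h.expansion (homValue a b n p) = PowerSeries.X ^ n * PowerSeries.C p := by
  rw [homValue, map_sum]
  conv_rhs => rw [p.as_sum_range_C_mul_X_pow' (Nat.lt_succ_of_le hp), map_sum, Finset.mul_sum]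
  refine Finset.sum_congr rfl fun j hj => ?_
  obtain ⟨i, rfl⟩ := Nat.exists_eq_add_of_le (Nat.lt_succ_iff.mp (Finset.mem_range.mp hj))
  rw [map_mul, map_mul, map_pow, map_pow, h.expansion_algebraMap, h.expansion_left,
    h.expansion_right, Nat.add_sub_cancel_left, map_mul, map_pow, mul_pow, pow_add]
  ring

/-- A linear relation with polynomial coefficients among expansions at one point holds at the other. -/
lemma sum_C_mul_expansion_eq_zero (h₁ : IsLocalParameters k m₁ a b) (h₂ : IsLocalParameters k m₂ a b)
    {r : Type*} [Fintype r] (f : r → A) (c : r → Polynomial k)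
    (h : ∑ i, PowerSeries.C (c i) * h₁.expansion (f i) = 0) :
    ∑ i, PowerSeries.C (c i) * h₂.expansion (f i) = 0 := by
  let D := Finset.univ.sup fun i => (c i).natDegree
  have hD : ∀ i, (c i).natDegree ≤ D := fun i =>
    Finset.le_sup (f := fun i => (c i).natDegree) (Finset.mem_univ i)
  have key : ∀ {m : Ideal A} (h : IsLocalParameters k m a b),
      h.expansion (∑ i, homValue a b D (c i) * f i) =
        PowerSeries.X ^ D * ∑ i, PowerSeries.C (c i) * h.expansion (f i) := by
    intro m h
    rw [map_sum, Finset.mul_sum]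
    refine Finset.sum_congr rfl fun i _ => ?_
    rw [map_mul, h.expansion_homValue (hD i), mul_assoc]
  have h0 : ∑ i, homValue a b D (c i) * f i = 0 := by
    apply h₁.expansion_injective
    rw [key h₁, h, mul_zero, map_zero]
  have h2 := key h₂
  rw [h0, map_zero] at h2
  exact (mul_eq_zero.mp h2.symm).resolve_left (pow_ne_zero _ PowerSeries.X_ne_zero)

/-- Restriction to the branch at `m` of the curve `b = c a`. -/
def IsLocalParameters.branch (h : IsLocalParameters k m a b) (c : k) : A →+* PowerSeries k :=
  (PowerSeries.map (Polynomial.evalRingHom c)).comp h.expansion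

lemma IsLocalParameters.branch_algebraMap (h : IsLocalParameters k m a b) (c d : k) :
    h.branch c (algebraMap k A d) = PowerSeries.C d := by
  simp [branch, h.expansion_algebraMap]

lemma IsLocalParameters.branch_left (h : IsLocalParameters k m a b) (c : k) :
    h.branch c a = PowerSeries.X := by
  simp [branch, h.expansion_left]

lemma IsLocalParameters.branch_right (h : IsLocalParameters k m a b) (c : k) :
    h.branch c b = PowerSeries.C c * PowerSeries.X := by
  simp [branch, h.expansion_right]

lemma IsLocalParameters.coeff_branch (h : IsLocalParameters k m a b) (c : k) (f : A) (n : ℕ) :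
    (h.branch c f).coeff n = ((h.expansion f).coeff n).eval c := by
  simp [branch]

lemma IsLocalParameters.exists_branch_ne_zero (h : IsLocalParameters k m a b) {f : A} (hf : f ≠ 0) :
    ∃ w : Polynomial k, w ≠ 0 ∧ ∀ c, w.eval c ≠ 0 → h.branch c f ≠ 0 := by
  have h1 : h.expansion f ≠ 0 := fun h0 => hf (h.expansion_injective (h0.trans (map_zero _).symm))
  obtain ⟨n, hn⟩ : ∃ n, (h.expansion f).coeff n ≠ 0 := by
    by_contra! h2
    exact h1 (PowerSeries.ext fun n => by rw [h2, map_zero])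
  refine ⟨_, hn, fun c hc h0 => hc ?_⟩
  rw [← h.coeff_branch, h0, map_zero]

/-- On a fixed finite-dimensional space of functions, the branches at two points of almost every
member of the pencil `b = c a` impose the same conditions. -/
lemma exists_branch_sum_eq_zero (h₁ : IsLocalParameters k m₁ a b) (h₂ : IsLocalParameters k m₂ a b)
    {r : Type*} [Fintype r] (f : r → A) :
    ∃ w : Polynomial k, w ≠ 0 ∧ ∀ c, w.eval c ≠ 0 → ∀ x : r → k,
      h₁.branch c (∑ i, algebraMap k A (x i) * f i) = 0 →
      h₂.branch c (∑ i, algebraMap k A (x i) * f i) = 0 := by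
  obtain ⟨d, hd0, hd⟩ := exists_smul_mem_span (fun n i => (h₁.expansion (f i)).coeff n)
    (fun n i => (h₂.expansion (f i)).coeff n) (fun c hc n => by
      have h1 := sum_C_mul_expansion_eq_zero h₁ h₂ f c (PowerSeries.ext fun n => by
        simpa [PowerSeries.coeff_C_mul] using hc n)
      simpa [PowerSeries.coeff_C_mul] using congrArg (PowerSeries.coeff n) h1)
  refine ⟨d, hd0, fun c hc x hx => ?_⟩
  have hcoeff : ∀ {m : Ideal A} (h : IsLocalParameters k m a b) (n : ℕ),
      (h.branch c (∑ i, algebraMap k A (x i) * f i)).coeff n =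
        ∑ i, x i * ((h.expansion (f i)).coeff n).eval c := by
    intro m h n
    simp [map_sum, h.branch_algebraMap, PowerSeries.coeff_C_mul, h.coeff_branch]
  have hspan : ∀ z ∈ Submodule.span (Polynomial k)
      (Set.range fun n i => (h₁.expansion (f i)).coeff n), ∑ i, x i * (z i).eval c = 0 := by
    intro z hz
    induction hz using Submodule.span_induction with
    | mem z hz =>
      obtain ⟨n, rfl⟩ := hz
      rw [← hcoeff h₁, hx, map_zero]
    | zero => simp
    | add y z _ _ hy hz => simp [mul_add, Finset.sum_add_distrib, hy, hz]
    | smul p z _ hz =>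
      have : ∑ i, x i * ((p • z) i).eval c = p.eval c * ∑ i, x i * (z i).eval c := by
        rw [Finset.mul_sum]
        exact Finset.sum_congr rfl fun i _ => by simp; ring
      rw [this, hz, mul_zero]
  ext n
  rw [hcoeff h₂, map_zero]
  have h3 := hspan _ (hd n)
  have h4 : ∑ i, x i * ((d • fun i => (h₂.expansion (f i)).coeff n) i).eval c =
      d.eval c * ∑ i, x i * ((h₂.expansion (f i)).coeff n).eval c := by
    rw [Finset.mul_sum]
    exact Finset.sum_congr rfl fun i _ => by simp; ring
  exact (mul_eq_zero.mp (h4.symm.trans h3)).resolve_left hc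

end TwoPoints
end K3
end

noncomputable section
namespace K3

section Separating
variable {k A : Type*} [Field k] [CommRing A] [IsDomain A] [Algebra k A] [Algebra.FiniteType k A]
  {m : Ideal A} {a b : A}

/-- The differentials of local parameters at a rational point generate. -/
lemma subsingleton_differentials {E : Type*} [Field E] [Algebra k E] [Algebra E (FractionRing A)]
    [IsScalarTower k E (FractionRing A)]
    (hm : m ≠ ⊤) (hrat : ∀ f : A, ∃ c : k, f - algebraMap k A c ∈ m)
    (hle : m ≤ Ideal.span {a, b} ⊔ m ^ 2) (ha : a ∈ m) (hb : b ∈ m)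
    (ha' : algebraMap A (FractionRing A) a ∈ (algebraMap E (FractionRing A)).range)
    (hb' : algebraMap A (FractionRing A) b ∈ (algebraMap E (FractionRing A)).range) :
    Subsingleton Ω[FractionRing A⁄E] := by
  let L := FractionRing A
  let D : A → Ω[L⁄E] := fun f => KaehlerDifferential.D E L (algebraMap A L f)
  have hDadd : ∀ f g, D (f + g) = D f + D g := fun f g => by simp [D]
  have hDmul : ∀ f g, D (f * g) = f • D g + g • D f := fun f g => by
    simp only [D, map_mul, Derivation.leibniz, algebraMap_smul]
  have hDa : ∀ f, algebraMap A L f ∈ (algebraMap E L).range → D f = 0 := by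
    rintro f ⟨e, he⟩
    simp only [D]
    rw [← he, Derivation.map_algebraMap]
  have hDc : ∀ c : k, D (algebraMap k A c) = 0 := fun c => hDa _ ⟨algebraMap k E c, by
    rw [← IsScalarTower.algebraMap_apply k E L, ← IsScalarTower.algebraMap_apply k A L]⟩
  let N : Submodule A Ω[L⁄E] := Submodule.span A (Set.range D)
  have hDN : ∀ f, D f ∈ N := fun f => Submodule.subset_span ⟨f, rfl⟩
  have hfg : N.FG := by
    obtain ⟨s, hs⟩ := Algebra.FiniteType.out (R := k) (A := A)
    refine ⟨(s.finite_toSet.image D).toFinset, le_antisymm ?_ ?_⟩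
    · refine Submodule.span_mono ?_
      rw [Set.Finite.coe_toFinset]
      exact Set.image_subset_range _ _
    · rw [Set.Finite.coe_toFinset, Submodule.span_le]
      rintro _ ⟨f, rfl⟩
      have hf : f ∈ Algebra.adjoin k (s : Set A) := hs ▸ trivial
      induction hf using Algebra.adjoin_induction with
      | mem x hx => exact Submodule.subset_span ⟨x, hx, rfl⟩
      | algebraMap c => rw [hDc]; exact zero_mem _
      | add x y _ _ hx hy => rw [hDadd]; exact add_mem hx hy
      | mul x y _ _ hx hy =>
        rw [hDmul]; exact add_mem (Submodule.smul_mem _ _ hy) (Submodule.smul_mem _ _ hx)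
  have hD2 : ∀ f ∈ m ^ 2, D f ∈ m • N := by
    intro f hf
    rw [pow_two] at hf
    induction hf using Submodule.mul_induction_on' with
    | mem_mul_mem x hx y hy =>
      rw [hDmul]
      exact add_mem (Submodule.smul_mem_smul hx (hDN _)) (Submodule.smul_mem_smul hy (hDN _))
    | add x _ y _ hx hy => rw [hDadd]; exact add_mem hx hy
  have hN : N ≤ m • N := by
    rw [Submodule.span_le]
    rintro _ ⟨f, rfl⟩
    obtain ⟨c, hc⟩ := hrat f
    obtain ⟨y, hy, z, hz, hyz⟩ := Submodule.mem_sup.mp (hle hc)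
    obtain ⟨α, β, rfl⟩ := Ideal.mem_span_pair.mp hy
    have h1 : f = algebraMap k A c + (α * a + β * b + z) := by rw [hyz]; ring
    rw [h1, hDadd, hDc, zero_add, hDadd, hDadd, hDmul, hDmul, hDa a ha', hDa b hb', smul_zero,
      smul_zero, zero_add, zero_add]
    exact add_mem (add_mem (Submodule.smul_mem_smul ha (hDN _))
      (Submodule.smul_mem_smul hb (hDN _))) (hD2 z hz)
  obtain ⟨r, hr, hr0⟩ := Submodule.exists_sub_one_mem_and_smul_eq_zero_of_fg_of_le_smul m N hfg hN
  have hr1 : algebraMap A L r ≠ 0 := by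
    rw [Ne, FaithfulSMul.algebraMap_eq_zero_iff]
    rintro rfl
    rw [zero_sub, neg_mem_iff] at hr
    exact hm ((Ideal.eq_top_iff_one m).mpr hr)
  have hD0 : ∀ f, D f = 0 := by
    intro f
    have h1 := hr0 _ (hDN f)
    rw [← algebraMap_smul L r (D f)] at h1
    exact (smul_eq_zero.mp h1).resolve_left hr1
  have hDL : ∀ x : L, KaehlerDifferential.D E L x = 0 := by
    intro x
    obtain ⟨f, g, hg, rfl⟩ := IsFractionRing.div_surjective (A := A) x
    have hg0 : algebraMap A L g ≠ 0 := by
      rw [Ne, FaithfulSMul.algebraMap_eq_zero_iff]; exact nonZeroDivisors.ne_zero hg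
    have h1 : D f = 0 := hD0 f
    have h2 : D g = 0 := hD0 g
    simp only [D] at h1 h2
    rw [Derivation.leibniz_div, h1, h2, smul_zero, smul_zero, sub_zero, smul_zero]
  have htop : (⊤ : Submodule L Ω[L⁄E]) ≤ ⊥ := by
    rw [← KaehlerDifferential.span_range_derivation, Submodule.span_le]
    rintro _ ⟨x, rfl⟩
    exact hDL x
  refine ⟨fun x y => ?_⟩
  rw [(Submodule.mem_bot L).mp (htop (x := x) trivial), (Submodule.mem_bot L).mp (htop (x := y) trivial)]

open IntermediateField.algebraAdjoinAdjoin in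
/-- The function field of a surface is generated by local parameters at a rational point and one
further regular function. -/
lemma exists_primitive_function [Infinite k]
    (hm : m ≠ ⊤) (hrat : ∀ f : A, ∃ c : k, f - algebraMap k A c ∈ m)
    (hle : m ≤ Ideal.span {a, b} ⊔ m ^ 2) (ha : a ∈ m) (hb : b ∈ m) :
    ∃ θ h : A, h ≠ 0 ∧ (∃ p : Polynomial (MvPolynomial (Fin 2) k),
        p.map (MvPolynomial.aeval (R := k) ![a, b]).toRingHom ≠ 0 ∧
        p.eval₂ (MvPolynomial.aeval (R := k) ![a, b]).toRingHom θ = 0) ∧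
      ∀ f, ∃ N : ℕ, h ^ N * f ∈ Algebra.adjoin k {a, b, θ} := by
  classical
  let L := FractionRing A
  let j : A →ₐ[k] L := IsScalarTower.toAlgHom k A L
  have hj : Function.Injective j := IsFractionRing.injective A L
  let E : IntermediateField k L := IntermediateField.adjoin k {j a, j b}
  have hEa : j a ∈ E := IntermediateField.subset_adjoin _ _ (by simp)
  have hEb : j b ∈ E := IntermediateField.subset_adjoin _ _ (by simp)
  have h0 : Subsingleton Ω[L⁄E] := subsingleton_differentials (E := E) hm hrat hle ha hb
    ⟨⟨_, hEa⟩, rfl⟩ ⟨⟨_, hEb⟩, rfl⟩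
  have h1 : Algebra.FormallyUnramified E L := (Algebra.formallyUnramified_iff _ _).mpr h0
  have h2 : Algebra.EssFiniteType k L := by
    have := Algebra.EssFiniteType.of_isLocalization (FractionRing A) (nonZeroDivisors A)
    exact Algebra.EssFiniteType.comp k A (FractionRing A)
  have h3 : Algebra.EssFiniteType E L := Algebra.EssFiniteType.of_comp k E L
  have h4 : Algebra.IsSeparable E L := (Algebra.FormallyUnramified.iff_isSeparable E L).mp h1
  have h5 : Module.Finite E L := Algebra.FormallyUnramified.finite_of_free E L
  have h6 : Finite (IntermediateField E L) :=
    Field.finite_intermediateField_of_exists_primitive_element E L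
      (Field.exists_primitive_element E L)
  let V : IntermediateField E L → Submodule k A := fun M =>
    (M.toSubalgebra.toSubmodule.restrictScalars k).comap j.toLinearMap
  have hV : ∀ M, V M = ⊤ → M = ⊤ := by
    intro M hM
    rw [eq_top_iff]
    rintro x -
    obtain ⟨f, g, hg, rfl⟩ := IsFractionRing.div_surjective (A := A) x
    have hf : f ∈ V M := hM ▸ trivial
    have hg : g ∈ V M := hM ▸ trivial
    exact M.div_mem hf hg
  have h7 := Subspace.biUnion_ne_univ_of_top_notMem (k := k) (E := A)
    (s := (Set.toFinite (V '' {M | M ≠ ⊤})).toFinset) (by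
      rw [Set.Finite.mem_toFinset]
      rintro ⟨M, hM, hM'⟩
      exact hM (hV M hM'))
  obtain ⟨θ, hθ⟩ := (Set.ne_univ_iff_exists_notMem _).mp h7
  have hθ' : IntermediateField.adjoin E {j θ} = ⊤ := by
    by_contra hne
    refine hθ (Set.mem_biUnion (x := V (IntermediateField.adjoin E {j θ})) ?_ ?_)
    · rw [Finset.mem_coe, Set.Finite.mem_toFinset]
      exact ⟨_, hne, rfl⟩
    · exact IntermediateField.mem_adjoin_simple_self E (j θ)
  have h8 : IntermediateField.adjoin k {j a, j b, j θ} = ⊤ := by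
    have h := IntermediateField.adjoin_adjoin_left k {j a, j b} {j θ}
    rw [Set.insert_union, Set.singleton_union] at h
    rw [← h]
    exact (congrArg (IntermediateField.restrictScalars k) hθ').trans
      IntermediateField.restrictScalars_top
  let C := Algebra.adjoin k {a, b, θ}
  have hC : Algebra.adjoin k {j a, j b, j θ} = C.map j := by
    rw [AlgHom.map_adjoin]; congr 1; simp [Set.image_insert_eq]
  have h9 : ∀ f : A, ∃ y ∈ C, y ≠ 0 ∧ y * f ∈ C := by
    intro f
    have : j f ∈ IntermediateField.adjoin k {j a, j b, j θ} := h8 ▸ trivial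
    obtain ⟨x, hx, y, hy, hxy⟩ := IntermediateField.mem_adjoin_iff_div.mp this
    rw [hC] at hx hy
    obtain ⟨x, hx, rfl⟩ := hx
    obtain ⟨y, hy, rfl⟩ := hy
    by_cases hy0 : y = 0
    · subst hy0
      have : f = 0 := hj (by rw [hxy]; simp)
      exact ⟨1, one_mem _, one_ne_zero, by rw [this, mul_zero]; exact zero_mem _⟩
    · refine ⟨y, hy, hy0, ?_⟩
      have : y * f = x := hj (by
        have : j y ≠ 0 := by rwa [Ne, map_eq_zero_iff j hj]
        rw [map_mul, hxy]
        change j y * (j x / j y) = j x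
        exact mul_div_cancel₀ _ this)
      rwa [this]
  choose y hyC hy0 hy using h9
  obtain ⟨s, hs⟩ := Algebra.FiniteType.out (R := k) (A := A)
  let h := ∏ f ∈ s, y f
  have hhC : h ∈ C := Subalgebra.prod_mem _ fun f _ => hyC f
  refine ⟨θ, h, Finset.prod_ne_zero_iff.mpr fun f _ => hy0 f, ?_, fun f => ?_⟩
  · have halg : IsAlgebraic (Algebra.adjoin k {j a, j b}) (j θ) :=
      (IsFractionRing.isAlgebraic_iff (Algebra.adjoin k {j a, j b}) E L).mpr
        (Algebra.IsAlgebraic.isAlgebraic (R := E) (j θ))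
    obtain ⟨q, hq0, hq⟩ := halg
    let B := Algebra.adjoin k {j a, j b}
    have hrange : Set.range ![j a, j b] = {j a, j b} := by simp [Set.pair_comm]
    let ψ : MvPolynomial (Fin 2) k →ₐ[k] B := MvPolynomial.aeval
      ![⟨j a, Algebra.subset_adjoin (by simp)⟩, ⟨j b, Algebra.subset_adjoin (by simp)⟩]
    have hψ : B.val.comp ψ = MvPolynomial.aeval ![j a, j b] := by
      ext i; fin_cases i <;> simp [ψ]
    have hψ' : B.val.comp ψ = j.comp (MvPolynomial.aeval ![a, b]) := by
      rw [hψ]; ext i; fin_cases i <;> simp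
    have hsurj : Function.Surjective ψ.toRingHom := by
      rintro ⟨y, hy⟩
      have hy' : y ∈ (MvPolynomial.aeval (R := k) ![j a, j b]).range := by
        rw [← Algebra.adjoin_range_eq_range_aeval, hrange]; exact hy
      obtain ⟨x, rfl⟩ := hy'
      exact ⟨x, Subtype.ext (congrArg (fun φ => φ x) hψ)⟩
    obtain ⟨p, rfl⟩ := Polynomial.map_surjective _ hsurj q
    have hval : Function.Injective B.val.toRingHom := Subtype.val_injective
    have hcomp : B.val.toRingHom.comp ψ.toRingHom =
        j.toRingHom.comp (MvPolynomial.aeval (R := k) ![a, b]).toRingHom :=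
      RingHom.ext fun x => congrArg (fun φ => φ x) hψ'
    refine ⟨p, fun h0 => hq0 ?_, hj ?_⟩
    · apply Polynomial.map_injective _ hval
      rw [Polynomial.map_map, hcomp, ← Polynomial.map_map, h0, Polynomial.map_zero,
        Polynomial.map_zero]
    · have h10 : j (p.eval₂ (MvPolynomial.aeval (R := k) ![a, b]).toRingHom θ) =
          p.eval₂ (j.toRingHom.comp (MvPolynomial.aeval (R := k) ![a, b]).toRingHom) (j θ) :=
        Polynomial.hom_eval₂ p _ j.toRingHom θ
      rw [h10, map_zero, ← hcomp, ← Polynomial.eval₂_map]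
      exact hq
  · have hf : f ∈ Algebra.adjoin k (s : Set A) := hs ▸ trivial
    induction hf using Algebra.adjoin_induction with
    | mem x hx =>
      refine ⟨1, ?_⟩
      change (∏ f ∈ s, y f) ^ 1 * x ∈ _
      rw [pow_one, ← Finset.prod_erase_mul s y hx, mul_assoc]
      exact mul_mem (Subalgebra.prod_mem _ fun f _ => hyC f) (hy x)
    | algebraMap c => exact ⟨0, by simp⟩
    | add x z _ _ hx hz =>
      obtain ⟨N, hN⟩ := hx
      obtain ⟨M, hM⟩ := hz
      refine ⟨N + M, ?_⟩
      have : h ^ (N + M) * (x + z) = h ^ M * (h ^ N * x) + h ^ N * (h ^ M * z) := by ring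
      rw [this]
      exact add_mem (mul_mem (pow_mem hhC _) hN) (mul_mem (pow_mem hhC _) hM)
    | mul x z _ _ hx hz =>
      obtain ⟨N, hN⟩ := hx
      obtain ⟨M, hM⟩ := hz
      refine ⟨N + M, ?_⟩
      have : h ^ (N + M) * (x * z) = (h ^ N * x) * (h ^ M * z) := by ring
      rw [this]
      exact mul_mem hN hM

end Separating
end K3
end

noncomputable section
namespace K3

lemma totalDegree_aeval_le {σ τ k : Type*} [Field k] (g : σ → MvPolynomial τ k)
    (hg : ∀ i, (g i).totalDegree ≤ 1) (p : MvPolynomial σ k) :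
    (MvPolynomial.aeval g p).totalDegree ≤ p.totalDegree := by
  rw [MvPolynomial.aeval_def, MvPolynomial.eval₂_eq]
  refine MvPolynomial.totalDegree_finsetSum_le fun d hd => ?_
  refine (MvPolynomial.totalDegree_mul _ _).trans ?_
  rw [MvPolynomial.algebraMap_eq, MvPolynomial.totalDegree_C, zero_add]
  refine (MvPolynomial.totalDegree_finsetProd _ _).trans
    (le_trans (Finset.sum_le_sum fun i _ => ?_) (MvPolynomial.le_totalDegree hd))
  refine (MvPolynomial.totalDegree_pow _ _).trans ?_
  simpa using Nat.mul_le_mul_left (d i) (hg i)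

/-- In the plane, a prime that contains an irreducible polynomial and is not maximal is generated
by it. -/
lemma le_span_of_prime_plane {k : Type*} [Field k] {Q : Ideal (MvPolynomial (Fin 2) k)} [Q.IsPrime]
    (hQ : ¬ Q.IsMaximal) {F : MvPolynomial (Fin 2) k} (hF : Prime F) (hFQ : F ∈ Q) :
    Q ≤ Ideal.span {F} := by
  have hP : (Ideal.span {F}).IsPrime := (Ideal.span_singleton_prime hF.ne_zero).mpr hF
  by_contra hlt
  have h1 : (⊥ : Ideal (MvPolynomial (Fin 2) k)) < Ideal.span {F} := by
    rw [bot_lt_iff_ne_bot, Ne, Ideal.span_singleton_eq_bot]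
    exact hF.ne_zero
  have h2 : Ideal.span {F} < Q :=
    lt_of_le_not_ge ((Ideal.span_singleton_le_iff_mem _).mpr hFQ) hlt
  obtain ⟨M, hM, hQM⟩ := Ideal.exists_le_maximal Q (Ideal.IsPrime.ne_top ‹_›)
  have h3 : Q < M := lt_of_le_of_ne hQM fun h => hQ (h ▸ hM)
  have hdim : ringKrullDim (MvPolynomial (Fin 2) k) = 2 := by
    rw [MvPolynomial.ringKrullDim_of_isNoetherianRing, ringKrullDim_eq_zero_of_field]
    simp
  have hM' := hM.isPrime
  have e1 := Ideal.height_strict_mono_of_isPrime_of_isPrime h1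
  have e2 := Ideal.height_strict_mono_of_isPrime_of_isPrime h2
  have e3 := Ideal.height_strict_mono_of_isPrime_of_isPrime h3
  have e4 := Ideal.height_le_ringKrullDim_of_ne_top hM.ne_top
  rw [hdim] at e4
  have e5 : M.height ≤ 2 := WithBot.coe_le_coe.mp e4
  have f1 := Order.add_one_le_of_lt e1
  have f2 := (add_le_add_left f1 1).trans (Order.add_one_le_of_lt e2)
  have f3 := (add_le_add_left f2 1).trans ((Order.add_one_le_of_lt e3).trans e5)
  rw [add_assoc, add_assoc] at f3
  have f4 := le_add_self.trans f3
  exact absurd f4 (by decide)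

section TwoPoints
variable {k A : Type*} [Field k] [CommRing A] [IsDomain A] [Algebra k A] {m₁ m₂ : Ideal A} {a b : A}

/-- Some member of the pencil spanned by common local parameters at two points has a component
passing through both. -/
theorem exists_prime_le_of_isLocalParameters [Infinite k] [Algebra.FiniteType k A] (hm₁ : m₁ ≠ ⊤)
    (h₁ : IsLocalParameters k m₁ a b) (h₂ : IsLocalParameters k m₂ a b) :
    ∃ P : Ideal A, P.IsPrime ∧ P ≤ m₁ ∧ P ≤ m₂ ∧ a ∉ P ∧ ∃ c, b - algebraMap k A c * a ∈ P := by
  classical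
  obtain ⟨θ, h, hh0, ⟨p, hp0, hpθ⟩, hh⟩ := exists_primitive_function hm₁ h₁.rational h₁.le
    h₁.mem_left h₁.mem_right
  let φ := (MvPolynomial.aeval (R := k) ![a, b]).toRingHom
  let D := ∑ i ∈ p.support, ((p.coeff i).totalDegree + i)
  let S := (Finsupp.finite_of_degree_le (σ := Fin 2) D).toFinset
  obtain ⟨w₁, hw₁, hw₁'⟩ := h₁.exists_branch_ne_zero (f := (p.map φ).leadingCoeff)
    (Polynomial.leadingCoeff_ne_zero.mpr hp0)
  obtain ⟨w₂, hw₂, hw₂'⟩ := h₂.exists_branch_ne_zero hh0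
  obtain ⟨w₃, hw₃, hw₃'⟩ := exists_branch_sum_eq_zero h₁ h₂
    (fun d : S => ∏ i, (![a, θ] i) ^ (d.1 i))
  obtain ⟨c, hc⟩ : ∃ c, (w₁ * w₂ * w₃).eval c ≠ 0 := by
    by_contra! h
    exact mul_ne_zero (mul_ne_zero hw₁ hw₂) hw₃
      (Polynomial.funext fun c => by rw [h c, Polynomial.eval_zero])
  rw [Polynomial.eval_mul, Polynomial.eval_mul] at hc
  have hq := hw₁' c (left_ne_zero_of_mul (left_ne_zero_of_mul hc))
  have hh2 := hw₂' c (right_ne_zero_of_mul (left_ne_zero_of_mul hc))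
  have hS := hw₃' c (right_ne_zero_of_mul hc)
  let β₁ := h₁.branch c
  let β₂ := h₂.branch c
  let R := MvPolynomial (Fin 2) k
  let τ : R →ₐ[k] R := MvPolynomial.aeval ![MvPolynomial.X 0, MvPolynomial.C c * MvPolynomial.X 0]
  let F : R := p.eval₂ τ.toRingHom (MvPolynomial.X 1)
  let η : R →ₐ[k] A := MvPolynomial.aeval ![a, θ]
  let ε₁ : R →+* PowerSeries k := β₁.comp η.toRingHom
  let ε₂ : R →+* PowerSeries k := β₂.comp η.toRingHom
  have hβη : ∀ {m : Ideal A} (h : IsLocalParameters k m a b) (x : k),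
      h.branch c (η (MvPolynomial.C x)) = PowerSeries.C x := by
    intro m h x
    rw [← MvPolynomial.algebraMap_eq, AlgHom.commutes, h.branch_algebraMap]
  have hη0 : η (MvPolynomial.X 0) = a := MvPolynomial.aeval_X _ 0
  have hη1 : η (MvPolynomial.X 1) = θ := MvPolynomial.aeval_X _ 1
  have hτ0 : τ (MvPolynomial.X 0) = MvPolynomial.X 0 := MvPolynomial.aeval_X _ 0
  have hτ1 : τ (MvPolynomial.X 1) = MvPolynomial.C c * MvPolynomial.X 0 := MvPolynomial.aeval_X _ 1
  have hτC : ∀ x, τ (MvPolynomial.C x) = MvPolynomial.C x := fun x => τ.commutes x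
  have hφ0 : φ (MvPolynomial.X 0) = a := MvPolynomial.aeval_X _ 0
  have hφ1 : φ (MvPolynomial.X 1) = b := MvPolynomial.aeval_X _ 1
  have hφC : ∀ x, φ (MvPolynomial.C x) = algebraMap k A x := fun x => AlgHom.commutes _ x
  have hετ : ε₁.comp τ.toRingHom = β₁.comp φ := by
    refine MvPolynomial.ringHom_ext (fun x => ?_) fun i => ?_
    · change β₁ (η (τ (MvPolynomial.C x))) = β₁ (φ (MvPolynomial.C x))
      rw [hτC, hφC, hβη, h₁.branch_algebraMap]
    · fin_cases i
      · change β₁ (η (τ (MvPolynomial.X 0))) = β₁ (φ (MvPolynomial.X 0))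
        rw [hτ0, hφ0, hη0]
      · change β₁ (η (τ (MvPolynomial.X 1))) = β₁ (φ (MvPolynomial.X 1))
        rw [hτ1, hφ1, map_mul, map_mul, hη0, hβη, h₁.branch_left, h₁.branch_right]
  have hF1 : ε₁ F = 0 := by
    have : ε₁ F = p.eval₂ (ε₁.comp τ.toRingHom) (ε₁ (MvPolynomial.X 1)) := Polynomial.hom_eval₂ p _ ε₁ _
    rw [this, hετ]
    have h2 : ε₁ (MvPolynomial.X 1) = β₁ θ := congrArg β₁ hη1
    rw [h2, ← Polynomial.hom_eval₂, hpθ, map_zero]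
  have hF0 : F ≠ 0 := by
    let κ : R →+* Polynomial (PowerSeries k) :=
      MvPolynomial.eval₂Hom (Polynomial.C.comp PowerSeries.C) ![Polynomial.C PowerSeries.X, Polynomial.X]
    have hκC : ∀ x, κ (MvPolynomial.C x) = Polynomial.C (PowerSeries.C x) :=
      fun x => MvPolynomial.eval₂Hom_C _ _ x
    have hκ0 : κ (MvPolynomial.X 0) = Polynomial.C PowerSeries.X := MvPolynomial.eval₂Hom_X' _ _ 0
    have hκ : κ.comp τ.toRingHom = Polynomial.C.comp (β₁.comp φ) := by
      refine MvPolynomial.ringHom_ext (fun x => ?_) fun i => ?_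
      · change κ (τ (MvPolynomial.C x)) = Polynomial.C (β₁ (φ (MvPolynomial.C x)))
        rw [hτC, hφC, h₁.branch_algebraMap, hκC]
      · fin_cases i
        · change κ (τ (MvPolynomial.X 0)) = Polynomial.C (β₁ (φ (MvPolynomial.X 0)))
          rw [hτ0, hφ0, hκ0, h₁.branch_left]
        · change κ (τ (MvPolynomial.X 1)) = Polynomial.C (β₁ (φ (MvPolynomial.X 1)))
          rw [hτ1, hφ1, map_mul, hκC, hκ0, h₁.branch_right, map_mul]
    have h1 : κ F = (p.map φ).map β₁ := by
      have h2 : κ F = p.eval₂ (κ.comp τ.toRingHom) (κ (MvPolynomial.X 1)) := Polynomial.hom_eval₂ p _ κ _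
      rw [h2, hκ, Polynomial.map_map]
      have h3 : κ (MvPolynomial.X 1) = Polynomial.X := MvPolynomial.eval₂Hom_X' _ _ 1
      rw [h3]; rfl
    intro h0
    rw [h0, map_zero] at h1
    apply hq
    have := congrArg (fun q => q.coeff (p.map φ).natDegree) h1
    simpa [Polynomial.coeff_map] using this.symm
  have hFD : F.totalDegree ≤ D := by
    have : F = ∑ i ∈ p.support, τ (p.coeff i) * MvPolynomial.X 1 ^ i := by
      simp only [F, Polynomial.eval₂_eq_sum, Polynomial.sum_def]; rfl
    rw [this]
    refine MvPolynomial.totalDegree_finsetSum_le fun i hi => ?_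
    refine le_trans ?_ (Finset.single_le_sum (f := fun i => (p.coeff i).totalDegree + i)
      (fun _ _ => Nat.zero_le _) hi)
    refine (MvPolynomial.totalDegree_mul _ _).trans (add_le_add ?_ (by simp))
    refine totalDegree_aeval_le _ (fun j => ?_) _
    fin_cases j
    · simp
    · refine (MvPolynomial.totalDegree_mul _ _).trans (by simp)
  have hprime : (RingHom.ker ε₁).IsPrime := RingHom.ker_isPrime ε₁
  obtain ⟨G, hGirr, hGF, hG1⟩ : ∃ G : R, Prime G ∧ G ∣ F ∧ G ∈ RingHom.ker ε₁ := by
    obtain ⟨s, hs, u, hu⟩ := UniqueFactorizationMonoid.exists_prime_factors F hF0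
    have h1 : s.prod ∈ RingHom.ker ε₁ := by
      have h2 : s.prod * u ∈ RingHom.ker ε₁ := by rw [hu]; exact hF1
      exact (hprime.mem_or_mem h2).resolve_right fun h => hprime.ne_top
        (Ideal.eq_top_of_isUnit_mem _ h u.isUnit)
    obtain ⟨G, hG, hG'⟩ := (hprime.multiset_prod_mem_iff_exists_mem s).mp h1
    exact ⟨G, hs G hG, (Multiset.dvd_prod hG).trans ⟨u, hu.symm⟩, hG'⟩
  have hGD : G.totalDegree ≤ D := by
    obtain ⟨H, hH⟩ := hGF
    have h1 := MvPolynomial.totalDegree_mul_of_isDomain (f := G) (g := H) hGirr.ne_zero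
      (by rintro rfl; exact hF0 (by rw [hH, mul_zero]))
    rw [← hH] at h1
    omega
  have hG2 : ε₂ G = 0 := by
    have h1 : η G = ∑ d : S, algebraMap k A (G.coeff d.1) * ∏ i, (![a, θ] i) ^ (d.1 i) := by
      rw [Finset.sum_coe_sort S (fun d : Fin 2 →₀ ℕ => algebraMap k A (G.coeff d) * ∏ i, (![a, θ] i) ^ (d i))]
      have e : η G = ∑ d ∈ G.support, algebraMap k A (G.coeff d) * ∏ i, (![a, θ] i) ^ (d i) :=
        MvPolynomial.eval₂_eq' _ _ _
      rw [e]
      refine Finset.sum_subset (fun d hd => ?_) fun d _ hd => ?_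
      · rw [Set.Finite.mem_toFinset]
        have h2 := (MvPolynomial.le_totalDegree hd).trans hGD
        rw [Finsupp.sum_fintype _ _ (by simp)] at h2
        change d.degree ≤ D
        rwa [Finsupp.degree_eq_sum]
      · rw [MvPolynomial.notMem_support_iff.mp hd, map_zero, zero_mul]
    have h2 := hS (fun d => G.coeff d.1)
    rw [← h1] at h2
    exact h2 hG1
  have hker : RingHom.ker ε₁ ≤ RingHom.ker ε₂ := by
    refine (le_span_of_prime_plane (fun hmax => ?_) hGirr hG1).trans
      ((Ideal.span_singleton_le_iff_mem _).mpr hG2)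
    have hX : (MvPolynomial.X 0 : R) ∉ RingHom.ker ε₁ := by
      intro h0
      have h1 : β₁ (η (MvPolynomial.X 0)) = 0 := h0
      rw [hη0, h₁.branch_left] at h1
      exact PowerSeries.X_ne_zero h1
    obtain ⟨y, i, hi, hy⟩ := hmax.exists_inv hX
    have h1 : ε₁ y * PowerSeries.X = 1 := by
      have h2 := congrArg ε₁ hy
      have h3 : ε₁ (MvPolynomial.X 0) = PowerSeries.X := by
        change β₁ (η (MvPolynomial.X 0)) = _
        rw [hη0, h₁.branch_left]
      rw [map_add, map_mul, h3, RingHom.mem_ker.mp hi, add_zero, map_one] at h2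
      exact h2
    have h2 := congrArg PowerSeries.constantCoeff h1
    simp at h2
  have hlift : ∀ f ∈ Algebra.adjoin k {a, b, θ}, ∃ G : R, β₁ f = ε₁ G ∧ β₂ f = ε₂ G := by
    intro f hf
    induction hf using Algebra.adjoin_induction with
    | mem x hx =>
      rcases hx with rfl | rfl | rfl
      · exact ⟨MvPolynomial.X 0, (congrArg β₁ hη0).symm, (congrArg β₂ hη0).symm⟩
      · refine ⟨MvPolynomial.C c * MvPolynomial.X 0, ?_, ?_⟩
        · change _ = β₁ (η _)
          rw [map_mul, map_mul, hη0, hβη, h₁.branch_left, h₁.branch_right]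
        · change _ = β₂ (η _)
          rw [map_mul, map_mul, hη0, hβη, h₂.branch_left, h₂.branch_right]
      · exact ⟨MvPolynomial.X 1, (congrArg β₁ hη1).symm, (congrArg β₂ hη1).symm⟩
    | algebraMap x =>
      refine ⟨MvPolynomial.C x, ?_, ?_⟩
      · change _ = β₁ (η _)
        rw [hβη, h₁.branch_algebraMap]
      · change _ = β₂ (η _)
        rw [hβη, h₂.branch_algebraMap]
    | add x y _ _ hx hy =>
      obtain ⟨G, hG, hG'⟩ := hx
      obtain ⟨H, hH, hH'⟩ := hy
      exact ⟨G + H, by rw [map_add, map_add, hG, hH], by rw [map_add, map_add, hG', hH']⟩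
    | mul x y _ _ hx hy =>
      obtain ⟨G, hG, hG'⟩ := hx
      obtain ⟨H, hH, hH'⟩ := hy
      exact ⟨G * H, by rw [map_mul, map_mul, hG, hH], by rw [map_mul, map_mul, hG', hH']⟩
  have hmem : ∀ {m : Ideal A} (h : IsLocalParameters k m a b), RingHom.ker (h.branch c) ≤ m := by
    intro m h f hf
    refine h.mem_of_eval_constantCoeff c ?_
    rw [← h.coeff_branch, RingHom.mem_ker.mp hf, map_zero]
  have hle : RingHom.ker β₁ ≤ RingHom.ker β₂ := by
    intro f hf
    obtain ⟨N, hN⟩ := hh f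
    obtain ⟨G, hG, hG'⟩ := hlift _ hN
    rw [map_mul, RingHom.mem_ker.mp hf, mul_zero] at hG
    have h1 : ε₂ G = 0 := hker hG.symm
    rw [h1, map_mul, map_pow] at hG'
    exact (mul_eq_zero.mp hG').resolve_left (pow_ne_zero _ hh2)
  refine ⟨RingHom.ker β₁, RingHom.ker_isPrime β₁, hmem h₁, hle.trans (hmem h₂), ?_, c, ?_⟩
  · rw [RingHom.mem_ker]
    change h₁.branch c a ≠ 0
    rw [h₁.branch_left]
    exact PowerSeries.X_ne_zero
  · rw [RingHom.mem_ker]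
    change h₁.branch c _ = 0
    rw [map_sub, map_mul, h₁.branch_algebraMap, h₁.branch_left, h₁.branch_right, sub_self]

end TwoPoints
end K3
end

noncomputable section
namespace K3

section Points
variable {ι F : Type*} [Field F]

/-- The maximal ideal of a point of affine space. -/
def pointIdeal (p : ι → F) : MaximalSpectrum (MvPolynomial ι F) :=
  ⟨RingHom.ker (MvPolynomial.eval p), RingHom.ker_isMaximal_of_surjective _ fun c =>
    ⟨MvPolynomial.C c, MvPolynomial.eval_C c⟩⟩

lemma mem_pointIdeal {p : ι → F} {f : MvPolynomial ι F} :
    f ∈ (pointIdeal p).asIdeal ↔ MvPolynomial.eval p f = 0 := Iff.rfl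

lemma pointIdeal_injective : Function.Injective (pointIdeal (ι := ι) (F := F)) := by
  intro p q h
  ext i
  have h1 : (MvPolynomial.X i - MvPolynomial.C (p i) : MvPolynomial ι F) ∈ (pointIdeal q).asIdeal := by
    rw [← h, mem_pointIdeal]; simp
  rw [mem_pointIdeal] at h1
  simpa [sub_eq_zero, eq_comm] using h1

lemma exists_eq_pointIdeal [IsAlgClosed F] [Finite ι] (m : MaximalSpectrum (MvPolynomial ι F)) :
    ∃ p, m = pointIdeal p := by
  obtain ⟨p, hp⟩ := MvPolynomial.isMaximal_iff_eq_vanishingIdeal_singleton.mp m.isMaximal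
  refine ⟨p, MaximalSpectrum.ext ?_⟩
  rw [hp]
  ext f
  rw [mem_pointIdeal, MvPolynomial.mem_vanishingIdeal_singleton_iff, MvPolynomial.aeval_eq_eval]

/-- The point corresponding to a maximal ideal. -/
def pointOf [IsAlgClosed F] [Finite ι] (m : MaximalSpectrum (MvPolynomial ι F)) : ι → F :=
  (exists_eq_pointIdeal m).choose

lemma pointIdeal_pointOf [IsAlgClosed F] [Finite ι] (m : MaximalSpectrum (MvPolynomial ι F)) :
    pointIdeal (pointOf m) = m := (exists_eq_pointIdeal m).choose_spec.symm

lemma pointOf_pointIdeal [IsAlgClosed F] [Finite ι] (p : ι → F) : pointOf (pointIdeal p) = p :=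
  pointIdeal_injective (pointIdeal_pointOf _)

lemma pointIdeal_le {p : ι → F} {I : Ideal (MvPolynomial ι F)}
    (h : ∀ i, MvPolynomial.X i - MvPolynomial.C (p i) ∈ I) : (pointIdeal p).asIdeal ≤ I := by
  have key : ∀ f, f - MvPolynomial.C (MvPolynomial.eval p f) ∈ I := by
    intro f
    induction f using MvPolynomial.induction_on with
    | C a => simp
    | add f g hf hg =>
      rw [map_add, map_add, add_sub_add_comm]
      exact add_mem hf hg
    | mul_X f i hf =>
      have h1 : f * MvPolynomial.X i - MvPolynomial.C (MvPolynomial.eval p (f * MvPolynomial.X i)) =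
          (f - MvPolynomial.C (MvPolynomial.eval p f)) * MvPolynomial.X i +
            MvPolynomial.C (MvPolynomial.eval p f) * (MvPolynomial.X i - MvPolynomial.C (p i)) := by
        rw [map_mul, MvPolynomial.eval_X, map_mul]; ring
      rw [h1]
      exact add_mem (Ideal.mul_mem_right _ _ hf) (Ideal.mul_mem_left _ _ (h i))
  intro f hf
  have h1 := key f
  rwa [mem_pointIdeal.mp hf, map_zero, sub_zero] at h1

/-- `e 0, e 1, …, e (r - 1)` generate the terms of a composition series of `M`, whose successive
quotients are the points `p 0, p 1, …, p (r - 1)`. -/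
structure IsTriangular {M : Type*} [AddCommGroup M] [Module (MvPolynomial ι F) M] (r : ℕ) (e : ℕ → M)
    (p : ℕ → ι → F) : Prop where
  act : ∀ s < r, ∀ i, (MvPolynomial.X i - MvPolynomial.C (p s i) : MvPolynomial ι F) • e s ∈
    Submodule.span (MvPolynomial ι F) (e '' Set.Iio s)
  indep : ∀ s < r, e s ∉ Submodule.span (MvPolynomial ι F) (e '' Set.Iio s)
  span_eq : Submodule.span (MvPolynomial ι F) (e '' Set.Iio r) = ⊤

lemma image_Iio_succ {α : Type*} (e : ℕ → α) (s : ℕ) : e '' Set.Iio (s + 1) = insert (e s) (e '' Set.Iio s) := by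
  rw [← Order.succ_eq_add_one, Order.Iio_succ_eq_insert, Set.image_insert_eq]

lemma exists_isTriangular [IsAlgClosed F] [Finite ι] {M : Type*} [AddCommGroup M]
    [Module (MvPolynomial ι F) M] (hM : IsFiniteLength (MvPolynomial ι F) M) :
    ∃ (r : ℕ) (e : ℕ → M) (p : ℕ → ι → F), IsTriangular r e p := by
  induction hM with
  | of_subsingleton =>
    exact ⟨0, fun _ => 0, fun _ _ => 0, fun s hs => absurd hs (Nat.not_lt_zero _),
      fun s hs => absurd hs (Nat.not_lt_zero _), Subsingleton.elim _ _⟩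
  | @of_simple_quotient M _ _ N hs hN ih =>
    obtain ⟨r, e, p, h⟩ := ih
    obtain ⟨I, hI, ⟨ψ⟩⟩ := isSimpleModule_iff_quot_maximal.mp hs
    obtain ⟨q, hq⟩ := exists_eq_pointIdeal ⟨I, hI⟩
    obtain ⟨x, hx⟩ := N.mkQ_surjective (ψ.symm (Submodule.Quotient.mk (1 : MvPolynomial ι F)))
    let e₁ : ℕ → M := fun s => if s < r then e s else x
    let p' : ℕ → ι → F := fun s => if s < r then p s else q
    have himg : ∀ s ≤ r, Submodule.span (MvPolynomial ι F) (e₁ '' Set.Iio s) =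
        (Submodule.span (MvPolynomial ι F) (e '' Set.Iio s)).map N.subtype := by
      intro s hs
      rw [Submodule.map_span, ← Set.image_comp]
      congr 1
      exact Set.image_congr fun t ht => if_pos (lt_of_lt_of_le ht hs)
    have he : ∀ s < r, e₁ s = e s := fun s hs => if_pos hs
    have hp : ∀ s < r, p' s = p s := fun s hs => if_pos hs
    have her : e₁ r = x := if_neg (lt_irrefl r)
    have hpr : p' r = q := if_neg (lt_irrefl r)
    have hr : Submodule.span (MvPolynomial ι F) (e₁ '' Set.Iio r) = N := by
      rw [himg r le_rfl, h.span_eq, Submodule.map_top, Submodule.range_subtype]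
    have hmem : ∀ f : MvPolynomial ι F, f • x ∈ N ↔ f ∈ I := by
      intro f
      rw [← Submodule.Quotient.mk_eq_zero, Submodule.Quotient.mk_smul]
      change f • N.mkQ x = 0 ↔ _
      rw [hx, ← map_smul, LinearEquiv.map_eq_zero_iff]
      rw [← Submodule.Quotient.mk_smul, smul_eq_mul, mul_one, Submodule.Quotient.mk_eq_zero]
    refine ⟨r + 1, e₁, p', fun s hs i => ?_, fun s hs => ?_, ?_⟩
    · rcases Nat.lt_succ_iff_lt_or_eq.mp hs with hs | rfl
      · rw [he s hs, hp s hs, himg s hs.le]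
        exact ⟨_, h.act s hs i, by simp⟩
      · rw [her, hpr, hr, hmem]
        have : I = (pointIdeal q).asIdeal := congrArg MaximalSpectrum.asIdeal hq
        rw [this, mem_pointIdeal]; simp
    · rcases Nat.lt_succ_iff_lt_or_eq.mp hs with hs | rfl
      · rw [he s hs, himg s hs.le]
        rintro ⟨y, hy, hy'⟩
        obtain rfl : y = e s := Subtype.ext hy'
        exact h.indep s hs hy
      · rw [her, hr]
        intro hx'
        have := (hmem 1).mp (by rwa [one_smul])
        exact hI.ne_top ((Ideal.eq_top_iff_one I).mpr this)
    · rw [image_Iio_succ, Submodule.span_insert, her, hr, eq_top_iff]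
      rintro y -
      obtain ⟨f, hf⟩ := Submodule.Quotient.mk_surjective _ (ψ (N.mkQ y))
      have : y - f • x ∈ N := by
        rw [← Submodule.Quotient.mk_eq_zero, Submodule.Quotient.mk_sub, Submodule.Quotient.mk_smul]
        change N.mkQ y - f • N.mkQ x = 0
        rw [hx, ← map_smul, sub_eq_zero, LinearEquiv.eq_symm_apply, ← hf,
          ← Submodule.Quotient.mk_smul, smul_eq_mul, mul_one]
      rw [← add_sub_cancel (f • x) y]
      exact Submodule.add_mem_sup (Submodule.smul_mem _ _ (Submodule.mem_span_singleton_self x)) this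

variable {M : Type*} [AddCommGroup M] [Module (MvPolynomial ι F) M] {r : ℕ} {e : ℕ → M}
  {p : ℕ → ι → F}

lemma IsTriangular.isFiniteLength_and_cycleOf {G : Type*} [AddCommGroup G]
    (cl : MaximalSpectrum (MvPolynomial ι F) → G) (h : IsTriangular r e p) (s : ℕ) (hs : s ≤ r) :
    IsFiniteLength (MvPolynomial ι F) (Submodule.span (MvPolynomial ι F) (e '' Set.Iio s)) ∧
    cycleOf cl (Submodule.span (MvPolynomial ι F) (e '' Set.Iio s)) =
      ∑ t ∈ Finset.range s, cl (pointIdeal (p t)) := by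
  induction s with
  | zero =>
    have : Subsingleton (Submodule.span (MvPolynomial ι F) (e '' Set.Iio 0)) := by
      have : e '' Set.Iio 0 = ∅ := by simp
      rw [this, Submodule.span_empty]; infer_instance
    exact ⟨.of_subsingleton, by rw [cycleOf_of_subsingleton]; simp⟩
  | succ s ih =>
    obtain ⟨ih1, ih2⟩ := ih (Nat.le_of_succ_le hs)
    let N := Submodule.span (MvPolynomial ι F) (e '' Set.Iio s)
    let N' := Submodule.span (MvPolynomial ι F) (e '' Set.Iio (s + 1))
    have hN' : N' = Submodule.span (MvPolynomial ι F) {e s} ⊔ N := by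
      simp only [N', image_Iio_succ, Submodule.span_insert, N]
    have hle : N ≤ N' := hN' ▸ le_sup_right
    have hes : e s ∈ N' := Submodule.subset_span ⟨s, Nat.lt_succ_self s, rfl⟩
    let N₀ : Submodule (MvPolynomial ι F) N' := N.submoduleOf N'
    let ψ : MvPolynomial ι F →ₗ[MvPolynomial ι F] (N' ⧸ N₀) :=
      N₀.mkQ ∘ₗ LinearMap.toSpanSingleton _ _ ⟨e s, hes⟩
    have hψ : ∀ f, ψ f = 0 ↔ f • e s ∈ N := by
      intro f
      simp only [ψ, LinearMap.comp_apply, LinearMap.toSpanSingleton_apply, Submodule.mkQ_apply,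
        Submodule.Quotient.mk_eq_zero]
      rfl
    have hsurj : Function.Surjective ψ := by
      intro y
      obtain ⟨⟨y, hy⟩, rfl⟩ := N₀.mkQ_surjective y
      have hy' := hy
      rw [hN'] at hy'
      obtain ⟨z, hz, n, hn, hzn⟩ := Submodule.mem_sup.mp hy'
      obtain ⟨f, rfl⟩ := Submodule.mem_span_singleton.mp hz
      refine ⟨f, ?_⟩
      simp only [ψ, LinearMap.comp_apply, LinearMap.toSpanSingleton_apply]
      rw [← sub_eq_zero, ← map_sub, Submodule.mkQ_apply, Submodule.Quotient.mk_eq_zero]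
      change f • e s - y ∈ N
      rw [← hzn, sub_add_cancel_left]
      exact neg_mem hn
    have hker : LinearMap.ker ψ = (pointIdeal (p s)).asIdeal := by
      refine ((pointIdeal (p s)).isMaximal.eq_of_le ?_ ?_).symm
      · intro htop
        have h1 : (1 : MvPolynomial ι F) ∈ LinearMap.ker ψ := htop ▸ trivial
        rw [LinearMap.mem_ker, hψ, one_smul] at h1
        exact h.indep s hs h1
      · refine pointIdeal_le fun i => ?_
        rw [LinearMap.mem_ker, hψ]
        exact h.act s hs i
    let ε : (N' ⧸ N₀) ≃ₗ[MvPolynomial ι F] (MvPolynomial ι F ⧸ (pointIdeal (p s)).asIdeal) :=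
      (ψ.quotKerEquivOfSurjective hsurj).symm.trans (Submodule.quotEquivOfEq _ _ hker)
    have hsimple : IsSimpleModule (MvPolynomial ι F) (N' ⧸ N₀) :=
      isSimpleModule_iff_quot_maximal.mpr ⟨_, (pointIdeal (p s)).isMaximal, ⟨ε⟩⟩
    let ε₀ : N₀ ≃ₗ[MvPolynomial ι F] N := Submodule.submoduleOfEquivOfLe hle
    have hfin : IsFiniteLength (MvPolynomial ι F) N' :=
      .of_simple_quotient (N := N₀) (ih1.of_injective ε₀.injective)
    refine ⟨hfin, ?_⟩
    rw [cycleOf_submodule_add_quotient cl hfin N₀, cycleOf_congr cl ε₀, cycleOf_congr cl ε,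
      cycleOf_quotient, Finset.sum_range_succ, ih2]

lemma IsTriangular.isFiniteLength (h : IsTriangular r e p) : IsFiniteLength (MvPolynomial ι F) M := by
  have h1 := (h.isFiniteLength_and_cycleOf (fun _ => (0 : ℤ)) r le_rfl).1
  rw [h.span_eq] at h1
  exact h1.of_injective Submodule.topEquiv.symm.injective

lemma IsTriangular.cycleOf_eq {G : Type*} [AddCommGroup G]
    (cl : MaximalSpectrum (MvPolynomial ι F) → G) (h : IsTriangular r e p) :
    cycleOf cl M = ∑ t ∈ Finset.range r, cl (pointIdeal (p t)) := by
  have h1 := (h.isFiniteLength_and_cycleOf cl r le_rfl).2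
  rw [h.span_eq] at h1
  rw [← h1]
  exact cycleOf_congr cl Submodule.topEquiv.symm

variable [Module F M] [IsScalarTower F (MvPolynomial ι F) M]

lemma mem_span_of_mem_span (act : ∀ s < r, ∀ i,
      (MvPolynomial.X i - MvPolynomial.C (p s i) : MvPolynomial ι F) • e s ∈
        Submodule.span (MvPolynomial ι F) (e '' Set.Iio s)) (s : ℕ) (hs : s ≤ r) {x : M}
    (hx : x ∈ Submodule.span (MvPolynomial ι F) (e '' Set.Iio s)) :
    x ∈ Submodule.span F (e '' Set.Iio s) := by
  induction s generalizing x with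
  | zero => simpa using hx
  | succ s ih =>
    have hmono : ∀ {a b : ℕ}, a ≤ b → Submodule.span F (e '' Set.Iio a) ≤ Submodule.span F (e '' Set.Iio b) :=
      fun hab => Submodule.span_mono (Set.image_mono (Set.Iio_subset_Iio hab))
    have hX : ∀ i, ∀ y ∈ Submodule.span F (e '' Set.Iio (s + 1)),
        (MvPolynomial.X i : MvPolynomial ι F) • y ∈ Submodule.span F (e '' Set.Iio (s + 1)) := by
      intro i y hy
      induction hy using Submodule.span_induction with
      | mem y hy =>
        obtain ⟨t, ht, rfl⟩ := hy
        have hts : t ≤ s := Nat.lt_succ_iff.mp ht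
        have h1 := act t (lt_of_lt_of_le ht hs) i
        have h2 := ih (Nat.le_of_succ_le hs) (Submodule.span_mono
          (Set.image_mono (Set.Iio_subset_Iio hts)) h1)
        have h3 : (MvPolynomial.X i : MvPolynomial ι F) • e t =
            (MvPolynomial.X i - MvPolynomial.C (p t i) : MvPolynomial ι F) • e t + p t i • e t := by
          rw [sub_smul, ← MvPolynomial.algebraMap_eq, algebraMap_smul, sub_add_cancel]
        rw [h3]
        exact add_mem (hmono (Nat.le_succ s) h2)
          (Submodule.smul_mem _ _ (Submodule.subset_span ⟨t, ht, rfl⟩))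
      | zero => rw [smul_zero]; exact zero_mem _
      | add y z _ _ hy hz => rw [smul_add]; exact add_mem hy hz
      | smul c y _ hy => rw [smul_comm]; exact Submodule.smul_mem _ _ hy
    have hS : ∀ (f : MvPolynomial ι F), ∀ y ∈ Submodule.span F (e '' Set.Iio (s + 1)),
        f • y ∈ Submodule.span F (e '' Set.Iio (s + 1)) := by
      intro f
      induction f using MvPolynomial.induction_on with
      | C a =>
        intro y hy
        rw [← MvPolynomial.algebraMap_eq, algebraMap_smul]
        exact Submodule.smul_mem _ _ hy
      | add f g hf hg => intro y hy; rw [add_smul]; exact add_mem (hf y hy) (hg y hy)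
      | mul_X f i hf => intro y hy; rw [mul_smul]; exact hf _ (hX i y hy)
    induction hx using Submodule.span_induction with
    | mem y hy => exact Submodule.subset_span hy
    | zero => exact zero_mem _
    | add y z _ _ hy hz => exact add_mem hy hz
    | smul f y _ hy => exact hS f y hy

lemma IsTriangular.linearIndepOn (h : IsTriangular r e p) : LinearIndepOn F e (Set.Iio r) := by
  have hle : ∀ s, Submodule.span F (e '' Set.Iio s) ≤
      (Submodule.span (MvPolynomial ι F) (e '' Set.Iio s)).restrictScalars F := fun s =>
    Submodule.span_le.mpr Submodule.subset_span
  have hli : ∀ s ≤ r, LinearIndepOn F e (Set.Iio s) := by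
    intro s
    induction s with
    | zero => intro; simp
    | succ s ih =>
      intro hs
      rw [← Order.succ_eq_add_one, Order.Iio_succ_eq_insert]
      exact (ih (Nat.le_of_succ_le hs)).insert fun hmem => h.indep s hs (hle s hmem)
  exact hli r le_rfl

lemma IsTriangular.finrank_eq (h : IsTriangular r e p) : Module.finrank F M = r := by
  have htop : ⊤ ≤ Submodule.span F (Set.range fun t : Set.Iio r => e t) := by
    rintro x -
    have := mem_span_of_mem_span h.act r le_rfl (x := x) (h.span_eq ▸ trivial)
    rwa [Set.image_eq_range] at this
  rw [Module.finrank_eq_card_basis (Module.Basis.mk h.linearIndepOn htop)]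
  simp

variable (F) in
lemma cycleOf_one [IsAlgClosed F] [Finite ι] (hM : IsFiniteLength (MvPolynomial ι F) M) :
    cycleOf (fun _ : MaximalSpectrum (MvPolynomial ι F) => (1 : ℤ)) M = Module.finrank F M := by
  obtain ⟨r, e, p, h⟩ := exists_isTriangular hM
  rw [h.cycleOf_eq, h.finrank_eq]; simp

end Points
end K3
end

noncomputable section
namespace K3

lemma exists_sum_range_of_mem_span {F M : Type*} [Ring F] [AddCommGroup M] [Module F M] {e : ℕ → M}
    {s : ℕ} {x : M} (hx : x ∈ Submodule.span F (e '' Set.Iio s)) :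
    ∃ c : ℕ → F, x = ∑ t ∈ Finset.range s, c t • e t := by
  classical
  induction hx using Submodule.span_induction with
  | mem x hx =>
    obtain ⟨t, ht, rfl⟩ := hx
    refine ⟨fun u => if u = t then 1 else 0, ?_⟩
    rw [Finset.sum_eq_single t (fun u _ hu => by simp [hu])
      (fun h => absurd (Finset.mem_range.mpr ht) h)]
    simp
  | zero => exact ⟨fun _ => 0, by simp⟩
  | add x y _ _ hx hy =>
    obtain ⟨c, rfl⟩ := hx
    obtain ⟨d, rfl⟩ := hy
    exact ⟨fun t => c t + d t, by rw [← Finset.sum_add_distrib]; simp only [add_smul]⟩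
  | smul a x _ hx =>
    obtain ⟨c, rfl⟩ := hx
    exact ⟨fun t => a * c t, by rw [Finset.smul_sum]; simp only [mul_smul]⟩

/-- The zero-cycle cut out by a nonzerodivisor, from a triangular basis of the quotient. -/
lemma eulerCycle_of_triangular_relations {ι F : Type*} [Field F] [IsAlgClosed F] [Finite ι] {r : ℕ}
    {J : Ideal (MvPolynomial ι F)} {g : MvPolynomial ι F} {E : ℕ → MvPolynomial ι F} {p : ℕ → ι → F}
    (hact : ∀ s < r, ∀ i, ∃ (c : ℕ → F) (y : MvPolynomial ι F),
      (MvPolynomial.X i - MvPolynomial.C (p s i)) * E s -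
        (∑ t ∈ Finset.range s, MvPolynomial.C (c t) * E t) - g * y ∈ J)
    (hone : ∃ (c : ℕ → F) (y : MvPolynomial ι F),
      1 - (∑ t ∈ Finset.range r, MvPolynomial.C (c t) * E t) - g * y ∈ J)
    (key : ∀ (c : ℕ → F) (y : MvPolynomial ι F),
      (∑ t ∈ Finset.range r, MvPolynomial.C (c t) * E t) + g * y ∈ J →
      (∀ s < r, c s = 0) ∧ y ∈ J) (G : Type*) [AddCommGroup G] :
    IsFiniteLength (MvPolynomial ι F) ((MvPolynomial ι F ⧸ J) ⧸
      LinearMap.range (LinearMap.lsmul (MvPolynomial ι F) (MvPolynomial ι F ⧸ J) g)) ∧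
    ∀ cl : (ι → F) → G, eulerCycle (fun m => cl (pointOf m)) g (MvPolynomial ι F ⧸ J) =
      ∑ t ∈ Finset.range r, cl (p t) := by
  let M := MvPolynomial ι F ⧸ J
  let N := LinearMap.range (LinearMap.lsmul (MvPolynomial ι F) M g)
  let π : MvPolynomial ι F →ₗ[MvPolynomial ι F] M ⧸ N := N.mkQ ∘ₗ J.mkQ
  have hπ : ∀ f, π f = 0 ↔ ∃ y, f - g * y ∈ J := by
    intro f
    have h0 : π f = 0 ↔ (Submodule.Quotient.mk f : M) ∈ N := Submodule.Quotient.mk_eq_zero N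
    rw [h0]
    constructor
    · rintro ⟨y, hy⟩
      obtain ⟨y, rfl⟩ := Submodule.Quotient.mk_surjective _ y
      rw [LinearMap.lsmul_apply, ← Submodule.Quotient.mk_smul, eq_comm, Submodule.Quotient.eq] at hy
      exact ⟨y, hy⟩
    · rintro ⟨y, hy⟩
      refine ⟨Submodule.Quotient.mk y, ?_⟩
      rw [LinearMap.lsmul_apply, ← Submodule.Quotient.mk_smul, eq_comm, Submodule.Quotient.eq]
      exact hy
  let e₁ : ℕ → M ⧸ N := fun s => π (E s)
  have hsum' : ∀ n (c : ℕ → F), ∑ t ∈ Finset.range n, c t • e₁ t =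
      π (∑ t ∈ Finset.range n, MvPolynomial.C (c t) * E t) := by
    intro n c
    rw [map_sum]
    refine Finset.sum_congr rfl fun t _ => ?_
    rw [← smul_eq_mul, map_smul, ← MvPolynomial.algebraMap_eq, algebraMap_smul]
  have hmem' : ∀ n (c : ℕ → F), π (∑ t ∈ Finset.range n, MvPolynomial.C (c t) * E t) ∈
      Submodule.span (MvPolynomial ι F) (e₁ '' Set.Iio n) := by
    intro n c
    rw [map_sum]
    refine Submodule.sum_mem _ fun t ht => ?_
    rw [← smul_eq_mul, map_smul]
    exact Submodule.smul_mem _ _ (Submodule.subset_span ⟨t, Finset.mem_range.mp ht, rfl⟩)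
  have hact' : ∀ s < r, ∀ i, (MvPolynomial.X i - MvPolynomial.C (p s i) : MvPolynomial ι F) • e₁ s ∈
      Submodule.span (MvPolynomial ι F) (e₁ '' Set.Iio s) := by
    intro s hs i
    obtain ⟨c, y, h1⟩ := hact s hs i
    have h3 := (hπ _).mpr ⟨_, h1⟩
    rw [map_sub, sub_eq_zero, ← smul_eq_mul, map_smul] at h3
    rw [h3]
    exact hmem' s _
  have htri : IsTriangular r e₁ p := by
    refine ⟨hact', fun s hs hmem => ?_, ?_⟩
    · obtain ⟨c, hc⟩ := exists_sum_range_of_mem_span (mem_span_of_mem_span hact' s hs.le hmem)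
      rw [hsum', eq_comm, ← sub_eq_zero, ← map_sub] at hc
      obtain ⟨y, hy⟩ := (hπ _).mp hc
      let c' : ℕ → F := fun t => if t < s then c t else if t = s then -1 else 0
      have h1 : ∑ t ∈ Finset.range r, MvPolynomial.C (c' t) * E t =
          (∑ t ∈ Finset.range s, MvPolynomial.C (c t) * E t) - E s := by
        rw [← Finset.sum_subset (Finset.range_mono (Nat.succ_le_of_lt hs)) (fun t _ ht => by
          have h3 : ¬ t < s := fun h => ht (Finset.mem_range.mpr (h.trans (Nat.lt_succ_self s)))
          have h4 : t ≠ s := fun h => ht (Finset.mem_range.mpr (h ▸ Nat.lt_succ_self s))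
          simp only [c', if_neg h3, if_neg h4, map_zero, zero_mul]), Nat.succ_eq_add_one,
          Finset.sum_range_succ]
        have h5 : c' s = -1 := by simp [c']
        rw [h5, map_neg, map_one, neg_one_mul, ← sub_eq_add_neg]
        congr 1
        exact Finset.sum_congr rfl fun t ht => by simp only [c', if_pos (Finset.mem_range.mp ht)]
      have h2 := (key c' (-y) (by rw [h1, mul_neg, ← sub_eq_add_neg]; exact hy)).1 s hs
      simp [c'] at h2
    · obtain ⟨c, y, h1⟩ := hone
      have h3 := (hπ _).mpr ⟨_, h1⟩
      rw [map_sub, sub_eq_zero] at h3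
      rw [eq_top_iff]
      rintro x -
      obtain ⟨x, rfl⟩ := N.mkQ_surjective x
      obtain ⟨x, rfl⟩ := J.mkQ_surjective x
      have h4 : N.mkQ (J.mkQ x) = x • π 1 := by
        rw [← map_smul, smul_eq_mul, mul_one]; rfl
      rw [h4, h3]
      exact Submodule.smul_mem _ _ (hmem' r _)
  refine ⟨htri.isFiniteLength, fun cl => ?_⟩
  have hker : Subsingleton (LinearMap.ker (LinearMap.lsmul (MvPolynomial ι F) M g)) := by
    rw [Submodule.subsingleton_iff_eq_bot, eq_bot_iff]
    intro x hx
    obtain ⟨x, rfl⟩ := Submodule.Quotient.mk_surjective _ x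
    rw [LinearMap.mem_ker, LinearMap.lsmul_apply, ← Submodule.Quotient.mk_smul,
      Submodule.Quotient.mk_eq_zero] at hx
    rw [Submodule.mem_bot, Submodule.Quotient.mk_eq_zero]
    refine (key 0 x ?_).2
    simpa using hx
  have h1 := cycleOf_of_subsingleton (fun m : MaximalSpectrum (MvPolynomial ι F) => cl (pointOf m))
    (M := LinearMap.ker (LinearMap.lsmul (MvPolynomial ι F) M g))
  have h2 := htri.cycleOf_eq (fun m => cl (pointOf m))
  refine (congrArg₂ (· - ·) h2 h1).trans ?_
  rw [sub_zero]
  exact Finset.sum_congr rfl fun t ht => by rw [pointOf_pointIdeal]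

section Specialization
variable (k K : Type*) [Field k] [Field K] [Algebra k K]

/-- The filter of sufficiently large finitely generated subalgebras. -/
def fgFilter : Filter (Subalgebra k K) := ⨅ x : K, Filter.principal {R | x ∈ R}

variable {k K}

lemma eventually_mem (x : K) : ∀ᶠ (R : Subalgebra k K) in fgFilter k K, x ∈ R :=
  Filter.mem_iInf_of_mem x (Filter.mem_principal_self _)

lemma exists_finset_of_eventually {P : Subalgebra k K → Prop} (h : ∀ᶠ (R : Subalgebra k K) in fgFilter k K, P R) :
    ∃ S : Finset K, ∀ R : Subalgebra k K, (S : Set K) ⊆ R → P R := by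
  obtain ⟨t, ht, h⟩ := (Filter.hasBasis_iInf_principal_finite _).mem_iff.mp h
  refine ⟨ht.toFinset, fun R hR => h ?_⟩
  rw [Set.mem_iInter₂]
  exact fun x hx => hR (ht.mem_toFinset.mpr hx)

variable {ι : Type*}

lemma eventually_exists_map_eq (q : MvPolynomial ι K) :
    ∀ᶠ (R : Subalgebra k K) in fgFilter k K, ∃ q₀ : MvPolynomial ι R, MvPolynomial.map (algebraMap R K) q₀ = q := by
  have h : ∀ᶠ (R : Subalgebra k K) in fgFilter k K, ∀ x ∈ q.coeffs, x ∈ R :=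
    (Filter.eventually_all_finset _).mpr fun x _ => eventually_mem x
  filter_upwards [h] with R hR
  exact MvPolynomial.mem_range_map_iff_coeffs_subset.mpr fun x hx => ⟨⟨x, hR x hx⟩, rfl⟩

/-- The specialization along `φ : R → k` of an ideal of polynomials over `K`. -/
def specIdeal {R : Subalgebra k K} (φ : R →ₐ[k] k) (I : Ideal (MvPolynomial ι K)) :
    Ideal (MvPolynomial ι k) :=
  (I.comap (MvPolynomial.map (algebraMap R K))).map (MvPolynomial.map φ.toRingHom)

lemma mem_specIdeal {R : Subalgebra k K} {φ : R →ₐ[k] k} {I : Ideal (MvPolynomial ι K)}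
    {f : MvPolynomial ι k} : f ∈ specIdeal φ I ↔ ∃ q : MvPolynomial ι R,
      MvPolynomial.map (algebraMap R K) q ∈ I ∧ MvPolynomial.map φ.toRingHom q = f := by
  rw [specIdeal, Ideal.mem_map_iff_of_surjective]
  · rfl
  · refine MvPolynomial.map_surjective _ fun c => ⟨algebraMap k R c, φ.commutes c⟩

/-- The function `cl` at the specialization of a point. -/
def specCl [IsAlgClosed K] [Finite ι] {R : Subalgebra k K} (φ : R →ₐ[k] k) {G : Type*} [AddCommGroup G]
    (cl : (ι → k) → G) (p : ι → K) : G :=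
  open Classical in if h : ∀ i, p i ∈ R then cl fun i => φ ⟨p i, h i⟩ else 0

lemma specCl_apply [IsAlgClosed K] [Finite ι] {R : Subalgebra k K} (φ : R →ₐ[k] k) {G : Type*}
    [AddCommGroup G] (cl : (ι → k) → G) (p : ι → R) :
    specCl φ cl (fun i => (p i : K)) = cl fun i => φ (p i) :=
  dif_pos fun i => (p i).2

variable [IsAlgClosed k] [IsAlgClosed K] [Finite ι]

/-- The zero-cycle cut out by `g` on the curve `I` specializes to the one cut out by the
specialization of `g` on the specialization of the curve. -/
theorem eventually_eulerCycle_spec {I : Ideal (MvPolynomial ι K)} [hI : I.IsPrime]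
    {g : MvPolynomial ι K} (hg : g ∉ I)
    (hfin : IsFiniteLength (MvPolynomial ι K) (MvPolynomial ι K ⧸ (I ⊔ Ideal.span {g})))
    (G : Type*) [AddCommGroup G] :
    ∀ᶠ (R : Subalgebra k K) in fgFilter k K, ∀ (φ : R →ₐ[k] k) (g₀ : MvPolynomial ι R),
      MvPolynomial.map (algebraMap R K) g₀ = g →
      IsFiniteLength (MvPolynomial ι k) ((MvPolynomial ι k ⧸ specIdeal φ I) ⧸
        LinearMap.range (LinearMap.lsmul (MvPolynomial ι k) (MvPolynomial ι k ⧸ specIdeal φ I)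
          (MvPolynomial.map φ.toRingHom g₀))) ∧
      ∀ cl : (ι → k) → G,
        eulerCycle (fun m => cl (pointOf m)) (MvPolynomial.map φ.toRingHom g₀)
          (MvPolynomial ι k ⧸ specIdeal φ I) =
        cycleOf (fun m => specCl φ cl (pointOf m)) (MvPolynomial ι K ⧸ (I ⊔ Ideal.span {g})) := by
  classical
  obtain ⟨r, e, p, h⟩ := exists_isTriangular hfin
  choose E hE using fun s => Ideal.Quotient.mk_surjective (e s)
  have hsum : ∀ (n : ℕ) (c : ℕ → K), ∑ t ∈ Finset.range n, c t • e t =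
      Ideal.Quotient.mk (I ⊔ Ideal.span {g}) (∑ t ∈ Finset.range n, MvPolynomial.C (c t) * E t) := by
    intro n c
    rw [map_sum]
    refine Finset.sum_congr rfl fun t _ => ?_
    rw [map_mul, hE, ← MvPolynomial.algebraMap_eq, Algebra.smul_def]
    rfl
  have hrel : ∀ {x y : MvPolynomial ι K}, Ideal.Quotient.mk (I ⊔ Ideal.span {g}) x =
      Ideal.Quotient.mk (I ⊔ Ideal.span {g}) y → ∃ z, x - y - g * z ∈ I := by
    intro x y hxy
    obtain ⟨j, hj, w, hw, hjw⟩ := Submodule.mem_sup.mp ((Ideal.Quotient.mk_eq_mk_iff_sub_mem _ _).mp hxy)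
    obtain ⟨z, rfl⟩ := Ideal.mem_span_singleton'.mp hw
    exact ⟨z, by rw [← hjw, mul_comm g, add_sub_cancel_right]; exact hj⟩
  have hact : ∀ s, ∀ i, ∃ (γ : ℕ → K) (Z : MvPolynomial ι K), s < r →
      (MvPolynomial.X i - MvPolynomial.C (p s i)) * E s -
        (∑ t ∈ Finset.range s, MvPolynomial.C (γ t) * E t) - g * Z ∈ I := by
    intro s i
    by_cases hs : s < r
    · obtain ⟨γ, hγ⟩ := exists_sum_range_of_mem_span
        (mem_span_of_mem_span h.act s hs.le (h.act s hs i))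
      rw [hsum, ← hE, ← Ideal.Quotient.mk_eq_mk, ← Submodule.Quotient.mk_smul] at hγ
      obtain ⟨Z, hZ⟩ := hrel hγ
      exact ⟨γ, Z, fun _ => hZ⟩
    · exact ⟨0, 0, fun h => absurd h hs⟩
  choose γ Z hZ using hact
  obtain ⟨δ, Y, hY⟩ : ∃ (δ : ℕ → K) (Y : MvPolynomial ι K),
      1 - (∑ t ∈ Finset.range r, MvPolynomial.C (δ t) * E t) - g * Y ∈ I := by
    obtain ⟨δ, hδ⟩ := exists_sum_range_of_mem_span (mem_span_of_mem_span h.act r le_rfl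
      (x := Ideal.Quotient.mk _ 1) (h.span_eq ▸ trivial))
    rw [hsum] at hδ
    exact ⟨δ, hrel hδ⟩
  have hindep : ∀ (c : ℕ → K) (z : MvPolynomial ι K),
      (∑ t ∈ Finset.range r, MvPolynomial.C (c t) * E t) + g * z ∈ I → ∀ s < r, c s = 0 := by
    intro c z hcz s hs
    have h1 := linearIndepOn_iff'.mp (h.linearIndepOn (F := K)) (Finset.range r) c
      (fun t ht => Finset.mem_range.mp ht)
    refine h1 ?_ s (Finset.mem_range.mpr hs)
    rw [hsum, Ideal.Quotient.eq_zero_iff_mem]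
    have h2 : g * z ∈ I ⊔ Ideal.span {g} :=
      Ideal.mem_sup_right (Ideal.mul_mem_right _ _ (Ideal.mem_span_singleton_self g))
    have := sub_mem (Ideal.mem_sup_left (T := Ideal.span {g}) hcz) h2
    rwa [add_sub_cancel_right] at this
  have e1 : ∀ᶠ (R : Subalgebra k K) in fgFilter k K, ∀ s ∈ Finset.range r, ∃ q₀ : MvPolynomial ι R,
      MvPolynomial.map (algebraMap R K) q₀ = E s :=
    (Filter.eventually_all_finset _).mpr fun s _ => eventually_exists_map_eq _
  have e2 : ∀ᶠ (R : Subalgebra k K) in fgFilter k K, ∀ s ∈ Finset.range r, ∀ i, p s i ∈ R :=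
    (Filter.eventually_all_finset _).mpr fun s _ => Filter.eventually_all.mpr fun i => eventually_mem _
  have e3 : ∀ᶠ (R : Subalgebra k K) in fgFilter k K, ∀ s ∈ Finset.range r, ∀ i, ∃ q₀ : MvPolynomial ι R,
      MvPolynomial.map (algebraMap R K) q₀ = Z s i :=
    (Filter.eventually_all_finset _).mpr fun s _ => Filter.eventually_all.mpr fun i =>
      eventually_exists_map_eq _
  have e4 : ∀ᶠ (R : Subalgebra k K) in fgFilter k K, ∀ s ∈ Finset.range r, ∀ i, ∀ t ∈ Finset.range r, γ s i t ∈ R :=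
    (Filter.eventually_all_finset _).mpr fun s _ => Filter.eventually_all.mpr fun i =>
      (Filter.eventually_all_finset _).mpr fun t _ => eventually_mem _
  have e5 : ∀ᶠ (R : Subalgebra k K) in fgFilter k K, ∀ t ∈ Finset.range r, δ t ∈ R :=
    (Filter.eventually_all_finset _).mpr fun t _ => eventually_mem _
  filter_upwards [e1, e2, e3, e4, e5, eventually_exists_map_eq Y] with R e1 e2 e3 e4 e5 e6 φ g₀ hg₀
  obtain ⟨Y₀, hY₀⟩ := e6
  choose! E₀ hE₀ using e1
  choose! Z₀ hZ₀ using e3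
  simp only [Finset.mem_range] at hE₀ hZ₀ e2 e4 e5
  let p₀ : ℕ → ι → R := fun s i => if hs : s < r then ⟨p s i, e2 s hs i⟩ else 0
  let γ₀ : ℕ → ι → ℕ → R := fun s i t => if hs : s < r ∧ t < r then ⟨γ s i t, e4 s hs.1 i t hs.2⟩ else 0
  let δ₀ : ℕ → R := fun t => if ht : t < r then ⟨δ t, e5 t ht⟩ else 0
  have hp₀ : ∀ s < r, ∀ i, (p₀ s i : K) = p s i := fun s hs i => by simp only [p₀, dif_pos hs]
  have hγ₀ : ∀ s < r, ∀ i, ∀ t < r, (γ₀ s i t : K) = γ s i t := fun s hs i t ht => by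
    simp only [γ₀, dif_pos (And.intro hs ht)]
  have hδ₀ : ∀ t < r, (δ₀ t : K) = δ t := fun t ht => by simp only [δ₀, dif_pos ht]
  let mR := MvPolynomial.map (σ := ι) (algebraMap R K)
  let mφ := MvPolynomial.map (σ := ι) φ.toRingHom
  have hmC : ∀ c : R, mR (MvPolynomial.C c) = MvPolynomial.C (c : K) := fun c => MvPolynomial.map_C _ _
  have hmX : ∀ i, mR (MvPolynomial.X i) = MvPolynomial.X i := fun i => MvPolynomial.map_X _ _
  have hmsum : ∀ n ≤ r, ∀ c : ℕ → R, mR (∑ t ∈ Finset.range n, MvPolynomial.C (c t) * E₀ t) =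
      ∑ t ∈ Finset.range n, MvPolynomial.C (c t : K) * E t := by
    intro n hn c
    rw [map_sum]
    exact Finset.sum_congr rfl fun t ht => by
      rw [map_mul, hmC]; exact congrArg _ (hE₀ t (lt_of_lt_of_le (Finset.mem_range.mp ht) hn))
  have hZ' : ∀ s < r, ∀ i, mR ((MvPolynomial.X i - MvPolynomial.C (p₀ s i)) * E₀ s -
      (∑ t ∈ Finset.range s, MvPolynomial.C (γ₀ s i t) * E₀ t) - g₀ * Z₀ s i) ∈ I := by
    intro s hs i
    have h1 := hZ s i hs
    have h2 : ∑ t ∈ Finset.range s, MvPolynomial.C (γ s i t) * E t =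
        ∑ t ∈ Finset.range s, MvPolynomial.C (γ₀ s i t : K) * E t :=
      Finset.sum_congr rfl fun t ht => by
        rw [hγ₀ s hs i t ((Finset.mem_range.mp ht).trans hs)]
    rw [h2, ← hmsum s hs.le, ← hp₀ s hs, ← hmC, ← hmX, ← hE₀ s hs, ← hZ₀ s hs i, ← hg₀] at h1
    simpa only [map_sub, map_mul] using h1
  have hY' : mR (1 - (∑ t ∈ Finset.range r, MvPolynomial.C (δ₀ t) * E₀ t) - g₀ * Y₀) ∈ I := by
    have h2 : ∑ t ∈ Finset.range r, MvPolynomial.C (δ t) * E t =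
        ∑ t ∈ Finset.range r, MvPolynomial.C (δ₀ t : K) * E t :=
      Finset.sum_congr rfl fun t ht => by rw [hδ₀ t (Finset.mem_range.mp ht)]
    rw [h2, ← hmsum r le_rfl, ← hY₀, ← hg₀] at hY
    simpa only [map_sub, map_mul, map_one] using hY
  have expand : ∀ q : MvPolynomial ι R, ∃ (c : ℕ → R) (z : MvPolynomial ι R),
      mR (q - (∑ t ∈ Finset.range r, MvPolynomial.C (c t) * E₀ t) - g₀ * z) ∈ I := by
    let T : Submodule R (MvPolynomial ι R) := ((I.comap mR).restrictScalars R ⊔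
      (Ideal.span {g₀}).restrictScalars R) ⊔ Submodule.span R (E₀ '' Set.Iio r)
    have hT1 : ∀ x, mR x ∈ I → x ∈ T := fun x hx =>
      Submodule.mem_sup_left (Submodule.mem_sup_left hx)
    have hT2 : ∀ x, g₀ * x ∈ T := fun x =>
      Submodule.mem_sup_left (Submodule.mem_sup_right
        (Ideal.mul_mem_right _ _ (Ideal.mem_span_singleton_self g₀)))
    have hT3 : ∀ n ≤ r, ∀ c : ℕ → R, ∑ t ∈ Finset.range n, MvPolynomial.C (c t) * E₀ t ∈ T := by
      intro n hn c
      refine Submodule.sum_mem _ fun t ht => ?_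
      rw [← MvPolynomial.smul_eq_C_mul]
      exact Submodule.smul_mem _ _ (Submodule.mem_sup_right (Submodule.subset_span
        ⟨t, lt_of_lt_of_le (Finset.mem_range.mp ht) hn, rfl⟩))
    have hTX : ∀ i, T ≤ T.comap (LinearMap.mulLeft R (MvPolynomial.X i)) := by
      intro i
      refine sup_le (sup_le (fun x hx => ?_) fun x hx => ?_) (Submodule.span_le.mpr ?_)
      · refine hT1 _ ?_
        rw [LinearMap.mulLeft_apply, map_mul]
        exact Ideal.mul_mem_left _ _ hx
      · obtain ⟨z, rfl⟩ := Ideal.mem_span_singleton'.mp hx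
        have := hT2 (MvPolynomial.X i * z)
        rw [Submodule.mem_comap, LinearMap.mulLeft_apply]
        convert this using 1
        ring
      · rintro _ ⟨s, hs, rfl⟩
        have h1 := hT1 _ (hZ' s hs i)
        have h2 := hT3 s (le_of_lt hs) (γ₀ s i)
        have h3 : MvPolynomial.C (p₀ s i) * E₀ s ∈ T := by
          rw [← MvPolynomial.smul_eq_C_mul]
          exact Submodule.smul_mem _ _ (Submodule.mem_sup_right (Submodule.subset_span ⟨s, hs, rfl⟩))
        have := add_mem (add_mem (add_mem h1 h2) (hT2 (Z₀ s i))) h3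
        change MvPolynomial.X i * E₀ s ∈ T
        convert this using 1
        ring
    have hT : ∀ q, q ∈ T := by
      intro q
      induction q using MvPolynomial.induction_on with
      | C a =>
        have h1 : (1 : MvPolynomial ι R) ∈ T := by
          have := add_mem (add_mem (hT1 _ hY') (hT3 r le_rfl δ₀)) (hT2 Y₀)
          convert this using 1
          ring
        have := T.smul_mem a h1
        rwa [MvPolynomial.smul_eq_C_mul, mul_one] at this
      | add x y hx hy => exact add_mem hx hy
      | mul_X x i hx => rw [mul_comm]; exact hTX i hx
    intro q
    obtain ⟨y, hy, w, hw, rfl⟩ := Submodule.mem_sup.mp (hT q)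
    obtain ⟨j, hj, y, hy', rfl⟩ := Submodule.mem_sup.mp hy
    obtain ⟨z, rfl⟩ := Ideal.mem_span_singleton'.mp hy'
    obtain ⟨c, rfl⟩ := exists_sum_range_of_mem_span hw
    refine ⟨c, z, ?_⟩
    simp only [MvPolynomial.smul_eq_C_mul]
    rw [add_sub_cancel_right, mul_comm g₀, add_sub_cancel_right]
    exact hj
  have expand' : ∀ q : MvPolynomial ι R, mφ q = 0 → ∃ (c : ℕ → R) (z : MvPolynomial ι R),
      (∀ t, φ (c t) = 0) ∧ mφ z = 0 ∧
      mR (q - (∑ t ∈ Finset.range r, MvPolynomial.C (c t) * E₀ t) - g₀ * z) ∈ I := by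
    intro q hq
    have hq' : q ∈ Ideal.span (MvPolynomial.C '' (RingHom.ker φ.toRingHom : Set R)) := by
      change q ∈ Ideal.map MvPolynomial.C (RingHom.ker φ.toRingHom)
      rw [← MvPolynomial.ker_map]; exact hq
    suffices ∀ a, ∃ (c : ℕ → R) (z : MvPolynomial ι R), (∀ t, φ (c t) = 0) ∧ mφ z = 0 ∧
        mR (a * q - (∑ t ∈ Finset.range r, MvPolynomial.C (c t) * E₀ t) - g₀ * z) ∈ I by
      simpa using this 1
    clear hq
    induction hq' using Submodule.span_induction with
    | mem x hx =>
      obtain ⟨n, hn, rfl⟩ := hx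
      intro a
      obtain ⟨c, z, hcz⟩ := expand a
      have hn' : φ n = 0 := hn
      refine ⟨fun t => n * c t, MvPolynomial.C n * z, fun t => by rw [map_mul, hn', zero_mul], ?_, ?_⟩
      · have : mφ (MvPolynomial.C n) = 0 := by
          refine (MvPolynomial.map_C _ _).trans ?_
          change MvPolynomial.C (φ n) = 0
          rw [hn', map_zero]
        rw [map_mul, this, zero_mul]
      · have h1 : a * MvPolynomial.C n - (∑ t ∈ Finset.range r, MvPolynomial.C (n * c t) * E₀ t) -
            g₀ * (MvPolynomial.C n * z) = MvPolynomial.C n *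
              (a - (∑ t ∈ Finset.range r, MvPolynomial.C (c t) * E₀ t) - g₀ * z) := by
          simp only [mul_sub, Finset.mul_sum, map_mul, mul_assoc]
          ring
        rw [h1, map_mul]
        exact Ideal.mul_mem_left _ _ hcz
    | zero => intro a; exact ⟨0, 0, by simp, by simp, by simp⟩
    | add x y _ _ hx hy =>
      intro a
      obtain ⟨c, z, h1, h2, h3⟩ := hx a
      obtain ⟨c', z', h1', h2', h3'⟩ := hy a
      refine ⟨fun t => c t + c' t, z + z', fun t => by rw [map_add, h1, h1', add_zero],
        by rw [map_add, h2, h2', add_zero], ?_⟩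
      have := add_mem h3 h3'
      rw [← map_add] at this
      convert this using 2
      simp only [map_add, add_mul, Finset.sum_add_distrib]
      ring
    | smul b x _ hx =>
      intro a
      simpa only [smul_eq_mul, mul_assoc] using hx (a * b)
  have hspecJ : ∀ q, mR q ∈ I → mφ q ∈ specIdeal φ I := fun q hq => mem_specIdeal.mpr ⟨q, hq, rfl⟩
  have hφC : ∀ c : R, mφ (MvPolynomial.C c) = MvPolynomial.C (φ c) := fun c => MvPolynomial.map_C _ _
  have key : ∀ (c : ℕ → k) (y : MvPolynomial ι k),
      (∑ t ∈ Finset.range r, MvPolynomial.C (c t) * mφ (E₀ t)) + mφ g₀ * y ∈ specIdeal φ I →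
      (∀ s < r, c s = 0) ∧ y ∈ specIdeal φ I := by
    intro c y hcy
    obtain ⟨q, hqI, hq⟩ := mem_specIdeal.mp hcy
    obtain ⟨z, rfl⟩ : ∃ z, mφ z = y :=
      MvPolynomial.map_surjective _ (fun c => ⟨algebraMap k R c, φ.commutes c⟩) y
    obtain ⟨c', z', h1, h2, h3⟩ := expand'
      (q - (∑ t ∈ Finset.range r, MvPolynomial.C (algebraMap k R (c t)) * E₀ t) - g₀ * z) (by
        rw [map_sub, map_sub, map_sum, map_mul]
        have : mφ q = _ := hq
        rw [this]
        simp only [map_mul, hφC, AlgHom.commutes, Algebra.algebraMap_self, RingHom.id_apply]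
        ring)
    have h4 : mR ((∑ t ∈ Finset.range r, MvPolynomial.C (algebraMap k R (c t) + c' t) * E₀ t) +
        g₀ * (z + z')) ∈ I := by
      have := sub_mem hqI h3
      change mR q - _ ∈ I at this
      rw [← map_sub] at this
      convert this using 2
      simp only [map_add, add_mul, Finset.sum_add_distrib]
      ring
    have h5 := h4
    rw [map_add, hmsum r le_rfl, map_mul] at h5
    have hg' : mR g₀ = g := hg₀
    rw [hg'] at h5
    have h6 := hindep _ _ h5
    have h7 : ∀ s < r, algebraMap k R (c s) + c' s = 0 := fun s hs => Subtype.ext (h6 s hs)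
    refine ⟨fun s hs => ?_, ?_⟩
    · have := congrArg φ (h7 s hs)
      rwa [map_add, φ.commutes, h1, add_zero, map_zero] at this
    · rw [Finset.sum_eq_zero (fun s hs => by
        rw [h7 s (Finset.mem_range.mp hs)]; simp), zero_add, map_mul, hg'] at h4
      refine mem_specIdeal.mpr ⟨z + z', (hI.mem_or_mem h4).resolve_left hg, ?_⟩
      change mφ (z + z') = _
      rw [map_add, h2, add_zero]
  obtain ⟨h1, h2⟩ := eulerCycle_of_triangular_relations (r := r) (J := specIdeal φ I) (g := mφ g₀)
    (E := fun t => mφ (E₀ t)) (p := fun t i => φ (p₀ t i)) (fun s hs i => by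
      have h1 := hspecJ _ (hZ' s hs i)
      rw [map_sub, map_sub, map_mul, map_sub, map_mul, map_sum, hφC] at h1
      simp only [map_mul, hφC] at h1
      have h2 : mφ (MvPolynomial.X i) = MvPolynomial.X i := MvPolynomial.map_X _ _
      rw [h2] at h1
      exact ⟨_, _, h1⟩) (by
      have h1 := hspecJ _ hY'
      rw [map_sub, map_sub, map_one, map_mul, map_sum] at h1
      simp only [map_mul, hφC] at h1
      exact ⟨_, _, h1⟩) key G
  refine ⟨h1, fun cl => (h2 cl).trans ?_⟩
  rw [h.cycleOf_eq]
  refine Finset.sum_congr rfl fun t ht => ?_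
  rw [pointOf_pointIdeal, ← specCl_apply φ cl (p₀ t)]
  congr 1
  funext i
  exact hp₀ t (Finset.mem_range.mp ht) i

end Specialization
end K3
end

noncomputable section
namespace K3

section Degree
variable {ι F : Type*} [Field F]

/-- The homogeneous polynomial `g` of degree `d` has no zeros at infinity on the projective closure
of the affine scheme defined by `I` (in a chart where some linear form is `1` modulo `I`). -/
def NoZerosAtInfinity (I : Ideal (MvPolynomial ι F)) (g : MvPolynomial ι F) (d : ℕ) : Prop :=
  ∃ M, d ≤ M ∧ 1 ≤ M ∧ ∀ i, ∃ c e : MvPolynomial ι F, c.IsHomogeneous (M - d) ∧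
    e.IsHomogeneous (M - 1) ∧ MvPolynomial.X i ^ M - g * c - e ∈ I

variable {A : Type*} [CommRing A] [Algebra F A] (π : MvPolynomial ι F →ₐ[F] A)

/-- The values of homogeneous polynomials of degree `n`. -/
def degreePart (n : ℕ) : Submodule F A := (MvPolynomial.homogeneousSubmodule ι F n).map π.toLinearMap

variable {π}

lemma mem_degreePart {n : ℕ} {a : A} : a ∈ degreePart π n ↔ ∃ q, q.IsHomogeneous n ∧ π q = a := by
  simp [degreePart]

instance [Finite ι] (n : ℕ) : Module.Finite F (degreePart π n) := by
  have : Module.Finite F (MvPolynomial.homogeneousSubmodule ι F n) := by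
    let S : Submodule F (MvPolynomial ι F) :=
      Submodule.span F ((fun d => MvPolynomial.monomial d 1) '' {d : ι →₀ ℕ | d.degree ≤ n})
    have hS : FiniteDimensional F S := FiniteDimensional.span_of_finite F
      ((Finsupp.finite_of_degree_le (σ := ι) n).image _)
    refine Submodule.finiteDimensional_of_le (S₂ := S) fun q hq => ?_
    rw [q.as_sum]
    refine Submodule.sum_mem _ fun d hd => ?_
    rw [← mul_one (q.coeff d), ← smul_eq_mul, ← MvPolynomial.smul_monomial]
    have hdeg : d.degree = n := by
      rw [Finsupp.degree_eq_weight_one]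
      exact hq (MvPolynomial.mem_support_iff.mp hd)
    exact Submodule.smul_mem _ _ (Submodule.subset_span ⟨d, hdeg.le, rfl⟩)
  unfold degreePart
  infer_instance

variable {l : MvPolynomial ι F}

lemma degreePart_mono (hl : l.IsHomogeneous 1) (hl1 : π l = 1) : Monotone (degreePart π) := by
  refine monotone_nat_of_le_succ fun n a ha => ?_
  obtain ⟨q, hq, rfl⟩ := mem_degreePart.mp ha
  exact mem_degreePart.mpr ⟨q * l, hq.mul hl, by rw [map_mul, hl1, mul_one]⟩

lemma exists_mem_degreePart (hl : l.IsHomogeneous 1) (hl1 : π l = 1)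
    (q : MvPolynomial ι F) : ∃ n, π q ∈ degreePart π n := by
  refine ⟨q.totalDegree, ?_⟩
  have h : π q = ∑ i ∈ Finset.range (q.totalDegree + 1), π (MvPolynomial.homogeneousComponent i q) := by
    rw [← map_sum, MvPolynomial.sum_homogeneousComponent]
  rw [h]
  refine Submodule.sum_mem _ fun i hi => degreePart_mono hl hl1
    (Nat.lt_succ_iff.mp (Finset.mem_range.mp hi)) (mem_degreePart.mpr
      ⟨_, MvPolynomial.homogeneousComponent_isHomogeneous i q, rfl⟩)

lemma exists_degreePart_succ_le [Finite ι] {g : MvPolynomial ι F} {d : ℕ}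
    (hg : g.IsHomogeneous d) (hinf : NoZerosAtInfinity (RingHom.ker π) g d) :
    ∃ N, d ≤ N ∧ ∀ n ≥ N, degreePart π (n + 1) ≤
      degreePart π n ⊔ (degreePart π (n + 1 - d)).map (LinearMap.mulLeft F (π g)) := by
  classical
  have := Fintype.ofFinite ι
  obtain ⟨M, hdM, hM1, h⟩ := hinf
  refine ⟨Fintype.card ι * M + d, Nat.le_add_left _ _, fun n hn a ha => ?_⟩
  obtain ⟨q, hq, rfl⟩ := mem_degreePart.mp ha
  rw [q.as_sum, map_sum]
  refine Submodule.sum_mem _ fun s hs => ?_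
  have hdeg : s.degree = n + 1 := by
    rw [Finsupp.degree_eq_weight_one]
    exact hq (MvPolynomial.mem_support_iff.mp hs)
  obtain ⟨i, hi⟩ : ∃ i, M ≤ s i := by
    by_contra! hlt
    have h1 : s.degree ≤ Fintype.card ι * M := by
      rw [Finsupp.degree_eq_sum]
      refine (Finset.sum_le_sum fun i _ => (hlt i).le).trans ?_
      simp
    omega
  obtain ⟨c, e, hc, he, hI⟩ := h i
  let s' := s - Finsupp.single i M
  have hs' : s = Finsupp.single i M + s' := by
    rw [add_comm]
    exact (tsub_add_cancel_of_le (Finsupp.single_le_iff.mpr hi)).symm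
  have hdeg' : s'.degree + M = n + 1 := by
    rw [← hdeg, hs', map_add, Finsupp.degree_single, add_comm]
  let m := MvPolynomial.monomial s' (q.coeff s)
  have hm : m.IsHomogeneous s'.degree := MvPolynomial.isHomogeneous_monomial _ rfl
  have h1 : MvPolynomial.monomial s (q.coeff s) = MvPolynomial.X i ^ M * m := by
    rw [MvPolynomial.X_pow_eq_monomial, MvPolynomial.monomial_mul, one_mul, ← hs']
  have h2 : π (MvPolynomial.X i ^ M) = π g * π c + π e := by
    have : π (MvPolynomial.X i ^ M - g * c - e) = 0 := hI
    rw [map_sub, map_sub, map_mul, sub_sub, sub_eq_zero] at this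
    exact this
  rw [h1, map_mul, h2, add_mul, add_comm (π g * π c * π m)]
  refine Submodule.add_mem_sup (mem_degreePart.mpr ⟨e * m, ?_, map_mul _ _ _⟩)
    ⟨π (c * m), mem_degreePart.mpr ⟨c * m, ?_, rfl⟩, ?_⟩
  · convert he.mul hm using 1
    omega
  · convert hc.mul hm using 1
    omega
  · rw [LinearMap.mulLeft_apply, map_mul, mul_assoc]

lemma exists_degreePart_surjective (hl : l.IsHomogeneous 1) (hl1 : π l = 1)
    [Finite ι] (hπ : Function.Surjective π) {g : MvPolynomial ι F} {d : ℕ}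
    (hg : g.IsHomogeneous d) (hinf : NoZerosAtInfinity (RingHom.ker π) g d) :
    ∃ N, ∀ n ≥ N, ∀ a : A, ∃ b ∈ degreePart π n, a - b ∈ Ideal.span {π g} := by
  obtain ⟨N, hdN, hN⟩ := exists_degreePart_succ_le hg hinf
  refine ⟨N, fun n hn a => ?_⟩
  have key : ∀ j, ∀ a ∈ degreePart π (n + j), ∃ b ∈ degreePart π n, a - b ∈ Ideal.span {π g} := by
    intro j
    induction j with
    | zero => exact fun a ha => ⟨a, ha, by simp⟩
    | succ j ih =>
      intro a ha
      obtain ⟨x, hx, _, ⟨y, hy, rfl⟩, rfl⟩ := Submodule.mem_sup.mp (hN (n + j) (by omega) ha)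
      obtain ⟨b, hb, hxb⟩ := ih x hx
      refine ⟨b, hb, ?_⟩
      rw [add_sub_right_comm]
      exact add_mem hxb (Ideal.mul_mem_right _ _ (Ideal.mem_span_singleton_self _))
  obtain ⟨q, rfl⟩ := hπ a
  obtain ⟨m, hm⟩ := exists_mem_degreePart hl hl1 q
  exact key m _ (degreePart_mono hl hl1 (Nat.le_add_left m n) hm)

lemma exists_finrank_quotient_add (hl : l.IsHomogeneous 1) (hl1 : π l = 1)
    [Finite ι] [IsDomain A] (hπ : Function.Surjective π)
    {g : MvPolynomial ι F} {d : ℕ} (hg : g.IsHomogeneous d) (hg0 : π g ≠ 0)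
    (hinf : NoZerosAtInfinity (RingHom.ker π) g d) :
    ∃ N, ∀ n ≥ N, Module.finrank F (A ⧸ Ideal.span {π g}) +
      Module.finrank F (degreePart π (n - d)) = Module.finrank F (degreePart π n) := by
  let V := degreePart π
  let v : ℕ → ℕ := fun n => Module.finrank F (V n)
  let μ := LinearMap.mulLeft F (π g)
  have hμ : Function.Injective μ := fun a b hab => mul_left_cancel₀ hg0 hab
  have hV : Monotone V := degreePart_mono hl hl1
  have hv : Monotone v := fun a b hab => Submodule.finrank_mono (hV hab)
  have hμV : ∀ n, Module.finrank F ((V n).map μ) = v n := fun n =>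
    (Submodule.equivMapOfInjective μ hμ (V n)).finrank_eq.symm
  have hgV : ∀ n, (V n).map μ ≤ V (n + d) := by
    rintro n _ ⟨a, ha, rfl⟩
    obtain ⟨q, hq, rfl⟩ := mem_degreePart.mp ha
    exact mem_degreePart.mpr ⟨q * g, hq.mul hg, by rw [map_mul, mul_comm]; rfl⟩
  obtain ⟨N, hdN, hN⟩ := exists_degreePart_succ_le hg hinf
  obtain ⟨N', hN'⟩ := exists_degreePart_surjective hl hl1 hπ hg hinf
  have hle : ∀ n ≥ N, (V (n - d)).map μ ≤ V n ⊓ (V (n + 1 - d)).map μ := by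
    intro n hn
    refine le_inf ?_ (Submodule.map_mono (hV (by omega)))
    have := hgV (n - d)
    rwa [Nat.sub_add_cancel (hdN.trans hn)] at this
  have hstep : ∀ n ≥ N, v (n + 1) + Module.finrank F (V n ⊓ (V (n + 1 - d)).map μ : Submodule F A) =
      v n + v (n + 1 - d) := by
    intro n hn
    have heq : V (n + 1) = V n ⊔ (V (n + 1 - d)).map μ := by
      refine le_antisymm (hN n hn) (sup_le (hV (Nat.le_succ n)) ?_)
      have := hgV (n + 1 - d)
      rwa [Nat.sub_add_cancel (hdN.trans (hn.trans (Nat.le_succ n)))] at this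
    have := Submodule.finrank_sup_add_finrank_inf_eq (V n) ((V (n + 1 - d)).map μ)
    rw [← heq, hμV] at this
    exact this
  let u : ℕ → ℕ := fun n => v n - v (n - d)
  have hu : ∀ n, u n + v (n - d) = v n := fun n => Nat.sub_add_cancel (hv (Nat.sub_le n d))
  have hanti : ∀ n ≥ N, u (n + 1) ≤ u n := by
    intro n hn
    have h1 := hstep n hn
    have h2 := Submodule.finrank_mono (hle n hn)
    rw [hμV] at h2
    have h3 := hu n
    have h4 := hu (n + 1)
    omega
  have hanti' : ∀ n ≥ N, ∀ j, u (n + j) ≤ u n := by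
    intro n hn j
    induction j with
    | zero => exact le_rfl
    | succ j ih => exact (hanti (n + j) (by omega)).trans ih
  obtain ⟨n₀, hn₀, hmin⟩ : ∃ n₀ ≥ N, ∀ n ≥ N, u n₀ ≤ u n := by
    obtain ⟨_, ⟨n₀, hn₀, rfl⟩, hmin⟩ := WellFounded.has_min (wellFounded_lt (α := ℕ)) (u '' Set.Ici N)
      ⟨_, N, Set.mem_Ici.mpr le_rfl, rfl⟩
    exact ⟨n₀, hn₀, fun n hn => not_lt.mp (hmin _ ⟨n, hn, rfl⟩)⟩
  have hconst : ∀ n ≥ n₀, u n = u n₀ := by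
    intro n hn
    obtain ⟨j, rfl⟩ := Nat.exists_eq_add_of_le hn
    exact le_antisymm (hanti' n₀ hn₀ j) (hmin _ (by omega))
  have hinf' : ∀ n ≥ n₀, V n ⊓ (V (n + 1 - d)).map μ = (V (n - d)).map μ := by
    intro n hn
    have hn' : n ≥ N := hn₀.trans hn
    have hfin : Module.Finite F (V n ⊓ (V (n + 1 - d)).map μ : Submodule F A) :=
      Submodule.finiteDimensional_inf_left _ _
    refine (Submodule.eq_of_le_of_finrank_eq (hle n hn') ?_).symm
    rw [hμV]
    have h1 := hstep n hn'
    have h2 := hconst n hn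
    have h3 := hconst (n + 1) (by omega)
    have h4 := hu n
    have h5 := hu (n + 1)
    omega
  have hdesc : ∀ n ≥ n₀, ∀ j, ∀ a ∈ V (n - d + j), π g * a ∈ V n → a ∈ V (n - d) := by
    intro n hn j
    induction j with
    | zero => exact fun a ha _ => ha
    | succ j ih =>
      intro a ha hga
      refine ih a ?_ hga
      have h1 : μ a ∈ V (n + j) ⊓ (V (n + j + 1 - d)).map μ :=
        ⟨hV (Nat.le_add_right n j) hga, a, by
          have : n + j + 1 - d = n - d + (j + 1) := by omega
          rw [this]; exact ha, rfl⟩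
      rw [hinf' (n + j) (by omega)] at h1
      obtain ⟨b, hb, hba⟩ := h1
      rw [← hμ hba]
      have : n + j - d = n - d + j := by omega
      rwa [this] at hb
  refine ⟨max n₀ N', fun n hn => ?_⟩
  have hn1 : n ≥ n₀ := (le_max_left _ _).trans hn
  have hn2 : n ≥ N' := (le_max_right _ _).trans hn
  let f : V n →ₗ[F] (A ⧸ Ideal.span {π g}) :=
    (Ideal.Quotient.mkₐ F (Ideal.span {π g})).toLinearMap ∘ₗ (V n).subtype
  have hf : Function.Surjective f := by
    intro x
    obtain ⟨a, rfl⟩ := Ideal.Quotient.mk_surjective x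
    obtain ⟨b, hb, hab⟩ := hN' n hn2 a
    exact ⟨⟨b, hb⟩, ((Ideal.Quotient.mk_eq_mk_iff_sub_mem _ _).mpr hab).symm⟩
  have hsub : (V (n - d)).map μ ≤ V n := (hle n (hn₀.trans hn1)).trans inf_le_left
  have hker : LinearMap.ker f = ((V (n - d)).map μ).submoduleOf (V n) := by
    ext ⟨a, ha⟩
    have h1 : f ⟨a, ha⟩ = 0 ↔ a ∈ Ideal.span {π g} := Ideal.Quotient.eq_zero_iff_mem
    rw [LinearMap.mem_ker, h1]
    change _ ↔ a ∈ (V (n - d)).map μ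
    constructor
    · intro h
      obtain ⟨b, rfl⟩ := Ideal.mem_span_singleton'.mp h
      rw [mul_comm] at ha ⊢
      obtain ⟨q, rfl⟩ := hπ b
      obtain ⟨m, hm⟩ := exists_mem_degreePart hl hl1 q
      exact ⟨_, hdesc n hn1 m _ (hV (Nat.le_add_left _ _) hm) ha, rfl⟩
    · rintro ⟨b, -, rfl⟩
      exact Ideal.mul_mem_right _ _ (Ideal.mem_span_singleton_self _)
  have h1 := LinearMap.finrank_range_add_finrank_ker f
  rw [LinearMap.range_eq_top.mpr hf, finrank_top, hker,
    (Submodule.submoduleOfEquivOfLe hsub).finrank_eq, hμV] at h1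
  exact h1

/-- Two hypersurfaces of the same degree without points at infinity cut out subschemes of the same
degree on a curve. -/
theorem finrank_quotient_eq (hl : l.IsHomogeneous 1) (hl1 : π l = 1)
    [Finite ι] [IsDomain A] (hπ : Function.Surjective π)
    {g h : MvPolynomial ι F} {d : ℕ} (hg : g.IsHomogeneous d) (hg0 : π g ≠ 0)
    (hginf : NoZerosAtInfinity (RingHom.ker π) g d) (hh : h.IsHomogeneous d) (hh0 : π h ≠ 0)
    (hhinf : NoZerosAtInfinity (RingHom.ker π) h d) :
    Module.finrank F (A ⧸ Ideal.span {π g}) = Module.finrank F (A ⧸ Ideal.span {π h}) := by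
  obtain ⟨N, hN⟩ := exists_finrank_quotient_add hl hl1 hπ hg hg0 hginf
  obtain ⟨N', hN'⟩ := exists_finrank_quotient_add hl hl1 hπ hh hh0 hhinf
  have h1 := hN (max N N') (le_max_left _ _)
  have h2 := hN' (max N N') (le_max_right _ _)
  omega

end Degree

section Specialization
variable {k K ι : Type*} [Field k] [Field K] [Algebra k K] [Finite ι]

lemma isHomogeneous_of_map {R S : Type*} [CommSemiring R] [CommSemiring S] {f : R →+* S}
    (hf : Function.Injective f) {q : MvPolynomial ι R} {n : ℕ}
    (h : (MvPolynomial.map f q).IsHomogeneous n) : q.IsHomogeneous n := by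
  intro d hd
  refine h ?_
  rw [MvPolynomial.coeff_map]
  exact fun h0 => hd (hf (h0.trans (map_zero f).symm))

lemma eventually_noZerosAtInfinity_spec {I : Ideal (MvPolynomial ι K)} {g : MvPolynomial ι K} {d : ℕ}
    (h : NoZerosAtInfinity I g d) :
    ∀ᶠ (R : Subalgebra k K) in fgFilter k K, ∀ (φ : R →ₐ[k] k) (g₀ : MvPolynomial ι R),
      MvPolynomial.map (algebraMap R K) g₀ = g →
      NoZerosAtInfinity (specIdeal φ I) (MvPolynomial.map φ.toRingHom g₀) d := by
  obtain ⟨M, hdM, hM, h⟩ := h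
  choose c e hc he hI using h
  filter_upwards [Filter.eventually_all.mpr fun i => eventually_exists_map_eq (k := k) (c i),
    Filter.eventually_all.mpr fun i => eventually_exists_map_eq (k := k) (e i)] with R hcR heR φ g₀ hg₀
  refine ⟨M, hdM, hM, fun i => ?_⟩
  obtain ⟨c₀, hc₀⟩ := hcR i
  obtain ⟨e₀, he₀⟩ := heR i
  have hinj : Function.Injective (algebraMap R K) := Subtype.val_injective
  refine ⟨MvPolynomial.map φ.toRingHom c₀, MvPolynomial.map φ.toRingHom e₀,
    (isHomogeneous_of_map hinj (hc₀ ▸ hc i)).map _, (isHomogeneous_of_map hinj (he₀ ▸ he i)).map _,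
    mem_specIdeal.mpr ⟨MvPolynomial.X i ^ M - g₀ * c₀ - e₀, ?_, ?_⟩⟩
  · rw [map_sub, map_sub, map_pow, map_mul, MvPolynomial.map_X, hg₀, hc₀, he₀]
    exact hI i
  · rw [map_sub, map_sub, map_pow, map_mul, MvPolynomial.map_X]

end Specialization
end K3
end

noncomputable section
namespace K3

section StandardSmooth

theorem height_eq_card_of_isMaximal {F : Type*} [Field F] {ι : Type*} [Finite ι]
    (m : Ideal (MvPolynomial ι F)) [m.IsMaximal] : m.height = Nat.card ι := by
  induction ι using Finite.induction_empty_option with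
  | of_equiv e H =>
    have := H (m.comap (MvPolynomial.renameEquiv F e).toRingEquiv)
    rw [RingEquiv.height_comap, Nat.card_congr e] at this
    exact this
  | h_empty =>
    have : m = ⊥ := by
      have hf : IsField (MvPolynomial PEmpty F) :=
        (MvPolynomial.isEmptyRingEquiv F PEmpty).toMulEquiv.isField (Field.toIsField F)
      letI := hf.toField
      exact (Ideal.eq_bot_or_top m).resolve_right Ideal.IsPrime.ne_top'
    simp [this]
  | @h_option ι _ IH =>
    let e := (MvPolynomial.optionEquivLeft F ι).symm.toRingEquiv
    have hP : (m.comap e).IsMaximal := inferInstance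
    rw [← RingEquiv.height_comap e m]
    generalize m.comap e = P at hP
    have : (P.under (MvPolynomial ι F)).IsMaximal :=
      Polynomial.isMaximal_comap_C_of_isJacobsonRing P
    have : P.LiesOver (P.under (MvPolynomial ι F)) := ⟨rfl⟩
    rw [Polynomial.height_eq_height_add_one (P.under (MvPolynomial ι F)) P, IH, Finite.card_option]
    simp

variable {F B : Type*} [Field F] [IsAlgClosed F] [CommRing B] [Algebra F B]

theorem exists_algHom_ker_eq [Algebra.FiniteType F B] (m : Ideal B) [m.IsMaximal] :
    ∃ ε : B →ₐ[F] F, RingHom.ker ε = m := by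
  let _ : Field (B ⧸ m) := Ideal.Quotient.field m
  have : Module.Finite F (B ⧸ m) := finite_of_finite_type_of_isJacobsonRing _ _
  let e : F ≃ₐ[F] (B ⧸ m) := AlgEquiv.ofBijective (Algebra.ofId F (B ⧸ m))
    IsAlgClosed.algebraMap_bijective_of_isIntegral
  refine ⟨e.symm.toAlgHom.comp (Ideal.Quotient.mkₐ F m), ?_⟩
  ext a
  simp [RingHom.mem_ker, Ideal.Quotient.eq_zero_iff_mem]

/-- The derivation `b ↦ b - b(p)` with values in the cotangent space at the point `p` given by
`ε : B → F`. -/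
def cotangentDerivation (ε : B →ₐ[F] F) (m : Ideal B) (hm : RingHom.ker ε = m) :
    Derivation F B m.Cotangent where
  toFun b := m.toCotangent ⟨b - algebraMap F B (ε b), by simp [← hm, RingHom.mem_ker]⟩
  map_add' a b := by
    rw [← map_add]
    congr 1
    ext
    simp
    ring
  map_smul' r a := by
    have : (⟨r • a - algebraMap F B (ε (r • a)), by simp [← hm, RingHom.mem_ker]⟩ : m) =
      algebraMap F B r • ⟨a - algebraMap F B (ε a), by simp [← hm, RingHom.mem_ker]⟩ := by
      ext
      simp [Algebra.smul_def]
      ring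
    change m.toCotangent _ = r • m.toCotangent _
    rw [this, map_smul, algebraMap_smul]
  map_one_eq_zero' := by
    rw [← map_zero m.toCotangent]
    change m.toCotangent _ = _
    congr 1
    ext
    simp
  leibniz' a b := by
    change m.toCotangent _ = a • m.toCotangent _ + b • m.toCotangent _
    rw [← map_smul, ← map_smul, ← map_add, Ideal.toCotangent_eq]
    have ha : a - algebraMap F B (ε a) ∈ m := by simp [← hm, RingHom.mem_ker]
    have hb : b - algebraMap F B (ε b) ∈ m := by simp [← hm, RingHom.mem_ker]
    have := Ideal.mul_mem_mul ha hb
    rw [← sq] at this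
    convert neg_mem this using 1
    simp
    ring

theorem exists_le_span_pair_sup_sq [Algebra.IsStandardSmoothOfRelativeDimension 2 F B]
    (m : Ideal B) [hmax : m.IsMaximal] :
    ∃ a ∈ m, ∃ b ∈ m, m ≤ Ideal.span {a, b} ⊔ m ^ 2 := by
  have : Algebra.IsStandardSmooth F B :=
    Algebra.IsStandardSmoothOfRelativeDimension.isStandardSmooth 2
  have : Nontrivial B := ⟨0, 1, fun h => hmax.ne_top ((Ideal.eq_top_iff_one m).mpr (h ▸ m.zero_mem))⟩
  obtain ⟨ε, hε⟩ := exists_algHom_ker_eq (F := F) m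
  have hr := Algebra.IsStandardSmoothOfRelativeDimension.rank_kaehlerDifferential (R := F) (S := B) 2
  let β := Module.finBasisOfFinrankEq B (Ω[B⁄F]) (Module.finrank_eq_of_rank_eq hr)
  let D := cotangentDerivation ε m hε
  choose a ha using fun i => m.toCotangent_surjective (D.liftKaehlerDifferential (β i))
  refine ⟨a 0, (a 0).2, a 1, (a 1).2, fun x hx => ?_⟩
  have h1 : D.liftKaehlerDifferential (KaehlerDifferential.D F B x) = m.toCotangent ⟨x, hx⟩ := by
    rw [Derivation.liftKaehlerDifferential_comp_D]
    change m.toCotangent _ = _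
    congr 1
    ext
    rw [← hε, RingHom.mem_ker] at hx
    simp [show ε x = 0 from hx]
  rw [← β.sum_repr (KaehlerDifferential.D F B x), Fin.sum_univ_two, map_add, map_smul, map_smul,
    ← ha, ← ha, ← map_smul, ← map_smul, ← map_add, Eq.comm, Ideal.toCotangent_eq] at h1
  have h2 : _ ∈ Ideal.span {(a 0 : B), (a 1 : B)} ⊔ m ^ 2 := Ideal.mem_sup_right h1
  refine (Submodule.sub_mem_iff_left _ ?_).mp h2
  refine Ideal.mem_sup_left (add_mem ?_ ?_)
  · exact Ideal.mul_mem_left _ _ (Ideal.subset_span (by simp))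
  · exact Ideal.mul_mem_left _ _ (Ideal.subset_span (by simp))

theorem le_height_of_isStandardSmooth {n : ℕ} [Algebra.IsStandardSmoothOfRelativeDimension n F B]
    (m : Ideal B) [hmax : m.IsMaximal] : (n : ℕ∞) ≤ m.height := by
  obtain ⟨ι, σ, _, _, P, hP⟩ :=
    Algebra.IsStandardSmoothOfRelativeDimension.out (n := n) (R := F) (S := B)
  have := Fintype.ofFinite σ
  let π : MvPolynomial ι F →+* B := algebraMap P.Ring B
  have hπ : Function.Surjective π := P.algebraMap_surjective
  have hk : RingHom.ker π = Ideal.span (Set.range P.relation) := P.span_range_relation_eq_ker.symm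
  let M : Ideal (MvPolynomial ι F) := m.comap π
  have : M.IsMaximal := Ideal.comap_isMaximal_of_surjective π hπ
  have h1 := Ideal.height_le_height_add_encard_of_subset (Set.range P.relation) (p := M) (by
    rw [← Ideal.span_le, ← hk]
    exact Ideal.ker_le_comap π)
  rw [height_eq_card_of_isMaximal] at h1
  let e : (MvPolynomial ι F ⧸ Ideal.span (Set.range P.relation)) ≃+* B :=
    (Ideal.quotEquivOfEq hk.symm).trans (RingHom.quotientKerEquivOfSurjective hπ)
  have h2 : M.map (Ideal.Quotient.mk (Ideal.span (Set.range P.relation))) = m.comap e := by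
    have : M = (m.comap e).comap (Ideal.Quotient.mk _) := rfl
    rw [this, Ideal.map_comap_of_surjective _ Ideal.Quotient.mk_surjective]
  rw [h2, RingEquiv.height_comap] at h1
  have h3 : (Set.range P.relation).encard ≤ Nat.card σ := by
    rw [← Set.image_univ]
    refine (Set.encard_image_le _ _).trans ?_
    simp [Set.encard_univ]
  have h4 : Nat.card ι ≤ n + Nat.card σ := by
    have : Nat.card ι - Nat.card σ = n := hP
    omega
  have h5 : Nat.card σ ≤ Nat.card ι := Nat.card_le_card_of_injective _ P.map_inj
  have h6 : ((n + Nat.card σ : ℕ) : ℕ∞) ≤ m.height + Nat.card σ := by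
    have : n + Nat.card σ = Nat.card ι := by
      have : Nat.card ι - Nat.card σ = n := hP
      omega
    rw [this]
    exact h1.trans (by gcongr)
  rw [Nat.cast_add] at h6
  exact (ENat.add_le_add_iff_right (by simp)).mp h6

theorem height_le_two_of_le_span_sup_sq [IsNoetherianRing B] {m : Ideal B} [m.IsMaximal] {a b : B}
    (ha : a ∈ m) (hb : b ∈ m) (h : m ≤ Ideal.span {a, b} ⊔ m ^ 2) : m.height ≤ 2 := by
  have hmin : m ∈ (Ideal.span {a, b}).minimalPrimes := by
    refine ⟨⟨inferInstance, by rw [Ideal.span_le]; rintro _ (rfl | rfl) <;> assumption⟩, ?_⟩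
    rintro q ⟨hq, hq1⟩ hqm
    have hfg : m.FG := IsNoetherian.noetherian m
    have h1 : m ≤ Ideal.span {a, b} ⊔ m • m := by rwa [smul_eq_mul, ← sq]
    obtain ⟨r, hr, hr'⟩ := Submodule.exists_sub_one_mem_and_smul_le_of_fg_of_le_sup hfg
      le_rfl h1
    intro x hx
    have h2 : r * x ∈ q := hq1 (hr' (Submodule.smul_mem_pointwise_smul x r m hx))
    refine (hq.mem_or_mem h2).resolve_left fun h3 => ?_
    have := m.sub_mem (hqm h3) hr
    rw [sub_sub_cancel] at this
    exact Ideal.IsPrime.ne_top' ((Ideal.eq_top_iff_one m).mpr this)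
  refine (Ideal.height_le_card_of_mem_minimalPrimes_span (Set.toFinite _) hmin).trans ?_
  exact_mod_cast Set.ncard_insert_le a {b} |>.trans (by simp)

end StandardSmooth

end K3
end

noncomputable section
namespace K3

section LocalGenerators
variable {A : Type*} [CommRing A] {m : Ideal A} [m.IsMaximal]
  {O : Type*} [CommRing O] [Algebra A O] [IsLocalRing O] [IsLocalization.AtPrime O m]

theorem maximalIdeal_eq_span_of_le_sup_sq [IsNoetherianRing A] {a b : A} (ha : a ∈ m) (hb : b ∈ m)
    (h : m ≤ Ideal.span {a, b} ⊔ m ^ 2) :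
    maximalIdeal O = Ideal.span {algebraMap A O a, algebraMap A O b} := by
  rw [← IsLocalization.AtPrime.map_eq_maximalIdeal m O]
  apply le_antisymm
  · obtain ⟨r, hr, hr'⟩ := Submodule.exists_sub_one_mem_and_smul_le_of_fg_of_le_sup
      (IsNoetherian.noetherian m) le_rfl (show m ≤ Ideal.span {a, b} ⊔ m • m by rwa [smul_eq_mul, ← sq])
    have hrm : r ∉ m := fun h3 => by
      have := m.sub_mem h3 hr
      rw [sub_sub_cancel] at this
      exact Ideal.IsPrime.ne_top' ((Ideal.eq_top_iff_one m).mpr this)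
    rw [Ideal.map_le_iff_le_comap]
    intro x hx
    have hu : IsUnit (algebraMap A O r) := IsLocalization.map_units O (⟨r, hrm⟩ : m.primeCompl)
    rw [Ideal.mem_comap, ← Ideal.unit_mul_mem_iff_mem _ hu, ← map_mul]
    have := Ideal.mem_map_of_mem (algebraMap A O)
      (hr' (Submodule.smul_mem_pointwise_smul x r m hx))
    rwa [Ideal.map_span, Set.image_pair] at this
  · rw [Ideal.span_le]
    rintro _ (rfl | rfl)
    · exact Ideal.mem_map_of_mem _ ha
    · exact Ideal.mem_map_of_mem _ hb

variable (m) in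
theorem exists_le_span_pair_sup_sq_of_localization {a' b' : O}
    (h : maximalIdeal O = Ideal.span {a', b'}) :
    ∃ a ∈ m, ∃ b ∈ m, m ≤ Ideal.span {a, b} ⊔ m ^ 2 := by
  have key : ∀ x ∈ maximalIdeal O, ∃ a ∈ m, ∃ s : O, IsUnit s ∧ s * x = algebraMap A O a := by
    intro x hx
    obtain ⟨⟨a, s⟩, has⟩ := IsLocalization.surj m.primeCompl x
    refine ⟨a, ?_, algebraMap A O s, IsLocalization.map_units O s, by rw [mul_comm]; exact has⟩
    rw [← IsLocalization.AtPrime.to_map_mem_maximal_iff O m, ← has]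
    exact Ideal.mul_mem_right _ _ hx
  obtain ⟨a, ha, s, hs, hsa⟩ := key a' (h ▸ Ideal.subset_span (by simp))
  obtain ⟨b, hb, t, ht, htb⟩ := key b' (h ▸ Ideal.subset_span (by simp))
  refine ⟨a, ha, b, hb, fun x hx => ?_⟩
  have h1 : algebraMap A O x ∈ Ideal.map (algebraMap A O) (Ideal.span {a, b}) := by
    have h2 : algebraMap A O x ∈ maximalIdeal O :=
      (IsLocalization.AtPrime.to_map_mem_maximal_iff O m x).mpr hx
    rw [Ideal.map_span, Set.image_pair, ← hsa, ← htb]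
    rw [h, Ideal.mem_span_pair] at h2
    obtain ⟨p, q, hpq⟩ := h2
    obtain ⟨s', hs'⟩ := hs.exists_left_inv
    obtain ⟨t', ht'⟩ := ht.exists_left_inv
    rw [Ideal.mem_span_pair]
    refine ⟨p * s', q * t', ?_⟩
    rw [← hpq]
    linear_combination p * a' * hs' + q * b' * ht'
  obtain ⟨⟨y, r⟩, hyr⟩ := (IsLocalization.mem_map_algebraMap_iff m.primeCompl O).mp h1
  rw [← map_mul] at hyr
  obtain ⟨c, hc⟩ := (IsLocalization.eq_iff_exists m.primeCompl O).mp hyr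
  let w : A := c * r
  have hw : w ∉ m := (c * r).2
  have hwx : w * x ∈ Ideal.span {a, b} := by
    have : w * x = c * y := by rw [← hc]; ring
    rw [this]
    exact Ideal.mul_mem_left _ _ y.2
  obtain ⟨w', hw'⟩ := Ideal.Quotient.exists_inv (I := m) (a := Ideal.Quotient.mk m w)
    (by rwa [Ne, Ideal.Quotient.eq_zero_iff_mem])
  obtain ⟨w', rfl⟩ := Ideal.Quotient.mk_surjective w'
  rw [← map_mul, ← map_one (Ideal.Quotient.mk m), Ideal.Quotient.eq] at hw'
  have : x = w' * (w * x) - (w * w' - 1) * x := by ring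
  rw [this]
  refine sub_mem (Ideal.mem_sup_left (Ideal.mul_mem_left _ _ hwx)) (Ideal.mem_sup_right ?_)
  rw [sq]
  exact Ideal.mul_mem_mul hw' hx

end LocalGenerators

section Dimension
variable {F : Type u} [Field F] [IsAlgClosed F] {Y : Scheme.{u}} (t : Y ⟶ Spec (.of F))

theorem isMaximal_primeIdealOf {V : Y.Opens} (hV : IsAffineOpen V) {y : Y} (hy : y ∈ V)
    (hc : IsClosed {y}) : (hV.primeIdealOf ⟨y, hy⟩).asIdeal.IsMaximal := by
  rw [← PrimeSpectrum.isClosed_singleton_iff_isMaximal]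
  have : ({hV.primeIdealOf ⟨y, hy⟩} : Set (PrimeSpectrum Γ(Y, V))) = hV.fromSpec ⁻¹' {y} := by
    ext z
    simp only [Set.mem_singleton_iff, Set.mem_preimage]
    constructor
    · rintro rfl
      exact hV.fromSpec_primeIdealOf ⟨y, hy⟩
    · intro h
      exact hV.fromSpec.isOpenEmbedding.injective (h.trans (hV.fromSpec_primeIdealOf ⟨y, hy⟩).symm)
  rw [this]
  exact hc.preimage hV.fromSpec.continuous

theorem coheight_eq_height_primeIdealOf {V : Y.Opens} (hV : IsAffineOpen V) {y : Y} (hy : y ∈ V) :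
    Order.coheight y = (hV.primeIdealOf ⟨y, hy⟩).asIdeal.height := by
  have h1 := coheight_eq_of_isOpenImmersion (x := hV.primeIdealOf ⟨y, hy⟩) hV.fromSpec
  have h2 := idealHeight_eq_coheight Γ(Y, V) (hV.primeIdealOf ⟨y, hy⟩)
  rw [hV.fromSpec_primeIdealOf ⟨y, hy⟩] at h1
  exact h1.trans h2.symm

theorem exists_isStandardSmooth_field {n : ℕ} [SmoothOfRelativeDimension n t] (y : Y) :
    ∃ (V : Y.Opens) (_ : IsAffineOpen V) (_ : y ∈ V) (ρ : F →+* Γ(Y, V)),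
      ρ.IsStandardSmoothOfRelativeDimension n := by
  obtain ⟨U, hU, V, hV, hy, e, h⟩ :=
    SmoothOfRelativeDimension.exists_isStandardSmoothOfRelativeDimension (n := n) (f := t) y
  obtain rfl : U = ⊤ := by
    ext z
    have : Subsingleton (Spec (CommRingCat.of F)) :=
      inferInstanceAs (Subsingleton (PrimeSpectrum F))
    simpa [Subsingleton.elim z (t y)] using e hy
  refine ⟨V, hV, hy, (t.appLE ⊤ V e).hom.comp
    (Scheme.ΓSpecIso (.of F)).symm.commRingCatIsoToRingEquiv, ?_⟩
  exact h.comp (.equiv _)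

theorem smooth_surface_closedPoint [SmoothOfRelativeDimension 2 t] {y : Y} (hy : IsClosed {y}) :
    Order.coheight y = 2 ∧ ∃ a b, maximalIdeal (Y.presheaf.stalk y) = Ideal.span {a, b} := by
  obtain ⟨V, hV, hyV, ρ, hρ⟩ := exists_isStandardSmooth_field (n := 2) t y
  algebraize [ρ]
  have : Algebra.IsStandardSmooth F Γ(Y, V) :=
    Algebra.IsStandardSmoothOfRelativeDimension.isStandardSmooth 2
  have : IsNoetherianRing Γ(Y, V) := Algebra.FiniteType.isNoetherianRing F _
  let m := (hV.primeIdealOf ⟨y, hyV⟩).asIdeal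
  have : m.IsMaximal := isMaximal_primeIdealOf hV hyV hy
  obtain ⟨a, ha, b, hb, hab⟩ := exists_le_span_pair_sup_sq (F := F) m
  refine ⟨?_, ?_⟩
  · rw [coheight_eq_height_primeIdealOf hV hyV]
    exact le_antisymm (height_le_two_of_le_span_sup_sq ha hb hab)
      (le_height_of_isStandardSmooth (F := F) (n := 2) m)
  · let y' : V := ⟨y, hyV⟩
    algebraize [(Y.presheaf.germ V y hyV).hom]
    have : IsLocalization.AtPrime (Y.presheaf.stalk y) m := hV.isLocalization_stalk y'
    exact ⟨_, _, maximalIdeal_eq_span_of_le_sup_sq ha hb hab⟩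

theorem lt_of_le_of_ne_of_scheme {x y : Y} (h : x ≤ y) (hne : x ≠ y) : x < y :=
  lt_of_le_not_ge h fun h' => hne
    ((Scheme.le_iff_specializes.mp h').antisymm (Scheme.le_iff_specializes.mp h)).eq

theorem isClosed_singleton_of_not_lt [CompactSpace Y] {y : Y} (h : ∀ z, ¬ z < y) : IsClosed {y} := by
  obtain ⟨z, hz, hc⟩ := (isClosed_closure (s := {y})).exists_closed_singleton ⟨y, subset_closure rfl⟩
  have hzy : z ≤ y := Scheme.le_iff_specializes.mpr (specializes_iff_mem_closure.mpr hz)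
  have : z = y := by
    by_contra hne
    exact h z (lt_of_le_of_ne_of_scheme hzy hne)
  exact this ▸ hc

theorem coheight_le_two [SmoothOfRelativeDimension 2 t] [CompactSpace Y]
    (y : Y) : Order.coheight y ≤ 2 := by
  obtain ⟨z, hz, hc⟩ := (isClosed_closure (s := {y})).exists_closed_singleton ⟨y, subset_closure rfl⟩
  have hzy : z ≤ y := Scheme.le_iff_specializes.mpr (specializes_iff_mem_closure.mpr hz)
  exact (Order.coheight_anti hzy).trans (smooth_surface_closedPoint t hc).1.le

theorem coheight_eq_two_iff [SmoothOfRelativeDimension 2 t] [CompactSpace Y]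
    {y : Y} : Order.coheight y = 2 ↔ IsClosed {y} := by
  refine ⟨fun h => isClosed_singleton_of_not_lt fun z hz => ?_,
    fun h => (smooth_surface_closedPoint t h).1⟩
  have h1 := Order.coheight_add_one_le hz
  have h2 := h1.trans (coheight_le_two t z)
  rw [h] at h2
  exact absurd h2 (by decide)

/-- The points of a curve on a smooth surface, other than the generic one. -/
theorem curve_point [SmoothOfRelativeDimension 2 t] [CompactSpace Y]
    {W : Scheme.{u}} [IsIntegral W] (i : W ⟶ Y) [IsClosedImmersion i]
    (hW : Order.coheight (i (genericPoint W)) = 1) {w : W} (hw : w ≠ genericPoint W) :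
    IsClosed {w} ∧ Order.coheight w = 1 := by
  have hlt : ∀ v : W, v ≠ genericPoint W → v < genericPoint W := fun v hv =>
    lt_of_le_of_ne_of_scheme (Scheme.le_iff_specializes.mpr
      ((genericPoint_spec W).specializes (Set.mem_univ v))) hv
  have hmono : ∀ {v v' : W}, v < v' → i v < i v' := by
    intro v v' h
    refine lt_of_le_of_ne_of_scheme ?_ fun h' => ne_of_lt h (i.isClosedEmbedding.injective h')
    exact Scheme.le_iff_specializes.mpr ((Scheme.le_iff_specializes.mp h.le).map i.continuous)
  have hclosed : ∀ v : W, v ≠ genericPoint W → IsClosed {v} := by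
    intro v hv
    have h1 := Order.coheight_add_one_le (hmono (hlt v hv))
    rw [hW] at h1
    have h2 : IsClosed {i v} := (coheight_eq_two_iff t).mp (le_antisymm (coheight_le_two t _) h1)
    rwa [i.isClosedEmbedding.isClosed_iff_image_isClosed, Set.image_singleton]
  refine ⟨hclosed w hw, le_antisymm ?_ ?_⟩
  · refine Order.coheight_le_coe_iff (n := 1) |>.mpr fun v hv => ?_
    have : v = genericPoint W := by
      by_contra hne
      have := hclosed v hne
      have h3 : w ∈ closure {v} := specializes_iff_mem_closure.mp (Scheme.le_iff_specializes.mp hv.le)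
      rw [this.closure_eq] at h3
      exact ne_of_lt hv h3
    rw [this, coheight_genericPoint]
    simp
  · simpa [coheight_genericPoint] using Order.coheight_add_one_le (hlt w hw)

end Dimension

end K3
end

noncomputable section
namespace K3

section LinearForms
variable {k ι : Type*} [Field k] [Fintype ι] {E : Type*} [Field E] [Algebra k E]

/-- The value of the linear form with coefficients `l` at the point `p`. -/
def formAt (l : ι → k) (p : ι → E) : E := ∑ i, algebraMap k E (l i) * p i

/-- The representative of the point of projective space with homogeneous coordinates `p` at which
the linear form `l` takes the value one. -/
def normAt (l : ι → k) (p : ι → E) (i : ι) : E := p i / formAt l p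

variable (E) in
/-- The linear form with coefficients `l`, as a polynomial. -/
def formPoly (l : ι → k) : MvPolynomial ι E :=
  ∑ i, MvPolynomial.C (algebraMap k E (l i)) * MvPolynomial.X i

lemma formPoly_isHomogeneous (l : ι → k) : (formPoly E l).IsHomogeneous 1 :=
  MvPolynomial.IsHomogeneous.sum _ _ _ fun i _ => by
    simpa using (MvPolynomial.isHomogeneous_C ι (algebraMap k E (l i))).mul
      (MvPolynomial.isHomogeneous_X E i)

lemma formAt_single [DecidableEq ι] (i : ι) (p : ι → E) :
    formAt (Pi.single i (1 : k)) p = p i := by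
  simp [formAt, Pi.single_apply, ite_mul]

lemma formAt_mul (l : ι → k) (c : E) (p : ι → E) : formAt l (fun i => c * p i) = c * formAt l p := by
  simp only [formAt, Finset.mul_sum]
  exact Finset.sum_congr rfl fun i _ => by ring

lemma eval_formPoly (l : ι → k) (p : ι → E) : MvPolynomial.eval p (formPoly E l) = formAt l p := by
  simp [formPoly, formAt]

lemma normAt_eq_mul (l : ι → k) (p : ι → E) : normAt l p = fun i => (formAt l p)⁻¹ * p i := by
  ext i
  rw [normAt, div_eq_inv_mul]

lemma formAt_normAt (l l' : ι → k) (p : ι → E) : formAt l' (normAt l p) = formAt l' p / formAt l p := by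
  rw [normAt_eq_mul, formAt_mul, div_eq_inv_mul]

lemma normAt_normAt {l l' : ι → k} {p : ι → E} (h : formAt l p ≠ 0) :
    normAt l' (normAt l p) = normAt l' p := by
  ext i
  rw [normAt, formAt_normAt, normAt, normAt, div_div_div_cancel_right₀ h]

variable {F : Type*} [Field F] [Algebra k F] [Algebra F E] [IsScalarTower k F E]

lemma aeval_formPoly (l : ι → k) (p : ι → E) :
    MvPolynomial.aeval p (formPoly F l) = formAt l p := by
  simp [formPoly, formAt, ← IsScalarTower.algebraMap_apply]

lemma aeval_mul_of_isHomogeneous {E : Type*} [CommRing E] [Algebra F E] {n : ℕ}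
    {g : MvPolynomial ι F} (hg : g.IsHomogeneous n) (c : E) (p : ι → E) : MvPolynomial.aeval (fun i => c * p i) g = c ^ n * MvPolynomial.aeval p g := by
  rw [g.as_sum, map_sum, map_sum, Finset.mul_sum]
  refine Finset.sum_congr rfl fun s hs => ?_
  rw [MvPolynomial.aeval_monomial, MvPolynomial.aeval_monomial]
  have hd : s.sum (fun _ e => e) = n := by
    have := hg (MvPolynomial.mem_support_iff.mp hs)
    rwa [Finsupp.weight_apply, show (fun (i : ι) (c : ℕ) => c • (1 : ι → ℕ) i) = fun _ e => e by
      ext; simp] at this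
  rw [← hd]
  simp only [Finsupp.prod, Finsupp.sum, mul_pow, Finset.prod_mul_distrib, Finset.prod_pow_eq_pow_sum]
  ring

lemma aeval_normAt_mul {n : ℕ} {g : MvPolynomial ι F} (hg : g.IsHomogeneous n) {l : ι → k}
    {p : ι → E} (h : formAt l p ≠ 0) :
    MvPolynomial.aeval (normAt l p) g * formAt l p ^ n = MvPolynomial.aeval p g := by
  rw [normAt_eq_mul, aeval_mul_of_isHomogeneous hg, inv_pow, mul_right_comm,
    inv_mul_cancel₀ (pow_ne_zero n h), one_mul]

lemma aeval_normAt_eq_zero_iff {n : ℕ} {g : MvPolynomial ι F} (hg : g.IsHomogeneous n) {l : ι → k}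
    {p : ι → E} (h : formAt l p ≠ 0) :
    MvPolynomial.aeval (normAt l p) g = 0 ↔ MvPolynomial.aeval p g = 0 := by
  rw [← aeval_normAt_mul hg h]
  simp [h]

/-- The homogenization of degree `N` of a polynomial with respect to a linear form. -/
def homogenize (l : ι → k) (N : ℕ) (q : MvPolynomial ι F) : MvPolynomial ι F :=
  ∑ j ∈ Finset.range (N + 1), formPoly F l ^ (N - j) * MvPolynomial.homogeneousComponent j q

lemma homogenize_isHomogeneous (l : ι → k) (N : ℕ) (q : MvPolynomial ι F) :
    (homogenize l N q).IsHomogeneous N := by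
  refine MvPolynomial.IsHomogeneous.sum _ _ _ fun j hj => ?_
  have := ((formPoly_isHomogeneous (E := F) l).pow (N - j)).mul
    (MvPolynomial.homogeneousComponent_isHomogeneous j q)
  rwa [one_mul, Nat.sub_add_cancel (Nat.lt_succ_iff.mp (Finset.mem_range.mp hj))] at this

lemma aeval_homogenize {l : ι → k} {N : ℕ} {q : MvPolynomial ι F} (hN : q.totalDegree ≤ N)
    {p : ι → E} (h : formAt l p ≠ 0) :
    MvPolynomial.aeval p (homogenize l N q) = formAt l p ^ N * MvPolynomial.aeval (normAt l p) q := by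
  have hq : q = ∑ j ∈ Finset.range (N + 1), MvPolynomial.homogeneousComponent j q := by
    conv_lhs => rw [← MvPolynomial.sum_homogeneousComponent q]
    refine Finset.sum_subset (Finset.range_mono (by omega)) fun j _ hj => ?_
    exact MvPolynomial.homogeneousComponent_eq_zero _ _ (by simpa using hj)
  conv_rhs => rw [hq]
  rw [homogenize, map_sum, map_sum, Finset.mul_sum]
  refine Finset.sum_congr rfl fun j hj => ?_
  have hj' : j ≤ N := Nat.lt_succ_iff.mp (Finset.mem_range.mp hj)
  rw [map_mul, map_pow, aeval_formPoly, ← aeval_normAt_mul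
    (MvPolynomial.homogeneousComponent_isHomogeneous j q) h]
  conv_rhs => rw [← Nat.sub_add_cancel hj', pow_add]
  ring

variable (F) in
/-- The ideal of the chart `l ≠ 0` of the projective variety with generic point `ξ`. -/
def chartIdeal (l : ι → k) (ξ : ι → E) : Ideal (MvPolynomial ι F) :=
  RingHom.ker (MvPolynomial.aeval (R := F) (normAt l ξ))

lemma mem_chartIdeal {l : ι → k} {ξ : ι → E} {g : MvPolynomial ι F} :
    g ∈ chartIdeal F l ξ ↔ MvPolynomial.aeval (normAt l ξ) g = 0 := Iff.rfl

instance chartIdeal_isPrime (l : ι → k) (ξ : ι → E) : (chartIdeal F l ξ).IsPrime :=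
  RingHom.ker_isPrime _

lemma multAt_quotient_eq_zero {S : Type*} [CommRing S] (m : MaximalSpectrum S) {J : Ideal S}
    (h : ¬ J ≤ m.asIdeal) : multAt m (S ⧸ J) = 0 := by
  obtain ⟨s, hs, hs'⟩ := Set.not_subset.mp h
  have : Subsingleton (LocalizedModule m.asIdeal.primeCompl (S ⧸ J)) :=
    LocalizedModule.subsingleton_iff.mpr fun x => ⟨s, hs', by
      obtain ⟨x, rfl⟩ := Ideal.Quotient.mk_surjective x
      rw [← Ideal.Quotient.mk_eq_mk, ← Submodule.Quotient.mk_smul, Submodule.Quotient.mk_eq_zero]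
      exact Ideal.mul_mem_right _ _ hs⟩
  rw [multAt, Module.length_eq_zero, ENat.toNat_zero]

lemma finite_setOf_le_of_isFiniteLength {S : Type*} [CommRing S] {J : Ideal S}
    (h : IsFiniteLength S (S ⧸ J)) : {m : MaximalSpectrum S | J ≤ m.asIdeal}.Finite := by
  refine (finite_multAt_ne_zero h).subset fun m hm h0 => ?_
  have h1 := multAt_eq_add m h (LinearMap.ker (Submodule.factor hm)).subtype (Submodule.factor hm)
    (Submodule.subtype_injective _) (Submodule.factor_surjective hm) (LinearMap.exact_subtype_ker_map _)
  rw [h0] at h1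
  have := multAt_quotient_self m
  omega

end LinearForms

section Avoidance
variable {k ι : Type*} [Field k] [Infinite k] [Fintype ι]

lemma exists_form_ne_zero {ρ : Type*} {E : Type*} [Field E] [Algebra k E]
    {Z : Set ρ} (hZ : Z.Finite) (π : ρ → ι → E) (h : ∀ q ∈ Z, ∃ i, π q i ≠ 0) :
    ∃ l : ι → k, ∀ q ∈ Z, formAt l (π q) ≠ 0 := by
  classical
  let ev : ρ → (ι → k) →ₗ[k] E := fun q =>
    { toFun := fun l => formAt l (π q)
      map_add' := fun a b => by simp [formAt, add_mul, Finset.sum_add_distrib]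
      map_smul' := fun c a => by
        simp [formAt, Algebra.smul_def, Finset.mul_sum, mul_assoc] }
  by_contra! hcon
  let s : Finset (Submodule k (ι → k)) := hZ.toFinset.image fun q => LinearMap.ker (ev q)
  have htop : ⊤ ∉ s := by
    intro hmem
    obtain ⟨q, hq, hq'⟩ := Finset.mem_image.mp hmem
    obtain ⟨i, hi⟩ := h q (hZ.mem_toFinset.mp hq)
    have : (Pi.single i 1 : ι → k) ∈ LinearMap.ker (ev q) := hq' ▸ trivial
    have h2 : formAt (Pi.single i (1 : k)) (π q) = 0 := this
    exact hi (by rwa [formAt_single] at h2)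
  refine Subspace.biUnion_ne_univ_of_top_notMem htop ?_
  ext l
  simp only [Set.mem_iUnion, Set.mem_univ, iff_true]
  obtain ⟨q, hq, hl⟩ := hcon l
  exact ⟨LinearMap.ker (ev q), Finset.mem_image.mpr ⟨q, hZ.mem_toFinset.mpr hq, rfl⟩, hl⟩

end Avoidance

end K3
end

noncomputable section
namespace K3

section ProjCurve
variable (k : Type*) {F L ι Q : Type*} [Field k] [Field F] [Field L] [Algebra k F] [Algebra F L]
  [Algebra k L] [IsScalarTower k F L] [Fintype ι]

/-- A projective curve over `F` with function field `L`, in terms of the homogeneous coordinates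
`ξ` of its generic point, the homogeneous coordinates `π` of its closed points `Q` and the orders of
vanishing at these. Charts are indexed by linear forms with coefficients in a subfield `k`. -/
structure ProjCurve (ξ : ι → L) (π : Q → ι → F) (ord : Q → L → ℤ) : Prop where
  exists_ne : ∀ q, ∃ i, π q i ≠ 0
  exists_ne' : ∃ i, ξ i ≠ 0
  formAt_ne : ∀ q (l : ι → k), formAt l (π q) ≠ 0 → formAt l ξ ≠ 0
  le_pointIdeal : ∀ q (l : ι → k), formAt l (π q) ≠ 0 →
    chartIdeal F l ξ ≤ (pointIdeal (normAt l (π q))).asIdeal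
  exists_point : ∀ l : ι → k, formAt l ξ ≠ 0 → ∀ p, chartIdeal F l ξ ≤ (pointIdeal p).asIdeal →
    ∃ q, formAt l (π q) ≠ 0 ∧ normAt l (π q) = p
  injective : ∀ (l : ι → k) q q', formAt l (π q) ≠ 0 → formAt l (π q') ≠ 0 →
    normAt l (π q) = normAt l (π q') → q = q'
  ord_div : ∀ q f g, f ≠ 0 → g ≠ 0 → ord q (f / g) = ord q f - ord q g
  ord_aeval : ∀ q (l : ι → k), formAt l (π q) ≠ 0 → ∀ P ∉ chartIdeal F l ξ,
    ord q (MvPolynomial.aeval (normAt l ξ) P) = multAt (pointIdeal (normAt l (π q)))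
      (MvPolynomial ι F ⧸ (chartIdeal F l ξ ⊔ Ideal.span {P}))
  exists_frac : ∀ l : ι → k, formAt l ξ ≠ 0 → ∀ f : L, ∃ P R : MvPolynomial ι F, R ∉ chartIdeal F l ξ ∧
    f = MvPolynomial.aeval (normAt l ξ) P / MvPolynomial.aeval (normAt l ξ) R
  isFiniteLength : ∀ l : ι → k, formAt l ξ ≠ 0 → ∀ P ∉ chartIdeal F l ξ,
    IsFiniteLength (MvPolynomial ι F) (MvPolynomial ι F ⧸ (chartIdeal F l ξ ⊔ Ideal.span {P}))

variable {k} {ξ : ι → L} {π : Q → ι → F} {ord : Q → L → ℤ}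

lemma mem_chartIdeal_iff_of_isHomogeneous {l : ι → k} (hl : formAt l ξ ≠ 0)
    {g : MvPolynomial ι F} {d : ℕ} (hg : g.IsHomogeneous d) :
    g ∈ chartIdeal F l ξ ↔ MvPolynomial.aeval ξ g = 0 := by
  rw [mem_chartIdeal, aeval_normAt_eq_zero_iff hg hl]

lemma div_aeval_normAt {l : ι → k} (hl : formAt l ξ ≠ 0)
    {g h : MvPolynomial ι F} {d : ℕ} (hg : g.IsHomogeneous d) (hh : h.IsHomogeneous d) :
    MvPolynomial.aeval (normAt l ξ) g / MvPolynomial.aeval (normAt l ξ) h =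
      MvPolynomial.aeval ξ g / MvPolynomial.aeval ξ h := by
  rw [← aeval_normAt_mul hg hl, ← aeval_normAt_mul hh hl, mul_div_mul_right _ _ (pow_ne_zero _ hl)]

namespace ProjCurve

/-- At points on the hyperplane at infinity, `g` does not vanish. -/
lemma aeval_ne_zero_of_noZerosAtInfinity (C : ProjCurve k ξ π ord) {l : ι → k} (hl : formAt l ξ ≠ 0)
    {g : MvPolynomial ι F} {d : ℕ} (hg : g.IsHomogeneous d)
    (hinf : NoZerosAtInfinity (chartIdeal F l ξ) g d) {q : Q} (hq : formAt l (π q) = 0) :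
    MvPolynomial.aeval (π q) g ≠ 0 := by
  classical
  intro h0
  obtain ⟨M, hdM, hM, h⟩ := hinf
  obtain ⟨i, hi⟩ := C.exists_ne q
  obtain ⟨c, e, hc, he, hce⟩ := h i
  have hT : (MvPolynomial.X i ^ M - g * c - formPoly F l * e : MvPolynomial ι F).IsHomogeneous M := by
    refine ((MvPolynomial.isHomogeneous_X_pow i M).sub ?_).sub ?_
    · have := hg.mul hc
      rwa [Nat.add_sub_cancel' hdM] at this
    · have := (formPoly_isHomogeneous (E := F) l).mul he
      rwa [Nat.add_sub_cancel' hM] at this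
  have h1 : MvPolynomial.aeval ξ (MvPolynomial.X i ^ M - g * c - formPoly F l * e) = 0 := by
    rw [← aeval_normAt_eq_zero_iff hT hl]
    rw [mem_chartIdeal] at hce
    have h2 : MvPolynomial.aeval (normAt l ξ) (formPoly F l) = 1 := by
      rw [aeval_formPoly, formAt_normAt, div_self hl]
    rw [map_sub, map_mul, h2, one_mul, ← map_sub, hce]
  have hi' : formAt (Pi.single i (1 : k)) (π q) ≠ 0 := by rwa [formAt_single]
  have h3 : MvPolynomial.X i ^ M - g * c - formPoly F l * e ∈ chartIdeal F (Pi.single i (1 : k)) ξ :=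
    (mem_chartIdeal_iff_of_isHomogeneous (C.formAt_ne q _ hi') hT).mpr h1
  have h4 := C.le_pointIdeal q _ hi' h3
  rw [mem_pointIdeal, ← MvPolynomial.coe_aeval_eq_eval, RingHom.coe_coe,
    aeval_normAt_eq_zero_iff hT hi'] at h4
  rw [map_sub, map_sub, map_mul, map_mul, h0, aeval_formPoly, hq] at h4
  simp only [map_pow, MvPolynomial.aeval_X, zero_mul, sub_zero] at h4
  exact hi (pow_eq_zero_iff (by omega) |>.mp h4)

lemma ord_eq_zero_of_aeval_ne_zero (C : ProjCurve k ξ π ord) {q : Q} {g h : MvPolynomial ι F} {d : ℕ}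
    (hg : g.IsHomogeneous d) (hh : h.IsHomogeneous d)
    (hg0 : MvPolynomial.aeval (π q) g ≠ 0) (hh0 : MvPolynomial.aeval (π q) h ≠ 0) :
    ord q (MvPolynomial.aeval ξ g / MvPolynomial.aeval ξ h) = 0 := by
  classical
  obtain ⟨i, hi⟩ := C.exists_ne q
  let l : ι → k := Pi.single i 1
  have hl : formAt l (π q) ≠ 0 := by rwa [formAt_single]
  have key : ∀ {g : MvPolynomial ι F}, g.IsHomogeneous d → MvPolynomial.aeval (π q) g ≠ 0 →
      MvPolynomial.aeval (normAt l ξ) g ≠ 0 ∧ ord q (MvPolynomial.aeval (normAt l ξ) g) = 0 := by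
    intro g hg hg0
    have h1 : g ∉ (pointIdeal (normAt l (π q))).asIdeal := by
      rw [mem_pointIdeal, ← MvPolynomial.coe_aeval_eq_eval, RingHom.coe_coe,
        aeval_normAt_eq_zero_iff hg hl]
      exact hg0
    have h2 : g ∉ chartIdeal F l ξ := fun h => h1 (C.le_pointIdeal q l hl h)
    refine ⟨h2, ?_⟩
    rw [C.ord_aeval q l hl g h2, multAt_quotient_eq_zero, Nat.cast_zero]
    exact fun h => h1 (h (Ideal.mem_sup_right (Ideal.mem_span_singleton_self g)))
  rw [← div_aeval_normAt (C.formAt_ne q l hl) hg hh, C.ord_div q _ _ (key hg hg0).1 (key hh hh0).1,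
    (key hg hg0).2, (key hh hh0).2, sub_zero]

/-- The divisor of `g / h` in terms of a chart at infinity of which `g` and `h` do not vanish. -/
lemma finsum_ord_smul (C : ProjCurve k ξ π ord) [IsAlgClosed F] {l : ι → k} (hl : formAt l ξ ≠ 0)
    {g h : MvPolynomial ι F} {d : ℕ} (hg : g.IsHomogeneous d) (hh : h.IsHomogeneous d)
    (hgI : g ∉ chartIdeal F l ξ) (hhI : h ∉ chartIdeal F l ξ)
    (hginf : NoZerosAtInfinity (chartIdeal F l ξ) g d)
    (hhinf : NoZerosAtInfinity (chartIdeal F l ξ) h d)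
    {G : Type*} [AddCommGroup G] (cl : (ι → F) → G) (c : Q → G)
    (hc : ∀ q, formAt l (π q) ≠ 0 → c q = cl (normAt l (π q))) :
    ∑ᶠ q, ord q (MvPolynomial.aeval ξ g / MvPolynomial.aeval ξ h) • c q =
      cycleOf (fun m => cl (pointOf m)) (MvPolynomial ι F ⧸ (chartIdeal F l ξ ⊔ Ideal.span {g})) -
      cycleOf (fun m => cl (pointOf m)) (MvPolynomial ι F ⧸ (chartIdeal F l ξ ⊔ Ideal.span {h})) := by
  rw [cycleOf, cycleOf, ← finsum_sub_distrib
    (finite_support_smul _ (C.isFiniteLength l hl g hgI))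
    (finite_support_smul _ (C.isFiniteLength l hl h hhI))]
  let A : Set Q := {q | formAt l (π q) ≠ 0}
  let B : Set (MaximalSpectrum (MvPolynomial ι F)) := {m | chartIdeal F l ξ ≤ m.asIdeal}
  rw [← finsum_mem_univ, ← finsum_mem_inter_support_eq' _ A Set.univ]
  rotate_left
  · intro q hq
    simp only [Set.mem_univ, iff_true]
    by_contra hqA
    rw [Set.mem_ofPred_eq, not_not] at hqA
    refine hq ?_
    change ord q _ • c q = 0
    rw [C.ord_eq_zero_of_aeval_ne_zero hg hh
      (C.aeval_ne_zero_of_noZerosAtInfinity hl hg hginf hqA)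
      (C.aeval_ne_zero_of_noZerosAtInfinity hl hh hhinf hqA), zero_smul]
  rw [← finsum_mem_univ (f := fun m : MaximalSpectrum (MvPolynomial ι F) =>
    multAt m (MvPolynomial ι F ⧸ (chartIdeal F l ξ ⊔ Ideal.span {g})) • cl (pointOf m) -
    multAt m (MvPolynomial ι F ⧸ (chartIdeal F l ξ ⊔ Ideal.span {h})) • cl (pointOf m)),
    ← finsum_mem_inter_support_eq' _ B Set.univ]
  rotate_left
  · intro m hm
    simp only [Set.mem_univ, iff_true]
    by_contra hmB
    refine hm ?_
    change _ - _ = _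
    rw [multAt_quotient_eq_zero m fun h => hmB (le_sup_left.trans h),
      multAt_quotient_eq_zero m fun h => hmB (le_sup_left.trans h), zero_smul, sub_zero]
  refine finsum_mem_eq_of_bijOn (fun q => pointIdeal (normAt l (π q))) ⟨?_, ?_, ?_⟩ ?_
  · exact fun q hq => C.le_pointIdeal q l hq
  · exact fun q hq q' hq' h => C.injective l q q' hq hq' (pointIdeal_injective h)
  · intro m hm
    obtain ⟨p, rfl⟩ := exists_eq_pointIdeal m
    obtain ⟨q, hq, hqp⟩ := C.exists_point l hl p hm
    exact ⟨q, hq, congrArg pointIdeal hqp⟩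
  · intro q hq
    rw [← div_aeval_normAt hl hg hh, C.ord_div q _ _ hgI hhI, C.ord_aeval q l hq g hgI,
      C.ord_aeval q l hq h hhI, sub_smul, pointOf_pointIdeal, hc q hq, natCast_zsmul, natCast_zsmul]

lemma finite_zeros (C : ProjCurve k ξ π ord) {g : MvPolynomial ι F} {d : ℕ} (hg : g.IsHomogeneous d)
    (hg0 : MvPolynomial.aeval ξ g ≠ 0) : {q | MvPolynomial.aeval (π q) g = 0}.Finite := by
  classical
  have : {q | MvPolynomial.aeval (π q) g = 0} ⊆
      ⋃ i, {q | π q i ≠ 0 ∧ MvPolynomial.aeval (π q) g = 0} := by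
    intro q hq
    obtain ⟨i, hi⟩ := C.exists_ne q
    exact Set.mem_iUnion.mpr ⟨i, hi, hq⟩
  refine (Set.finite_iUnion fun i => ?_).subset this
  let l : ι → k := Pi.single i 1
  by_cases hl : formAt l ξ = 0
  · refine Set.Finite.subset Set.finite_empty ?_
    rintro q ⟨hq, -⟩
    exact C.formAt_ne q l (by rwa [formAt_single]) hl
  have hgI : g ∉ chartIdeal F l ξ := by rwa [mem_chartIdeal_iff_of_isHomogeneous hl hg]
  refine Set.Finite.of_finite_image (f := fun q => pointIdeal (normAt l (π q)))
    ((finite_setOf_le_of_isFiniteLength (C.isFiniteLength l hl g hgI)).subset ?_) ?_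
  · rintro _ ⟨q, ⟨hq, hq0⟩, rfl⟩
    have hq' : formAt l (π q) ≠ 0 := by rwa [formAt_single]
    refine sup_le (C.le_pointIdeal q l hq') ?_
    rw [Ideal.span_singleton_le_iff_mem, mem_pointIdeal, ← MvPolynomial.coe_aeval_eq_eval,
      RingHom.coe_coe, aeval_normAt_eq_zero_iff hg hq']
    exact hq0
  · rintro q ⟨hq, -⟩ q' ⟨hq', -⟩ h
    exact C.injective l q q' (by rwa [formAt_single]) (by rwa [formAt_single])
      (pointIdeal_injective h)

lemma noZerosAtInfinity (C : ProjCurve k ξ π ord) [IsAlgClosed F] {g : MvPolynomial ι F} {d : ℕ} (hg : g.IsHomogeneous d)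
    {l : ι → k} (hl : formAt l ξ ≠ 0)
    (h : ∀ q, MvPolynomial.aeval (π q) g = 0 → formAt l (π q) ≠ 0) :
    NoZerosAtInfinity (chartIdeal F l ξ) g d := by
  classical
  have key : ∀ i, ∃ M₀, ∀ M ≥ M₀, ∃ c e : MvPolynomial ι F, c.IsHomogeneous (M - d) ∧
    e.IsHomogeneous (M - 1) ∧ MvPolynomial.X i ^ M - g * c - e ∈ chartIdeal F l ξ := by
    intro i
    by_cases hi : ξ i = 0
    · refine ⟨1, fun M hM => ⟨0, 0, MvPolynomial.isHomogeneous_zero _ _ _,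
        MvPolynomial.isHomogeneous_zero _ _ _, ?_⟩⟩
      rw [mem_chartIdeal]
      simp [normAt, hi, show M ≠ 0 by omega]
    let e₁ : ι → k := Pi.single i 1
    have he₁ : formAt e₁ ξ ≠ 0 := by rwa [formAt_single]
    have htop : chartIdeal F e₁ ξ ⊔ Ideal.span {g} ⊔ Ideal.span {formPoly F l} = ⊤ := by
      by_contra hne
      obtain ⟨m, hm, hle⟩ := Ideal.exists_le_maximal _ hne
      obtain ⟨p, hp⟩ := exists_eq_pointIdeal ⟨m, hm⟩
      obtain rfl : m = (pointIdeal p).asIdeal := congrArg MaximalSpectrum.asIdeal hp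
      obtain ⟨q, hq, hqp⟩ := C.exists_point e₁ he₁ p ((le_sup_left.trans le_sup_left).trans hle)
      have h1 : g ∈ (pointIdeal p).asIdeal :=
        hle (Ideal.mem_sup_left (Ideal.mem_sup_right (Ideal.mem_span_singleton_self g)))
      have h2 : formPoly F l ∈ (pointIdeal p).asIdeal :=
        hle (Ideal.mem_sup_right (Ideal.mem_span_singleton_self _))
      rw [mem_pointIdeal, eval_formPoly, ← hqp, formAt_normAt, div_eq_zero_iff, or_iff_left hq] at h2
      refine h q ?_ h2
      rw [mem_pointIdeal, ← MvPolynomial.coe_aeval_eq_eval, RingHom.coe_coe, ← hqp,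
        aeval_normAt_eq_zero_iff hg hq] at h1
      exact h1
    obtain ⟨a, ha, b, hb, hab⟩ := Submodule.mem_sup.mp ((Ideal.eq_top_iff_one _).mp htop)
    obtain ⟨a, ha', a', ha'', rfl⟩ := Submodule.mem_sup.mp ha
    obtain ⟨c, rfl⟩ := Ideal.mem_span_singleton'.mp ha''
    obtain ⟨e, rfl⟩ := Ideal.mem_span_singleton'.mp hb
    refine ⟨c.totalDegree + d + e.totalDegree + 1, fun M hM => ⟨homogenize e₁ (M - d) c,
      homogenize e₁ (M - 1) e, homogenize_isHomogeneous _ _ _, homogenize_isHomogeneous _ _ _, ?_⟩⟩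
    have hy : formAt e₁ (normAt l ξ) ≠ 0 := by
      rw [formAt_normAt]
      exact div_ne_zero he₁ hl
    have h1 := congrArg (MvPolynomial.aeval (normAt e₁ ξ)) hab
    rw [mem_chartIdeal] at ha'
    simp only [map_add, map_mul, map_one, ha', zero_add] at h1
    rw [aeval_formPoly, formAt_normAt] at h1
    rw [mem_chartIdeal, map_sub, map_sub, map_mul, aeval_homogenize (by omega) hy,
      aeval_homogenize (by omega) hy, normAt_normAt hl, ← aeval_normAt_mul hg hy, normAt_normAt hl,
      map_pow, MvPolynomial.aeval_X]
    have h2 : formAt e₁ (normAt l ξ) = normAt l ξ i := formAt_single i _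
    have h3 : formAt l ξ / formAt e₁ ξ = (normAt l ξ i)⁻¹ := by
      rw [← h2, formAt_normAt, inv_div]
    rw [h2] at hy ⊢
    rw [h3] at h1
    generalize normAt l ξ i = y at *
    obtain ⟨N, rfl⟩ : ∃ N, M = d + N := ⟨M - d, by omega⟩
    rw [Nat.add_sub_cancel_left]
    have h4 : y ^ (d + N) = y ^ d * y ^ N := pow_add _ _ _
    have h5 : y ^ (d + N - 1) = y ^ (d + N) * y⁻¹ := by
      rw [pow_sub₀ y hy (by omega), pow_one]
    rw [h5, h4]
    linear_combination (-(y ^ d * y ^ N)) * h1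
  choose M₀ hM₀ using key
  refine ⟨d + 1 + ∑ i, M₀ i, by omega, by omega, fun i => hM₀ i _ ?_⟩
  have := Finset.single_le_sum (f := M₀) (fun _ _ => Nat.zero_le _) (Finset.mem_univ i)
  omega

lemma nonempty (C : ProjCurve k ξ π ord) [IsAlgClosed F] : Nonempty Q := by
  classical
  obtain ⟨i, hi⟩ := C.exists_ne'
  let l : ι → k := Pi.single i 1
  have hl : formAt l ξ ≠ 0 := by rwa [formAt_single]
  obtain ⟨m, hm, hle⟩ := Ideal.exists_le_maximal _ (chartIdeal_isPrime (F := F) l ξ).ne_top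
  obtain ⟨p, hp⟩ := exists_eq_pointIdeal ⟨m, hm⟩
  obtain rfl : m = (pointIdeal p).asIdeal := congrArg MaximalSpectrum.asIdeal hp
  obtain ⟨q, -⟩ := C.exists_point l hl p hle
  exact ⟨q⟩

/-- Rational functions are quotients of forms, and the charts containing the zeros of these forms
compute their divisors. -/
theorem exists_forms (C : ProjCurve k ξ π ord) [IsAlgClosed F] {f : L} (hf : f ≠ 0) :
    ∃ (d : ℕ) (g h : MvPolynomial ι F) (Z : Set Q), g.IsHomogeneous d ∧ h.IsHomogeneous d ∧
      f = MvPolynomial.aeval ξ g / MvPolynomial.aeval ξ h ∧ Z.Finite ∧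
      ∀ l : ι → k, (∀ q ∈ Z, formAt l (π q) ≠ 0) → formAt l ξ ≠ 0 ∧
        g ∉ chartIdeal F l ξ ∧ h ∉ chartIdeal F l ξ ∧
        NoZerosAtInfinity (chartIdeal F l ξ) g d ∧ NoZerosAtInfinity (chartIdeal F l ξ) h d := by
  classical
  obtain ⟨i, hi⟩ := C.exists_ne'
  obtain ⟨q₀⟩ := C.nonempty
  let e₁ : ι → k := Pi.single i 1
  have he₁ : formAt e₁ ξ ≠ 0 := by rwa [formAt_single]
  obtain ⟨P, R, hR, hPR⟩ := C.exists_frac e₁ he₁ f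
  have hP : MvPolynomial.aeval (normAt e₁ ξ) P ≠ 0 := by
    intro h
    rw [h, zero_div] at hPR
    exact hf hPR
  let d := P.totalDegree + R.totalDegree
  let g := homogenize e₁ d P
  let h := homogenize e₁ d R
  have hg : g.IsHomogeneous d := homogenize_isHomogeneous _ _ _
  have hh : h.IsHomogeneous d := homogenize_isHomogeneous _ _ _
  have hgξ : MvPolynomial.aeval ξ g = formAt e₁ ξ ^ d * MvPolynomial.aeval (normAt e₁ ξ) P :=
    aeval_homogenize (by omega) he₁
  have hhξ : MvPolynomial.aeval ξ h = formAt e₁ ξ ^ d * MvPolynomial.aeval (normAt e₁ ξ) R :=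
    aeval_homogenize (by omega) he₁
  have hg0 : MvPolynomial.aeval ξ g ≠ 0 := by
    rw [hgξ]; exact mul_ne_zero (pow_ne_zero _ he₁) hP
  have hh0 : MvPolynomial.aeval ξ h ≠ 0 := by
    rw [hhξ]; exact mul_ne_zero (pow_ne_zero _ he₁) hR
  refine ⟨d, g, h, {q | MvPolynomial.aeval (π q) g = 0} ∪ {q | MvPolynomial.aeval (π q) h = 0} ∪ {q₀},
    hg, hh, ?_, ((C.finite_zeros hg hg0).union (C.finite_zeros hh hh0)).union (Set.finite_singleton _),
    fun l hl => ?_⟩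
  · rw [hgξ, hhξ, mul_div_mul_left _ _ (pow_ne_zero _ he₁), hPR]
  · have hlξ : formAt l ξ ≠ 0 := C.formAt_ne q₀ l (hl q₀ (Or.inr rfl))
    refine ⟨hlξ, ?_, ?_, C.noZerosAtInfinity hg hlξ fun q hq => hl q (Or.inl (Or.inl hq)),
      C.noZerosAtInfinity hh hlξ fun q hq => hl q (Or.inl (Or.inr hq))⟩
    · rwa [mem_chartIdeal_iff_of_isHomogeneous hlξ hg]
    · rwa [mem_chartIdeal_iff_of_isHomogeneous hlξ hh]

lemma finite_support_ord (C : ProjCurve k ξ π ord) [IsAlgClosed F] {f : L} (hf : f ≠ 0) :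
    (Function.support fun q => ord q f).Finite := by
  obtain ⟨d, g, h, Z, hg, hh, rfl, hZ, H⟩ := C.exists_forms hf
  have hg0 : MvPolynomial.aeval ξ g ≠ 0 := fun h0 => hf (by rw [h0, zero_div])
  have hh0 : MvPolynomial.aeval ξ h ≠ 0 := fun h0 => hf (by rw [h0, div_zero])
  refine ((C.finite_zeros hg hg0).union (C.finite_zeros hh hh0)).subset fun q hq => ?_
  by_contra hcon
  rw [Set.mem_union, not_or] at hcon
  exact hq (C.ord_eq_zero_of_aeval_ne_zero hg hh hcon.1 hcon.2)

/-- Principal divisors have degree zero. -/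
theorem finsum_ord_eq_zero (C : ProjCurve k ξ π ord) [IsAlgClosed F] [Infinite k] {f : L} (hf : f ≠ 0) :
    ∑ᶠ q, ord q f = 0 := by
  obtain ⟨d, g, h, Z, hg, hh, rfl, hZ, H⟩ := C.exists_forms hf
  obtain ⟨l, hl⟩ := exists_form_ne_zero (k := k) hZ π fun q _ => C.exists_ne q
  obtain ⟨hlξ, hgI, hhI, hgi, hhi⟩ := H l hl
  have h1 := C.finsum_ord_smul hlξ hg hh hgI hhI hgi hhi (fun _ => (1 : ℤ)) (fun _ => 1)
    fun _ _ => rfl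
  simp only [smul_eq_mul, mul_one] at h1
  rw [h1, cycleOf_one F (C.isFiniteLength l hlξ g hgI), cycleOf_one F (C.isFiniteLength l hlξ h hhI),
    sub_eq_zero, Nat.cast_inj]
  let I := chartIdeal F l ξ
  let ψ := Ideal.Quotient.mkₐ F I
  have hψ : Function.Surjective ψ := Ideal.Quotient.mkₐ_surjective F I
  have hker : RingHom.ker ψ = I := Ideal.Quotient.mkₐ_ker F I
  have e : ∀ p : MvPolynomial ι F, Module.finrank F (MvPolynomial ι F ⧸ (I ⊔ Ideal.span {p})) =
      Module.finrank F ((MvPolynomial ι F ⧸ I) ⧸ Ideal.span {ψ p}) := by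
    intro p
    have : Ideal.span {ψ p} = (Ideal.span {p}).map (Ideal.Quotient.mkₐ F I) := by
      rw [Ideal.map_span, Set.image_singleton]
    rw [this]
    exact (DoubleQuot.quotQuotEquivQuotSupₐ F I (Ideal.span {p})).symm.toLinearEquiv.finrank_eq
  rw [e, e]
  refine finrank_quotient_eq (formPoly_isHomogeneous l) ?_ hψ hg ?_ (by rwa [hker]) hh ?_
    (by rwa [hker])
  · rw [← sub_eq_zero, ← map_one ψ, ← map_sub]
    refine Ideal.Quotient.eq_zero_iff_mem.mpr ?_
    rw [mem_chartIdeal, map_sub, aeval_formPoly, formAt_normAt, div_self hlξ, map_one, sub_self]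
  · exact fun h0 => hgI (Ideal.Quotient.eq_zero_iff_mem.mp h0)
  · exact fun h0 => hhI (Ideal.Quotient.eq_zero_iff_mem.mp h0)

end ProjCurve
end ProjCurve

end K3
end

noncomputable section
namespace K3

section ProjectiveSpace
open HomogeneousLocalization
variable {n : ℕ} {k : Type u} [Field k]

/-- The grading of the homogeneous coordinate ring of projective space. -/
abbrev homogGrading (n : ℕ) (k : Type u) [Field k] : ℕ → Submodule k (MvPolynomial (Fin (n + 1)) k) :=
  MvPolynomial.homogeneousSubmodule (Fin (n + 1)) k

attribute [local instance] MvPolynomial.gradedAlgebra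

lemma formPoly_mem (c : Fin (n + 1) → k) : formPoly k c ∈ homogGrading n k 1 :=
  formPoly_isHomogeneous c

/-- The fraction `c' / c` of linear forms. -/
def ratioAway (c c' : Fin (n + 1) → k) : Away (homogGrading n k) (formPoly k c) :=
  Away.mk _ (formPoly_mem c) 1 (formPoly k c') (by simpa using formPoly_mem c')

/-- Constants in the degree zero part of a localization of the homogeneous coordinate ring. -/
def constAway (c : Fin (n + 1) → k) : k →+* Away (homogGrading n k) (formPoly k c) :=
  (fromZeroRingHom (homogGrading n k) _).comp (algebraMap k (homogGrading n k 0))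

lemma val_constAway (c : Fin (n + 1) → k) (a : k) :
    (constAway c a).val = algebraMap (MvPolynomial (Fin (n + 1)) k) (Localization.Away (formPoly k c)) (MvPolynomial.C a) := by
  change Localization.mk _ _ = _
  rw [Localization.mk_eq_mk']
  exact (IsLocalization.mk'_one _ _)

lemma val_ratioAway (c c' : Fin (n + 1) → k) : (ratioAway c c').val =
    IsLocalization.mk' (Localization.Away (formPoly k c)) (formPoly k c')
      (⟨formPoly k c, 1, by simp⟩ : Submonoid.powers (formPoly k c)) := by
  rw [ratioAway, Away.val_mk, Localization.mk_eq_mk']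
  congr 2
  simp

lemma algebraMap_mul_ratioAway (c c' : Fin (n + 1) → k) :
    algebraMap _ (Localization.Away (formPoly k c)) (formPoly k c) * (ratioAway c c').val =
      algebraMap _ _ (formPoly k c') := by
  rw [val_ratioAway]
  exact IsLocalization.mk'_spec' _ _ (⟨formPoly k c, 1, by simp⟩ : Submonoid.powers (formPoly k c))

lemma away_ext_mul {c : Fin (n + 1) → k} {a b : Away (homogGrading n k) (formPoly k c)} (N : ℕ)
    (h : algebraMap _ (Localization.Away (formPoly k c)) (formPoly k c) ^ N * a.val =
      algebraMap _ (Localization.Away (formPoly k c)) (formPoly k c) ^ N * b.val) : a = b := by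
  apply HomogeneousLocalization.val_injective
  exact ((IsLocalization.Away.algebraMap_isUnit (formPoly k c)).pow N).mul_left_cancel h

lemma ratioAway_self (c : Fin (n + 1) → k) : ratioAway c c = 1 :=
  away_ext_mul 1 (by rw [pow_one, algebraMap_mul_ratioAway, val_one, mul_one])

lemma formPoly_eq_sum_single (c' : Fin (n + 1) → k) :
    formPoly k c' = ∑ i, MvPolynomial.C (c' i) * formPoly k (Pi.single i (1 : k)) := by
  simp [formPoly, Pi.single_apply, ite_mul]

lemma ratioAway_eq_sum (c c' : Fin (n + 1) → k) :
    ratioAway c c' = ∑ i, constAway c (c' i) * ratioAway c (Pi.single i 1) := by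
  refine away_ext_mul 1 ?_
  rw [pow_one, algebraMap_mul_ratioAway]
  have : (∑ i, constAway c (c' i) * ratioAway c (Pi.single i 1)).val =
      ∑ i, (constAway c (c' i)).val * (ratioAway c (Pi.single i 1)).val := by
    rw [← HomogeneousLocalization.algebraMap_apply, map_sum]
    exact Finset.sum_congr rfl fun i _ => by
      rw [map_mul]
      rfl
  rw [this, Finset.mul_sum, formPoly_eq_sum_single c', map_sum]
  refine Finset.sum_congr rfl fun i _ => ?_
  rw [val_constAway, map_mul, mul_left_comm, algebraMap_mul_ratioAway]

/-- The chart ring of projective space is generated by the ratios of the coordinates. -/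
lemma exists_eval₂_eq_of_away (c : Fin (n + 1) → k) (a : Away (homogGrading n k) (formPoly k c)) :
    ∃ p : MvPolynomial (Fin (n + 1)) k,
      p.eval₂ (constAway c) (fun i => ratioAway c (Pi.single i 1)) = a := by
  obtain ⟨N, p, hp, rfl⟩ := Away.mk_surjective (homogGrading n k) (formPoly_mem c) a
  refine ⟨p, away_ext_mul N ?_⟩
  rw [← HomogeneousLocalization.algebraMap_apply, MvPolynomial.hom_eval₂]
  have h1 : ((algebraMap (Away (homogGrading n k) (formPoly k c))
      (Localization.Away (formPoly k c))).comp (constAway c)) = algebraMap k _ := by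
    ext a
    rw [RingHom.comp_apply, HomogeneousLocalization.algebraMap_apply, val_constAway,
      IsScalarTower.algebraMap_apply k (MvPolynomial (Fin (n + 1)) k)]
    rfl
  have hp' : p.IsHomogeneous N := by
    simpa using (MvPolynomial.mem_homogeneousSubmodule _ _).mp hp
  have h2 := aeval_mul_of_isHomogeneous (E := Localization.Away (formPoly k c)) hp'
    (algebraMap _ (Localization.Away (formPoly k c)) (formPoly k c))
    (fun i => algebraMap _ _ (ratioAway c (Pi.single i 1)))
  rw [h1, ← MvPolynomial.aeval_def]
  refine h2.symm.trans ?_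
  rw [Away.val_mk, Localization.mk_eq_mk', ← map_pow]
  have h4 := IsLocalization.mk'_spec' (Localization.Away (formPoly k c)) p
    (⟨formPoly k c ^ N, N, rfl⟩ : Submonoid.powers (formPoly k c))
  refine Eq.trans ?_ h4.symm
  have h3 : (fun i : Fin (n + 1) => algebraMap _ (Localization.Away (formPoly k c)) (formPoly k c) *
      algebraMap _ (Localization.Away (formPoly k c)) (ratioAway c (Pi.single i 1))) =
      fun i => algebraMap (MvPolynomial (Fin (n + 1)) k) _ (MvPolynomial.X i) := by
    ext i
    rw [HomogeneousLocalization.algebraMap_apply, algebraMap_mul_ratioAway]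
    congr 1
    simp [formPoly, Pi.single_apply, ite_mul]
  rw [h3]
  refine (MvPolynomial.aeval_algebraMap_apply _ _ _).trans ?_
  simp

/-- The chart of projective space where the linear form `c` does not vanish. -/
def projChart (c : Fin (n + 1) → k) : (projectiveSpace n k).Opens :=
  Proj.basicOpen (homogGrading n k) (formPoly k c)

lemma isAffineOpen_projChart (c : Fin (n + 1) → k) : IsAffineOpen (projChart c) :=
  Proj.isAffineOpen_basicOpen _ _ (formPoly_mem c) Nat.one_pos

/-- The isomorphism of the chart ring with the degree zero part of the localization. -/
def awaySection (c : Fin (n + 1) → k) :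
    Away (homogGrading n k) (formPoly k c) →+* Γ(projectiveSpace n k, projChart c) :=
  (Proj.awayToSection (homogGrading n k) (formPoly k c)).hom

lemma awaySection_bijective (c : Fin (n + 1) → k) : Function.Bijective (awaySection c) := by
  have h := ConcreteCategory.bijective_of_isIso
    (Proj.basicOpenIsoAway (homogGrading n k) (formPoly k c) (formPoly_mem c) Nat.one_pos).hom
  rwa [Proj.basicOpenIsoAway_hom] at h

/-- The ratio `c' / c` of linear forms, as a function on the chart `c ≠ 0`. -/
def projRatio (c c' : Fin (n + 1) → k) : Γ(projectiveSpace n k, projChart c) :=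
  awaySection c (ratioAway c c')

lemma ι_projectiveSpaceToSpec (c : Fin (n + 1) → k) :
    (projChart c).ι ≫ projectiveSpaceToSpec n k =
      Proj.basicOpenToSpec (homogGrading n k) (formPoly k c) ≫
        Spec.map (CommRingCat.ofHom (constAway c)) := by
  have h := Proj.awayι_toSpecZero (homogGrading n k) (formPoly k c) (formPoly_mem c) Nat.one_pos
  rw [Proj.awayι, Category.assoc, Iso.inv_comp_eq, Proj.basicOpenIsoSpec_hom] at h
  rw [constAway, CommRingCat.ofHom_comp, Spec.map_comp, ← Category.assoc, ← h]
  rfl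

lemma awaySection_constAway (c : Fin (n + 1) → k) (a : k) :
    awaySection c (constAway c a) =
      ((constToPresheaf (projectiveSpaceToSpec n k)).app (op (projChart c))).hom a := by
  have h := congrArg Scheme.Hom.appTop (ι_projectiveSpaceToSpec c)
  rw [Scheme.Hom.comp_appTop, Scheme.Hom.comp_appTop] at h
  have h0 := Proj.basicOpenToSpec_app_top (homogGrading n k) (formPoly k c)
  have h1 : (Proj.basicOpenToSpec (homogGrading n k) (formPoly k c)).appTop =
    (Scheme.ΓSpecIso _).hom ≫ Proj.awayToSection _ _ ≫ (Proj.basicOpen _ _).topIso.inv := h0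
  rw [h1, Scheme.ΓSpecIso_naturality_assoc] at h
  have h2 : (constToPresheaf (projectiveSpaceToSpec n k)).app (op (projChart c)) =
      CommRingCat.ofHom (constAway c) ≫ CommRingCat.ofHom (awaySection c) := by
    change (Scheme.ΓSpecIso (.of k)).inv ≫ _ ≫ _ = _
    rw [Iso.inv_comp_eq]
    have h3 : (projectiveSpace n k).presheaf.map (homOfLE le_top : projChart c ⟶ ⊤).op =
        (projChart c).ι.appTop ≫ (projChart c).topIso.hom := by
      simp [← Functor.map_comp]
      rfl
    change _ ≫ (projectiveSpace n k).presheaf.map (homOfLE le_top : projChart c ⟶ ⊤).op = _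
    rw [h3, reassoc_of% h]
    change _ ≫ _ ≫ _ ≫ (projChart c).topIso.inv ≫ (projChart c).topIso.hom = _
    rw [Iso.inv_hom_id]
    rfl
  rw [h2]
  rfl

lemma mem_projChart (c : Fin (n + 1) → k) (z : projectiveSpace n k) :
    z ∈ projChart c ↔ formPoly k c ∉ ProjectiveSpectrum.asHomogeneousIdeal
      (𝒜 := homogGrading n k) z := Iff.rfl

/-- The homogeneous prime ideal of a point of projective space. -/
abbrev homogPrime (z : ProjectiveSpectrum (homogGrading n k)) : Ideal (MvPolynomial (Fin (n + 1)) k) :=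
  z.asHomogeneousIdeal.toIdeal

instance homogPrime_isPrime (z : projectiveSpace n k) :
    (homogPrime (n := n) (k := k) z).IsPrime :=
  ProjectiveSpectrum.isPrime (𝒜 := homogGrading n k) z

/-- The stalk of projective space is contained in the localization of the polynomial ring. -/
def stalkVal (z : projectiveSpace n k) : (projectiveSpace n k).presheaf.stalk z →+*
    Localization.AtPrime (homogPrime (n := n) (k := k) z) :=
  (algebraMap (HomogeneousLocalization.AtPrime (homogGrading n k)
    (homogPrime (n := n) (k := k) z)) _).comp
    (Proj.stalkIso (homogGrading n k) z).hom.hom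

lemma stalkVal_injective (z : projectiveSpace n k) : Function.Injective (stalkVal z) := by
  intro a b h
  apply (ConcreteCategory.bijective_of_isIso (Proj.stalkIso (homogGrading n k) z).hom).1
  exact HomogeneousLocalization.val_injective _ h

lemma isUnit_stalkVal_iff (z : projectiveSpace n k) (a : (projectiveSpace n k).presheaf.stalk z) :
    IsUnit (stalkVal z a) ↔ IsUnit a := by
  change IsUnit (HomogeneousLocalization.val _) ↔ _
  rw [HomogeneousLocalization.isUnit_iff_isUnit_val]
  exact MulEquiv.isUnit_map (Proj.stalkIso (homogGrading n k) z).commRingCatIsoToRingEquiv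

lemma stalkVal_germ_projRatio (z : projectiveSpace n k) (c c' : Fin (n + 1) → k)
    (hz : z ∈ projChart c) :
    stalkVal z ((projectiveSpace n k).presheaf.germ (projChart c) z hz (projRatio c c')) =
      IsLocalization.mk' _ (formPoly k c') (⟨formPoly k c, hz⟩ :
        (homogPrime (n := n) (k := k) z).primeCompl) := by
  have h := ProjectiveSpectrum.Proj.awayToSection_apply (homogGrading n k) (formPoly k c)
    (ratioAway c c') ⟨z, hz⟩
  have h1 : (Proj.stalkIso (homogGrading n k) z).hom.hom
      ((projectiveSpace n k).presheaf.germ (projChart c) z hz (projRatio c c')) =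
      ((ProjectiveSpectrum.Proj.awayToSection (homogGrading n k) (formPoly k c)).1
        (ratioAway c c')).val ⟨z, hz⟩ := Proj.stalkIso'_germ _ _ _ _ _
  change HomogeneousLocalization.val _ = _
  refine (congrArg HomogeneousLocalization.val h1).trans ?_
  rw [h, val_ratioAway, IsLocalization.map_mk']
  rfl

lemma isUnit_germ_projRatio_iff (z : projectiveSpace n k) (c c' : Fin (n + 1) → k)
    (hz : z ∈ projChart c) :
    IsUnit ((projectiveSpace n k).presheaf.germ (projChart c) z hz (projRatio c c')) ↔
      z ∈ projChart c' := by
  rw [← isUnit_stalkVal_iff, stalkVal_germ_projRatio,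
    IsLocalization.AtPrime.isUnit_mk'_iff _ (homogPrime (n := n) (k := k) z)]
  rfl

lemma germ_projRatio_mul (z : projectiveSpace n k) (c c' c'' : Fin (n + 1) → k)
    (hz : z ∈ projChart c) (hz' : z ∈ projChart c') :
    (projectiveSpace n k).presheaf.germ (projChart c) z hz (projRatio c c') *
      (projectiveSpace n k).presheaf.germ (projChart c') z hz' (projRatio c' c'') =
      (projectiveSpace n k).presheaf.germ (projChart c) z hz (projRatio c c'') := by
  apply stalkVal_injective
  rw [map_mul, stalkVal_germ_projRatio, stalkVal_germ_projRatio, stalkVal_germ_projRatio,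
    ← IsLocalization.mk'_mul, IsLocalization.mk'_eq_iff_eq]
  congr 1
  simp only [Submonoid.coe_mul]
  ring

lemma exists_mem_projChart (z : projectiveSpace n k) :
    ∃ i, z ∈ projChart (Pi.single i (1 : k)) := by
  by_contra! h
  refine ProjectiveSpectrum.not_irrelevant_le (𝒜 := homogGrading n k) z fun p hp => ?_
  have h1 : ∀ i, MvPolynomial.X i ∈ ProjectiveSpectrum.asHomogeneousIdeal
      (𝒜 := homogGrading n k) z := by
    intro i
    have := not_not.mp ((mem_projChart _ _).not.mp (h i))
    simpa [formPoly, Pi.single_apply, ite_mul] using this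
  have h2 : MvPolynomial.constantCoeff p = 0 := by
    have h3 := (HomogeneousIdeal.mem_irrelevant_iff _ _).mp hp
    have h4 : MvPolynomial.homogeneousComponent 0 p = 0 := by
      rw [← MvPolynomial.decomposition.decompose'_apply]
      exact h3
    rw [MvPolynomial.homogeneousComponent_zero] at h4
    rw [MvPolynomial.constantCoeff_eq]
    simpa using h4
  refine pointIdeal_le (p := (0 : Fin (n + 1) → k)) (I := homogPrime (n := n) (k := k) z)
    (fun i => by simpa using h1 i) ?_
  rw [mem_pointIdeal]
  rw [← h2, MvPolynomial.eval_zero]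

end ProjectiveSpace

end K3
end

noncomputable section
namespace K3

section Constants
variable {F : Type u} [Field F] {Y : Scheme.{u}} (t : Y ⟶ Spec (.of F))

/-- The constants in the ring of sections over an open set. -/
def sectionConst (U : Y.Opens) : F →+* Γ(Y, U) := ((constToPresheaf t).app (op U)).hom

/-- The constants in the local ring at a point. -/
def stalkConst (y : Y) : F →+* Y.presheaf.stalk y :=
  (Y.presheaf.germ ⊤ y trivial).hom.comp (sectionConst t ⊤)

lemma map_sectionConst {U V : Y.Opens} (h : V ≤ U) (a : F) :
    Y.presheaf.map (homOfLE h).op (sectionConst t U a) = sectionConst t V a :=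
  (ConcreteCategory.congr_hom ((constToPresheaf t).naturality (homOfLE h).op) a).symm

@[simp]
lemma germ_sectionConst (U : Y.Opens) (y : Y) (hy : y ∈ U) (a : F) :
    Y.presheaf.germ U y hy (sectionConst t U a) = stalkConst t y a := by
  rw [← map_sectionConst t (le_top : U ≤ ⊤)]
  exact Y.presheaf.germ_res_apply (homOfLE le_top) y hy _

lemma app_sectionConst {W : Scheme.{u}} (f : W ⟶ Y) (U : Y.Opens) (a : F) :
    f.app U (sectionConst t U a) = sectionConst (f ≫ t) (f ⁻¹ᵁ U) a := by
  have h : (constToPresheaf t).app (op U) ≫ f.app U = (constToPresheaf (f ≫ t)).app (op (f ⁻¹ᵁ U)) := by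
    change ((Scheme.ΓSpecIso (.of F)).inv ≫ t.appTop ≫ Y.presheaf.map _) ≫ f.app U =
      (Scheme.ΓSpecIso (.of F)).inv ≫ (f ≫ t).appTop ≫ _
    rw [Scheme.Hom.comp_appTop, Category.assoc, Category.assoc, Category.assoc]
    congr 2
    exact f.naturality _
  exact ConcreteCategory.congr_hom h a

lemma stalkMap_stalkConst {W : Scheme.{u}} (f : W ⟶ Y) (w : W) (a : F) :
    f.stalkMap w (stalkConst t (f w) a) = stalkConst (f ≫ t) w a := by
  rw [← germ_sectionConst t ⊤ (f w) (Opens.mem_top _), Scheme.Hom.germ_stalkMap_apply,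
    app_sectionConst]
  exact germ_sectionConst (f ≫ t) _ w (Opens.mem_top _) a

lemma sectionConst_comp_map {k : Type u} [Field k] [Algebra k F] (U : Y.Opens) (a : k) :
    sectionConst (t ≫ Spec.map (CommRingCat.ofHom (algebraMap k F))) U a =
      sectionConst t U (algebraMap k F a) := by
  have h : (constToPresheaf (t ≫ Spec.map (CommRingCat.ofHom (algebraMap k F)))).app (op U) =
      CommRingCat.ofHom (algebraMap k F) ≫ (constToPresheaf t).app (op U) := by
    change (Scheme.ΓSpecIso (.of k)).inv ≫ _ ≫ _ = _ ≫ (Scheme.ΓSpecIso (.of F)).inv ≫ t.appTop ≫ _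
    rw [Scheme.Hom.comp_appTop, Category.assoc, ← Scheme.ΓSpecIso_inv_naturality_assoc]
  exact ConcreteCategory.congr_hom h a

lemma stalkConst_comp_map {k : Type u} [Field k] [Algebra k F] (y : Y) (a : k) :
    stalkConst (t ≫ Spec.map (CommRingCat.ofHom (algebraMap k F))) y a =
      stalkConst t y (algebraMap k F a) := by
  rw [← germ_sectionConst _ ⊤ y (Opens.mem_top _), sectionConst_comp_map, germ_sectionConst]

theorem finiteType_sectionConst [LocallyOfFiniteType t] {V : Y.Opens} (hV : IsAffineOpen V) :
    (sectionConst t V).FiniteType := by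
  have h := LocallyOfFiniteType.finiteType_appLE t (isAffineOpen_top (Spec (.of F))) hV le_top
  have h2 := h.comp (RingHom.FiniteType.of_surjective (Scheme.ΓSpecIso (.of F)).inv.hom
    (ConcreteCategory.bijective_of_isIso _).2)
  exact h2

/-- The residue field of a closed point is the ground field. -/
theorem exists_residue [IsAlgClosed F] [LocallyOfFiniteType t] {y : Y} (hy : IsClosed {y}) :
    ∃ κ : Y.presheaf.stalk y →+* F, IsLocalHom κ ∧ ∀ a, κ (stalkConst t y a) = a := by
  obtain ⟨_, ⟨V, hV, rfl⟩, hyV, -⟩ := Y.isBasis_affineOpens.exists_subset_of_mem_open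
    (Set.mem_univ y) isOpen_univ
  let _ : Algebra F Γ(Y, V) := (sectionConst t V).toAlgebra
  have : Algebra.FiniteType F Γ(Y, V) := finiteType_sectionConst t hV
  let m := (hV.primeIdealOf ⟨y, hyV⟩).asIdeal
  have : m.IsMaximal := isMaximal_primeIdealOf hV hyV hy
  obtain ⟨ε, hε⟩ := exists_algHom_ker_eq (F := F) m
  let _ : Algebra Γ(Y, V) (Y.presheaf.stalk y) := (Y.presheaf.germ V y hyV).hom.toAlgebra
  have hloc : IsLocalization.AtPrime (Y.presheaf.stalk y) m := hV.isLocalization_stalk ⟨y, hyV⟩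
  have hu : ∀ b : m.primeCompl, IsUnit ((ε : Γ(Y, V) →+* F) b) := by
    intro b
    rw [isUnit_iff_ne_zero]
    intro h
    exact b.2 (hε.le h)
  refine ⟨IsLocalization.lift hu, ⟨fun a ha => ?_⟩, fun a => ?_⟩
  · obtain ⟨b, s, rfl⟩ := IsLocalization.exists_mk'_eq m.primeCompl a
    rw [IsLocalization.AtPrime.isUnit_mk'_iff _ m]
    intro hb
    rw [← hε] at hb
    rw [IsLocalization.lift_mk'] at ha
    have hb' : (ε : Γ(Y, V) →+* F) b = 0 := hb
    rw [hb', zero_mul] at ha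
    exact not_isUnit_zero ha
  · rw [← germ_sectionConst t V y hyV]
    exact (IsLocalization.lift_eq hu _).trans (ε.commutes a)

end Constants

section Coordinates
variable {n : ℕ} {k : Type u} [Field k]

attribute [local instance] MvPolynomial.gradedAlgebra

lemma projRatio_self (c : Fin (n + 1) → k) : projRatio c c = 1 := by
  rw [projRatio, ratioAway_self, map_one]

lemma projRatio_eq_sum (c c' : Fin (n + 1) → k) : projRatio c c' =
    ∑ i, sectionConst (projectiveSpaceToSpec n k) (projChart c) (c' i) * projRatio c (Pi.single i 1) := by
  rw [projRatio, ratioAway_eq_sum, map_sum]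
  refine Finset.sum_congr rfl fun i _ => ?_
  rw [map_mul, awaySection_constAway]
  rfl

/-- Homogeneous coordinates of a point of projective space with values in a field. -/
theorem exists_homogeneousCoords (z : projectiveSpace n k) {E : Type*} [Field E] [Algebra k E]
    (χ : (projectiveSpace n k).presheaf.stalk z →+* E) [IsLocalHom χ]
    (hχ : ∀ a, χ (stalkConst (projectiveSpaceToSpec n k) z a) = algebraMap k E a) :
    ∃ π : Fin (n + 1) → E, (∃ j, π j ≠ 0) ∧ ∀ c : Fin (n + 1) → k,
      (z ∈ projChart c ↔ formAt c π ≠ 0) ∧ ∀ (hz : z ∈ projChart c) (c' : Fin (n + 1) → k),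
        χ ((projectiveSpace n k).presheaf.germ (projChart c) z hz (projRatio c c')) =
          formAt c' π / formAt c π := by
  obtain ⟨i, hi⟩ := exists_mem_projChart z
  let π : Fin (n + 1) → E := fun j =>
    χ ((projectiveSpace n k).presheaf.germ _ z hi (projRatio (Pi.single i 1) (Pi.single j 1)))
  have hπ : ∀ c : Fin (n + 1) → k, formAt c π =
      χ ((projectiveSpace n k).presheaf.germ _ z hi (projRatio (Pi.single i 1) c)) := by
    intro c
    rw [projRatio_eq_sum, map_sum, map_sum]
    refine Finset.sum_congr rfl fun j _ => ?_
    rw [map_mul, map_mul, germ_sectionConst, hχ]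
  have hmem : ∀ c : Fin (n + 1) → k, z ∈ projChart c ↔ formAt c π ≠ 0 := by
    intro c
    rw [hπ, ← isUnit_iff_ne_zero, isUnit_map_iff, isUnit_germ_projRatio_iff]
  refine ⟨π, ⟨i, ?_⟩, fun c => ⟨hmem c, fun hz c' => ?_⟩⟩
  · simp [π, projRatio_self]
  · rw [eq_div_iff ((hmem c).mp hz), hπ, hπ, mul_comm, ← map_mul, germ_projRatio_mul]

end Coordinates

section ChartMap
attribute [local instance] MvPolynomial.gradedAlgebra
variable {n : ℕ} {k F : Type u} [Field k] [Field F] {Y : Scheme.{u}}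
  (t : Y ⟶ Spec (.of F)) (q : Y ⟶ projectiveSpace n k)

/-- Polynomials as functions on the chart of `Y` where the linear form `c` does not vanish, by means
of the affine coordinates `xᵢ / c`. -/
def chartMap (c : Fin (n + 1) → k) : MvPolynomial (Fin (n + 1)) F →+* Γ(Y, q ⁻¹ᵁ projChart c) :=
  MvPolynomial.eval₂Hom (sectionConst t _) fun i => q.app (projChart c) (projRatio c (Pi.single i 1))

variable [Algebra k F]

/-- `q` describes `Y`, a scheme over `F`, as a closed subscheme of projective space over `F`: the
charts are affine, with coordinate rings generated by the affine coordinates. -/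
structure IsChartModel : Prop where
  comp : q ≫ projectiveSpaceToSpec n k = t ≫ Spec.map (CommRingCat.ofHom (algebraMap k F))
  isAffineOpen : ∀ c, IsAffineOpen (q ⁻¹ᵁ projChart c)
  surjective : ∀ c, Function.Surjective (chartMap t q c)

variable {t q}

lemma app_chartMap {W : Scheme.{u}} (i : W ⟶ Y) (c : Fin (n + 1) → k) (P : MvPolynomial (Fin (n + 1)) F) :
    i.app (q ⁻¹ᵁ projChart c) (chartMap t q c P) = chartMap (i ≫ t) (i ≫ q) c P := by
  have h : (i.app (q ⁻¹ᵁ projChart c)).hom.comp (chartMap t q c) = chartMap (i ≫ t) (i ≫ q) c := by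
    refine MvPolynomial.ringHom_ext (fun a => ?_) fun j => ?_
    · refine Eq.trans ?_ (MvPolynomial.eval₂Hom_C _ _ a).symm
      simp only [chartMap, RingHom.comp_apply, MvPolynomial.eval₂Hom_C]
      exact app_sectionConst t i _ a
    · refine Eq.trans ?_ (MvPolynomial.eval₂Hom_X' _ _ j).symm
      simp only [chartMap, RingHom.comp_apply, MvPolynomial.eval₂Hom_X']
      rw [Scheme.Hom.comp_app]
      rfl
  exact congrArg (fun f => f P) h

theorem IsChartModel.of_closedImmersion (h : IsChartModel t q) {W : Scheme.{u}} (i : W ⟶ Y)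
    [IsClosedImmersion i] : IsChartModel (i ≫ t) (i ≫ q) where
  comp := by rw [Category.assoc, h.comp, Category.assoc]
  isAffineOpen c := (h.isAffineOpen c).preimage i
  surjective c := by
    intro a
    obtain ⟨b, hb⟩ := i.app_surjective _ (h.isAffineOpen c) a
    obtain ⟨P, rfl⟩ := h.surjective c b
    exact ⟨P, by rw [← app_chartMap]; exact hb⟩

theorem isChartModel_projectiveSpace :
    IsChartModel (k := k) (projectiveSpaceToSpec n k) (𝟙 (projectiveSpace n k)) where
  comp := by
    rw [Category.id_comp]
    have : CommRingCat.ofHom (algebraMap k k) = 𝟙 (CommRingCat.of k) := rfl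
    rw [this, Spec.map_id, Category.comp_id]
  isAffineOpen c := isAffineOpen_projChart c
  surjective c a := by
    obtain ⟨b, rfl⟩ := (awaySection_bijective c).2 a
    obtain ⟨p, rfl⟩ := exists_eval₂_eq_of_away c b
    refine ⟨p, ?_⟩
    rw [MvPolynomial.hom_eval₂]
    have : (awaySection c).comp (constAway c) = sectionConst (projectiveSpaceToSpec n k) (projChart c) :=
      RingHom.ext fun a => awaySection_constAway c a
    rw [this]
    rfl

theorem surjective_of_isPushout {A B C P R : CommRingCat.{u}} {f : A ⟶ B} {g : A ⟶ C} {f' : B ⟶ P}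
    {g' : C ⟶ P} (h : IsPushout f g f' g') (ρ : R ⟶ P) (hB : ∀ b, f' b ∈ ρ.hom.range)
    (hC : ∀ c, g' c ∈ ρ.hom.range) : Function.Surjective ρ := by
  let b : B ⟶ CommRingCat.of ρ.hom.range := CommRingCat.ofHom (f'.hom.codRestrict _ hB)
  let c : C ⟶ CommRingCat.of ρ.hom.range := CommRingCat.ofHom (g'.hom.codRestrict _ hC)
  let j : CommRingCat.of ρ.hom.range ⟶ P := CommRingCat.ofHom ρ.hom.range.subtype
  have hbc : f ≫ b = g ≫ c := by
    have h1 : ∀ a, (⟨f' (f a), hB _⟩ : ρ.hom.range) = ⟨g' (g a), hC _⟩ :=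
      fun a => Subtype.ext (ConcreteCategory.congr_hom h.w a)
    exact CommRingCat.hom_ext (RingHom.ext h1)
  have hd : h.desc b c hbc ≫ j = 𝟙 P := by
    apply h.hom_ext
    · rw [h.inl_desc_assoc]
      rfl
    · rw [h.inr_desc_assoc]
      rfl
  intro p
  have h1 : (h.desc b c hbc p : P) = p := ConcreteCategory.congr_hom hd p
  rw [← h1]
  exact (h.desc b c hbc p).2

theorem exists_ringHom_of_isPushout {A B C P : CommRingCat.{u}} {f : A ⟶ B} {g : A ⟶ C} {f' : B ⟶ P}
    {g' : C ⟶ P} (h : IsPushout f g f' g') {E : Type u} [CommRing E] (β : B →+* E) (γ : C →+* E)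
    (hw : ∀ a, β (f a) = γ (g a)) :
    ∃ d : P →+* E, (∀ b, d (f' b) = β b) ∧ ∀ c, d (g' c) = γ c := by
  have hw' : f ≫ CommRingCat.ofHom β = g ≫ CommRingCat.ofHom γ := by
    ext a
    exact hw a
  exact ⟨(h.desc _ _ hw').hom, ConcreteCategory.congr_hom (h.inl_desc _ _ hw'),
    ConcreteCategory.congr_hom (h.inr_desc _ _ hw')⟩

section BaseChange
variable {X : Scheme.{u}} {s : X ⟶ Spec (.of k)} {i : X ⟶ projectiveSpace n k}

lemma chartMap_map (c : Fin (n + 1) → k) (P : MvPolynomial (Fin (n + 1)) k) :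
    chartMap (pullback.snd s (Spec.map (CommRingCat.ofHom (algebraMap k F)))) (baseChangeProj F s ≫ i) c
      (MvPolynomial.map (algebraMap k F) P) = (baseChangeProj F s).app _ (chartMap s i c P) := by
  refine Eq.trans ?_ (app_chartMap (baseChangeProj F s) c P).symm
  rw [chartMap, MvPolynomial.coe_eval₂Hom, MvPolynomial.eval₂_map, chartMap, MvPolynomial.coe_eval₂Hom]
  congr 1
  ext a
  rw [pullback.condition]
  exact (sectionConst_comp_map _ _ a).symm

lemma isPushout_chart (h : IsChartModel (k := k) s i) (c : Fin (n + 1) → k) :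
    IsPushout (s.appLE ⊤ (i ⁻¹ᵁ projChart c) le_top)
      ((Spec.map (CommRingCat.ofHom (algebraMap k F))).appLE ⊤ ⊤ le_top)
      ((baseChangeProj F s).appLE (i ⁻¹ᵁ projChart c) (baseChangeProj F s ⁻¹ᵁ i ⁻¹ᵁ projChart c) le_rfl)
      ((pullback.snd s (Spec.map (CommRingCat.ofHom (algebraMap k F)))).appLE ⊤
        (baseChangeProj F s ⁻¹ᵁ i ⁻¹ᵁ projChart c) le_top) := by
  have H : IsPullback (baseChangeProj F s) (pullback.snd s (Spec.map (CommRingCat.ofHom (algebraMap k F))))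
    s (Spec.map (CommRingCat.ofHom (algebraMap k F))) := .of_hasPullback _ _
  exact (isIso_pushoutSection_iff H (US := ⊤) (UT := ⊤) (UX := i ⁻¹ᵁ projChart c) le_top le_top
      (UY := baseChangeProj F s ⁻¹ᵁ i ⁻¹ᵁ projChart c) (by simp)).mp
      (isIso_pushoutSection_of_isAffineOpen H _ _ _ (isAffineOpen_top _) (isAffineOpen_top _)
        (h.isAffineOpen c))

/-- The chart rings of a base change. -/
theorem IsChartModel.baseChange (h : IsChartModel (k := k) s i) :
    IsChartModel (pullback.snd s (Spec.map (CommRingCat.ofHom (algebraMap k F))))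
      (baseChangeProj F s ≫ i) where
  comp := by
    have h1 := h.comp
    have : CommRingCat.ofHom (algebraMap k k) = 𝟙 (CommRingCat.of k) := rfl
    rw [this, Spec.map_id, Category.comp_id] at h1
    rw [Category.assoc, h1, pullback.condition]
  isAffineOpen c := by
    have : IsAffineHom (baseChangeProj F s) :=
      MorphismProperty.IsStableUnderBaseChange.of_isPullback (P := @IsAffineHom)
        (IsPullback.of_hasPullback s (Spec.map (CommRingCat.ofHom (algebraMap k F)))).flip inferInstance
    exact (h.isAffineOpen c).preimage (baseChangeProj F s)
  surjective c := by
    refine surjective_of_isPushout (isPushout_chart h c) (CommRingCat.ofHom (chartMap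
      (pullback.snd s (Spec.map (CommRingCat.ofHom (algebraMap k F)))) (baseChangeProj F s ≫ i) c))
      (fun b => ?_) fun a => ?_
    · obtain ⟨P, rfl⟩ := h.surjective c b
      refine ⟨MvPolynomial.map (algebraMap k F) P, ?_⟩
      rw [← Scheme.Hom.app_eq_appLE]
      exact chartMap_map c P
    · obtain ⟨b, rfl⟩ := (ConcreteCategory.bijective_of_isIso (Scheme.ΓSpecIso (.of F)).inv).2 a
      exact ⟨MvPolynomial.C b, MvPolynomial.eval₂Hom_C _ _ b⟩

/-- A point with values in `F` which satisfies the equations of a chart satisfies those of the chart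
of the base change. -/
theorem IsChartModel.ker_chartMap_baseChange_le (h : IsChartModel (k := k) s i) {c : Fin (n + 1) → k}
    {p : Fin (n + 1) → F} (hp : ∀ P ∈ RingHom.ker (chartMap s i c), MvPolynomial.aeval p P = 0) :
    RingHom.ker (chartMap (pullback.snd s (Spec.map (CommRingCat.ofHom (algebraMap k F))))
      (baseChangeProj F s ≫ i) c) ≤ (pointIdeal p).asIdeal := by
  let e : Γ(X, i ⁻¹ᵁ projChart c) →+* F :=
    RingHom.liftOfSurjective (chartMap s i c) (h.surjective c)
      ⟨(MvPolynomial.aeval p : MvPolynomial (Fin (n + 1)) k →ₐ[k] F).toRingHom, hp⟩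
  have he : ∀ P, e (chartMap s i c P) = MvPolynomial.aeval p P := fun P =>
    RingHom.liftOfRightInverse_comp_apply _ _ _ _ P
  obtain ⟨d, hd1, hd2⟩ := exists_ringHom_of_isPushout (isPushout_chart (F := F) h c) e
    (Scheme.ΓSpecIso (.of F)).hom.hom fun a => by
      obtain ⟨a, rfl⟩ := (ConcreteCategory.bijective_of_isIso (Scheme.ΓSpecIso (.of k)).inv).2 a
      have h1 := he (MvPolynomial.C a)
      rw [MvPolynomial.aeval_C, chartMap, MvPolynomial.eval₂Hom_C] at h1
      have h2 : (Scheme.ΓSpecIso (.of k)).inv ≫ (Spec.map (CommRingCat.ofHom (algebraMap k F))).appTop ≫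
          (Scheme.ΓSpecIso (.of F)).hom = CommRingCat.ofHom (algebraMap k F) := by
        rw [Scheme.ΓSpecIso_naturality, Iso.inv_hom_id_assoc]
      refine h1.trans ((ConcreteCategory.congr_hom h2 a).symm.trans ?_)
      rw [Scheme.Hom.appTop, Scheme.Hom.app_eq_appLE]
      rfl
  have hd : d.comp (chartMap (pullback.snd s (Spec.map (CommRingCat.ofHom (algebraMap k F))))
      (baseChangeProj F s ≫ i) c) = MvPolynomial.eval p := by
    refine MvPolynomial.ringHom_ext (fun a => ?_) fun j => ?_
    · have h1 := hd2 ((Scheme.ΓSpecIso (.of F)).inv a)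
      rw [MvPolynomial.eval_C]
      refine Eq.trans ?_ (h1.trans (ConcreteCategory.congr_hom (Scheme.ΓSpecIso (.of F)).inv_hom_id a))
      refine congrArg d ?_
      exact MvPolynomial.eval₂Hom_C _ _ a
    · have h1 := hd1 (chartMap s i c (MvPolynomial.X j))
      rw [he, MvPolynomial.aeval_X, ← Scheme.Hom.app_eq_appLE] at h1
      rw [MvPolynomial.eval_X, ← h1]
      refine congrArg d ?_
      refine Eq.trans ?_ (chartMap_map (F := F) c (MvPolynomial.X j))
      exact congrArg (chartMap _ _ c) (MvPolynomial.map_X _ j).symm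
  intro P hP
  rw [mem_pointIdeal, ← hd]
  exact (congrArg d (RingHom.mem_ker.mp hP)).trans (map_zero d)

end BaseChange

theorem IsChartModel.exists_coords (h : IsChartModel t q) (y : Y) {E : Type*} [Field E] [Algebra F E]
    [Algebra k E] [IsScalarTower k F E] (χ : Y.presheaf.stalk y →+* E) [IsLocalHom χ]
    (hχ : ∀ a, χ (stalkConst t y a) = algebraMap F E a) :
    ∃ π : Fin (n + 1) → E, (∃ j, π j ≠ 0) ∧ ∀ c : Fin (n + 1) → k,
      (y ∈ q ⁻¹ᵁ projChart c ↔ formAt c π ≠ 0) ∧ ∀ (hy : y ∈ q ⁻¹ᵁ projChart c) P,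
        χ (Y.presheaf.germ _ y hy (chartMap t q c P)) = MvPolynomial.aeval (normAt c π) P := by
  obtain ⟨π, hπ, hc⟩ := exists_homogeneousCoords (q y) (χ.comp (q.stalkMap y).hom) (E := E) (fun a => by
    refine (congrArg χ (stalkMap_stalkConst _ q y a)).trans ?_
    rw [h.comp, stalkConst_comp_map, hχ, ← IsScalarTower.algebraMap_apply])
  refine ⟨π, hπ, fun c => ⟨(hc c).1, fun hy P => ?_⟩⟩
  have h1 : (χ.comp (Y.presheaf.germ _ y hy).hom).comp (chartMap t q c) =
      (MvPolynomial.aeval (normAt c π) : MvPolynomial (Fin (n + 1)) F →ₐ[F] E).toRingHom := by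
    refine MvPolynomial.ringHom_ext (fun a => ?_) fun j => ?_
    · simp only [chartMap, RingHom.comp_apply, MvPolynomial.eval₂Hom_C, AlgHom.toRingHom_eq_coe,
        RingHom.coe_coe, MvPolynomial.aeval_C]
      exact (congrArg χ (germ_sectionConst t _ y hy a)).trans (hχ a)
    · simp only [chartMap, RingHom.comp_apply, MvPolynomial.eval₂Hom_X', AlgHom.toRingHom_eq_coe,
        RingHom.coe_coe, MvPolynomial.aeval_X]
      have h2 := (hc c).2 hy (Pi.single j 1)
      rw [formAt_single] at h2
      refine Eq.trans ?_ h2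
      exact congrArg χ (Scheme.Hom.germ_stalkMap_apply q (projChart c) y hy _).symm
  exact congrArg (fun f => f P) h1

variable (t q) in
/-- `π` are homogeneous coordinates of the closed point `y`. -/
structure IsPointCoords (y : Y) (π : Fin (n + 1) → F) : Prop where
  exists_ne : ∃ j, π j ≠ 0
  mem_iff : ∀ c : Fin (n + 1) → k, y ∈ q ⁻¹ᵁ projChart c ↔ formAt c π ≠ 0
  isUnit_iff : ∀ (c : Fin (n + 1) → k) (hy : y ∈ q ⁻¹ᵁ projChart c) (P : MvPolynomial (Fin (n + 1)) F),
    IsUnit (Y.presheaf.germ _ y hy (chartMap t q c P)) ↔ MvPolynomial.eval (normAt c π) P ≠ 0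

theorem IsChartModel.exists_isPointCoords (h : IsChartModel t q) [IsAlgClosed F] [LocallyOfFiniteType t]
    {y : Y} (hy : IsClosed {y}) : ∃ π, IsPointCoords t q y π := by
  obtain ⟨κ, hκ, hκ'⟩ := exists_residue t hy
  obtain ⟨π, hπ, hc⟩ := h.exists_coords y κ hκ'
  refine ⟨π, hπ, fun c => (hc c).1, fun c hy P => ?_⟩
  rw [← isUnit_map_iff κ, (hc c).2 hy P, isUnit_iff_ne_zero]
  rfl

theorem IsPointCoords.of_comp {W : Scheme.{u}} (i : W ⟶ Y) {w : W} {π : Fin (n + 1) → F}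
    (h : IsPointCoords t q (i w) π) : IsPointCoords (i ≫ t) (i ≫ q) w π where
  exists_ne := h.exists_ne
  mem_iff := h.mem_iff
  isUnit_iff c hy P := by
    rw [← h.isUnit_iff c hy P, ← isUnit_map_iff (i.stalkMap w).hom]
    refine iff_of_eq (congrArg IsUnit ?_)
    refine Eq.trans ?_ (Scheme.Hom.germ_stalkMap_apply i (q ⁻¹ᵁ projChart c) w hy _).symm
    rw [app_chartMap]
    rfl

end ChartMap

end K3
end

noncomputable section
namespace K3

section LocalLength
variable {S A O : Type*} [CommRing S] [CommRing A] [CommRing O] [Algebra S A] [Algebra A O]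
  [Algebra S O] [IsScalarTower S A O]

lemma isFiniteLength_of_surjective_algebraMap (hS : Function.Surjective (algebraMap S A)) {M : Type*}
    [AddCommGroup M] [Module A M] [Module S M] [IsScalarTower S A M] (h : IsFiniteLength A M) :
    IsFiniteLength S M := by
  rw [← Module.length_ne_top_iff] at h ⊢
  rwa [Module.length_eq_of_surjective hS]

lemma isFiniteLength_quotient_of_comap (hS : Function.Surjective (algebraMap S A)) {J : Ideal S} {I : Ideal A}
    (hJ : J = I.comap (algebraMap S A)) (h : IsFiniteLength A (A ⧸ I)) : IsFiniteLength S (S ⧸ J) := by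
  let f : S ⧸ J →ₗ[S] A ⧸ I := J.liftQ ((Ideal.Quotient.mkₐ S I).toLinearMap ∘ₗ Algebra.linearMap S A)
    (fun x hx => by
      rw [hJ] at hx
      exact Ideal.Quotient.eq_zero_iff_mem.mpr hx)
  refine (isFiniteLength_of_surjective_algebraMap hS h).of_injective (f := f) ?_
  rw [← LinearMap.ker_eq_bot]
  refine Submodule.ker_liftQ_eq_bot _ _ _ fun x hx => ?_
  rw [hJ]
  exact (Ideal.Quotient.eq_zero_iff_mem (I := I)).mp (LinearMap.mem_ker.mp hx)

/-- The multiplicity of a quotient as the length over a local ring. -/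
theorem multAt_quotient_eq_length [IsDomain A] (hS : Function.Surjective (algebraMap S A)) {p : Ideal A}
    [p.IsPrime] [IsLocalization.AtPrime O p] {m : MaximalSpectrum S}
    (hm : m.asIdeal = p.comap (algebraMap S A)) {J : Ideal S} {a : A}
    (hJ : J = (Ideal.span {a}).comap (algebraMap S A)) (hfin : IsFiniteLength S (S ⧸ J)) :
    multAt m (S ⧸ J) = (Module.length O (O ⧸ Ideal.span {algebraMap A O a})).toNat := by
  let B := O ⧸ Ideal.span {algebraMap A O a}
  let g : S →ₗ[S] B :=
    (Ideal.Quotient.mkₐ S (Ideal.span {algebraMap A O a})).toLinearMap ∘ₗ Algebra.linearMap S O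
  have hg : ∀ x, g x = Ideal.Quotient.mk _ (algebraMap A O (algebraMap S A x)) := fun x =>
    congrArg (Ideal.Quotient.mk _) (IsScalarTower.algebraMap_apply S A O x)
  have hJg : J ≤ LinearMap.ker g := by
    intro x hx
    rw [hJ, Ideal.mem_comap, Ideal.mem_span_singleton] at hx
    obtain ⟨c, hc⟩ := hx
    rw [LinearMap.mem_ker, hg, hc, map_mul, Ideal.Quotient.eq_zero_iff_mem]
    exact Ideal.mul_mem_right _ _ (Ideal.mem_span_singleton_self _)
  let f : S ⧸ J →ₗ[S] B := J.liftQ g hJg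
  have hf : ∀ x, f (Ideal.Quotient.mk J x) = g x := fun x => J.liftQ_apply g x
  have hu : ∀ s : m.asIdeal.primeCompl, IsUnit (algebraMap A O (algebraMap S A s)) := by
    intro s
    refine IsLocalization.map_units O (⟨algebraMap S A s, fun h => s.2 ?_⟩ : p.primeCompl)
    exact hm.ge h
  have hsmul : ∀ (s : S) (b : B), s • b = Ideal.Quotient.mk _ (algebraMap A O (algebraMap S A s)) * b := by
    intro s b
    rw [Algebra.smul_def, IsScalarTower.algebraMap_apply S O B, IsScalarTower.algebraMap_apply S A O]
    rfl
  have hA : Function.Injective (algebraMap A O) :=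
    IsLocalization.injective O p.primeCompl_le_nonZeroDivisors
  have hloc : IsLocalizedModule m.asIdeal.primeCompl f := by
    refine ⟨fun s => ?_, fun y => ?_, fun {x₁ x₂} h => ?_⟩
    · rw [Module.End.isUnit_iff]
      have hb : IsUnit (Ideal.Quotient.mk (Ideal.span {algebraMap A O a})
        (algebraMap A O (algebraMap S A s))) := (hu s).map _
      convert! IsUnit.isUnit_iff_mulLeft_bijective.mp hb using 1
      ext b
      exact hsmul s b
    · obtain ⟨y, rfl⟩ := Ideal.Quotient.mk_surjective y
      obtain ⟨b, s, rfl⟩ := IsLocalization.exists_mk'_eq p.primeCompl y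
      obtain ⟨x, rfl⟩ := hS b
      obtain ⟨s', hs'⟩ := hS s
      refine ⟨(Ideal.Quotient.mk J x, ⟨s', fun h => s.2 ?_⟩), ?_⟩
      · rw [← hs']
        exact hm.le h
      · rw [hf, hg, Submonoid.smul_def, hsmul, ← map_mul]
        congr 1
        rw [hs', IsLocalization.mk'_spec']
    · obtain ⟨x₁, rfl⟩ := Ideal.Quotient.mk_surjective x₁
      obtain ⟨x₂, rfl⟩ := Ideal.Quotient.mk_surjective x₂
      rw [hf, hf, hg, hg, Ideal.Quotient.eq, Ideal.mem_span_singleton] at h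
      obtain ⟨z, hz⟩ := h
      obtain ⟨b, s, rfl⟩ := IsLocalization.exists_mk'_eq p.primeCompl z
      obtain ⟨s', hs'⟩ := hS s
      refine ⟨⟨s', fun h => s.2 ?_⟩, ?_⟩
      · rw [← hs']
        exact hm.le h
      · rw [Submonoid.smul_def, Submonoid.smul_def]
        change Ideal.Quotient.mk J (s' * x₁) = Ideal.Quotient.mk J (s' * x₂)
        rw [Ideal.Quotient.eq, hJ, Ideal.mem_comap, Ideal.mem_span_singleton]
        refine ⟨b, hA ?_⟩
        rw [← mul_sub, map_mul, map_sub, hs', map_mul, map_sub, hz, map_mul, mul_left_comm,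
          IsLocalization.mk'_spec']
  have hmk : Function.Surjective (LocalizedModule.mkLinearMap m.asIdeal.primeCompl (S ⧸ J)) :=
    mkLinearMap_surjective m hfin
  let e := IsLocalizedModule.iso m.asIdeal.primeCompl f
  have hfs : Function.Surjective f := by
    intro b
    obtain ⟨x, hx⟩ := hmk (e.symm b)
    refine ⟨x, ?_⟩
    rw [← e.apply_symm_apply b, ← hx]
    exact (IsLocalizedModule.iso_mk_one m.asIdeal.primeCompl f x).symm
  have hSB : Function.Surjective (algebraMap S B) := by
    intro b
    obtain ⟨x, hx⟩ := hfs b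
    obtain ⟨x, rfl⟩ := Ideal.Quotient.mk_surjective x
    exact ⟨x, by rw [← hx, hf]; rfl⟩
  rw [multAt, e.length_eq, Module.length_eq_of_surjective (R := B) hSB,
    ← Module.length_eq_of_surjective (R := B) (S := O) Ideal.Quotient.mk_surjective]

end LocalLength

section CurveModel
variable {n : ℕ} {k F : Type u} [Field k] [Field F] [Algebra k F] {W : Scheme.{u}} [IsIntegral W]
  {t : W ⟶ Spec (.of F)} {q : W ⟶ projectiveSpace n k}

lemma mem_of_nonempty {U : W.Opens} {w : W} (hw : w ∈ U) : genericPoint W ∈ U :=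
  ((genericPoint_spec W).mem_open_set_iff U.isOpen).mpr ⟨w, trivial, hw⟩

lemma mem_primeIdealOf {Y : Scheme.{u}} {V : Y.Opens} (hV : IsAffineOpen V) {y : Y} (hy : y ∈ V)
    (a : Γ(Y, V)) : a ∈ (hV.primeIdealOf ⟨y, hy⟩).asIdeal ↔ ¬ IsUnit (Y.presheaf.germ V y hy a) := by
  let _ : Algebra Γ(Y, V) (Y.presheaf.stalk y) := (Y.presheaf.germ V y hy).hom.toAlgebra
  have hloc : IsLocalization.AtPrime (Y.presheaf.stalk y) (hV.primeIdealOf ⟨y, hy⟩).asIdeal :=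
    hV.isLocalization_stalk ⟨y, hy⟩
  have := IsLocalization.AtPrime.isUnit_to_map_iff (Y.presheaf.stalk y) (hV.primeIdealOf ⟨y, hy⟩).asIdeal a
  change _ ↔ ¬ IsUnit (algebraMap Γ(Y, V) (Y.presheaf.stalk y) a)
  rw [this]
  exact not_not.symm

lemma IsPointCoords.comap_primeIdealOf {Y : Scheme.{u}} {t : Y ⟶ Spec (.of F)} {q : Y ⟶ projectiveSpace n k}
    {c : Fin (n + 1) → k} (hV : IsAffineOpen (q ⁻¹ᵁ projChart c)) {y : Y} {π : Fin (n + 1) → F}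
    (h : IsPointCoords t q y π) (hy : y ∈ q ⁻¹ᵁ projChart c) :
    (pointIdeal (normAt c π)).asIdeal = (hV.primeIdealOf ⟨y, hy⟩).asIdeal.comap (chartMap t q c) := by
  ext P
  rw [mem_pointIdeal, Ideal.mem_comap, mem_primeIdealOf, h.isUnit_iff c hy, not_not]

lemma eq_of_primeIdealOf_eq {Y : Scheme.{u}} {V : Y.Opens} (hV : IsAffineOpen V) {y y' : Y} (hy : y ∈ V)
    (hy' : y' ∈ V) (h : (hV.primeIdealOf ⟨y, hy⟩).asIdeal = (hV.primeIdealOf ⟨y', hy'⟩).asIdeal) : y = y' := by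
  have h1 := hV.fromSpec_primeIdealOf ⟨y, hy⟩
  rw [PrimeSpectrum.ext h, hV.fromSpec_primeIdealOf ⟨y', hy'⟩] at h1
  exact h1.symm

lemma exists_primeIdealOf_eq {Y : Scheme.{u}} {V : Y.Opens} (hV : IsAffineOpen V) (p : Ideal Γ(Y, V)) [hp : p.IsPrime] :
    ∃ (y : Y) (hy : y ∈ V), (hV.primeIdealOf ⟨y, hy⟩).asIdeal = p := by
  let z : PrimeSpectrum Γ(Y, V) := ⟨p, hp⟩
  have hz : hV.fromSpec z ∈ V := by
    rw [← SetLike.mem_coe, ← hV.range_fromSpec]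
    exact ⟨z, rfl⟩
  refine ⟨hV.fromSpec z, hz, ?_⟩
  have h1 := hV.fromSpec_primeIdealOf ⟨_, hz⟩
  rw [hV.fromSpec.isOpenEmbedding.injective h1]

lemma isClosed_of_isMaximal {Y : Scheme.{u}} (t : Y ⟶ Spec (.of F)) [LocallyOfFiniteType t] {V : Y.Opens}
    (hV : IsAffineOpen V) {y : Y} (hy : y ∈ V) (h : (hV.primeIdealOf ⟨y, hy⟩).asIdeal.IsMaximal) :
    IsClosed {y} := by
  have : JacobsonSpace Y := LocallyOfFiniteType.jacobsonSpace t
  have h1 : hV.primeIdealOf ⟨y, hy⟩ ∈ closedPoints (Spec Γ(Y, V)) :=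
    (PrimeSpectrum.isClosed_singleton_iff_isMaximal _).mpr h
  rw [← hV.fromSpec.isOpenEmbedding.preimage_closedPoints] at h1
  have h2 := hV.fromSpec_primeIdealOf ⟨y, hy⟩
  change hV.fromSpec _ ∈ closedPoints Y at h1
  rwa [h2] at h1

/-- An integral scheme over `F` whose points other than the generic one are closed of codimension
one, but whose generic point is not closed. -/
structure IsCurve (W : Scheme.{u}) [IsIntegral W] : Prop where
  isClosed : ∀ w : W, w ≠ genericPoint W → IsClosed {w}
  coheight_eq_one : ∀ w : W, w ≠ genericPoint W → Order.coheight w = 1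
  not_isClosed : ¬ IsClosed {genericPoint W}

lemma IsCurve.coheight_eq_one_of_isClosed (hW : IsCurve W) {w : W} (hw : IsClosed {w}) :
    Order.coheight w = 1 :=
  hW.coheight_eq_one w fun h => hW.not_isClosed (h ▸ hw)

lemma IsCurve.krullDimLE (hW : IsCurve W) {V : W.Opens} (hV : IsAffineOpen V) [hne : Nonempty V] :
    Ring.KrullDimLE 1 Γ(W, V) := by
  rw [Ring.krullDimLE_one_iff_of_noZeroDivisors]
  intro p hp hp'
  obtain ⟨w, hw, rfl⟩ := exists_primeIdealOf_eq hV p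
  refine isMaximal_primeIdealOf hV hw (hW.isClosed w ?_)
  rintro rfl
  exact hp (congrArg PrimeSpectrum.asIdeal
    (hV.primeIdealOf_genericPoint.trans (genericPoint_eq_bot_of_affine _)))

lemma ord_germToFunctionField [IsLocallyNoetherian W] {V : W.Opens} [Nonempty V] {w : W} (hw : w ∈ V)
    (h1 : Order.coheight w = 1) {a : Γ(W, V)} (ha : a ≠ 0) :
    Scheme.ord (W.germToFunctionField V a) w = (Module.length (W.presheaf.stalk w)
      (W.presheaf.stalk w ⧸ Ideal.span {W.presheaf.germ V w hw a})).toNat := by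
  have : Ring.KrullDimLE 1 (W.presheaf.stalk w) := krullDimLE_of_coheight_le h1.le
  have hb : W.presheaf.germ V w hw a ≠ 0 := fun h =>
    ha (germ_injective_of_isIntegral W w hw (h.trans (map_zero _).symm))
  have hb' := mem_nonZeroDivisors_of_ne_zero hb
  obtain ⟨N, hN⟩ := ENat.ne_top_iff_exists.mp (Ring.ord_ne_top hb')
  rw [← Scheme.algebraMap_germ_eq_germToFunctionField W hw]
  rw [Scheme.ord_eq_iff h1 (by
    rw [Ne, FaithfulSMul.algebraMap_eq_zero_iff]
    exact hb)]
  change Ring.ordFrac (W.presheaf.stalk w) _ = _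
  rw [Ring.ordFrac_eq_ord _ hb, Ring.ordMonoidWithZeroHom_eq_coe _ hb' hN.symm]
  have h2 : Module.length (W.presheaf.stalk w)
      (W.presheaf.stalk w ⧸ Ideal.span {W.presheaf.germ V w hw a}) = N := hN.symm
  rw [h2]
  rfl

theorem IsChartModel.exists_projCurve [IsAlgClosed F] [IsLocallyNoetherian W] [LocallyOfFiniteType t]
    (h : IsChartModel t q) (hW : IsCurve W) (π : {w : W // IsClosed {w}} → Fin (n + 1) → F)
    (hπ : ∀ w, IsPointCoords t q w.1 (π w)) :
    ∃ (_ : Algebra F W.functionField) (_ : Algebra k W.functionField)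
      (_ : IsScalarTower k F W.functionField) (ξ : Fin (n + 1) → W.functionField),
      ProjCurve k ξ π (fun w f => Scheme.ord f w.1) ∧
      ∀ l : Fin (n + 1) → k, (genericPoint W ∈ q ⁻¹ᵁ projChart l ↔ formAt l ξ ≠ 0) ∧
        (genericPoint W ∈ q ⁻¹ᵁ projChart l → chartIdeal F l ξ = RingHom.ker (chartMap t q l)) ∧
        ∀ (hl : genericPoint W ∈ q ⁻¹ᵁ projChart l) P,
          W.presheaf.germ _ _ hl (chartMap t q l P) = MvPolynomial.aeval (normAt l ξ) P := by
  let aF : Algebra F W.functionField := (stalkConst t (genericPoint W)).toAlgebra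
  let ak : Algebra k W.functionField := ((algebraMap F W.functionField).comp (algebraMap k F)).toAlgebra
  have ht : IsScalarTower k F W.functionField := .of_algebraMap_eq fun _ => rfl
  obtain ⟨ξ, hξ, hc⟩ := h.exists_coords (genericPoint W) (E := W.functionField) (RingHom.id _)
    (fun _ => rfl)
  have hg : ∀ (l : Fin (n + 1) → k) (hl : genericPoint W ∈ q ⁻¹ᵁ projChart l) P,
      W.presheaf.germ _ _ hl (chartMap t q l P) = MvPolynomial.aeval (normAt l ξ) P :=
    fun l hl P => (hc l).2 hl P
  have hinj : ∀ (l : Fin (n + 1) → k) (hl : genericPoint W ∈ q ⁻¹ᵁ projChart l),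
      Function.Injective (W.presheaf.germ _ _ hl) := fun l hl => germ_injective_of_isIntegral W _ hl
  have hker : ∀ (l : Fin (n + 1) → k), genericPoint W ∈ q ⁻¹ᵁ projChart l →
      chartIdeal F l ξ = RingHom.ker (chartMap t q l) := by
    intro l hl
    ext P
    rw [mem_chartIdeal, ← hg l hl, RingHom.mem_ker, map_eq_zero_iff _ (hinj l hl)]
  have hmem : ∀ w (l : Fin (n + 1) → k), formAt l (π w) ≠ 0 → w.1 ∈ q ⁻¹ᵁ projChart l :=
    fun w l hl => ((hπ w).mem_iff l).mpr hl
  have hgen : ∀ w (l : Fin (n + 1) → k), formAt l (π w) ≠ 0 → genericPoint W ∈ q ⁻¹ᵁ projChart l :=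
    fun w l hl => mem_of_nonempty (hmem w l hl)
  have hJ : ∀ (l : Fin (n + 1) → k), genericPoint W ∈ q ⁻¹ᵁ projChart l → ∀ P,
      chartIdeal F l ξ ⊔ Ideal.span {P} = (Ideal.span {chartMap t q l P}).comap (chartMap t q l) := by
    intro l hl P
    rw [hker l hl, ← Set.image_singleton, ← Ideal.map_span,
      Ideal.comap_map_of_surjective' _ (h.surjective l), sup_comm]
  have hfin : ∀ l : Fin (n + 1) → k, formAt l ξ ≠ 0 → ∀ P ∉ chartIdeal F l ξ,
      IsFiniteLength (MvPolynomial (Fin (n + 1)) F)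
        (MvPolynomial (Fin (n + 1)) F ⧸ (chartIdeal F l ξ ⊔ Ideal.span {P})) := by
    intro l hl P hP
    have hl' := (hc l).1.mpr hl
    have : Nonempty (q ⁻¹ᵁ projChart l) := ⟨⟨_, hl'⟩⟩
    have := hW.krullDimLE (h.isAffineOpen l)
    have : IsNoetherianRing Γ(W, q ⁻¹ᵁ projChart l) :=
      isNoetherianRing_of_surjective _ _ (chartMap t q l) (h.surjective l)
    let _ : Algebra (MvPolynomial (Fin (n + 1)) F) Γ(W, q ⁻¹ᵁ projChart l) := (chartMap t q l).toAlgebra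
    refine isFiniteLength_quotient_of_comap (h.surjective l) (hJ l hl' P)
      (isFiniteLength_quotient_span_singleton _ (mem_nonZeroDivisors_of_ne_zero fun h0 => hP ?_))
    rw [hker l hl']
    exact h0
  refine ⟨aF, ak, ht, ξ, ⟨fun w => (hπ w).exists_ne, hξ, fun w l hl => (hc l).1.mp (hgen w l hl),
    fun w l hl P hP => ?_, fun l hl p hp => ?_, fun l w w' hw hw' hww => ?_, fun w f g hf hg => ?_,
    fun w l hl P hP => ?_, fun l hl f => ?_, hfin⟩, fun l => ⟨(hc l).1, hker l, hg l⟩⟩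
  · rw [hker l (hgen w l hl), RingHom.mem_ker] at hP
    rw [mem_pointIdeal]
    by_contra h0
    have := ((hπ w).isUnit_iff l (hmem w l hl) P).mpr h0
    rw [hP, map_zero] at this
    exact not_isUnit_zero this
  · have hl' := (hc l).1.mpr hl
    rw [hker l hl'] at hp
    have hmax := (pointIdeal p).isMaximal
    have hcm : (Ideal.map (chartMap t q l) (pointIdeal p).asIdeal).comap (chartMap t q l) =
        (pointIdeal p).asIdeal := by
      rw [Ideal.comap_map_of_surjective' _ (h.surjective l), sup_eq_left]
      exact hp
    have hmax' : (Ideal.map (chartMap t q l) (pointIdeal p).asIdeal).IsMaximal := by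
      refine (Ideal.map_eq_top_or_isMaximal_of_surjective _ (h.surjective l) hmax).resolve_left ?_
      intro h0
      rw [h0, Ideal.comap_top] at hcm
      exact hmax.ne_top hcm.symm
    obtain ⟨w, hw, hwp⟩ := exists_primeIdealOf_eq (h.isAffineOpen l)
      (Ideal.map (chartMap t q l) (pointIdeal p).asIdeal)
    have hcl : IsClosed {w} := isClosed_of_isMaximal t (h.isAffineOpen l) hw (hwp ▸ hmax')
    refine ⟨⟨w, hcl⟩, ((hπ ⟨w, hcl⟩).mem_iff l).mp hw, pointIdeal_injective ?_⟩
    have := (hπ ⟨w, hcl⟩).comap_primeIdealOf (h.isAffineOpen l) hw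
    rw [hwp, hcm] at this
    exact MaximalSpectrum.ext this
  · have h1 := (hπ w).comap_primeIdealOf (h.isAffineOpen l) (hmem w l hw)
    have h2 := (hπ w').comap_primeIdealOf (h.isAffineOpen l) (hmem w' l hw')
    rw [hww, h2] at h1
    exact Subtype.ext (eq_of_primeIdealOf_eq (h.isAffineOpen l) _ _
      (Ideal.comap_injective_of_surjective _ (h.surjective l) h1.symm))
  · have := Scheme.ord_mul (x := w.1) (div_ne_zero hf hg) hg
    rw [div_mul_cancel₀ _ hg] at this
    change Scheme.ord _ _ = _
    omega
  · have hl' := hgen w l hl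
    have : Nonempty (q ⁻¹ᵁ projChart l) := ⟨⟨_, hl'⟩⟩
    have hw := hmem w l hl
    let _ : Algebra (MvPolynomial (Fin (n + 1)) F) Γ(W, q ⁻¹ᵁ projChart l) := (chartMap t q l).toAlgebra
    let _ : Algebra Γ(W, q ⁻¹ᵁ projChart l) (W.presheaf.stalk w.1) :=
      (W.presheaf.germ _ w.1 hw).hom.toAlgebra
    let _ : Algebra (MvPolynomial (Fin (n + 1)) F) (W.presheaf.stalk w.1) :=
      ((W.presheaf.germ _ w.1 hw).hom.comp (chartMap t q l)).toAlgebra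
    have : IsScalarTower (MvPolynomial (Fin (n + 1)) F) Γ(W, q ⁻¹ᵁ projChart l)
      (W.presheaf.stalk w.1) := .of_algebraMap_eq fun _ => rfl
    have hloc : IsLocalization.AtPrime (W.presheaf.stalk w.1)
      ((h.isAffineOpen l).primeIdealOf ⟨w.1, hw⟩).asIdeal := (h.isAffineOpen l).isLocalization_stalk ⟨w.1, hw⟩
    have h0 : chartMap t q l P ≠ 0 := by
      intro h0
      rw [hker l hl'] at hP
      exact hP h0
    rw [multAt_quotient_eq_length (O := W.presheaf.stalk w.1) (h.surjective l)
      ((hπ w).comap_primeIdealOf (h.isAffineOpen l) hw) (hJ l hl' P) (hfin l ((hc l).1.mp hl') P hP)]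
    refine Eq.trans ?_ (ord_germToFunctionField hw (hW.coheight_eq_one_of_isClosed w.2) h0)
    rw [← hg l hl']
  · have hl' := (hc l).1.mpr hl
    have : Nonempty (q ⁻¹ᵁ projChart l) := ⟨⟨_, hl'⟩⟩
    have := functionField_isFractionRing_of_isAffineOpen W _ (h.isAffineOpen l)
    obtain ⟨a, b, hb, rfl⟩ := IsFractionRing.div_surjective (A := Γ(W, q ⁻¹ᵁ projChart l)) f
    obtain ⟨P, rfl⟩ := h.surjective l a
    obtain ⟨R, rfl⟩ := h.surjective l b
    refine ⟨P, R, ?_, ?_⟩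
    · rw [hker l hl']
      exact nonZeroDivisors.ne_zero hb
    · rw [← hg l hl', ← hg l hl']
      rfl

end CurveModel

end K3
end

noncomputable section
namespace K3

section PointClass
variable {X : Scheme.{u}}

lemma finite_support_cycle [CompactSpace X] (c : AlgebraicCycle X ℤ) : (Function.support c).Finite := by
  have := c.locallyFiniteSupport.finite_inter_support_of_isCompact isCompact_univ
  simpa using this

/-- A function with finite support on the points of codimension `p`, as a cycle. -/
def cycleOfFinite {p : ℕ} (c : X → ℤ) (hc : (Function.support c).Finite)
    (hp : ∀ x, c x ≠ 0 → Order.coheight x = p) : cyclesOfCodim X p :=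
  ⟨{ toFun := c
     supportWithinDomain' := Set.subset_univ _
     supportLocallyFiniteWithinDomain' := fun _ _ =>
      ⟨Set.univ, Filter.univ_mem, hc.subset Set.inter_subset_right⟩ }, hp⟩

open Classical in
/-- The point `x` as a cycle, zero unless `x` has codimension two. -/
def pointCycle (x : X) : cyclesOfCodim X 2 :=
  if hx : Order.coheight x = 2 then
    cycleOfFinite (fun y => if y = x then 1 else 0)
      ((Set.finite_singleton x).subset fun y hy => by
        by_contra h
        exact hy (if_neg h)) fun y hy => by
        by_cases h : y = x
        · rw [h, hx]; rfl
        · exact absurd (if_neg h) hy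
  else 0

open Classical in
lemma pointCycle_apply {x : X} (hx : Order.coheight x = 2) (y : X) :
    (pointCycle x).1 y = if y = x then 1 else 0 := by
  rw [pointCycle, dif_pos hx]
  rfl

/-- The class of the point `x`, zero unless `x` has codimension two. -/
def pointClass (x : X) : ChowGroup X 2 := QuotientAddGroup.mk (pointCycle x)

lemma cycle_eq_sum [CompactSpace X] (c : cyclesOfCodim X 2) :
    c = ∑ x ∈ (finite_support_cycle c.1).toFinset, c.1 x • pointCycle x := by
  classical
  apply Subtype.ext
  rw [AddSubgroup.val_finsetSum]
  ext y
  rw [Function.locallyFinsuppWithin.coe_sum, Finset.sum_apply]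
  have h : ∀ x ∈ (finite_support_cycle c.1).toFinset,
      ((c.1 x • pointCycle x : cyclesOfCodim X 2) : AlgebraicCycle X ℤ) y = if y = x then c.1 x else 0 := by
    intro x hx
    rw [Set.Finite.mem_toFinset] at hx
    change c.1 x • (pointCycle x).1 y = _
    rw [pointCycle_apply (c.2 x hx)]
    simp
  rw [Finset.sum_congr rfl h, Finset.sum_ite_eq]
  split_ifs with h1
  · rfl
  · simpa using h1

lemma mk_eq_finsum [CompactSpace X] (c : cyclesOfCodim X 2) :
    (QuotientAddGroup.mk c : ChowGroup X 2) = ∑ᶠ x, c.1 x • pointClass x := by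
  rw [finsum_eq_sum_of_support_subset (s := (finite_support_cycle c.1).toFinset)]
  · conv_lhs => rw [cycle_eq_sum c]
    rw [← QuotientAddGroup.mk'_apply, map_sum]
    rfl
  · intro x hx
    rw [Set.Finite.coe_toFinset]
    intro h0
    exact hx (by simp only [h0, zero_zsmul])

end PointClass

section Surface
variable {n : ℕ} {k F : Type u} [Field k] [Field F] [Algebra k F] [IsAlgClosed F] {Y : Scheme.{u}}
  {t : Y ⟶ Spec (.of F)} {q : Y ⟶ projectiveSpace n k}

lemma IsChartModel.compactSpace (h : IsChartModel t q) : CompactSpace Y := by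
  have h1 : (Set.univ : Set Y) = ⋃ i, (q ⁻¹ᵁ projChart (Pi.single i (1 : k)) : Set Y) := by
    ext y
    simp only [Set.mem_univ, Set.mem_iUnion, true_iff]
    exact exists_mem_projChart (q y)
  refine ⟨?_⟩
  rw [h1]
  exact isCompact_iUnion fun i => (h.isAffineOpen _).isCompact

lemma isCurve_of_isClosedImmersion (t : Y ⟶ Spec (.of F)) [SmoothOfRelativeDimension 2 t] [CompactSpace Y]
    {W : Scheme.{u}} [IsIntegral W] (i : W ⟶ Y) [IsClosedImmersion i]
    (hW : Order.coheight (i (genericPoint W)) = 1) : IsCurve W where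
  isClosed w hw := (curve_point t i hW hw).1
  coheight_eq_one w hw := (curve_point t i hW hw).2
  not_isClosed hc := by
    have h1 : IsClosed {i (genericPoint W)} := by
      rw [← Set.image_singleton]
      exact i.isClosedEmbedding.isClosedMap _ hc
    rw [← coheight_eq_two_iff t, hW] at h1
    exact absurd h1 (by decide)

lemma locallyOfFiniteType_of_smooth (t : Y ⟶ Spec (.of F)) [SmoothOfRelativeDimension 2 t] :
    LocallyOfFiniteType t :=
  have : Smooth t := SmoothOfRelativeDimension.smooth 2 t
  inferInstance

open Classical in
/-- Homogeneous coordinates of the closed points. -/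
def IsChartModel.coords [SmoothOfRelativeDimension 2 t] (h : IsChartModel t q) (y : Y) : Fin (n + 1) → F :=
  have := locallyOfFiniteType_of_smooth t
  if hy : IsClosed {y} then (h.exists_isPointCoords hy).choose else 0

lemma IsChartModel.isPointCoords_coords [SmoothOfRelativeDimension 2 t] (h : IsChartModel t q) {y : Y}
    (hy : IsClosed {y}) : IsPointCoords t q y (h.coords y) := by
  have := locallyOfFiniteType_of_smooth t
  rw [coords, dif_pos hy]
  exact (h.exists_isPointCoords hy).choose_spec

lemma isClosed_map {W : Scheme.{u}} (i : W ⟶ Y) [IsClosedImmersion i] {w : W} (hw : IsClosed {w}) :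
    IsClosed {i w} := by
  rw [← Set.image_singleton]
  exact i.isClosedEmbedding.isClosedMap _ hw

/-- The model of a curve on a surface. -/
theorem IsChartModel.exists_projCurve_of_isClosedImmersion [SmoothOfRelativeDimension 2 t]
    (h : IsChartModel t q) {W : Scheme.{u}} [IsIntegral W] [IsLocallyNoetherian W] (i : W ⟶ Y)
    [IsClosedImmersion i] (hW : Order.coheight (i (genericPoint W)) = 1) :
    ∃ (_ : Algebra F W.functionField) (_ : Algebra k W.functionField)
      (_ : IsScalarTower k F W.functionField) (ξ : Fin (n + 1) → W.functionField),
      ProjCurve k ξ (fun w : {w : W // IsClosed {w}} => h.coords (i w.1)) (fun w f => Scheme.ord f w.1) ∧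
      ∀ l : Fin (n + 1) → k, (i (genericPoint W) ∈ q ⁻¹ᵁ projChart l ↔ formAt l ξ ≠ 0) ∧
        (i (genericPoint W) ∈ q ⁻¹ᵁ projChart l →
          chartIdeal F l ξ = RingHom.ker (chartMap (i ≫ t) (i ≫ q) l)) ∧
        ∀ (hl : genericPoint W ∈ (i ≫ q) ⁻¹ᵁ projChart l) P,
          W.presheaf.germ _ _ hl (chartMap (i ≫ t) (i ≫ q) l P) = MvPolynomial.aeval (normAt l ξ) P := by
  have := locallyOfFiniteType_of_smooth t
  have := h.compactSpace
  exact (h.of_closedImmersion i).exists_projCurve (isCurve_of_isClosedImmersion t i hW) _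
    fun w => (h.isPointCoords_coords (isClosed_map i w.2)).of_comp i

section
variable [SmoothOfRelativeDimension 2 t] (h : IsChartModel t q) {W : Scheme.{u}} [IsIntegral W]
  [IsLocallyNoetherian W] (i : W ⟶ Y) [IsClosedImmersion i]

open Classical in
lemma finsum_eq_finsum_of_isPrincipal {G : Type*} [AddCommGroup G] (t : Y ⟶ Spec (.of F))
    [SmoothOfRelativeDimension 2 t] [CompactSpace Y] {f : W.functionField}
    (hW : Order.coheight (i (genericPoint W)) = 1) {c : Y → ℤ} (hc : ∀ w, c (i w) = Scheme.ord f w)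
    (hc' : ∀ y ∉ Set.range i, c y = 0) (γ : Y → G) :
    ∑ᶠ y, c y • γ y = ∑ᶠ w : {w : W // IsClosed {w}}, Scheme.ord f w.1 • γ (i w.1) := by
  have hcurve := isCurve_of_isClosedImmersion t i hW
  let j : {w : W // IsClosed {w}} → Y := fun w => i w.1
  have hj : Function.Injective j := fun w w' hww =>
    Subtype.ext (i.isClosedEmbedding.injective hww)
  have h1 : (Function.support fun y => c y • γ y) ⊆ Set.range j := by
    intro y hy
    have hy' : c y ≠ 0 := fun h0 => hy (by simp only [h0, zero_smul])
    obtain ⟨w, rfl⟩ : y ∈ Set.range i := by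
      by_contra hcon
      exact hy' (hc' y hcon)
    refine ⟨⟨w, hcurve.isClosed w fun hw => hy' ?_⟩, rfl⟩
    rw [hc, hw, Scheme.ord_eq_zero_of_coheight_neq_one]
    rw [coheight_genericPoint]
    exact zero_ne_one
  rw [← finsum_mem_univ, ← finsum_mem_inter_support_eq' _ (Set.range j) Set.univ
    (fun y hy => ⟨fun _ => trivial, fun _ => h1 hy⟩), finsum_mem_range hj]
  exact finsum_congr fun w => by rw [hc]

/-- The divisor of a rational function on a curve is rationally equivalent to zero. -/
theorem finsum_ord_smul_pointClass (hW : Order.coheight (i (genericPoint W)) = 1) {f : W.functionField}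
    (hf : f ≠ 0) (h : IsChartModel t q) : ∑ᶠ w : {w : W // IsClosed {w}}, Scheme.ord f w.1 • pointClass (i w.1) = 0 := by
  classical
  have := h.compactSpace
  obtain ⟨_, _, _, ξ, C, -⟩ := h.exists_projCurve_of_isClosedImmersion i hW
  have hfin := C.finite_support_ord hf
  let c : Y → ℤ := fun y => if hy : y ∈ Set.range i then Scheme.ord f hy.choose else 0
  have hc : ∀ w, c (i w) = Scheme.ord f w := by
    intro w
    have hw : i w ∈ Set.range i := ⟨w, rfl⟩
    simp only [c]
    rw [dif_pos hw, i.isClosedEmbedding.injective hw.choose_spec]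
  have hc' : ∀ y ∉ Set.range i, c y = 0 := fun y hy => dif_neg hy
  have hcurve := isCurve_of_isClosedImmersion t i hW
  have hcl : ∀ y, c y ≠ 0 → ∃ w : {w : W // IsClosed {w}}, i w.1 = y ∧ Scheme.ord f w.1 ≠ 0 := by
    intro y hy
    obtain ⟨w, rfl⟩ : y ∈ Set.range i := by
      by_contra hcon
      exact hy (hc' y hcon)
    rw [hc] at hy
    refine ⟨⟨w, hcurve.isClosed w ?_⟩, rfl, hy⟩
    rintro rfl
    rw [Scheme.ord_eq_zero_of_coheight_neq_one] at hy
    · exact hy rfl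
    · rw [coheight_genericPoint]
      exact zero_ne_one
  let c₀ : cyclesOfCodim Y 2 := cycleOfFinite c
    ((hfin.image fun w => i w.1).subset fun y hy => by
      obtain ⟨w, rfl, hw⟩ := hcl y hy
      exact ⟨w, hw, rfl⟩) fun y hy => by
      obtain ⟨w, rfl, -⟩ := hcl y hy
      exact (coheight_eq_two_iff t).mpr (isClosed_map i w.2)
  have h0 : (QuotientAddGroup.mk c₀ : ChowGroup Y 2) = 0 := by
    rw [QuotientAddGroup.eq_zero_iff]
    refine AddSubgroup.subset_closure ⟨W, i, inferInstance, inferInstance, inferInstance, f, hf, ?_, hc, hc'⟩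
    rw [hW]
    rfl
  rw [mk_eq_finsum] at h0
  rw [← h0]
  exact (finsum_eq_finsum_of_isPrincipal i t hW hc hc' _).symm

end

/-- The degree of zero-cycles. -/
theorem IsChartModel.exists_degree [SmoothOfRelativeDimension 2 t] [Infinite k] (h : IsChartModel t q) :
    ∃ δ : ChowGroup Y 2 →+ ℤ, ∀ y : Y, IsClosed {y} → δ (pointClass y) = 1 := by
  classical
  have := h.compactSpace
  let d : cyclesOfCodim Y 2 →+ ℤ :=
    { toFun := fun c => ∑ᶠ y, c.1 y
      map_zero' := by
        change ∑ᶠ _ : Y, (0 : ℤ) = 0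
        exact finsum_zero
      map_add' := fun c c' => finsum_add_distrib (finite_support_cycle c.1) (finite_support_cycle c'.1) }
  have hd : rationallyTrivial Y 2 ≤ d.ker := by
    rw [rationallyTrivial, AddSubgroup.closure_le]
    rintro c ⟨W, i, _, _, _, f, hf, hW, hc, hc'⟩
    have hW' : Order.coheight (i (genericPoint W)) = 1 := by
      have h2 : Order.coheight (i (genericPoint W)) + 1 = 1 + 1 := by rw [hW]; rfl
      exact (ENat.add_left_injective_of_ne_top (by simp)) h2
    obtain ⟨_, _, _, ξ, C, -⟩ := h.exists_projCurve_of_isClosedImmersion i hW'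
    have h1 := finsum_eq_finsum_of_isPrincipal i t hW' hc hc' (fun _ => (1 : ℤ))
    simp only [smul_eq_mul, mul_one] at h1
    rw [SetLike.mem_coe, AddMonoidHom.mem_ker]
    exact h1.trans (C.finsum_ord_eq_zero hf)
  refine ⟨QuotientAddGroup.lift _ d hd, fun y hy => ?_⟩
  change ∑ᶠ z, (pointCycle y).1 z = 1
  have h2 : Order.coheight y = 2 := (coheight_eq_two_iff t).mpr hy
  rw [finsum_eq_single _ y]
  · rw [pointCycle_apply h2, if_pos rfl]
  · intro z hz
    rw [pointCycle_apply h2, if_neg hz]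

end Surface

end K3
end

noncomputable section
namespace K3

section FiniteLength
variable {S : Type*} [CommRing S]

lemma isFiniteLength_of_forall_smul_eq_zero {I : Ideal S} (hI : IsFiniteLength S (S ⧸ I)) {N : Type*}
    [AddCommGroup N] [Module S N] [Module.Finite S N] (h : ∀ a ∈ I, ∀ x : N, a • x = 0) :
    IsFiniteLength S N := by
  obtain ⟨m, x, hx⟩ := Module.Finite.exists_fin (R := S) (M := N)
  let φ : Fin m → (S ⧸ I) →ₗ[S] N := fun j => I.liftQ (LinearMap.toSpanSingleton S N (x j))
    fun a ha => h a ha (x j)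
  have hφ : ∀ j, φ j (Ideal.Quotient.mk I 1) = x j := fun j => by
    change LinearMap.toSpanSingleton S N (x j) 1 = x j
    simp
  obtain ⟨_, _⟩ := isFiniteLength_iff_isNoetherian_isArtinian.mp hI
  have h1 : IsFiniteLength S (Fin m → S ⧸ I) :=
    isFiniteLength_iff_isNoetherian_isArtinian.mpr ⟨inferInstance, inferInstance⟩
  refine h1.of_surjective (f := LinearMap.lsum S (fun _ => S ⧸ I) S φ) ?_
  rw [← LinearMap.range_eq_top, eq_top_iff, ← hx, Submodule.span_le]
  rintro _ ⟨j, rfl⟩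
  refine ⟨Pi.single j (Ideal.Quotient.mk I 1), ?_⟩
  rw [LinearMap.lsum_apply, LinearMap.sum_apply, Finset.sum_eq_single j]
  · simpa using hφ j
  · intro b _ hb
    simp [Pi.single_eq_of_ne hb]
  · simp

lemma isMaximal_of_isFiniteLength {p : Ideal S} [p.IsPrime] (h : IsFiniteLength S (S ⧸ p)) :
    p.IsMaximal := by
  have h1 : IsArtinian S (S ⧸ p) := (isFiniteLength_iff_isNoetherian_isArtinian.mp h).2
  have : IsArtinianRing (S ⧸ p) := isArtinian_of_tower S h1
  exact Ideal.Quotient.maximal_of_isField _ (IsArtinianRing.isField_of_isDomain _)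

/-- The quotient of `S ⧸ I` by the multiples of `a`. -/
def quotientRangeEquiv (I : Ideal S) (a : S) :
    ((S ⧸ I) ⧸ LinearMap.range (LinearMap.lsmul S (S ⧸ I) a)) ≃ₗ[S] S ⧸ (I ⊔ Ideal.span {a}) :=
  (Submodule.quotEquivOfEq _ _ (by
    ext x
    constructor
    · rintro ⟨y, rfl⟩
      obtain ⟨y, rfl⟩ := Ideal.Quotient.mk_surjective y
      exact ⟨a * y, Ideal.mul_mem_right _ _ (Ideal.mem_span_singleton_self a), rfl⟩
    · rintro ⟨y, hy, rfl⟩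
      obtain ⟨z, rfl⟩ := Ideal.mem_span_singleton.mp hy
      exact ⟨Ideal.Quotient.mk I z, rfl⟩)).trans
    (Submodule.quotientQuotientEquivQuotientSup I (Ideal.span {a}))

lemma eulerCycle_quotient_of_notMem {G : Type*} [AddCommGroup G] (cl : MaximalSpectrum S → G) {p : Ideal S}
    [p.IsPrime] {a : S} (ha : a ∉ p) :
    eulerCycle cl a (S ⧸ p) = cycleOf cl (S ⧸ (p ⊔ Ideal.span {a})) := by
  have : Subsingleton (LinearMap.ker (LinearMap.lsmul S (S ⧸ p) a)) := by
    rw [Submodule.subsingleton_iff_eq_bot, LinearMap.ker_eq_bot']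
    intro x hx
    obtain ⟨x, rfl⟩ := Ideal.Quotient.mk_surjective x
    have hx' : Ideal.Quotient.mk p (a * x) = 0 := hx
    rw [Ideal.Quotient.eq_zero_iff_mem] at hx' ⊢
    exact (Ideal.IsPrime.mem_or_mem ‹_› hx').resolve_left ha
  rw [eulerCycle, cycleOf_of_subsingleton cl (M := LinearMap.ker (LinearMap.lsmul S (S ⧸ p) a)), sub_zero,
    cycleOf_congr cl (quotientRangeEquiv p a)]

lemma isFiniteLength_quotient_range {J : Ideal S} {a : S} (hfin : IsFiniteLength S (S ⧸ (J ⊔ Ideal.span {a})))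
    {N : Type*} [AddCommGroup N] [Module S N] [Module.Finite S N] (h : ∀ a ∈ J, ∀ x : N, a • x = 0) :
    IsFiniteLength S (N ⧸ LinearMap.range (LinearMap.lsmul S N a)) := by
  refine isFiniteLength_of_forall_smul_eq_zero hfin fun b hb x => ?_
  obtain ⟨x, rfl⟩ := Submodule.Quotient.mk_surjective _ x
  obtain ⟨c, hc, d, hd, rfl⟩ := Submodule.mem_sup.mp hb
  obtain ⟨e, rfl⟩ := Ideal.mem_span_singleton.mp hd
  rw [← Submodule.Quotient.mk_smul, Submodule.Quotient.mk_eq_zero, add_smul, h c hc, zero_add]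
  exact ⟨e • x, (mul_smul a e x).symm⟩

lemma isFiniteLength_ker [IsNoetherianRing S] {J : Ideal S} {a : S}
    (hfin : IsFiniteLength S (S ⧸ (J ⊔ Ideal.span {a})))
    {N : Type*} [AddCommGroup N] [Module S N] [Module.Finite S N] (h : ∀ a ∈ J, ∀ x : N, a • x = 0) :
    IsFiniteLength S (LinearMap.ker (LinearMap.lsmul S N a)) := by
  refine isFiniteLength_of_forall_smul_eq_zero hfin fun b hb x => ?_
  obtain ⟨c, hc, d, hd, rfl⟩ := Submodule.mem_sup.mp hb
  obtain ⟨e, rfl⟩ := Ideal.mem_span_singleton.mp hd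
  apply Subtype.ext
  have hx : a • (x : N) = 0 := x.2
  rw [Submodule.coe_smul, add_smul, h c hc, zero_add, mul_comm, mul_smul, hx, smul_zero,
    Submodule.coe_zero]

/-- An equality of Euler characteristics follows from the case of the quotients by primes. -/
theorem eulerCycle_eq_of_prime [IsNoetherianRing S] {G : Type*} [AddCommGroup G] (cl : MaximalSpectrum S → G)
    {J : Ideal S} {a b : S} (ha : IsFiniteLength S (S ⧸ (J ⊔ Ideal.span {a})))
    (hb : IsFiniteLength S (S ⧸ (J ⊔ Ideal.span {b})))
    (hprime : ∀ p : Ideal S, p.IsPrime → J ≤ p → a ∉ p → b ∉ p →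
      cycleOf cl (S ⧸ (p ⊔ Ideal.span {a})) = cycleOf cl (S ⧸ (p ⊔ Ideal.span {b})))
    (N : Type*) [AddCommGroup N] [Module S N] [hN : Module.Finite S N] (hJ : ∀ a ∈ J, ∀ x : N, a • x = 0) :
    eulerCycle cl a N = eulerCycle cl b N := by
  revert hJ
  induction hN using IsNoetherianRing.induction_on_isQuotientEquivQuotientPrime S with
  | subsingleton N =>
    intro _
    rw [eulerCycle_of_isFiniteLength cl a (.of_subsingleton), eulerCycle_of_isFiniteLength cl b (.of_subsingleton)]
  | quotient N p e =>
    intro hJ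
    have := p.2
    have hJp : J ≤ p.1 := by
      intro x hx
      have := hJ x hx (e.symm (Ideal.Quotient.mk p.1 1))
      rw [← map_smul, e.symm.map_eq_zero_iff] at this
      have h2 : Ideal.Quotient.mk p.1 (x * 1) = 0 := this
      rwa [mul_one, Ideal.Quotient.eq_zero_iff_mem] at h2
    rw [eulerCycle_congr cl a e, eulerCycle_congr cl b e]
    have key : ∀ c, IsFiniteLength S (S ⧸ (J ⊔ Ideal.span {c})) → c ∈ p.1 → IsFiniteLength S (S ⧸ p.1) := by
      intro c hc hcp
      refine isFiniteLength_of_forall_smul_eq_zero hc fun x hx y => ?_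
      obtain ⟨y, rfl⟩ := Ideal.Quotient.mk_surjective y
      refine Ideal.Quotient.eq_zero_iff_mem.mpr (Ideal.mul_mem_right _ _ ?_)
      exact (sup_le hJp ((Ideal.span_singleton_le_iff_mem _).mpr hcp)) hx
    by_cases hap : a ∈ p.1
    · rw [eulerCycle_of_isFiniteLength cl a (key a ha hap), eulerCycle_of_isFiniteLength cl b (key a ha hap)]
    by_cases hbp : b ∈ p.1
    · rw [eulerCycle_of_isFiniteLength cl a (key b hb hbp), eulerCycle_of_isFiniteLength cl b (key b hb hbp)]
    rw [eulerCycle_quotient_of_notMem cl hap, eulerCycle_quotient_of_notMem cl hbp,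
      hprime p.1 p.2 hJp hap hbp]
  | exact N₁ N₂ N₃ f g hf hg hfg h₁ h₃ =>
    intro hJ
    have hJ₁ : ∀ a ∈ J, ∀ x : N₁, a • x = 0 := fun a ha x => hf (by rw [map_smul, hJ a ha, map_zero])
    have hJ₃ : ∀ a ∈ J, ∀ x : N₃, a • x = 0 := fun a ha x => by
      obtain ⟨y, rfl⟩ := hg x
      rw [← map_smul, hJ a ha, map_zero]
    rw [eulerCycle_eq_add cl a f g hf hg hfg (isFiniteLength_quotient_range ha hJ₁)
      (isFiniteLength_quotient_range ha hJ) (isFiniteLength_ker ha hJ) (isFiniteLength_ker ha hJ₃),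
      eulerCycle_eq_add cl b f g hf hg hfg (isFiniteLength_quotient_range hb hJ₁)
      (isFiniteLength_quotient_range hb hJ) (isFiniteLength_ker hb hJ) (isFiniteLength_ker hb hJ₃),
      h₁ hJ₁, h₃ hJ₃]

end FiniteLength

section Surface
variable {n : ℕ} {k F : Type u} [Field k] [Field F] [Algebra k F] [IsAlgClosed F] {Y : Scheme.{u}}
  {t : Y ⟶ Spec (.of F)} {q : Y ⟶ projectiveSpace n k} [SmoothOfRelativeDimension 2 t]

lemma IsChartModel.eq_of_normAt_eq (h : IsChartModel t q) {l : Fin (n + 1) → k} {y y' : Y}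
    (hy : IsClosed {y}) (hy' : IsClosed {y'}) (hl : y ∈ q ⁻¹ᵁ projChart l) (hl' : y' ∈ q ⁻¹ᵁ projChart l)
    (hyy : normAt l (h.coords y) = normAt l (h.coords y')) : y = y' := by
  have h1 := (h.isPointCoords_coords hy).comap_primeIdealOf (h.isAffineOpen l) hl
  have h2 := (h.isPointCoords_coords hy').comap_primeIdealOf (h.isAffineOpen l) hl'
  rw [hyy, h2] at h1
  exact eq_of_primeIdealOf_eq (h.isAffineOpen l) _ _
      (Ideal.comap_injective_of_surjective _ (h.surjective l) h1.symm)

open Classical in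
/-- The class of the closed point with given affine coordinates in a chart. -/
def IsChartModel.chartClass (h : IsChartModel t q) (l : Fin (n + 1) → k) (p : Fin (n + 1) → F) :
    ChowGroup Y 2 :=
  if hp : ∃ y, IsClosed {y} ∧ y ∈ q ⁻¹ᵁ projChart l ∧ normAt l (h.coords y) = p then
    pointClass hp.choose else 0

lemma IsChartModel.chartClass_normAt (h : IsChartModel t q) {l : Fin (n + 1) → k} {y : Y}
    (hy : IsClosed {y}) (hl : y ∈ q ⁻¹ᵁ projChart l) :
    h.chartClass l (normAt l (h.coords y)) = pointClass y := by
  have hp : ∃ y', IsClosed {y'} ∧ y' ∈ q ⁻¹ᵁ projChart l ∧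
    normAt l (h.coords y') = normAt l (h.coords y) := ⟨y, hy, hl, rfl⟩
  rw [chartClass, dif_pos hp, h.eq_of_normAt_eq hp.choose_spec.1 hy hp.choose_spec.2.1 hl hp.choose_spec.2.2]

lemma exists_integral_closure [IsLocallyNoetherian Y] (y : Y) :
    ∃ (W : Scheme.{u}) (i : W ⟶ Y) (_ : IsClosedImmersion i) (_ : IsIntegral W)
      (_ : IsLocallyNoetherian W), i (genericPoint W) = y := by
  let r := Y.fromSpecResidueField y
  have : IsIntegral r.image := isIntegral_image r
  let z : Spec (Y.residueField y) := IsLocalRing.closedPoint (Y.residueField y)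
  refine ⟨r.image, r.imageι, inferInstance, this, LocallyOfFiniteType.isLocallyNoetherian r.imageι, ?_⟩
  have hw : r.imageι (r.toImage z) = y := by
    refine (Scheme.Hom.comp_apply r.toImage r.imageι z).symm.trans ?_
    rw [Scheme.Hom.toImage_imageι]
    exact Scheme.fromSpecResidueField_apply y z
  have h1 : closure {r.toImage z} = Set.univ := by
    rw [← (Scheme.Hom.denseRange r.toImage).closure_range]
    congr 1
    ext w
    constructor
    · rintro rfl; exact ⟨z, rfl⟩
    · rintro ⟨z', rfl⟩
      rw [Subsingleton.elim z' z]; rfl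
  rw [← IsGenericPoint.eq (S := Set.univ) h1 (genericPoint_spec r.image), hw]

/-- The ideal of a curve in a chart is the prime ideal of its generic point. -/
lemma IsChartModel.ker_chartMap_comp (h : IsChartModel t q) {W : Scheme.{u}} [IsIntegral W]
    (i : W ⟶ Y) {l : Fin (n + 1) → k} (hl : i (genericPoint W) ∈ q ⁻¹ᵁ projChart l) :
    RingHom.ker (chartMap (i ≫ t) (i ≫ q) l) =
      ((h.isAffineOpen l).primeIdealOf ⟨_, hl⟩).asIdeal.comap (chartMap t q l) := by
  ext P
  rw [Ideal.mem_comap, mem_primeIdealOf, RingHom.mem_ker]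
  have hl' : genericPoint W ∈ (i ≫ q) ⁻¹ᵁ projChart l := hl
  have h1 : W.presheaf.germ _ _ hl' (chartMap (i ≫ t) (i ≫ q) l P) =
      i.stalkMap (genericPoint W) (Y.presheaf.germ _ _ hl (chartMap t q l P)) := by
    refine Eq.trans ?_ (Scheme.Hom.germ_stalkMap_apply i (q ⁻¹ᵁ projChart l) _ hl _).symm
    rw [app_chartMap]
    rfl
  rw [← map_eq_zero_iff _ (germ_injective_of_isIntegral W _ hl'), h1]
  rw [← isUnit_map_iff (i.stalkMap (genericPoint W)).hom]
  exact (not_iff_comm.mp isUnit_iff_ne_zero.symm).symm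

lemma IsChartModel.exists_point_of_isPrime (h : IsChartModel t q) {l : Fin (n + 1) → k}
    {p : Ideal (MvPolynomial (Fin (n + 1)) F)} [p.IsPrime] (hp : RingHom.ker (chartMap t q l) ≤ p) :
    ∃ (y : Y) (hy : y ∈ q ⁻¹ᵁ projChart l),
      p = ((h.isAffineOpen l).primeIdealOf ⟨y, hy⟩).asIdeal.comap (chartMap t q l) := by
  have : (p.map (chartMap t q l)).IsPrime := Ideal.map_isPrime_of_surjective (h.surjective l) hp
  obtain ⟨y, hy, hyp⟩ := exists_primeIdealOf_eq (h.isAffineOpen l) (p.map (chartMap t q l))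
  refine ⟨y, hy, ?_⟩
  rw [hyp, Ideal.comap_map_of_surjective' _ (h.surjective l)]
  exact (sup_eq_left.mpr hp).symm

/-- On a surface, a nonzero function with finitely many zeros has none. -/
lemma IsChartModel.isUnit_of_isFiniteLength [IsIntegral Y] (h : IsChartModel t q) {l : Fin (n + 1) → k}
    {g : MvPolynomial (Fin (n + 1)) F}
    (hfin : IsFiniteLength (MvPolynomial (Fin (n + 1)) F)
      (MvPolynomial (Fin (n + 1)) F ⧸ (RingHom.ker (chartMap t q l) ⊔ Ideal.span {g}))) :
    IsUnit (chartMap t q l g) := by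
  by_contra hu
  have : IsNoetherianRing Γ(Y, q ⁻¹ᵁ projChart l) :=
    isNoetherianRing_of_surjective _ _ (chartMap t q l) (h.surjective l)
  have := h.compactSpace
  obtain ⟨p, hp⟩ := (Ideal.nonempty_minimalPrimes (I := Ideal.span {chartMap t q l g})
    (mt Ideal.span_singleton_eq_top.mp hu))
  have hpp : p.IsPrime := hp.1.1
  have hht := Ideal.height_le_one_of_isPrincipal_of_mem_minimalPrimes _ p hp
  have hgp : chartMap t q l g ∈ p := hp.1.2 (Ideal.mem_span_singleton_self _)
  have hle : RingHom.ker (chartMap t q l) ⊔ Ideal.span {g} ≤ p.comap (chartMap t q l) := by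
    refine sup_le (fun x hx => ?_) ((Ideal.span_singleton_le_iff_mem _).mpr hgp)
    rw [Ideal.mem_comap, RingHom.mem_ker.mp hx]
    exact p.zero_mem
  have hmax : (p.comap (chartMap t q l)).IsMaximal := by
    refine isMaximal_of_isFiniteLength (isFiniteLength_of_forall_smul_eq_zero hfin fun x hx y => ?_)
    obtain ⟨y, rfl⟩ := Ideal.Quotient.mk_surjective y
    exact Ideal.Quotient.eq_zero_iff_mem.mpr (Ideal.mul_mem_right _ _ (hle hx))
  have hpm : p.IsMaximal := by
    rw [← Ideal.map_comap_of_surjective _ (h.surjective l) p]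
    refine (Ideal.map_eq_top_or_isMaximal_of_surjective _ (h.surjective l) hmax).resolve_left ?_
    rw [Ideal.map_comap_of_surjective _ (h.surjective l) p]
    exact hpp.ne_top
  obtain ⟨y, hy, rfl⟩ := exists_primeIdealOf_eq (h.isAffineOpen l) p
  have := locallyOfFiniteType_of_smooth t
  have hcl := isClosed_of_isMaximal t (h.isAffineOpen l) hy hpm
  rw [← coheight_eq_height_primeIdealOf, (coheight_eq_two_iff t).mpr hcl] at hht
  exact absurd hht (by decide)

theorem IsChartModel.cycleOf_eq_of_isPrime [IsIntegral Y] [IsLocallyNoetherian Y] (h : IsChartModel t q)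
    {l : Fin (n + 1) → k} {p : Ideal (MvPolynomial (Fin (n + 1)) F)} [p.IsPrime]
    (hp : RingHom.ker (chartMap t q l) ≤ p) {a b : MvPolynomial (Fin (n + 1)) F} {d : ℕ}
    (ha : a.IsHomogeneous d) (hb : b.IsHomogeneous d) (hap : a ∉ p) (hbp : b ∉ p)
    (hainf : NoZerosAtInfinity p a d) (hbinf : NoZerosAtInfinity p b d)
    (hafin : IsFiniteLength (MvPolynomial (Fin (n + 1)) F)
      (MvPolynomial (Fin (n + 1)) F ⧸ (p ⊔ Ideal.span {a})))
    (hbfin : IsFiniteLength (MvPolynomial (Fin (n + 1)) F)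
      (MvPolynomial (Fin (n + 1)) F ⧸ (p ⊔ Ideal.span {b}))) :
    cycleOf (fun m => h.chartClass l (pointOf m)) (MvPolynomial (Fin (n + 1)) F ⧸ (p ⊔ Ideal.span {a})) =
      cycleOf (fun m => h.chartClass l (pointOf m)) (MvPolynomial (Fin (n + 1)) F ⧸ (p ⊔ Ideal.span {b})) := by
  have := h.compactSpace
  have htop : ∀ c, p ⊔ Ideal.span {c} = ⊤ → cycleOf (fun m => h.chartClass l (pointOf m))
      (MvPolynomial (Fin (n + 1)) F ⧸ (p ⊔ Ideal.span {c})) = 0 := by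
    intro c hc
    have : Subsingleton (MvPolynomial (Fin (n + 1)) F ⧸ (p ⊔ Ideal.span {c})) :=
      Ideal.Quotient.subsingleton_iff.mpr hc
    exact cycleOf_of_subsingleton _
  obtain ⟨y, hy, hyp⟩ := h.exists_point_of_isPrime hp
  have h2 := coheight_le_two t y
  obtain ⟨N, hN⟩ := ENat.ne_top_iff_exists.mp (ne_top_of_le_ne_top (by simp) h2)
  rw [← hN] at h2
  have h2' : N ≤ 2 := by exact_mod_cast h2
  interval_cases N
  · have hy0 := eq_genericPoint_of_coheight_eq_zero y hN.symm
    have hker : RingHom.ker (chartMap t q l) = p := by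
      subst hy0
      ext P
      rw [hyp, Ideal.mem_comap, mem_primeIdealOf, RingHom.mem_ker,
        ← map_eq_zero_iff _ (germ_injective_of_isIntegral Y _ hy)]
      exact (not_iff_comm.mp isUnit_iff_ne_zero.symm).symm
    have key : ∀ c, IsFiniteLength (MvPolynomial (Fin (n + 1)) F)
        (MvPolynomial (Fin (n + 1)) F ⧸ (p ⊔ Ideal.span {c})) → p ⊔ Ideal.span {c} = ⊤ := by
      intro c hc
      rw [← hker] at hc ⊢
      have hu := h.isUnit_of_isFiniteLength hc
      rw [sup_comm, ← Ideal.comap_map_of_surjective' _ (h.surjective l), Ideal.map_span, Set.image_singleton,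
        Ideal.span_singleton_eq_top.mpr hu, Ideal.comap_top]
    rw [htop a (key a hafin), htop b (key b hbfin)]
  · obtain ⟨W, i, _, _, _, rfl⟩ := exists_integral_closure y
    obtain ⟨_, _, _, ξ, C, hC⟩ := h.exists_projCurve_of_isClosedImmersion i hN.symm
    have hI : chartIdeal F l ξ = p := by
      rw [(hC l).2.1 hy, h.ker_chartMap_comp i hy, hyp]
    rw [← hI] at hap hbp hainf hbinf ⊢
    have hl := (hC l).1.mp hy
    have h3 := C.finsum_ord_smul hl ha hb hap hbp hainf hbinf (h.chartClass l)
      (fun w => pointClass (i w.1)) fun w hw => (h.chartClass_normAt (isClosed_map i w.2)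
        (((h.isPointCoords_coords (isClosed_map i w.2)).mem_iff l).mpr hw)).symm
    rw [finsum_ord_smul_pointClass i hN.symm (div_ne_zero _ _) h] at h3
    · exact sub_eq_zero.mp h3.symm
    · rwa [Ne, ← mem_chartIdeal_iff_of_isHomogeneous hl ha]
    · rwa [Ne, ← mem_chartIdeal_iff_of_isHomogeneous hl hb]
  · have hcl : IsClosed {y} := (coheight_eq_two_iff t).mp hN.symm
    have hmax := isMaximal_primeIdealOf (h.isAffineOpen l) hy hcl
    have hpm : p.IsMaximal := by
      rw [hyp]
      exact Ideal.comap_isMaximal_of_surjective _ (h.surjective l)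
    have key : ∀ c, c ∉ p → p ⊔ Ideal.span {c} = ⊤ := by
      intro c hc
      refine hpm.out.2 _ (left_lt_sup.mpr fun hle => hc (hle (Ideal.mem_span_singleton_self c)))
    rw [htop a (key a hap), htop b (key b hbp)]

/-- The Euler characteristics of two forms of the same degree agree in the Chow group. -/
theorem IsChartModel.eulerCycle_eq [IsIntegral Y] [IsLocallyNoetherian Y] (h : IsChartModel t q)
    {l : Fin (n + 1) → k} {J : Ideal (MvPolynomial (Fin (n + 1)) F)}
    (hJ : RingHom.ker (chartMap t q l) ≤ J) {a b : MvPolynomial (Fin (n + 1)) F} {d : ℕ}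
    (ha : a.IsHomogeneous d) (hb : b.IsHomogeneous d)
    (hainf : NoZerosAtInfinity J a d) (hbinf : NoZerosAtInfinity J b d)
    (hafin : IsFiniteLength (MvPolynomial (Fin (n + 1)) F)
      (MvPolynomial (Fin (n + 1)) F ⧸ (J ⊔ Ideal.span {a})))
    (hbfin : IsFiniteLength (MvPolynomial (Fin (n + 1)) F)
      (MvPolynomial (Fin (n + 1)) F ⧸ (J ⊔ Ideal.span {b}))) :
    eulerCycle (fun m => h.chartClass l (pointOf m)) a (MvPolynomial (Fin (n + 1)) F ⧸ J) =
      eulerCycle (fun m => h.chartClass l (pointOf m)) b (MvPolynomial (Fin (n + 1)) F ⧸ J) := by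
  have hmono : ∀ {p : Ideal (MvPolynomial (Fin (n + 1)) F)} {c}, J ≤ p → NoZerosAtInfinity J c d →
      NoZerosAtInfinity p c d := by
    rintro p c hp ⟨M, h1, h2, h3⟩
    refine ⟨M, h1, h2, fun i => ?_⟩
    obtain ⟨u, v, hu, hv, huv⟩ := h3 i
    exact ⟨u, v, hu, hv, hp huv⟩
  have hfin : ∀ {p : Ideal (MvPolynomial (Fin (n + 1)) F)} {c}, J ≤ p →
      IsFiniteLength (MvPolynomial (Fin (n + 1)) F) (MvPolynomial (Fin (n + 1)) F ⧸ (J ⊔ Ideal.span {c})) →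
      IsFiniteLength (MvPolynomial (Fin (n + 1)) F) (MvPolynomial (Fin (n + 1)) F ⧸ (p ⊔ Ideal.span {c})) := by
    intro p c hp hc
    refine isFiniteLength_of_forall_smul_eq_zero hc fun x hx y => ?_
    obtain ⟨y, rfl⟩ := Ideal.Quotient.mk_surjective y
    exact Ideal.Quotient.eq_zero_iff_mem.mpr (Ideal.mul_mem_right _ _ (sup_le_sup_right hp _ hx))
  refine eulerCycle_eq_of_prime _ hafin hbfin (fun p hp hJp hap hbp => ?_) _ fun x hx y => ?_
  · exact h.cycleOf_eq_of_isPrime (hJ.trans hJp) ha hb hap hbp (hmono hJp hainf) (hmono hJp hbinf)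
      (hfin hJp hafin) (hfin hJp hbfin)
  · obtain ⟨y, rfl⟩ := Ideal.Quotient.mk_surjective y
    exact Ideal.Quotient.eq_zero_iff_mem.mpr (Ideal.mul_mem_right _ _ hx)

end Surface

end K3
end

noncomputable section
namespace K3

section Specialization
variable {n : ℕ} {k K : Type u} [Field k] [Field K] [Algebra k K] [IsAlgClosed k] [IsAlgClosed K]
  {X : Scheme.{u}} {s : X ⟶ Spec (.of k)} {i : X ⟶ projectiveSpace n k}

instance smoothOfRelativeDimension_baseChange [SmoothOfRelativeDimension 2 s] :
    SmoothOfRelativeDimension 2 (pullback.snd s (Spec.map (CommRingCat.ofHom (algebraMap k K)))) :=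
  have := smoothOfRelativeDimension_isStableUnderBaseChange (n := 2)
  MorphismProperty.IsStableUnderBaseChange.of_isPullback (P := @SmoothOfRelativeDimension 2)
    (IsPullback.of_hasPullback s (Spec.map (CommRingCat.ofHom (algebraMap k K)))) inferInstance

lemma chartMap_comp_eq_zero {Y W : Scheme.{u}} {t : Y ⟶ Spec (.of K)} {q : Y ⟶ projectiveSpace n k} (j : W ⟶ Y)
    {l : Fin (n + 1) → k} {P : MvPolynomial (Fin (n + 1)) K} (hP : chartMap t q l P = 0) :
    chartMap (j ≫ t) (j ≫ q) l P = 0 := by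
  rw [← app_chartMap, hP]
  exact map_zero (j.app (q ⁻¹ᵁ projChart l)).hom

lemma chartMap_map_eq_zero {l : Fin (n + 1) → k} {P : MvPolynomial (Fin (n + 1)) k}
    (hP : P ∈ RingHom.ker (chartMap s i l)) :
    chartMap (pullback.snd s (Spec.map (CommRingCat.ofHom (algebraMap k K))))
      (baseChangeProj K s ≫ i) l (MvPolynomial.map (algebraMap k K) P) = 0 := by
  rw [chartMap_map, RingHom.mem_ker.mp hP]
  exact map_zero ((baseChangeProj K s).app (i ⁻¹ᵁ projChart l)).hom

lemma ker_chartMap_le_specIdeal {W : Scheme.{u}} {j : W ⟶ baseChangeScheme K s} {l : Fin (n + 1) → k}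
    {I : Ideal (MvPolynomial (Fin (n + 1)) K)}
    (hI : I = RingHom.ker (chartMap (j ≫ pullback.snd s (Spec.map (CommRingCat.ofHom (algebraMap k K))))
      (j ≫ baseChangeProj K s ≫ i) l)) {R : Subalgebra k K} (φ : R →ₐ[k] k) :
    RingHom.ker (chartMap s i l) ≤ specIdeal φ I := by
  intro P hP
  refine mem_specIdeal.mpr ⟨MvPolynomial.map (algebraMap k R) P, ?_, ?_⟩
  · rw [MvPolynomial.map_map, ← IsScalarTower.algebraMap_eq, hI, RingHom.mem_ker]
    exact chartMap_comp_eq_zero j (chartMap_map_eq_zero hP)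
  · rw [MvPolynomial.map_map]
    have : φ.toRingHom.comp (algebraMap k R) = RingHom.id k := RingHom.ext φ.commutes
    rw [this, MvPolynomial.map_id]

variable [SmoothOfRelativeDimension 2 s] [IsIntegral X] [IsLocallyNoetherian X]

theorem IsChartModel.eventually_finsum_specCl_of_isPrincipal (h : IsChartModel (k := k) s i)
    {c : AlgebraicCycle (baseChangeScheme K s) ℤ} (hc : IsPrincipalCycle 2 c) :
    ∃ Z : Set (baseChangeScheme K s), Z.Finite ∧ (∀ z ∈ Z, IsClosed {z}) ∧ ∀ l : Fin (n + 1) → k,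
      (∀ z ∈ Z, formAt l (h.baseChange.coords z) ≠ 0) → ∀ᶠ (R : Subalgebra k K) in fgFilter k K,
        ∀ φ : R →ₐ[k] k,
          ∑ᶠ z, c z • specCl φ (h.chartClass l) (normAt l (h.baseChange.coords z)) = 0 := by
  obtain ⟨W, j, _, _, _, f, hf, hW, hc, hc'⟩ := hc
  have hW' : Order.coheight (j (genericPoint W)) = 1 := by
    have h2 : Order.coheight (j (genericPoint W)) + 1 = 1 + 1 := by rw [hW]; rfl
    exact (ENat.add_left_injective_of_ne_top (by simp)) h2
  have := (h.baseChange (F := K)).compactSpace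
  obtain ⟨_, _, _, ξ, C, hC⟩ := (h.baseChange (F := K)).exists_projCurve_of_isClosedImmersion j hW'
  obtain ⟨d, g₁, g₂, Z, hg₁, hg₂, rfl, hZ, H⟩ := C.exists_forms hf
  refine ⟨(fun w => j w.1) '' Z, hZ.image _, ?_, fun l hl => ?_⟩
  · rintro _ ⟨w, -, rfl⟩
    exact isClosed_map j w.2
  obtain ⟨hlξ, hI₁, hI₂, hinf₁, hinf₂⟩ := H l fun w hw => hl _ ⟨w, hw, rfl⟩
  have hprime := chartIdeal_isPrime (F := K) l ξ
  filter_upwards [eventually_eulerCycle_spec (k := k) hI₁ (C.isFiniteLength l hlξ g₁ hI₁) (ChowGroup X 2),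
    eventually_eulerCycle_spec (k := k) hI₂ (C.isFiniteLength l hlξ g₂ hI₂) (ChowGroup X 2),
    eventually_noZerosAtInfinity_spec (k := k) hinf₁, eventually_noZerosAtInfinity_spec (k := k) hinf₂,
    eventually_exists_map_eq (k := k) g₁, eventually_exists_map_eq (k := k) g₂] with
    R hR₁ hR₂ hRinf₁ hRinf₂ ⟨e₁, he₁⟩ ⟨e₂, he₂⟩ φ
  rw [finsum_eq_finsum_of_isPrincipal j
    (pullback.snd s (Spec.map (CommRingCat.ofHom (algebraMap k K)))) hW' hc hc',
    C.finsum_ord_smul hlξ hg₁ hg₂ hI₁ hI₂ hinf₁ hinf₂ (specCl φ (h.chartClass l)) _ fun _ _ => rfl,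
    ← (hR₁ φ e₁ he₁).2, ← (hR₂ φ e₂ he₂).2, sub_eq_zero]
  have hhom : ∀ {g : MvPolynomial (Fin (n + 1)) K} {e : MvPolynomial (Fin (n + 1)) R},
      MvPolynomial.map (algebraMap R K) e = g → g.IsHomogeneous d →
      (MvPolynomial.map φ.toRingHom e).IsHomogeneous d := by
    rintro g e rfl hg
    exact (isHomogeneous_of_map Subtype.val_injective hg).map _
  exact h.eulerCycle_eq (ker_chartMap_le_specIdeal ((hC l).2.1 ((hC l).1.mpr hlξ)) φ) (hhom he₁ hg₁)
    (hhom he₂ hg₂) (hRinf₁ φ e₁ he₁) (hRinf₂ φ e₂ he₂)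
    ((quotientRangeEquiv _ _).isFiniteLength (hR₁ φ e₁ he₁).1)
    ((quotientRangeEquiv _ _).isFiniteLength (hR₂ φ e₂ he₂).1)

/-- Rational equivalences specialize. -/
theorem IsChartModel.eventually_finsum_specCl (h : IsChartModel (k := k) s i)
    {c : cyclesOfCodim (baseChangeScheme K s) 2} (hc : c ∈ rationallyTrivial (baseChangeScheme K s) 2) :
    ∃ Z : Set (baseChangeScheme K s), Z.Finite ∧ (∀ z ∈ Z, IsClosed {z}) ∧ ∀ l : Fin (n + 1) → k,
      (∀ z ∈ Z, formAt l (h.baseChange.coords z) ≠ 0) → ∀ᶠ (R : Subalgebra k K) in fgFilter k K,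
        ∀ φ : R →ₐ[k] k,
          ∑ᶠ z, c.1 z • specCl φ (h.chartClass l) (normAt l (h.baseChange.coords z)) = 0 := by
  have := (h.baseChange (F := K)).compactSpace
  have hfin : ∀ (c : cyclesOfCodim (baseChangeScheme K s) 2) (γ : baseChangeScheme K s → ChowGroup X 2),
      (Function.support fun z => c.1 z • γ z).Finite := fun c γ =>
    (finite_support_cycle c.1).subset fun z hz h0 => hz (by simp only [h0, zero_zsmul])
  refine AddSubgroup.closure_induction (fun c hc => h.eventually_finsum_specCl_of_isPrincipal hc) ?_ ?_ ?_ hc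
  · refine ⟨∅, Set.finite_empty, by simp, fun l _ => .of_forall fun R φ => ?_⟩
    refine finsum_eq_zero_of_forall_eq_zero fun z => ?_
    exact zero_zsmul _
  · rintro c c' - - ⟨Z, hZ, hcl, H⟩ ⟨Z', hZ', hcl', H'⟩
    refine ⟨Z ∪ Z', hZ.union hZ', fun z hz => hz.elim (hcl z) (hcl' z), fun l hl => ?_⟩
    filter_upwards [H l fun z hz => hl z (Or.inl hz), H' l fun z hz => hl z (Or.inr hz)] with R hR hR' φ
    refine Eq.trans ?_ ((finsum_add_distrib (hfin c _) (hfin c' _)).trans (by rw [hR φ, hR' φ, add_zero]))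
    exact finsum_congr fun z => add_zsmul _ _ _
  · rintro c - ⟨Z, hZ, hcl, H⟩
    refine ⟨Z, hZ, hcl, fun l hl => ?_⟩
    filter_upwards [H l hl] with R hR φ
    refine Eq.trans ?_ ((finsum_neg_distrib _).trans (neg_eq_zero.mpr (hR φ)))
    exact finsum_congr fun z => neg_zsmul _ _

end Specialization

end K3
end

noncomputable section
namespace K3

/-- A generic specialization of the coordinates of a point extends to a finitely generated algebra. -/
theorem exists_algHom_extension {ι k R : Type*} [Field k] [IsAlgClosed k] [Finite ι] [CommRing R] [IsDomain R]
    [Algebra k R] [Algebra.FiniteType k R] (p : ι → R) :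
    ∃ a : MvPolynomial ι k, MvPolynomial.aeval p a ≠ 0 ∧ ∀ q : ι → k,
      (∀ P, MvPolynomial.aeval p P = 0 → MvPolynomial.eval q P = 0) → MvPolynomial.eval q a ≠ 0 →
      ∃ φ : R →ₐ[k] k, ∀ j, φ (p j) = q j := by
  let f : MvPolynomial ι k →+* R := (MvPolynomial.aeval p : MvPolynomial ι k →ₐ[k] R).toRingHom
  have hf : f.FinitePresentation := by
    rw [← RingHom.FinitePresentation.of_finiteType]
    let _ : Algebra (MvPolynomial ι k) R := f.toAlgebra
    have : IsScalarTower k (MvPolynomial ι k) R :=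
      .of_algebraMap_eq fun a => ((MvPolynomial.aeval p : MvPolynomial ι k →ₐ[k] R).commutes a).symm
    exact Algebra.FiniteType.of_restrictScalars_finiteType k (MvPolynomial ι k) R
  obtain ⟨T, hT⟩ := PrimeSpectrum.exists_constructibleSetData_iff.mpr
    (PrimeSpectrum.isConstructible_range_comap hf)
  have hmem : PrimeSpectrum.comap f ⊥ ∈ T.toSet := by
    rw [hT]
    exact ⟨_, rfl⟩
  obtain ⟨D, hD, hD1, hD2⟩ := Set.mem_iUnion₂.mp hmem
  rw [PrimeSpectrum.mem_zeroLocus] at hD1 hD2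
  refine ⟨D.f, fun h0 => hD2 ?_, fun q hq hqa => ?_⟩
  · rintro _ rfl
    exact h0
  have h1 : (⟨(pointIdeal q).asIdeal, (pointIdeal q).isMaximal.isPrime⟩ : PrimeSpectrum (MvPolynomial ι k)) ∈
      T.toSet := by
    refine Set.mem_iUnion₂.mpr ⟨D, hD, ?_, fun h2 => hqa (mem_pointIdeal.mp (h2 rfl))⟩
    rw [PrimeSpectrum.mem_zeroLocus]
    intro P hP
    exact mem_pointIdeal.mpr (hq P (hD1 hP))
  rw [hT] at h1
  obtain ⟨𝔭, h𝔭⟩ := h1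
  obtain ⟨m, hm, hle⟩ := Ideal.exists_le_maximal 𝔭.asIdeal 𝔭.2.ne_top
  obtain ⟨φ, hφ⟩ := exists_algHom_ker_eq (F := k) m
  refine ⟨φ, fun j => ?_⟩
  have h2 : (MvPolynomial.X j - MvPolynomial.C (q j) : MvPolynomial ι k) ∈ 𝔭.asIdeal.comap f := by
    have : 𝔭.asIdeal.comap f = (pointIdeal q).asIdeal := congrArg PrimeSpectrum.asIdeal h𝔭
    rw [this, mem_pointIdeal]
    simp
  have h3 : f (MvPolynomial.X j - MvPolynomial.C (q j)) ∈ RingHom.ker φ := hφ ▸ hle h2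
  have h4 : f (MvPolynomial.X j - MvPolynomial.C (q j)) = p j - algebraMap k R (q j) := by
    simp [f]
  rw [h4, RingHom.mem_ker, map_sub, sub_eq_zero] at h3
  rw [h3]
  exact φ.commutes (q j)

lemma le_one_of_isIntegral {k A : Type*} [Field k] [CommRing A] [IsDomain A] [Ring.KrullDimLE 1 A] {r : ℕ}
    [Algebra (MvPolynomial (Fin r) k) A] [Algebra.IsIntegral (MvPolynomial (Fin r) k) A]
    (hinj : Function.Injective (algebraMap (MvPolynomial (Fin r) k) A)) : r ≤ 1 := by
  classical
  by_contra! hr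
  let x₀ : Fin r := ⟨0, by omega⟩
  let x₁ : Fin r := ⟨1, hr⟩
  have hx : x₁ ≠ x₀ := by simp [x₀, x₁]
  let e : MvPolynomial (Fin r) k →ₐ[k] MvPolynomial (Fin r) k :=
    MvPolynomial.aeval fun j => if j = x₀ then 0 else MvPolynomial.X j
  let P := RingHom.ker e
  have hP : P.IsPrime := RingHom.ker_isPrime _
  have h0 : MvPolynomial.X x₀ ∈ P := by simp [P, e, RingHom.mem_ker]
  obtain ⟨Q, -, hQ, hQP⟩ := Ideal.exists_ideal_over_prime_of_isIntegral (S := A) P ⊥ (by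
    rw [← RingHom.ker_eq_comap_bot, (RingHom.injective_iff_ker_eq_bot _).mp hinj]
    exact bot_le)
  have hQ0 : Q ≠ ⊥ := by
    rintro rfl
    rw [← RingHom.ker_eq_comap_bot, (RingHom.injective_iff_ker_eq_bot _).mp hinj] at hQP
    rw [← hQP] at h0
    exact MvPolynomial.X_ne_zero x₀ h0
  have hQm : Q.IsMaximal := Ring.krullDimLE_one_iff_of_noZeroDivisors.mp inferInstance Q hQ0 hQ
  have hPm : P.IsMaximal := hQP ▸ Ideal.isMaximal_comap_of_isIntegral_of_isMaximal Q
  have hle : P ≤ (pointIdeal (0 : Fin r → k)).asIdeal := by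
    intro f hf
    have h1 : MvPolynomial.eval 0 (e f) = MvPolynomial.eval 0 f := by
      have : (MvPolynomial.aeval (0 : Fin r → k)).comp e = MvPolynomial.aeval (0 : Fin r → k) := by
        ext j
        by_cases hj : j = x₀ <;> simp [e, hj]
      exact congrArg (fun g => g f) this
    rw [mem_pointIdeal, ← h1, RingHom.mem_ker.mp hf, map_zero]
  have h1 : MvPolynomial.X x₁ ∈ P := by
    rw [hPm.eq_of_le (pointIdeal (0 : Fin r → k)).isMaximal.ne_top hle, mem_pointIdeal]
    simp
  have h2 : e (MvPolynomial.X x₁) = MvPolynomial.X x₁ := by simp [e, hx]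
  exact MvPolynomial.X_ne_zero x₁ (h2 ▸ RingHom.mem_ker.mp h1)

/-- The function field of a curve embeds in every transcendental algebraically closed extension. -/
theorem nonempty_algHom_of_krullDimLE_one {k K A L : Type*} [Field k] [Field K] [Algebra k K] [IsAlgClosed K]
    (htr : 0 < Algebra.trdeg k K) [CommRing A] [IsDomain A] [Algebra k A] [Algebra.FiniteType k A]
    [Ring.KrullDimLE 1 A] [Field L] [Algebra k L] [Algebra A L] [IsScalarTower k A L] [IsFractionRing A L] :
    Nonempty (L →ₐ[k] K) := by
  obtain ⟨r, g, hg, hgi⟩ := exists_integral_inj_algHom_of_fg k A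
  let _ : Algebra (MvPolynomial (Fin r) k) A := g.toRingHom.toAlgebra
  have : Algebra.IsIntegral (MvPolynomial (Fin r) k) A := ⟨hgi⟩
  have hr := le_one_of_isIntegral (k := k) (A := A) (r := r) hg
  have : Algebra.Transcendental k K := trdeg_ne_zero_iff.mp htr.ne'
  obtain ⟨τ, hτ⟩ := Algebra.Transcendental.transcendental (R := k) (A := K)
  let e : MvPolynomial (Fin r) k →ₐ[k] K := MvPolynomial.aeval fun _ => τ
  have he : Function.Injective e := by
    change AlgebraicIndependent k fun _ : Fin r => τ
    interval_cases r
    · exact algebraicIndependent_empty_type_iff.mpr (algebraMap k K).injective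
    · exact algebraicIndependent_unique_type_iff.mpr hτ
  let _ : Algebra (MvPolynomial (Fin r) k) K := e.toRingHom.toAlgebra
  let _ : Algebra (MvPolynomial (Fin r) k) L := ((algebraMap A L).comp g.toRingHom).toAlgebra
  have : IsScalarTower (MvPolynomial (Fin r) k) A L := .of_algebraMap_eq fun _ => rfl
  have : FaithfulSMul (MvPolynomial (Fin r) k) K := (faithfulSMul_iff_algebraMap_injective _ _).mpr he
  have : FaithfulSMul (MvPolynomial (Fin r) k) A := (faithfulSMul_iff_algebraMap_injective _ _).mpr hg
  have : FaithfulSMul (MvPolynomial (Fin r) k) L := (faithfulSMul_iff_algebraMap_injective _ _).mpr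
    ((IsFractionRing.injective A L).comp hg)
  have : Algebra.IsAlgebraic (MvPolynomial (Fin r) k) L :=
    (IsFractionRing.isAlgebraic_iff' (MvPolynomial (Fin r) k) A L).mp inferInstance
  let ψ : L →ₐ[MvPolynomial (Fin r) k] K := IsAlgClosed.lift
  refine ⟨{ ψ.toRingHom with commutes' := fun a => ?_ }⟩
  have h1 : algebraMap k L a = algebraMap (MvPolynomial (Fin r) k) L (MvPolynomial.C a) := by
    rw [IsScalarTower.algebraMap_apply k A L]
    exact congrArg (algebraMap A L) (g.commutes a).symm
  rw [h1]
  exact (ψ.commutes _).trans (e.commutes a)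

end K3
end

noncomputable section
namespace K3

section Coordinates
variable {ι k E : Type*} [Fintype ι] [Field k] [Field E] [Algebra k E]

lemma formAt_smul (l : ι → k) (c : E) (p : ι → E) : formAt l (c • p) = c * formAt l p := by
  simp only [formAt, Pi.smul_apply, smul_eq_mul, Finset.mul_sum]
  exact Finset.sum_congr rfl fun _ _ => by ring

lemma normAt_smul (l : ι → k) {c : E} (hc : c ≠ 0) (p : ι → E) : normAt l (c • p) = normAt l p := by
  ext j
  rw [normAt, normAt, formAt_smul, Pi.smul_apply, smul_eq_mul, mul_div_mul_left _ _ hc]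

lemma exists_eq_smul_of_normAt_eq {l : ι → k} {p p' : ι → E} (hp : formAt l p ≠ 0) (hp' : formAt l p' ≠ 0)
    (h : normAt l p = normAt l p') : ∃ c : E, c ≠ 0 ∧ p = c • p' := by
  refine ⟨formAt l p / formAt l p', div_ne_zero hp hp', funext fun j => ?_⟩
  have h1 : p j / formAt l p = p' j / formAt l p' := congrFun h j
  rw [div_eq_iff hp] at h1
  rw [h1, Pi.smul_apply, smul_eq_mul]
  ring

lemma formAt_comp {L : Type*} [Field L] [Algebra k L] (ψ : L →ₐ[k] E) (l : ι → k) (ξ : ι → L) :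
    formAt l (ψ ∘ ξ) = ψ (formAt l ξ) := by
  simp [formAt]

lemma normAt_comp {L : Type*} [Field L] [Algebra k L] (ψ : L →ₐ[k] E) (l : ι → k) (ξ : ι → L) :
    normAt l (ψ ∘ ξ) = ψ ∘ normAt l ξ := by
  ext j
  rw [Function.comp_apply, normAt, normAt, formAt_comp, map_div₀, Function.comp_apply]

end Coordinates

section Surjectivity
variable {n : ℕ} {k K : Type u} [Field k] [Field K] [Algebra k K] [IsAlgClosed k] [IsAlgClosed K]
  {X : Scheme.{u}} {s : X ⟶ Spec (.of k)} {i : X ⟶ projectiveSpace n k} [SmoothOfRelativeDimension 2 s]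

lemma IsChartModel.normAt_coords_baseChange (h : IsChartModel (k := k) s i) {z : baseChangeScheme K s}
    (hz : IsClosed {z}) (hz' : IsClosed {baseChangeProj K s z}) {l : Fin (n + 1) → k}
    (hl : formAt l (h.baseChange.coords z) ≠ 0) (j : Fin (n + 1)) :
    normAt l (h.baseChange.coords z) j = algebraMap k K (normAt l (h.coords (baseChangeProj K s z)) j) := by
  have hc := (h.baseChange (F := K)).isPointCoords_coords hz
  have hc' := h.isPointCoords_coords hz'
  have hy := (hc.mem_iff l).mpr hl
  have hy' : baseChangeProj K s z ∈ i ⁻¹ᵁ projChart l := hy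
  have h1 := (hc'.isUnit_iff l hy' (MvPolynomial.X j - MvPolynomial.C
    (normAt l (h.coords (baseChangeProj K s z)) j))).not.mpr (by simp)
  have h2 := (hc.isUnit_iff l hy (MvPolynomial.map (algebraMap k K) (MvPolynomial.X j - MvPolynomial.C
    (normAt l (h.coords (baseChangeProj K s z)) j)))).not.mp (by
      intro hu
      refine h1 ?_
      rw [← isUnit_map_iff ((baseChangeProj K s).stalkMap z).hom]
      refine (congrArg IsUnit ?_).mp hu
      refine Eq.trans ?_ (Scheme.Hom.germ_stalkMap_apply (baseChangeProj K s) (i ⁻¹ᵁ projChart l) z hy _).symm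
      exact congrArg _ (chartMap_map l _))
  rw [not_not] at h2
  simpa [sub_eq_zero] using h2

lemma IsChartModel.exists_point_baseChange (h : IsChartModel (k := k) s i) {l : Fin (n + 1) → k}
    {p : Fin (n + 1) → K} (hp : ∀ P ∈ RingHom.ker (chartMap s i l), MvPolynomial.aeval p P = 0) :
    ∃ z : baseChangeScheme K s, IsClosed {z} ∧ formAt l (h.baseChange.coords z) ≠ 0 ∧
      normAt l (h.baseChange.coords z) = p := by
  have hK := h.baseChange (F := K)
  have := (pointIdeal p).isMaximal.isPrime
  obtain ⟨z, hz, hzp⟩ := hK.exists_point_of_isPrime (h.ker_chartMap_baseChange_le hp)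
  have := locallyOfFiniteType_of_smooth (pullback.snd s (Spec.map (CommRingCat.ofHom (algebraMap k K))))
  have hm : ((hK.isAffineOpen l).primeIdealOf ⟨z, hz⟩).asIdeal.IsMaximal := by
    rw [← Ideal.map_comap_of_surjective _ (hK.surjective l)
      ((hK.isAffineOpen l).primeIdealOf ⟨z, hz⟩).asIdeal, ← hzp]
    refine (Ideal.map_eq_top_or_isMaximal_of_surjective _ (hK.surjective l)
      (pointIdeal p).isMaximal).resolve_left ?_
    rw [hzp, Ideal.map_comap_of_surjective _ (hK.surjective l)]
    exact ((hK.isAffineOpen l).primeIdealOf ⟨z, hz⟩).2.ne_top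
  have hcl := isClosed_of_isMaximal (pullback.snd s (Spec.map (CommRingCat.ofHom (algebraMap k K))))
    (hK.isAffineOpen l) hz hm
  have hc := hK.isPointCoords_coords hcl
  refine ⟨z, hcl, (hc.mem_iff l).mp hz, pointIdeal_injective (MaximalSpectrum.ext ?_)⟩
  rw [hc.comap_primeIdealOf (hK.isAffineOpen l) hz, hzp]

/-- The function field of a curve on `X` embeds in `K`. -/
theorem IsChartModel.nonempty_algHom_functionField (h : IsChartModel (k := k) s i)
    (htr : 0 < Algebra.trdeg k K) {W : Scheme.{u}} [IsIntegral W] (j : W ⟶ X) [IsClosedImmersion j]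
    (hW : Order.coheight (j (genericPoint W)) = 1) [Algebra k W.functionField] {l : Fin (n + 1) → k}
    {ξ : Fin (n + 1) → W.functionField} (hl : genericPoint W ∈ (j ≫ i) ⁻¹ᵁ projChart l)
    (hξ : ∀ P, W.presheaf.germ _ _ hl (chartMap (j ≫ s) (j ≫ i) l P) = MvPolynomial.aeval (normAt l ξ) P) :
    Nonempty (W.functionField →ₐ[k] K) := by
  have := h.compactSpace
  have := locallyOfFiniteType_of_smooth s
  have hU : IsAffineOpen ((j ≫ i) ⁻¹ᵁ projChart l) := (h.of_closedImmersion j).isAffineOpen l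
  have : Nonempty ((j ≫ i) ⁻¹ᵁ projChart l) := ⟨⟨_, hl⟩⟩
  have := (isCurve_of_isClosedImmersion s j hW).krullDimLE hU
  let _ : Algebra k Γ(W, (j ≫ i) ⁻¹ᵁ projChart l) := (sectionConst (j ≫ s) _).toAlgebra
  have : Algebra.FiniteType k Γ(W, (j ≫ i) ⁻¹ᵁ projChart l) := finiteType_sectionConst (j ≫ s) hU
  have := functionField_isFractionRing_of_isAffineOpen W _ hU
  have : IsScalarTower k Γ(W, (j ≫ i) ⁻¹ᵁ projChart l) W.functionField := .of_algebraMap_eq fun a => by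
    have h1 := hξ (MvPolynomial.C a)
    rw [MvPolynomial.aeval_C, chartMap, MvPolynomial.eval₂Hom_C] at h1
    exact h1.symm
  exact nonempty_algHom_of_krullDimLE_one (A := Γ(W, (j ≫ i) ⁻¹ᵁ projChart l)) htr

/-- A cycle with the class of a point defined over `K` but not over `k`, specialized at the points of a
curve. -/
theorem IsChartModel.chartClass_eq_of_sub_mem [IsIntegral X] [IsLocallyNoetherian X]
    (h : IsChartModel (k := k) s i) {c : cyclesOfCodim (baseChangeScheme K s) 2}
    (hc : ∀ z, c.1 z ≠ 0 → IsClosed {baseChangeProj K s z}) {z₀ : baseChangeScheme K s} (hz₀ : IsClosed {z₀})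
    (hrat : -c + pointCycle z₀ ∈ rationallyTrivial (baseChangeScheme K s) 2) :
    ∃ l : Fin (n + 1) → k, formAt l (h.baseChange.coords z₀) ≠ 0 ∧ ∃ (α : ChowGroup X 2) (S : Finset K),
      ∀ R : Subalgebra k K, (S : Set K) ⊆ R → ∀ (φ : R →ₐ[k] k) (p : Fin (n + 1) → R),
        (∀ j, (p j : K) = normAt l (h.baseChange.coords z₀) j) → h.chartClass l (fun j => φ (p j)) = α := by
  classical
  have hK := h.baseChange (F := K)
  have := hK.compactSpace
  have hcl : ∀ z, c.1 z ≠ 0 → IsClosed {z} := fun z hz =>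
    (coheight_eq_two_iff (pullback.snd s (Spec.map (CommRingCat.ofHom (algebraMap k K))))).mp (c.2 z hz)
  obtain ⟨Z, hZ, hZcl, H⟩ := h.eventually_finsum_specCl hrat
  obtain ⟨l, hl⟩ := exists_form_ne_zero (k := k) (Z := Z ∪ {z₀} ∪ Function.support c.1)
    ((hZ.union (Set.finite_singleton z₀)).union (finite_support_cycle c.1)) hK.coords (by
      intro z hz
      refine (hK.isPointCoords_coords ?_).exists_ne
      rcases hz with (hz | rfl) | hz
      · exact hZcl z hz
      · exact hz₀
      · exact hcl z hz)
  obtain ⟨S, hS⟩ := exists_finset_of_eventually (H l fun z hz => hl z (Or.inl (Or.inl hz)))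
  refine ⟨l, hl z₀ (Or.inl (Or.inr rfl)),
    ∑ᶠ z, c.1 z • h.chartClass l (normAt l (h.coords (baseChangeProj K s z))), S, fun R hR φ p hp => ?_⟩
  have h1 := hS R hR φ
  have hγ : ∀ z, c.1 z • specCl φ (h.chartClass l) (normAt l (hK.coords z)) =
      c.1 z • h.chartClass l (normAt l (h.coords (baseChangeProj K s z))) := by
    intro z
    by_cases hz : c.1 z = 0
    · rw [hz, zero_zsmul, zero_zsmul]
    have h2 : normAt l (hK.coords z) =
        fun j => (algebraMap k R (normAt l (h.coords (baseChangeProj K s z)) j) : K) :=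
      funext fun j => h.normAt_coords_baseChange (hcl z hz) (hc z hz) (hl z (Or.inr hz)) j
    rw [h2, specCl_apply]
    simp
  have hγ₀ : specCl φ (h.chartClass l) (normAt l (hK.coords z₀)) = h.chartClass l fun j => φ (p j) := by
    rw [← specCl_apply φ (h.chartClass l) p, ← funext hp]
  have hsupp : ∀ (c : cyclesOfCodim (baseChangeScheme K s) 2) (γ : baseChangeScheme K s → ChowGroup X 2),
      (Function.support fun z => c.1 z • γ z).Finite := fun c γ =>
    (finite_support_cycle c.1).subset fun z hz h0 => hz (by simp only [h0, zero_zsmul])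
  have h2 : ∑ᶠ z, (-c + pointCycle z₀).1 z • specCl φ (h.chartClass l) (normAt l (hK.coords z)) =
      ∑ᶠ z, (-c).1 z • specCl φ (h.chartClass l) (normAt l (hK.coords z)) +
        ∑ᶠ z, (pointCycle z₀).1 z • specCl φ (h.chartClass l) (normAt l (hK.coords z)) := by
    rw [← finsum_add_distrib (hsupp _ _) (hsupp _ _)]
    exact finsum_congr fun z => add_zsmul _ _ _
  have h3 : ∑ᶠ z, (-c).1 z • specCl φ (h.chartClass l) (normAt l (hK.coords z)) =
      -∑ᶠ z, c.1 z • h.chartClass l (normAt l (h.coords (baseChangeProj K s z))) := by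
    rw [← finsum_neg_distrib]
    exact finsum_congr fun z => (neg_zsmul _ _).trans (congrArg _ (hγ z))
  have h4 : ∑ᶠ z, (pointCycle z₀).1 z • specCl φ (h.chartClass l) (normAt l (hK.coords z)) =
      h.chartClass l fun j => φ (p j) := by
    have hco := (coheight_eq_two_iff
      (pullback.snd s (Spec.map (CommRingCat.ofHom (algebraMap k K))))).mpr hz₀
    rw [finsum_eq_single _ z₀ fun z hz => by rw [pointCycle_apply hco, if_neg hz, zero_zsmul],
      pointCycle_apply hco, if_pos rfl, one_zsmul, hγ₀]
  rw [h2, h3, h4, neg_add_eq_zero] at h1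
  exact h1.symm

/-- If base change is surjective, then almost all points of a curve have the same class. -/
theorem IsChartModel.exists_class_of_surjective [IsIntegral X] [LocallyOfFiniteType s]
    (h : IsChartModel (k := k) s i) (htr : 0 < Algebra.trdeg k K)
    (hsurj : Function.Surjective (ChowGroup.baseChange K s 2)) {W : Scheme.{u}} [IsIntegral W]
    [IsLocallyNoetherian W] (j : W ⟶ X) [IsClosedImmersion j]
    (hW : Order.coheight (j (genericPoint W)) = 1) :
    ∃ α : ChowGroup X 2, {w : {w : W // IsClosed {w}} | pointClass (j w.1) ≠ α}.Finite := by
  classical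
  have := isLocallyNoetherian_of_field s
  have := h.compactSpace
  obtain ⟨aF, ak, ht, ξ, C, hC⟩ := h.exists_projCurve_of_isClosedImmersion j hW
  obtain rfl : ak = aF := Algebra.algebra_ext _ _ fun r =>
    @IsScalarTower.algebraMap_apply k k W.functionField _ _ _ _ aF ak ht r
  obtain ⟨j₀, hj₀⟩ := C.exists_ne'
  let l₀ : Fin (n + 1) → k := Pi.single j₀ 1
  have hl₀ : formAt l₀ ξ ≠ 0 := by rwa [formAt_single]
  have hη : genericPoint W ∈ (j ≫ i) ⁻¹ᵁ projChart l₀ := (hC l₀).1.mpr hl₀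
  obtain ⟨ψ⟩ := h.nonempty_algHom_functionField htr j hW hη ((hC l₀).2.2 hη)
  have haeval : ∀ (l : Fin (n + 1) → k) (P : MvPolynomial (Fin (n + 1)) k),
      MvPolynomial.aeval (normAt l (ψ ∘ ξ)) P = ψ (MvPolynomial.aeval (normAt l ξ) P) := by
    intro l P
    rw [normAt_comp]
    exact (MvPolynomial.comp_aeval_apply _ ψ P).symm
  obtain ⟨z₀, hz₀, hz₀l, hz₀p⟩ := h.exists_point_baseChange (l := l₀) (p := normAt l₀ (ψ ∘ ξ)) fun P hP => by
    rw [haeval, ← (hC l₀).2.2 hη, chartMap_comp_eq_zero j hP, map_zero, map_zero]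
  obtain ⟨r, hr, hz₀r⟩ := exists_eq_smul_of_normAt_eq hz₀l
    (by rw [formAt_comp]; exact (map_ne_zero ψ).mpr hl₀) hz₀p
  obtain ⟨c, hc⟩ := hsurj (pointClass z₀)
  obtain ⟨c, rfl⟩ := QuotientAddGroup.mk_surjective c
  have hrat := QuotientAddGroup.eq.mp hc
  obtain ⟨l, hl, α, S, hα⟩ := h.chartClass_eq_of_sub_mem (fun z hz => by
    rw [← coheight_eq_two_iff s]
    refine c.2 _ fun h0 => hz ?_
    exact pullbackCycle_apply_of_eq_zero _ _ 2 c z h0) hz₀ hrat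
  rw [hz₀r, formAt_smul, formAt_comp] at hl
  have hlξ : formAt l ξ ≠ 0 := fun h0 => hl (by rw [h0, map_zero, mul_zero])
  have hp : normAt l (h.baseChange.coords z₀) = normAt l (ψ ∘ ξ) := by rw [hz₀r, normAt_smul l hr]
  rw [hp] at hα
  let T : Finset K := S ∪ Finset.univ.image (normAt l (ψ ∘ ξ))
  let R : Subalgebra k K := Algebra.adjoin k T
  have : Algebra.FiniteType k R := R.fg_iff_finiteType.mp ⟨T, rfl⟩
  have hTR : (T : Set K) ⊆ R := Algebra.subset_adjoin
  let p : Fin (n + 1) → R := fun j => ⟨normAt l (ψ ∘ ξ) j, hTR (by simp [T])⟩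
  have hpP : ∀ P : MvPolynomial (Fin (n + 1)) k, ((MvPolynomial.aeval p P : R) : K) = ψ (MvPolynomial.aeval (normAt l ξ) P) := by
    intro P
    rw [← haeval]
    exact MvPolynomial.comp_aeval_apply p R.val P
  obtain ⟨a, ha, hext⟩ := exists_algHom_extension (k := k) p
  have ha' : MvPolynomial.aeval (normAt l ξ) a ≠ 0 := by
    intro h0
    refine ha (Subtype.ext ?_)
    rw [hpP, h0, map_zero]
    rfl
  refine ⟨α, ((C.finite_zeros (formPoly_isHomogeneous l) (by rwa [aeval_formPoly])).union
    (C.finite_zeros (homogenize_isHomogeneous l a.totalDegree a) (by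
      rw [aeval_homogenize le_rfl hlξ]
      exact mul_ne_zero (pow_ne_zero _ hlξ) ha'))).subset fun w hw => ?_⟩
  by_contra hcon
  rw [Set.mem_union, not_or, Set.mem_ofPred_eq, Set.mem_ofPred_eq, aeval_formPoly] at hcon
  obtain ⟨hw₁, hw₂⟩ := hcon
  rw [aeval_homogenize le_rfl hw₁] at hw₂
  have hcl := isClosed_map j w.2
  obtain ⟨φ, hφ⟩ := hext (normAt l (h.coords (j w.1))) (fun P hP => by
    refine mem_pointIdeal.mp (C.le_pointIdeal w l hw₁ ?_)
    rw [mem_chartIdeal]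
    exact (map_eq_zero ψ).mp ((hpP P).symm.trans (congrArg Subtype.val hP))) (right_ne_zero_of_mul hw₂)
  refine hw ?_
  rw [← h.chartClass_normAt hcl (((h.isPointCoords_coords hcl).mem_iff l).mpr hw₁),
    ← hα R (fun x hx => hTR (by simp [T]; exact Or.inl hx)) φ p fun _ => rfl]
  exact congrArg _ (funext fun j => (hφ j).symm)

end Surjectivity

end K3
end

noncomputable section
namespace K3

/-- A function on an affine open set of a curve with a simple zero at one given closed point and no zero
at finitely many others. -/
theorem IsCurve.exists_simple_zero {W : Scheme.{u}} [IsIntegral W] [IsLocallyNoetherian W] (hW : IsCurve W)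
    {V : W.Opens} (hV : IsAffineOpen V) {B : Set W} (hB : B.Finite) (hBV : ∀ b ∈ B, b ∈ V ∧ IsClosed {b})
    {w₀ : W} (hw₀ : w₀ ∈ V) (hcl : IsClosed {w₀}) {t : W.presheaf.stalk w₀}
    (ht : maximalIdeal (W.presheaf.stalk w₀) = Ideal.span {t}) :
    ∃ f : W.functionField, f ≠ 0 ∧ Scheme.ord f w₀ = 1 ∧ ∀ b ∈ B, b ≠ w₀ → Scheme.ord f b = 0 := by
  classical
  let _ : Algebra Γ(W, V) (W.presheaf.stalk w₀) := (W.presheaf.germ V w₀ hw₀).hom.toAlgebra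
  let m₀ := (hV.primeIdealOf ⟨w₀, hw₀⟩).asIdeal
  have hloc : IsLocalization.AtPrime (W.presheaf.stalk w₀) m₀ := hV.isLocalization_stalk ⟨w₀, hw₀⟩
  have hm₀ : m₀.IsMaximal := isMaximal_primeIdealOf hV hw₀ hcl
  obtain ⟨⟨x, d⟩, hx⟩ := IsLocalization.surj m₀.primeCompl t
  have hd : IsUnit (algebraMap Γ(W, V) (W.presheaf.stalk w₀) d) := IsLocalization.map_units _ d
  have hx' : maximalIdeal (W.presheaf.stalk w₀) = Ideal.span {algebraMap _ (W.presheaf.stalk w₀) x} := by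
    rw [ht, ← hx, Ideal.span_singleton_mul_right_unit hd]
  have := hB.to_subtype
  let I : Option {b // b ∈ B ∧ b ≠ w₀} → Ideal Γ(W, V) := fun o =>
    o.elim (m₀ ^ 2) fun b => (hV.primeIdealOf ⟨b.1, (hBV b.1 b.2.1).1⟩).asIdeal
  have hmax : ∀ b : {b // b ∈ B ∧ b ≠ w₀}, (hV.primeIdealOf ⟨b.1, (hBV b.1 b.2.1).1⟩).asIdeal.IsMaximal :=
    fun b => isMaximal_primeIdealOf hV _ (hBV b.1 b.2.1).2
  have : Finite {b // b ∈ B ∧ b ≠ w₀} := (hB.subset fun b hb => hb.1 : {b | b ∈ B ∧ b ≠ w₀}.Finite).to_subtype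
  have h0b : ∀ b : {b // b ∈ B ∧ b ≠ w₀},
      IsCoprime m₀ (hV.primeIdealOf ⟨b.1, (hBV b.1 b.2.1).1⟩).asIdeal := fun b =>
    have := hmax b
    Ideal.isCoprime_of_isMaximal fun hcon => b.2.2 (eq_of_primeIdealOf_eq hV _ hw₀ hcon.symm)
  have hI : Pairwise (Function.onFun IsCoprime I) := by
    rintro (_ | b) (_ | b') hne
    · exact absurd rfl hne
    · exact (h0b b').pow_left
    · exact (h0b b).symm.pow_right
    · have : (I (some b)).IsMaximal := hmax b
      have : (I (some b')).IsMaximal := hmax b'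
      refine Ideal.isCoprime_of_isMaximal fun hcon => hne ?_
      exact congrArg some (Subtype.ext (eq_of_primeIdealOf_eq hV _ _ hcon))
  obtain ⟨f, hf⟩ := Ideal.exists_forall_sub_mem_ideal hI fun o => o.elim x fun _ => 1
  have hf₀ : f - x ∈ m₀ ^ 2 := hf none
  have hfb : ∀ b : {b // b ∈ B ∧ b ≠ w₀}, f ∉ (hV.primeIdealOf ⟨b.1, (hBV b.1 b.2.1).1⟩).asIdeal := by
    intro b hcon
    have h1 : f - 1 ∈ (hV.primeIdealOf ⟨b.1, (hBV b.1 b.2.1).1⟩).asIdeal := hf (some b)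
    refine (hmax b).ne_top ((Ideal.eq_top_iff_one _).mpr ?_)
    simpa using Ideal.sub_mem _ hcon h1
  have hspan : Ideal.span {algebraMap _ (W.presheaf.stalk w₀) f} = maximalIdeal (W.presheaf.stalk w₀) := by
    have h1 : algebraMap _ (W.presheaf.stalk w₀) (f - x) ∈ maximalIdeal (W.presheaf.stalk w₀) ^ 2 := by
      rw [← IsLocalization.AtPrime.map_eq_maximalIdeal m₀ (W.presheaf.stalk w₀), ← Ideal.map_pow]
      exact Ideal.mem_map_of_mem _ hf₀
    rw [hx', Ideal.span_singleton_pow, Ideal.mem_span_singleton, map_sub] at h1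
    obtain ⟨r, hr⟩ := h1
    have hxm : algebraMap _ (W.presheaf.stalk w₀) x ∈ maximalIdeal (W.presheaf.stalk w₀) :=
      hx' ▸ Ideal.mem_span_singleton_self _
    have hu : IsUnit (1 + algebraMap _ (W.presheaf.stalk w₀) x * r) := by
      by_contra hcon
      have h3 := Ideal.sub_mem _ ((IsLocalRing.mem_maximalIdeal _).mpr hcon) (Ideal.mul_mem_right r _ hxm)
      rw [add_sub_cancel_right] at h3
      exact (IsLocalRing.maximalIdeal.isMaximal _).ne_top ((Ideal.eq_top_iff_one _).mpr h3)
    have h2 : algebraMap _ (W.presheaf.stalk w₀) f =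
        algebraMap _ (W.presheaf.stalk w₀) x * (1 + algebraMap _ (W.presheaf.stalk w₀) x * r) := by
      rw [sub_eq_iff_eq_add] at hr
      rw [hr]
      ring
    rw [h2, Ideal.span_singleton_mul_right_unit hu, hx']
  have hf0 : f ≠ 0 := by
    rintro rfl
    rw [map_zero, Ideal.span_singleton_eq_bot.mpr rfl] at hspan
    have h1 : m₀ = ⊥ := by
      rw [eq_bot_iff]
      intro a ha
      have h2 : algebraMap _ (W.presheaf.stalk w₀) a ∈ maximalIdeal (W.presheaf.stalk w₀) :=
        (IsLocalization.AtPrime.to_map_mem_maximal_iff _ m₀ a).mpr ha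
      rw [← hspan] at h2
      exact germ_injective_of_isIntegral W w₀ hw₀ (h2.trans (map_zero _).symm)
    have : Nonempty V := ⟨⟨w₀, hw₀⟩⟩
    refine hW.not_isClosed ?_
    have hg : genericPoint W ∈ V := mem_of_nonempty hw₀
    have h3 : w₀ = genericPoint W := eq_of_primeIdealOf_eq hV hw₀ hg (h1.trans
      (congrArg PrimeSpectrum.asIdeal
        (hV.primeIdealOf_genericPoint.trans (genericPoint_eq_bot_of_affine _))).symm)
    exact h3 ▸ hcl
  have : Nonempty V := ⟨⟨w₀, hw₀⟩⟩
  refine ⟨W.germToFunctionField V f, ?_, ?_, fun b hb hne => ?_⟩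
  · exact fun h0 => hf0 (germ_injective_of_isIntegral W _ _ (h0.trans (map_zero _).symm))
  · rw [ord_germToFunctionField hw₀ (hW.coheight_eq_one_of_isClosed hcl) hf0]
    have h1 : Ideal.span {W.presheaf.germ V w₀ hw₀ f} = maximalIdeal (W.presheaf.stalk w₀) := hspan
    rw [h1]
    have : IsSimpleModule (W.presheaf.stalk w₀) (W.presheaf.stalk w₀ ⧸ maximalIdeal (W.presheaf.stalk w₀)) :=
      isSimpleModule_iff_quot_maximal.mpr ⟨_, inferInstance, ⟨LinearEquiv.refl _ _⟩⟩
    rw [Module.length_eq_one]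
    rfl
  · rw [ord_germToFunctionField (hBV b hb).1 (hW.coheight_eq_one_of_isClosed (hBV b hb).2) hf0]
    have hu : IsUnit (W.presheaf.germ V b (hBV b hb).1 f) := by
      by_contra hcon
      exact hfb ⟨b, hb, hne⟩ ((mem_primeIdealOf hV _ f).mpr hcon)
    rw [Ideal.span_singleton_eq_top.mpr hu]
    have : Subsingleton (W.presheaf.stalk b ⧸ (⊤ : Ideal (W.presheaf.stalk b))) :=
      Ideal.Quotient.subsingleton_iff.mpr rfl
    rw [Module.length_eq_zero]
    rfl

section Surface
variable {n : ℕ} {k : Type u} [Field k] [IsAlgClosed k] {X : Scheme.{u}} {s : X ⟶ Spec (.of k)}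
  {i : X ⟶ projectiveSpace n k} [SmoothOfRelativeDimension 2 s]

/-- A regular point of a curve can be moved along the curve. -/
theorem IsChartModel.pointClass_eq_of_isPrincipal (h : IsChartModel (k := k) s i) {W : Scheme.{u}} [IsIntegral W]
    [IsLocallyNoetherian W] (j : W ⟶ X) [IsClosedImmersion j] (hW : Order.coheight (j (genericPoint W)) = 1)
    {α : ChowGroup X 2} (hα : {w : {w : W // IsClosed {w}} | pointClass (j w.1) ≠ α}.Finite) {w₀ : W}
    (hw₀ : IsClosed {w₀}) {t : W.presheaf.stalk w₀} (ht : maximalIdeal (W.presheaf.stalk w₀) = Ideal.span {t}) :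
    pointClass (j w₀) = α := by
  classical
  have := h.compactSpace
  have hcurve := isCurve_of_isClosedImmersion s j hW
  obtain ⟨aF, ak, htower, ξ, C, -⟩ := h.exists_projCurve_of_isClosedImmersion j hW
  obtain rfl : ak = aF := Algebra.algebra_ext _ _ fun r =>
    @IsScalarTower.algebraMap_apply k k W.functionField _ _ _ _ aF ak htower r
  obtain ⟨l, hl⟩ := exists_form_ne_zero (k := k) (hα.union (Set.finite_singleton ⟨w₀, hw₀⟩))
    (fun w : {w : W // IsClosed {w}} => h.coords (j w.1)) fun w _ => C.exists_ne w
  have hmem : ∀ w : {w : W // IsClosed {w}}, formAt l (h.coords (j w.1)) ≠ 0 → w.1 ∈ (j ≫ i) ⁻¹ᵁ projChart l :=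
    fun w hw => ((h.isPointCoords_coords (isClosed_map j w.2)).mem_iff l).mpr hw
  obtain ⟨f, hf, hf₀, hfB⟩ := hcurve.exists_simple_zero ((h.of_closedImmersion j).isAffineOpen l)
    (hα.image Subtype.val) (by
      rintro _ ⟨w, hw, rfl⟩
      exact ⟨hmem w (hl w (Or.inl hw)), w.2⟩) (hmem ⟨w₀, hw₀⟩ (hl _ (Or.inr rfl))) hw₀ ht
  have hfin := C.finite_support_ord hf
  have h1 := finsum_ord_smul_pointClass j hW hf h
  have h2 : ∑ᶠ w : {w : W // IsClosed {w}}, Scheme.ord f w.1 • α = 0 := by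
    have h3 := (AddMonoidHom.map_finsum ((smulAddHom ℤ (ChowGroup X 2)).flip α) hfin).symm
    rw [C.finsum_ord_eq_zero hf, map_zero] at h3
    exact h3
  have h3 : ∑ᶠ w : {w : W // IsClosed {w}}, Scheme.ord f w.1 • (pointClass (j w.1) - α) = 0 := by
    have h4 := finsum_sub_distrib (f := fun w : {w : W // IsClosed {w}} => Scheme.ord f w.1 • pointClass (j w.1))
      (g := fun w => Scheme.ord f w.1 • α)
      (hfin.subset fun w hw h0 => hw (by simp only [h0, zero_zsmul]))
      (hfin.subset fun w hw h0 => hw (by simp only [h0, zero_zsmul]))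
    rw [h1, h2, sub_zero] at h4
    rw [← h4]
    exact finsum_congr fun w => zsmul_sub _ _ _
  rw [finsum_eq_single _ ⟨w₀, hw₀⟩, hf₀, one_zsmul, sub_eq_zero] at h3
  · exact h3
  · intro w hw
    by_cases hB : pointClass (j w.1) = α
    · rw [hB, sub_self, zsmul_zero]
    · rw [hfB w.1 ⟨w, hB, rfl⟩ fun h0 => hw (Subtype.ext h0), zero_zsmul]

end Surface

end K3
end

noncomputable section
namespace K3

lemma le_span_pair_sup_sq_of_sub_mem {A : Type*} [CommRing A] {m : Ideal A} {a b a' b' : A}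
    (ha : a - a' ∈ m ^ 2) (hb : b - b' ∈ m ^ 2) (h : m ≤ Ideal.span {a', b'} ⊔ m ^ 2) :
    m ≤ Ideal.span {a, b} ⊔ m ^ 2 := by
  refine h.trans (sup_le (Ideal.span_le.mpr ?_) le_sup_right)
  have key : ∀ c c' : A, c ∈ ({a, b} : Set A) → c - c' ∈ m ^ 2 → c' ∈ Ideal.span {a, b} ⊔ m ^ 2 := by
    intro c c' hc hcc
    have h1 := Ideal.sub_mem (Ideal.span {a, b} ⊔ m ^ 2) (le_sup_left (a := Ideal.span {a, b})
      (Ideal.subset_span hc)) (le_sup_right (a := Ideal.span {a, b}) hcc)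
    rwa [sub_sub_cancel] at h1
  rintro c (rfl | rfl)
  · exact key a c (by simp) ha
  · exact key b c (by simp) hb

/-- Local parameters at two points of a surface can be chosen in common. -/
theorem exists_common_localParameters {k A : Type*} [Field k] [IsAlgClosed k] [CommRing A] [IsDomain A]
    [Algebra k A] [Algebra.FiniteType k A] (m : Fin 2 → Ideal A) (hm : ∀ e, (m e).IsMaximal)
    (hne : m 0 ≠ m 1) (hht : ∀ e, (m e).height = 2)
    (h : ∀ e, ∃ a ∈ m e, ∃ b ∈ m e, m e ≤ Ideal.span {a, b} ⊔ m e ^ 2) :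
    ∃ a b : A, ∀ e, IsLocalParameters k (m e) a b := by
  have : IsNoetherianRing A := Algebra.FiniteType.isNoetherianRing k A
  choose a ha b hb hab using h
  have hI : Pairwise (Function.onFun IsCoprime fun e => m e ^ 2) := by
    have h01 : IsCoprime (m 0 ^ 2) (m 1 ^ 2) := by
      have := hm 0
      have := hm 1
      exact (Ideal.isCoprime_of_isMaximal hne).pow
    intro e e' hee
    fin_cases e <;> fin_cases e'
    · exact absurd rfl hee
    · exact h01
    · exact h01.symm
    · exact absurd rfl hee
  obtain ⟨a₀, ha₀⟩ := Ideal.exists_forall_sub_mem_ideal hI a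
  obtain ⟨b₀, hb₀⟩ := Ideal.exists_forall_sub_mem_ideal hI b
  have hmem : ∀ e (c c' : A), c - c' ∈ m e ^ 2 → c' ∈ m e → c ∈ m e := fun e c c' hc hc' => by
    have := Ideal.add_mem _ (Ideal.pow_le_self two_ne_zero hc) hc'
    rwa [sub_add_cancel] at this
  refine ⟨a₀, b₀, fun e => ?_⟩
  have := hm e
  refine isLocalParameters_of_height (hmem e _ _ (ha₀ e) (ha e)) (hmem e _ _ (hb₀ e) (hb e)) (fun f => ?_)
    (le_span_pair_sup_sq_of_sub_mem (ha₀ e) (hb₀ e) (hab e)) (hht e)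
  obtain ⟨ε, hε⟩ := exists_algHom_ker_eq (F := k) (m e)
  refine ⟨ε f, ?_⟩
  rw [← hε, RingHom.mem_ker, map_sub, sub_eq_zero]
  exact (ε.commutes _).symm

lemma IsLocalParameters.sub_ne_zero {k A : Type*} [Field k] [CommRing A] [Algebra k A] {m : Ideal A} {a b : A}
    (h : IsLocalParameters k m a b) (c : k) : b - algebraMap k A c * a ≠ 0 := by
  intro h0
  have h1 := h.regular 1 (Polynomial.X - Polynomial.C c) (by simp) (by
    have : homValue a b 1 (Polynomial.X - Polynomial.C c) = b - algebraMap k A c * a := by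
      simp [homValue, Finset.sum_range_succ]
      ring
    rw [this, h0]
    exact Ideal.zero_mem _)
  exact Polynomial.X_sub_C_ne_zero c h1

section Surface
variable {n : ℕ} {k : Type u} [Field k] [IsAlgClosed k] {X : Scheme.{u}} {s : X ⟶ Spec (.of k)}
  {i : X ⟶ projectiveSpace n k} [SmoothOfRelativeDimension 2 s]

/-- At a point where two local parameters become dependent, the curve is regular. -/
theorem IsChartModel.exists_isPrincipal (h : IsChartModel (k := k) s i) {W : Scheme.{u}} [IsIntegral W]
    (j : W ⟶ X) [IsClosedImmersion j] {l : Fin (n + 1) → k} {a b : Γ(X, i ⁻¹ᵁ projChart l)}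
    (hη : j (genericPoint W) ∈ i ⁻¹ᵁ projChart l) {c : k}
    (hP : b - sectionConst s _ c * a ∈ ((h.isAffineOpen l).primeIdealOf ⟨_, hη⟩).asIdeal) {w : W}
    (hw : j w ∈ i ⁻¹ᵁ projChart l)
    (hab : maximalIdeal (X.presheaf.stalk (j w)) =
      Ideal.span {X.presheaf.germ _ _ hw a, X.presheaf.germ _ _ hw b}) :
    maximalIdeal (W.presheaf.stalk w) = Ideal.span {j.stalkMap w (X.presheaf.germ _ _ hw a)} := by
  have h0 : j.stalkMap w (X.presheaf.germ _ _ hw (b - sectionConst s _ c * a)) = 0 := by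
    obtain ⟨P, hPe⟩ := h.surjective l (b - sectionConst s _ c * a)
    rw [← hPe] at hP ⊢
    have h1 : P ∈ RingHom.ker (chartMap (j ≫ s) (j ≫ i) l) := by
      rw [h.ker_chartMap_comp j hη]
      exact hP
    have h2 : j.app (i ⁻¹ᵁ projChart l) (chartMap s i l P) = 0 := (app_chartMap j l P).trans h1
    rw [Scheme.Hom.germ_stalkMap_apply, h2, map_zero]
  rw [map_sub, map_mul, map_sub, map_mul, sub_eq_zero] at h0
  rw [← fiberIdeal_of_isClosedImmersion j w, fiberIdeal, hab, Ideal.map_span, Set.image_pair]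
  apply le_antisymm
  · rw [Ideal.span_le]
    rintro x (rfl | rfl)
    · exact Ideal.mem_span_singleton_self _
    · refine Ideal.mem_span_singleton.mpr ?_
      exact ⟨_, h0.trans (mul_comm _ _)⟩
  · exact Ideal.span_mono (by simp)

/-- Two closed points of a surface lie on a curve which is regular at both. -/
theorem IsChartModel.exists_curve [IsIntegral X] [LocallyOfFiniteType s] (h : IsChartModel (k := k) s i)
    {x : Fin 2 → X} (hx : ∀ e, IsClosed {x e}) (hne : x 0 ≠ x 1) :
    ∃ (W : Scheme.{u}) (j : W ⟶ X) (_ : IsClosedImmersion j) (_ : IsIntegral W) (_ : IsLocallyNoetherian W),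
      Order.coheight (j (genericPoint W)) = 1 ∧ ∀ e, ∃ w : W, j w = x e ∧ IsClosed {w} ∧
        ∃ t, maximalIdeal (W.presheaf.stalk w) = Ideal.span {t} := by
  have := isLocallyNoetherian_of_field s
  have := h.compactSpace
  obtain ⟨l, hl⟩ := exists_form_ne_zero (k := k) (Set.finite_univ (α := Fin 2))
    (fun e => h.coords (x e)) fun e _ => (h.isPointCoords_coords (hx e)).exists_ne
  have hmem : ∀ e, x e ∈ i ⁻¹ᵁ projChart l := fun e =>
    ((h.isPointCoords_coords (hx e)).mem_iff l).mpr (hl e trivial)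
  have hV := h.isAffineOpen l
  have : Nonempty (i ⁻¹ᵁ projChart l) := ⟨⟨_, hmem 0⟩⟩
  let _ : Algebra k Γ(X, i ⁻¹ᵁ projChart l) := (sectionConst s _).toAlgebra
  have : Algebra.FiniteType k Γ(X, i ⁻¹ᵁ projChart l) := finiteType_sectionConst s hV
  have : IsNoetherianRing Γ(X, i ⁻¹ᵁ projChart l) := Algebra.FiniteType.isNoetherianRing k _
  let m : Fin 2 → Ideal Γ(X, i ⁻¹ᵁ projChart l) := fun e => (hV.primeIdealOf ⟨x e, hmem e⟩).asIdeal
  have hm : ∀ e, (m e).IsMaximal := fun e => isMaximal_primeIdealOf hV (hmem e) (hx e)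
  obtain ⟨a, b, hab⟩ := exists_common_localParameters (k := k) m hm
    (fun hcon => hne (eq_of_primeIdealOf_eq hV _ _ hcon))
    (fun e => (coheight_eq_height_primeIdealOf hV (hmem e)).symm.trans
      (smooth_surface_closedPoint s (hx e)).1) fun e => by
      obtain ⟨a', b', hab⟩ := (smooth_surface_closedPoint s (hx e)).2
      let _ : Algebra Γ(X, i ⁻¹ᵁ projChart l) (X.presheaf.stalk (x e)) :=
        (X.presheaf.germ _ (x e) (hmem e)).hom.toAlgebra
      have : IsLocalization.AtPrime (X.presheaf.stalk (x e)) (m e) := hV.isLocalization_stalk ⟨x e, hmem e⟩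
      have := hm e
      exact exists_le_span_pair_sup_sq_of_localization (m e) hab
  obtain ⟨P, hP, hP₀, hP₁, haP, c, hc⟩ := exists_prime_le_of_isLocalParameters (hm 0).ne_top (hab 0) (hab 1)
  have hPm : ∀ e, P ≤ m e := by
    intro e
    fin_cases e
    · exact hP₀
    · exact hP₁
  obtain ⟨η, hη, hηP⟩ := exists_primeIdealOf_eq hV P
  have hco : Order.coheight η = 1 := by
    have h2 := coheight_le_two s η
    obtain ⟨N, hN⟩ := ENat.ne_top_iff_exists.mp (ne_top_of_le_ne_top (by simp) h2)
    rw [← hN] at h2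
    have h2' : N ≤ 2 := by exact_mod_cast h2
    interval_cases N
    · have hgen := eq_genericPoint_of_coheight_eq_zero η hN.symm
      subst hgen
      have h3 : P = ⊥ := hηP.symm.trans (congrArg PrimeSpectrum.asIdeal
        (hV.primeIdealOf_genericPoint.trans (genericPoint_eq_bot_of_affine _)))
      rw [h3] at hc
      exact absurd hc ((hab 0).sub_ne_zero c)
    · exact hN.symm
    · have h3 := isMaximal_primeIdealOf hV hη ((coheight_eq_two_iff s).mp hN.symm)
      rw [hηP] at h3
      exact absurd (h3.eq_of_le (hm 0).ne_top (hPm 0) ▸ (hab 0).mem_left) haP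
  obtain ⟨W, j, _, _, _, hj⟩ := exists_integral_closure η
  subst hj
  refine ⟨W, j, inferInstance, inferInstance, inferInstance, hco, fun e => ?_⟩
  have hspec : j (genericPoint W) ⤳ x e := by
    have h4 : hV.primeIdealOf ⟨_, hη⟩ ⤳ hV.primeIdealOf ⟨x e, hmem e⟩ := by
      rw [← PrimeSpectrum.le_iff_specializes]
      change (hV.primeIdealOf ⟨_, hη⟩).asIdeal ≤ m e
      rw [hηP]
      exact hPm e
    have h5 := h4.map hV.fromSpec.continuous
    rwa [hV.fromSpec_primeIdealOf, hV.fromSpec_primeIdealOf] at h5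
  obtain ⟨w, hw⟩ : x e ∈ Set.range j :=
    hspec.mem_closed j.isClosedEmbedding.isClosed_range ⟨_, rfl⟩
  have hwl : j w ∈ i ⁻¹ᵁ projChart l := hw ▸ hmem e
  refine ⟨w, hw, ?_, _, h.exists_isPrincipal j hη (c := c) (a := a) (b := b) (hηP ▸ hc) hwl ?_⟩
  · have h6 : {w} = j ⁻¹' {x e} := by
      ext v
      rw [Set.mem_preimage, Set.mem_singleton_iff, Set.mem_singleton_iff, ← hw]
      exact ⟨fun hv => by rw [hv], fun hv => j.isClosedEmbedding.injective hv⟩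
    rw [h6]
    exact (hx e).preimage j.continuous
  · have key : ∀ (z : X) (hz : z ∈ i ⁻¹ᵁ projChart l), z = x e → maximalIdeal (X.presheaf.stalk z) =
        Ideal.span {X.presheaf.germ _ _ hz a, X.presheaf.germ _ _ hz b} := by
      rintro z hz rfl
      let _ : Algebra Γ(X, i ⁻¹ᵁ projChart l) (X.presheaf.stalk (x e)) :=
        (X.presheaf.germ _ (x e) (hmem e)).hom.toAlgebra
      have : IsLocalization.AtPrime (X.presheaf.stalk (x e)) (m e) := hV.isLocalization_stalk ⟨x e, hmem e⟩
      have := hm e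
      exact maximalIdeal_eq_span_of_le_sup_sq (m := m e) (hab e).mem_left (hab e).mem_right (hab e).le
    exact key _ hwl hw

/-- A surface all of whose points are rationally equivalent has Chow group `ℤ`. -/
theorem IsChartModel.nonempty_addEquiv_int [IsIntegral X] (h : IsChartModel (k := k) s i)
    (heq : ∀ x y : X, IsClosed {x} → IsClosed {y} → pointClass x = pointClass y) :
    Nonempty (ChowGroup X 2 ≃+ ℤ) := by
  have := h.compactSpace
  obtain ⟨δ, hδ⟩ := h.exists_degree
  obtain ⟨x₀, -, hx₀⟩ := (isClosed_univ (X := X)).exists_closed_singleton ⟨genericPoint X, trivial⟩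
  have hmul : ∀ e : ChowGroup X 2, ∃ N : ℤ, e = N • pointClass x₀ := by
    intro e
    obtain ⟨c, rfl⟩ := QuotientAddGroup.mk_surjective e
    refine ⟨∑ᶠ x, c.1 x, ?_⟩
    rw [mk_eq_finsum]
    refine Eq.trans ?_
      (AddMonoidHom.map_finsum ((smulAddHom ℤ (ChowGroup X 2)).flip (pointClass x₀))
        (finite_support_cycle c.1)).symm
    refine finsum_congr fun x => ?_
    by_cases hcx : c.1 x = 0
    · simp only [hcx, zero_zsmul, map_zero]
    · rw [heq x x₀ ((coheight_eq_two_iff s).mp (c.2 x hcx)) hx₀]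
      rfl
  refine ⟨AddEquiv.ofBijective δ ⟨(injective_iff_map_eq_zero δ).mpr fun e he => ?_, fun N => ?_⟩⟩
  · obtain ⟨N, rfl⟩ := hmul e
    rw [map_zsmul, hδ x₀ hx₀, smul_eq_mul, mul_one] at he
    rw [he, zero_zsmul]
  · exact ⟨N • pointClass x₀, by rw [map_zsmul, hδ x₀ hx₀, smul_eq_mul, mul_one]⟩

end Surface

end K3
end

theorem base_change_not_surjective {k K : Type u} [Field k] [Field K] [Algebra k K]
    [IsAlgClosed k] [IsAlgClosed K] (htr : 0 < Algebra.trdeg k K)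
    {X : Scheme.{u}} (s : X ⟶ Spec (.of k)) [K3.IsProjectiveK3 s]
    (hX : IsEmpty (K3.ChowGroup X 2 ≃+ ℤ)) :
    ¬ Function.Surjective (K3.ChowGroup.baseChange K s 2) := by
  intro hsurj
  obtain ⟨n, i, _, hi⟩ := K3.IsProjectiveK3.projective (s := s)
  have : SmoothOfRelativeDimension 2 s := K3.IsProjectiveK3.smooth
  have : GeometricallyIntegral s := K3.IsProjectiveK3.geometricallyIntegral
  have : IsIntegral X := GeometricallyIntegral.isIntegral_of_subsingleton s
  have h : K3.IsChartModel (k := k) s i := by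
    have h1 := (K3.isChartModel_projectiveSpace (n := n) (k := k)).of_closedImmersion i
    rwa [hi, Category.comp_id] at h1
  refine hX.elim (h.nonempty_addEquiv_int fun x y hx hy => ?_).some
  by_cases hxy : x = y
  · rw [hxy]
  obtain ⟨W, j, _, _, _, hW, hpt⟩ := h.exists_curve (x := ![x, y])
    (fun e => by fin_cases e; exacts [hx, hy]) hxy
  obtain ⟨α, hα⟩ := h.exists_class_of_surjective htr hsurj j hW
  have key : ∀ e, K3.pointClass (![x, y] e) = α := by
    intro e
    obtain ⟨w, hw, hcl, t, ht⟩ := hpt e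
    rw [← hw, h.pointClass_eq_of_isPrincipal j hW hα hcl ht]
  exact (key 0).trans (key 1).symm
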